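/- Let n > q ≥ 2 and 0 ≤ k ≤ q+1. Let Π be a Nambu structure of order q on an open neighborhood U of 0 in ℝⁿ which is real-analytic (each coordinate function of Π in the standard basis of ⋀^q(ℝⁿ) is real-analytic on U), with Π(0) = 0 and with linear part Π_{k,q} at 0. Then Π is analytically linearizable up to multiplication by an analytic function not vanishing at 0: there exist an open neighborhood W ⊆ U of 0, a real-analytic function f : W → ℝ with f(0) ≠ 0, and a real-analytic diffeomorphism φ from W onto an open neighborhood of 0 in ℝⁿ with φ(0) = 0, such that (φ_*(f·Π))(y) = Π_{k,q}(y) for all y ∈ φ(W). -/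

import Mathlib

open scoped ContDiff

namespace NambuLin

/-- Index set for the standard basis of the `q`-th exterior power of `ℝⁿ`:
increasing multi-indices, encoded as `q`-element subsets of `Fin n`. -/
abbrev Idx (n q : ℕ) := {s : Finset (Fin n) // s.card = q}

/-- A `q`-vector of `ℝⁿ`, given by its coordinates in the standard basis
`{e_{i₁} ∧ ⋯ ∧ e_{i_q}}` of `⋀^q(ℝⁿ)`. -/
abbrev MultiVec (n q : ℕ) := Idx n q → ℝ

/-- The Jacobian matrix of a map `φ : ℝⁿ → ℝⁿ` at a point `x`. -/
noncomputable def jac {n : ℕ} (φ : (Fin n → ℝ) → (Fin n → ℝ)) (x : Fin n → ℝ) :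
    Matrix (Fin n) (Fin n) ℝ :=
  Matrix.of fun i j => fderiv ℝ φ x (Pi.single j 1) i

/-- The `q`-th exterior power `⋀^q A` of a matrix `A`, acting on `q`-vectors in
coordinates: `((⋀^q A) w)_J = ∑_I det(A[J,I]) w_I`. -/
noncomputable def extPow (n q : ℕ) (A : Matrix (Fin n) (Fin n) ℝ) (w : MultiVec n q) :
    MultiVec n q :=
  fun J => ∑ I : Idx n q,
    (A.submatrix (J.1.orderEmbOfFin J.2) (I.1.orderEmbOfFin I.2)).det * w I

/-- The constant `q`-vector `e₁ ∧ ⋯ ∧ e_q` in coordinates. -/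
def stdVec (n q : ℕ) : MultiVec n q :=
  fun J => if (J : Finset (Fin n)) = Finset.univ.filter (fun i : Fin n => (i : ℕ) < q) then 1 else 0

/-- `φ` is a `C^∞` diffeomorphism from the open set `W` onto the open set `φ '' W`. -/
def IsSmoothDiffeoOn {n : ℕ} (φ : (Fin n → ℝ) → (Fin n → ℝ)) (W : Set (Fin n → ℝ)) : Prop :=
  IsOpen W ∧ IsOpen (φ '' W) ∧ ContDiffOn ℝ ∞ φ W ∧
    ∃ ψ : (Fin n → ℝ) → (Fin n → ℝ), ContDiffOn ℝ ∞ ψ (φ '' W) ∧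
      (∀ x ∈ W, ψ (φ x) = x) ∧ (∀ y ∈ φ '' W, φ (ψ y) = y)

/-- `P` is a (smooth) Nambu structure of order `q` on `U`: it is a smooth `q`-vector
field, and around every point where it does not vanish there is a local `C^∞`
coordinate system in which it becomes the constant `q`-vector `e₁ ∧ ⋯ ∧ e_q`. -/
def IsNambu (n q : ℕ) (P : (Fin n → ℝ) → MultiVec n q) (U : Set (Fin n → ℝ)) : Prop :=
  ContDiffOn ℝ ∞ P U ∧
    ∀ p ∈ U, P p ≠ 0 →
      ∃ W, p ∈ W ∧ W ⊆ U ∧ ∃ φ, IsSmoothDiffeoOn φ W ∧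
        ∀ x ∈ W, extPow n q (jac φ x) (P x) = stdVec n q

/-- The signs `ε_j` (`= 1` for the first `k` indices, `= -1` afterwards;
`0`-based indexing, so `ε_j = 1` iff `j < k`). -/
def eps {n : ℕ} (k : ℕ) (j : Fin n) : ℝ := if (j : ℕ) < k then 1 else -1

/-- The set of indices `{1, …, q+1}` (in `0`-based form: `{0,…,q}`). -/
def topIdx (n q : ℕ) : Finset (Fin n) := Finset.univ.filter (fun i : Fin n => (i : ℕ) < q + 1)

/-- The nondegenerate Type 1 linear Nambu structure `Π_{k,q}` of order `q` and
signature `(k, q+1-k)`: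
`Π_{k,q}(x) = ∑_{j=1}^{q+1} (−1)^{j−1} ε_j x_j e₁ ∧ ⋯ ∧ ê_j ∧ ⋯ ∧ e_{q+1}`
(here written with `0`-based indices `j`, whence the sign `(−1)^j`). -/
def modelPi (n q k : ℕ) (x : Fin n → ℝ) : MultiVec n q :=
  fun J => ∑ j : Fin n,
    if ((j : ℕ) < q + 1 ∧ (J : Finset (Fin n)) = (topIdx n q).erase j)
    then (-1 : ℝ) ^ (j : ℕ) * eps k j * x j else 0

/-- `φ` is a real-analytic diffeomorphism from the open set `W` onto the open set
`φ '' W` (with real-analytic inverse). -/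
def IsAnalyticDiffeoOn {n : ℕ} (φ : (Fin n → ℝ) → (Fin n → ℝ)) (W : Set (Fin n → ℝ)) : Prop :=
  IsOpen W ∧ IsOpen (φ '' W) ∧ AnalyticOnNhd ℝ φ W ∧
    ∃ ψ : (Fin n → ℝ) → (Fin n → ℝ), AnalyticOnNhd ℝ ψ (φ '' W) ∧
      (∀ x ∈ W, ψ (φ x) = x) ∧ (∀ y ∈ φ '' W, φ (ψ y) = y)


end NambuLin

open scoped ContDiff
namespace NambuLin
open Metric Filter Topology

theorem baseChange {ι : Type} [Fintype ι] [DecidableEq ι] {f : (ι → ℝ) → ℝ} (hf : AnalyticAt ℝ f 0)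
    (𝔸 : Type) [NormedRing 𝔸] [NormedAlgebra ℝ 𝔸] [CompleteSpace 𝔸] [NormOneClass 𝔸] :
    ∃ r > 0, ∃ F : (ι → 𝔸) → 𝔸, AnalyticOnNhd ℝ F (ball 0 r) ∧
      ∀ A ∈ ball (0 : ι → 𝔸) r, ∀ x : ι → ℝ, ‖x‖ < r →
        ∀ (V : Type) [NormedAddCommGroup V] [NormedSpace ℝ V] (l : 𝔸 →L[ℝ] V),
          (∀ a i, l (a * A i) = x i • l a) → l (F A) = f x • l 1 := by
  obtain ⟨p, r₀, hp⟩ := hf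
  obtain ⟨r₁, hr₁0, hr₁⟩ : ∃ r₁ : NNReal, 0 < r₁ ∧ (r₁ : ENNReal) < r₀ := by
    obtain ⟨r, h1, h2⟩ := ENNReal.lt_iff_exists_nnreal_btwn.1 hp.r_pos
    exact ⟨r, by exact_mod_cast h1, h2⟩
  obtain ⟨C, hC0, hC⟩ := p.norm_mul_pow_le_of_lt_radius (lt_of_lt_of_le hr₁ hp.r_le)
  set N : NNReal := (Fintype.card ι : NNReal) + 1 with hN
  have hNpos : 0 < N := by positivity
  let P : FormalMultilinearSeries ℝ (ι → 𝔸) 𝔸 := fun n =>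
    ∑ i : Fin n → ι, p n (fun k => Pi.single (i k) 1) •
      (ContinuousMultilinearMap.mkPiAlgebraFin ℝ n 𝔸).compContinuousLinearMap
        (fun k => ContinuousLinearMap.proj (i k))
  have hPapp : ∀ n (m : Fin n → ι → 𝔸), P n m = ∑ i : Fin n → ι, p n (fun k => Pi.single (i k) 1) •
      (ContinuousMultilinearMap.mkPiAlgebraFin ℝ n 𝔸) (fun k => m k (i k)) := by
    intro n m
    simp [P, ContinuousMultilinearMap.sum_apply]
  have hPn : ∀ n, ‖P n‖ ≤ ‖p n‖ * (N : ℝ) ^ n := by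
    intro n
    refine ContinuousMultilinearMap.opNorm_le_bound (by positivity) ?_
    intro m
    rw [hPapp]
    have h1 : ∀ i : Fin n → ι, ‖p n (fun k => Pi.single (i k) 1) •
      (ContinuousMultilinearMap.mkPiAlgebraFin ℝ n 𝔸) (fun k => m k (i k))‖ ≤
        ‖p n‖ * ∏ k, ‖m k‖ := by
      intro i
      rw [norm_smul]
      have e1 : ‖p n (fun k => Pi.single (i k) 1)‖ ≤ ‖p n‖ := by
        refine ((p n).le_opNorm _).trans ?_
        have : ∏ k : Fin n, ‖(Pi.single (i k) (1:ℝ) : ι → ℝ)‖ ≤ 1 := by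
          apply Finset.prod_le_one
          · intros; positivity
          · intro k _
            rw [Pi.norm_single]; simp
        nlinarith [norm_nonneg (p n)]
      have e2 : ‖(ContinuousMultilinearMap.mkPiAlgebraFin ℝ n 𝔸) (fun k => m k (i k))‖
          ≤ ∏ k, ‖m k‖ := by
        refine (ContinuousMultilinearMap.le_opNorm _ _).trans ?_
        rw [ContinuousMultilinearMap.norm_mkPiAlgebraFin, one_mul]
        exact Finset.prod_le_prod (fun _ _ => norm_nonneg _) (fun k _ => norm_le_pi_norm _ _)
      gcongr
    refine (norm_sum_le _ _).trans ((Finset.sum_le_sum fun i _ => h1 i).trans ?_)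
    rw [Finset.sum_const, nsmul_eq_mul, mul_comm, mul_right_comm]
    refine mul_le_mul_of_nonneg_right ?_ (by positivity)
    refine mul_le_mul_of_nonneg_left ?_ (norm_nonneg _)
    simp only [Finset.card_univ, Fintype.card_fun, Fintype.card_fin, hN]
    push_cast
    gcongr
    linarith
  have hrad : ((r₁ / N : NNReal) : ENNReal) ≤ P.radius := by
    apply P.le_radius_of_bound C
    intro n
    refine le_trans ?_ (hC n)
    refine (mul_le_mul_of_nonneg_right (hPn n) (by positivity)).trans (le_of_eq ?_)
    push_cast
    rw [div_pow, mul_assoc, mul_div_cancel₀]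
    positivity
  have hr : 0 < r₁ / N := by positivity
  have hPpos : 0 < P.radius := lt_of_lt_of_le (by exact_mod_cast hr) hrad
  have hPs := P.hasFPowerSeriesOnBall hPpos
  have hsub : ball (0 : ι → 𝔸) ((r₁ / N : NNReal) : ℝ) ⊆ eball 0 P.radius := by
    intro A hA
    rw [← Metric.eball_coe] at hA
    exact Metric.eball_subset_eball hrad hA
  refine ⟨((r₁ / N : NNReal) : ℝ), by exact_mod_cast hr, P.sum, ?_, ?_⟩
  · intro A hA
    exact hPs.analyticAt_of_mem (hsub hA)
  · intro A hA x hx V _ _ l hl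
    have hx' : x ∈ eball (0 : ι → ℝ) r₀ := by
      have : x ∈ ball (0 : ι → ℝ) (r₁ : ℝ) := by
        rw [mem_ball_zero_iff]
        refine hx.trans_le ?_
        have : r₁ / N ≤ r₁ := div_le_self (zero_le) (by rw [hN]; exact le_add_of_nonneg_left (zero_le))
        exact_mod_cast this
      rw [← Metric.eball_coe] at this
      exact Metric.eball_subset_eball hr₁.le this
    have s1 : HasSum (fun n => l (P n fun _ => A)) (l (P.sum A)) := by
      have := hPs.hasSum (hsub hA)
      rw [zero_add] at this
      exact l.hasSum this
    have s2 : HasSum (fun n => (p n fun _ => x) • l 1) (f x • l 1) := by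
      have := hp.hasSum hx'
      rw [zero_add] at this
      exact this.smul_const _
    have key : ∀ n, l (P n fun _ => A) = (p n fun _ => x) • l 1 := by
      intro n
      rw [hPapp, map_sum]
      have hprod : ∀ i : Fin n → ι, l ((ContinuousMultilinearMap.mkPiAlgebraFin ℝ n 𝔸)
          (fun k => A (i k))) = (∏ k, x (i k)) • l 1 := by
        intro i
        rw [ContinuousMultilinearMap.mkPiAlgebraFin_apply, ← List.prod_ofFn]
        generalize hL : i = i'
        rw [List.ofFn_comp' i' A |> fun h => (h : _ = _), List.ofFn_comp' i' x |> fun h => (h : _ = _)]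
        generalize List.ofFn i' = L
        induction L using List.reverseRecOn with
        | nil => simp
        | append_singleton L j ih =>
          simp only [List.map_append, List.map_cons, List.map_nil, List.prod_append,
            List.prod_singleton]
          rw [hl, ih, smul_smul, mul_comm]
      have hx1 : (fun _ : Fin n => x) = fun _ => ∑ i : ι, x i • (Pi.single i (1:ℝ) : ι → ℝ) := by
        funext _
        ext j
        simp [Finset.sum_apply, Pi.single_apply]
      rw [hx1, (p n).map_sum, Finset.sum_smul]
      refine Finset.sum_congr rfl fun i _ => ?_
      rw [map_smul, hprod, (p n).map_smul_univ, smul_smul, smul_eq_mul, mul_comm]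
    simp_rw [key] at s1
    exact s1.unique s2
end NambuLin

open scoped ContDiff
namespace NambuLin
open Metric Filter Topology

theorem analyticAt_iff_omega {E F : Type*} [NormedAddCommGroup E] [NormedSpace ℝ E]
    [NormedAddCommGroup F] [NormedSpace ℝ F] [CompleteSpace F] {f : E → F} {x : E} :
    ContDiffAt ℝ ω f x ↔ AnalyticAt ℝ f x := by
  rw [← contDiffWithinAt_univ, contDiffWithinAt_omega_iff_analyticWithinAt, analyticWithinAt_univ]

theorem implicit_zero {E B C : Type*} [NormedAddCommGroup E] [NormedSpace ℝ E] [CompleteSpace E]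
    [NormedAddCommGroup B] [NormedSpace ℝ B] [CompleteSpace B]
    [NormedAddCommGroup C] [NormedSpace ℝ C] [CompleteSpace C]
    {G : E × B → C} (hG : AnalyticAt ℝ G 0) (hG0 : G 0 = 0)
    (hi : (fderiv ℝ G 0 ∘L .inr ℝ E B).IsInvertible) :
    ∃ u : E → B, AnalyticAt ℝ u 0 ∧ u 0 = 0 ∧ (∀ᶠ p in 𝓝 0, G (p, u p) = 0) ∧
      ∀ᶠ z : E × B in 𝓝 0, G z = 0 → z.2 = u z.1 := by
  have cd : ContDiffAt ℝ ω G 0 := analyticAt_iff_omega.2 hG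
  have pn : (ω : WithTop ℕ∞) ≠ 0 := by simp
  refine ⟨cd.implicitFunction pn hi, analyticAt_iff_omega.1 (cd.contDiffAt_implicitFunction pn hi),
    cd.implicitFunction_apply_self pn hi, ?_, ?_⟩
  · have := cd.eventually_apply_implicitFunction pn hi
    simpa [hG0] using this
  · filter_upwards [cd.eventually_apply_eq_iff_implicitFunction pn hi] with z hz h
    rw [hG0] at hz
    exact (hz.1 h).symm

theorem implicit_fixed {E B : Type*} [NormedAddCommGroup E] [NormedSpace ℝ E] [CompleteSpace E]
    [NormedAddCommGroup B] [NormedSpace ℝ B] [CompleteSpace B]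
    {G : E × B → B} (hG : AnalyticAt ℝ G 0) (hG0 : G 0 = 0)
    (hi : ∀ v, fderiv ℝ G 0 (0, v) = 0) :
    ∃ u : E → B, AnalyticAt ℝ u 0 ∧ u 0 = 0 ∧ (∀ᶠ p in 𝓝 0, u p = G (p, u p)) ∧
      ∀ᶠ z : E × B in 𝓝 0, z.2 = G z → z.2 = u z.1 := by
  have hd : HasFDerivAt (fun z : E × B => z.2 - G z) (ContinuousLinearMap.snd ℝ E B - fderiv ℝ G 0) 0 :=
    (hasFDerivAt_snd).sub hG.differentiableAt.hasFDerivAt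
  obtain ⟨u, h1, h2, h3, h4⟩ := implicit_zero (G := fun z : E × B => z.2 - G z)
    (analyticAt_snd.sub hG) (by simp [hG0]) (by
      rw [hd.fderiv]
      refine ⟨ContinuousLinearEquiv.refl ℝ B, ?_⟩
      ext v
      simp [hi])
  refine ⟨u, h1, h2, ?_, ?_⟩
  · filter_upwards [h3] with p hp
    exact sub_eq_zero.1 hp
  · filter_upwards [h4] with z hz h
    exact hz (sub_eq_zero.2 h)

theorem local_inverse {E F : Type*} [NormedAddCommGroup E] [NormedSpace ℝ E] [CompleteSpace E]
    [NormedAddCommGroup F] [NormedSpace ℝ F] [CompleteSpace F]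
    {φ : E → F} (hφ : AnalyticAt ℝ φ 0) (h0 : φ 0 = 0) (e : E ≃L[ℝ] F)
    (he : fderiv ℝ φ 0 = (e : E →L[ℝ] F)) :
    ∃ ψ : F → E, AnalyticAt ℝ ψ 0 ∧ ψ 0 = 0 ∧ (∀ᶠ x in 𝓝 0, ψ (φ x) = x) ∧
      (∀ᶠ y in 𝓝 0, φ (ψ y) = y) := by
  have cd : ContDiffAt ℝ ω φ 0 := analyticAt_iff_omega.2 hφ
  have pn : (ω : WithTop ℕ∞) ≠ 0 := by simp
  have hd : HasFDerivAt φ (e : E →L[ℝ] F) 0 := he ▸ hφ.differentiableAt.hasFDerivAt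
  have hs := cd.hasStrictFDerivAt' hd pn
  refine ⟨cd.localInverse hd pn, ?_, ?_, ?_, ?_⟩
  · have := cd.to_localInverse hd pn
    rw [h0] at this
    exact analyticAt_iff_omega.1 this
  · have := cd.localInverse_apply_image hd pn
    rwa [h0] at this
  · exact hs.eventually_left_inverse
  · have := hs.eventually_right_inverse
    rwa [h0] at this

/-- decomposition into even and odd part w.r.t. one coordinate -/
theorem even_odd {ι : Type} [Fintype ι] [DecidableEq ι] {f : (ι → ℝ) → ℝ} (hf : AnalyticAt ℝ f 0)
    (i : ι) : ∃ h₀ h₁ : (ι → ℝ) → ℝ, AnalyticAt ℝ h₀ 0 ∧ AnalyticAt ℝ h₁ 0 ∧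
      ∀ᶠ x in 𝓝 0, f x = h₀ (Function.update x i (x i ^ 2)) +
        x i * h₁ (Function.update x i (x i ^ 2)) := by
  obtain ⟨r, hr, F, hF, hFe⟩ := baseChange hf ((ℝ × ℝ) →L[ℝ] (ℝ × ℝ))
  let Q : (ℝ × ℝ) →L[ℝ] (ℝ × ℝ) := (ContinuousLinearMap.inl ℝ ℝ ℝ) ∘L (ContinuousLinearMap.snd ℝ ℝ ℝ)
  let R : (ℝ × ℝ) →L[ℝ] (ℝ × ℝ) := (ContinuousLinearMap.inr ℝ ℝ ℝ) ∘L (ContinuousLinearMap.fst ℝ ℝ ℝ)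
  obtain ⟨δ, hδ, hδr⟩ : ∃ δ > 0, δ * ‖R‖ < r := by
    refine ⟨r / (‖R‖ + 1), by positivity, ?_⟩
    rw [div_mul_eq_mul_div, div_lt_iff₀ (by positivity)]
    nlinarith
  let M : (ι → ℝ) → ι → ((ℝ × ℝ) →L[ℝ] (ℝ × ℝ)) := fun x k =>
    x k • (if k = i then δ⁻¹ • Q else 1) + if k = i then δ • R else 0
  have hM : ∀ x, AnalyticAt ℝ M x := by
    intro x
    refine AnalyticAt.pi fun k => ?_
    exact (((ContinuousLinearMap.proj k : (ι → ℝ) →L[ℝ] ℝ).analyticAt x).smul analyticAt_const).add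
      analyticAt_const
  have hM0 : M 0 ∈ ball 0 r := by
    rw [mem_ball_zero_iff, pi_norm_lt_iff hr]
    intro k
    by_cases hk : k = i
    · simpa [M, hk, norm_smul, abs_of_pos hδ] using hδr
    · simpa [M, hk] using hr
  have hFM : AnalyticAt ℝ (fun x => F (M x)) 0 := (hF _ hM0).comp (hM 0)
  have hz : ∀ v, AnalyticAt ℝ (fun x => (F (M x) v).2) 0 := fun v =>
    ((ContinuousLinearMap.snd ℝ ℝ ℝ ∘L ContinuousLinearMap.apply ℝ (ℝ × ℝ) v).analyticAt _).comp hFM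
  refine ⟨fun x => (F (M x) (0,1)).2, fun x => δ⁻¹ * (F (M x) (1, 0)).2, hz _,
    analyticAt_const.mul (hz _), ?_⟩
  have hsq : Tendsto (fun x : ι → ℝ => Function.update x i (x i ^ 2)) (𝓝 0) (𝓝 0) := by
    have : Continuous (fun x : ι → ℝ => Function.update x i (x i ^ 2)) := by fun_prop
    have h := this.tendsto 0
    simpa using h
  have e1 : ∀ᶠ x in 𝓝 (0 : ι → ℝ), M x ∈ ball 0 r :=
    (hM 0).continuousAt.eventually_mem (isOpen_ball.mem_nhds hM0)
  filter_upwards [hsq.eventually e1, eventually_norm_sub_lt (0 : ι → ℝ) hr] with x hx hxr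
  rw [sub_zero] at hxr
  have := hFe _ hx x hxr (ℝ × ℝ) (ContinuousLinearMap.apply ℝ (ℝ × ℝ) (x i, δ)) (by
    intro a k
    simp only [ContinuousLinearMap.apply_apply, ContinuousLinearMap.mul_apply]
    rw [← map_smul]
    congr 1
    by_cases hk : k = i
    · subst hk
      simp only [M, Q, R, Function.update_self, if_true]
      ext <;> simp <;> field_simp
    · simp [M, hk])
  simp only [ContinuousLinearMap.apply_apply, ContinuousLinearMap.one_apply] at this
  have h2 : ((x i, δ) : ℝ × ℝ) = x i • (1, 0) + δ • (0, 1) := by ext <;> simp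
  rw [h2, map_add, map_smul, map_smul] at this
  have h3 := congrArg Prod.snd this
  simp at h3
  field_simp
  linarith

/-- Hadamard's lemma in one coordinate -/
theorem hadamard_one {ι : Type} [Fintype ι] [DecidableEq ι] {f : (ι → ℝ) → ℝ}
    (hf : AnalyticAt ℝ f 0) (i : ι) : ∃ h : (ι → ℝ) → ℝ, AnalyticAt ℝ h 0 ∧
      ∀ᶠ x in 𝓝 0, f x = f (Function.update x i 0) + x i * h x := by
  obtain ⟨r, hr, F, hF, hFe⟩ := baseChange hf ((ℝ × ℝ) →L[ℝ] (ℝ × ℝ))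
  let Q : (ℝ × ℝ) →L[ℝ] (ℝ × ℝ) := (ContinuousLinearMap.inl ℝ ℝ ℝ) ∘L (ContinuousLinearMap.snd ℝ ℝ ℝ)
  let R : (ℝ × ℝ) →L[ℝ] (ℝ × ℝ) := (ContinuousLinearMap.inl ℝ ℝ ℝ) ∘L (ContinuousLinearMap.fst ℝ ℝ ℝ)
  obtain ⟨δ, hδ, hδr⟩ : ∃ δ > 0, δ * ‖Q‖ < r := by
    refine ⟨r / (‖Q‖ + 1), by positivity, ?_⟩
    rw [div_mul_eq_mul_div, div_lt_iff₀ (by positivity)]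
    nlinarith
  let M : (ι → ℝ) → ι → ((ℝ × ℝ) →L[ℝ] (ℝ × ℝ)) := fun x k =>
    x k • (if k = i then R else 1) + if k = i then δ • Q else 0
  have hM : ∀ x, AnalyticAt ℝ M x := by
    intro x
    refine AnalyticAt.pi fun k => ?_
    exact (((ContinuousLinearMap.proj k : (ι → ℝ) →L[ℝ] ℝ).analyticAt x).smul analyticAt_const).add
      analyticAt_const
  have hM0 : M 0 ∈ ball 0 r := by
    rw [mem_ball_zero_iff, pi_norm_lt_iff hr]
    intro k
    by_cases hk : k = i
    · simpa [M, hk, norm_smul, abs_of_pos hδ] using hδr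
    · simpa [M, hk] using hr
  have hFM : AnalyticAt ℝ (fun x => F (M x)) 0 := (hF _ hM0).comp (hM 0)
  have hz : ∀ v, AnalyticAt ℝ (fun x => (F (M x) v).1) 0 := fun v =>
    ((ContinuousLinearMap.fst ℝ ℝ ℝ ∘L ContinuousLinearMap.apply ℝ (ℝ × ℝ) v).analyticAt _).comp hFM
  refine ⟨fun x => δ⁻¹ * (F (M x) (0,1)).1, analyticAt_const.mul (hz _), ?_⟩
  have hsq : Tendsto (fun x : ι → ℝ => Function.update x i 0) (𝓝 0) (𝓝 0) := by
    have : Continuous (fun x : ι → ℝ => Function.update x i 0) := by fun_prop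
    have h := this.tendsto 0
    simpa using h
  have e1 : ∀ᶠ x in 𝓝 (0 : ι → ℝ), M x ∈ ball 0 r :=
    (hM 0).continuousAt.eventually_mem (isOpen_ball.mem_nhds hM0)
  have e2 := eventually_norm_sub_lt (0 : ι → ℝ) hr
  filter_upwards [e1, e2, hsq.eventually e2] with x hx hxr hxr'
  rw [sub_zero] at hxr hxr'
  have t1 := hFe _ hx x hxr (ℝ × ℝ) (ContinuousLinearMap.apply ℝ (ℝ × ℝ) (1, 0)) (by
    intro a k
    simp only [ContinuousLinearMap.apply_apply, ContinuousLinearMap.mul_apply]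
    rw [← map_smul]
    congr 1
    by_cases hk : k = i
    · subst hk
      simp only [M, Q, R, if_true]
      ext <;> simp
    · simp [M, hk])
  have t2 := hFe _ hx _ hxr' (ℝ × ℝ) (ContinuousLinearMap.apply ℝ (ℝ × ℝ) (-δ, x i)) (by
    intro a k
    simp only [ContinuousLinearMap.apply_apply, ContinuousLinearMap.mul_apply]
    rw [← map_smul]
    congr 1
    by_cases hk : k = i
    · subst hk
      simp only [M, Q, R, if_true]
      ext <;> simp <;> ring
    · simp [M, hk])
  simp only [ContinuousLinearMap.apply_apply, ContinuousLinearMap.one_apply] at t1 t2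
  have h2 : ((-δ, x i) : ℝ × ℝ) = (-δ) • (1, 0) + x i • (0, 1) := by ext <;> simp
  rw [h2, map_add, map_smul, map_smul, t1] at t2
  have h3 := congrArg Prod.fst t2
  simp at h3
  field_simp
  linarith

/-- Nemytskii operators on `C(K, ℝ)` -/
theorem nemytskii {ι : Type} [Fintype ι] [DecidableEq ι] {f : (ι → ℝ) → ℝ}
    (hf : AnalyticAt ℝ f 0) (K : Type) [TopologicalSpace K] [CompactSpace K] [Nonempty K] :
    ∃ F : (ι → C(K, ℝ)) → C(K, ℝ), AnalyticAt ℝ F 0 ∧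
      ∀ᶠ u in 𝓝 0, ∀ t, F u t = f (fun k => u k t) := by
  obtain ⟨r, hr, F, hF, hFe⟩ := baseChange hf C(K, ℝ)
  refine ⟨F, hF 0 (mem_ball_self hr), ?_⟩
  filter_upwards [eventually_norm_sub_lt (0 : ι → C(K, ℝ)) hr] with u hu t
  rw [sub_zero] at hu
  have := hFe u (by simpa using hu) (fun k => u k t) (by
    rw [pi_norm_lt_iff hr] at hu ⊢
    exact fun k => ((u k).norm_coe_le_norm t).trans_lt (hu k)) ℝ
    (ContinuousMap.evalCLM ℝ t) (by intro a i; simp [mul_comm])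
  simpa using this
end NambuLin

open scoped ContDiff
namespace NambuLin
open Metric Filter Topology

theorem eventually_analyticAt' {E F : Type*} [NormedAddCommGroup E] [NormedSpace ℝ E]
    [NormedAddCommGroup F] [NormedSpace ℝ F] [CompleteSpace F] {f : E → F} {x : E}
    (h : AnalyticAt ℝ f x) : ∀ᶠ y in 𝓝 x, AnalyticAt ℝ f y := h.eventually_analyticAt

theorem continuation {E F : Type*} [NormedAddCommGroup E] [NormedSpace ℝ E]
    [NormedAddCommGroup F] [NormedSpace ℝ F] [CompleteSpace F] {f : E → F}
    (h : AnalyticAt ℝ f 0) (hz : ∃ᶠ x₀ in 𝓝 (0 : E), ∀ᶠ x in 𝓝 x₀, f x = 0) :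
    ∀ᶠ x in 𝓝 (0 : E), f x = 0 := by
  obtain ⟨r, hr, hb⟩ := Metric.eventually_nhds_iff_ball.1 h.eventually_analyticAt
  obtain ⟨x₀, h1, h2⟩ := (hz.and_eventually (ball_mem_nhds 0 hr)).exists
  have := AnalyticOnNhd.eqOn_zero_of_preconnected_of_eventuallyEq_zero (f := f) (U := ball 0 r)
    hb (convex_ball 0 r).isPreconnected h2 h1
  exact eventually_of_mem (ball_mem_nhds 0 hr) this

theorem frequently_line {E : Type*} [NormedAddCommGroup E] [NormedSpace ℝ E] {p : E → Prop} (e : E)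
    (h : ∀ᶠ t in 𝓝[>] (0:ℝ), p (t • e)) : ∃ᶠ x in 𝓝 (0 : E), p x := by
  have ht : Tendsto (fun t : ℝ => t • e) (𝓝[>] 0) (𝓝 0) := by
    have : Continuous (fun t : ℝ => t • e) := by fun_prop
    have := (this.tendsto 0).mono_left (nhdsWithin_le_nhds (s := Set.Ioi 0))
    simpa using this
  exact ht.frequently h.frequently

theorem eventually_line {E : Type*} [NormedAddCommGroup E] [NormedSpace ℝ E] {p : E → Prop} (e : E)
    (h : ∀ᶠ x in 𝓝 (0 : E), p x) : ∀ᶠ t in 𝓝[>] (0:ℝ), p (t • e) := by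
  have ht : Tendsto (fun t : ℝ => t • e) (𝓝[>] 0) (𝓝 0) := by
    have : Continuous (fun t : ℝ => t • e) := by fun_prop
    have := (this.tendsto 0).mono_left (nhdsWithin_le_nhds (s := Set.Ioi 0))
    simpa using this
  exact ht.eventually h

theorem density {E F : Type*} [NormedAddCommGroup E] [NormedSpace ℝ E]
    [NormedAddCommGroup F] {f : E → F} {g : E → ℝ} (v : E)
    (hf : ∀ᶠ x in 𝓝 (0 : E), ContinuousAt f x) (hg : AnalyticAt ℝ g 0) (hv : fderiv ℝ g 0 v ≠ 0)
    (h : ∀ᶠ x in 𝓝 (0 : E), g x ≠ 0 → f x = 0) : ∀ᶠ x in 𝓝 (0 : E), f x = 0 := by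
  have h1 : ∀ᶠ x in 𝓝 (0 : E), fderiv ℝ g x v ≠ 0 := by
    have : ContinuousAt (fun x => fderiv ℝ g x v) 0 :=
      hg.fderiv.continuousAt.clm_apply continuousAt_const
    exact this.eventually_ne hv
  filter_upwards [hf, h1, hg.eventually_analyticAt, h.eventually_nhds] with x hx hx1 hx2 hx3
  by_cases hgx : g x = 0
  swap
  · exact hx3.self_of_nhds hgx
  have hl : HasDerivAt (fun t : ℝ => x + t • v) v 0 := by
    simpa using ((hasDerivAt_id (0:ℝ)).smul_const v).const_add x
  have hc : HasDerivAt (fun t : ℝ => g (x + t • v)) (fderiv ℝ g x v) 0 := by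
    have hd : HasFDerivAt g (fderiv ℝ g x) (x + (0:ℝ) • v) := by
      simpa using hx2.differentiableAt.hasFDerivAt
    exact hd.comp_hasDerivAt 0 hl
  have hne := hc.eventually_ne hx1 (c := 0)
  have hlc : Tendsto (fun t : ℝ => x + t • v) (𝓝[≠] 0) (𝓝 x) := by
    have := hl.continuousAt.tendsto.mono_left (nhdsWithin_le_nhds (s := {0}ᶜ))
    simpa using this
  have hlim : Tendsto (fun t : ℝ => f (x + t • v)) (𝓝[≠] 0) (𝓝 (f x)) := hx.tendsto.comp hlc
  have hev : ∀ᶠ t : ℝ in 𝓝[≠] 0, f (x + t • v) = 0 := by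
    filter_upwards [hne, hlc.eventually hx3] with t h1 h2 using h2 h1
  exact tendsto_nhds_unique (hlim.congr' hev) tendsto_const_nhds |>.symm ▸ rfl

abbrev Circ := AddCircle (2 * Real.pi)
noncomputable instance : Fact (0 < 2 * Real.pi) := ⟨by positivity⟩

noncomputable def mean : C(Circ, ℝ) →L[ℝ] ℝ :=
  LinearMap.mkContinuous
    { toFun := fun f => (2 * Real.pi)⁻¹ * ∫ t in (0:ℝ)..(2 * Real.pi), f (t : Circ)
      map_add' := by
        intro f g
        have : ∀ f : C(Circ, ℝ), IntervalIntegrable (fun t : ℝ => f (t : Circ)) MeasureTheory.volume 0 (2 * Real.pi) :=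
          fun f => (f.continuous.comp (AddCircle.continuous_mk' _)).intervalIntegrable _ _
        simp only [ContinuousMap.add_apply]
        rw [intervalIntegral.integral_add (this f) (this g)]; ring
      map_smul' := by
        intro c f
        simp only [ContinuousMap.smul_apply, smul_eq_mul, intervalIntegral.integral_const_mul,
          RingHom.id_apply]
        ring } 1 (by
      intro f
      have := intervalIntegral.norm_integral_le_of_norm_le_const (f := fun t : ℝ => f (t : Circ))
        (a := 0) (b := 2 * Real.pi) (C := ‖f‖) (fun x _ => f.norm_coe_le_norm _)
      rw [sub_zero, abs_of_pos (by positivity)] at this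
      simp only [LinearMap.coe_mk, AddHom.coe_mk, norm_mul, norm_inv]
      rw [Real.norm_of_nonneg (by positivity : (0:ℝ) ≤ Real.pi),
        Real.norm_of_nonneg (by positivity : (0:ℝ) ≤ 2), one_mul,
        inv_mul_le_iff₀ (by positivity), mul_comm (2 * Real.pi)]
      exact this)

theorem mean_apply (f : C(Circ, ℝ)) :
    mean f = (2 * Real.pi)⁻¹ * ∫ t in (0:ℝ)..(2 * Real.pi), f (t : Circ) := rfl

theorem prim_cont (f : C(Circ, ℝ)) : Continuous (fun θ : Circ =>
    (2 * Real.pi)⁻¹ * ∫ t in (0:ℝ)..(2 * Real.pi), (t - Real.pi) * f (θ + (t : Circ))) := by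
  refine continuous_const.mul ?_
  apply intervalIntegral.continuous_parametric_intervalIntegral_of_continuous'
  have h1 : Continuous (fun z : Circ × ℝ => f (z.1 + (z.2 : Circ))) :=
    f.continuous.comp (continuous_fst.add ((AddCircle.continuous_mk' _).comp continuous_snd))
  exact (continuous_snd.sub continuous_const).mul h1

theorem prim_ii (f : C(Circ, ℝ)) (θ : Circ) (a b : ℝ) : IntervalIntegrable
    (fun t : ℝ => (t - Real.pi) * f (θ + (t : Circ))) MeasureTheory.volume a b := by
  apply Continuous.intervalIntegrable
  exact (continuous_id.sub continuous_const).mul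
    (f.continuous.comp (continuous_const.add (AddCircle.continuous_mk' _)))

noncomputable def prim : C(Circ, ℝ) →L[ℝ] C(Circ, ℝ) :=
  LinearMap.mkContinuous
    { toFun := fun f => ⟨_, prim_cont f⟩
      map_add' := by
        intro f g
        ext θ
        simp only [ContinuousMap.add_apply, ContinuousMap.coe_mk, mul_add]
        rw [intervalIntegral.integral_add (prim_ii f θ _ _) (prim_ii g θ _ _)]; ring
      map_smul' := by
        intro c f
        ext θ
        simp only [ContinuousMap.smul_apply, smul_eq_mul, ContinuousMap.coe_mk, RingHom.id_apply]
        have : ∀ t : ℝ, (t - Real.pi) * (c * f (θ + (t : Circ))) =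
          c * ((t - Real.pi) * f (θ + (t : Circ))) := fun t => by ring
        simp only [this, intervalIntegral.integral_const_mul]
        ring } Real.pi (by
      intro f
      rw [ContinuousMap.norm_le _ (by positivity)]
      intro θ
      have := intervalIntegral.norm_integral_le_of_norm_le_const
        (f := fun t : ℝ => (t - Real.pi) * f (θ + (t : Circ)))
        (a := 0) (b := 2 * Real.pi) (C := Real.pi * ‖f‖) (by
          intro t ht
          rw [Set.uIoc_of_le (by positivity)] at ht
          rw [norm_mul]
          refine mul_le_mul ?_ (f.norm_coe_le_norm _) (norm_nonneg _) (by positivity)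
          rw [Real.norm_eq_abs, abs_le]
          constructor <;> linarith [ht.1, ht.2])
      rw [sub_zero, abs_of_pos (by positivity)] at this
      simp only [LinearMap.coe_mk, AddHom.coe_mk, ContinuousMap.coe_mk, norm_mul, norm_inv]
      rw [Real.norm_of_nonneg (by positivity : (0:ℝ) ≤ Real.pi),
        Real.norm_of_nonneg (by positivity : (0:ℝ) ≤ 2),
        inv_mul_le_iff₀ (by positivity), mul_comm (2 * Real.pi)]
      exact this)

theorem prim_apply (f : C(Circ, ℝ)) (θ : Circ) : prim f θ =
    (2 * Real.pi)⁻¹ * ∫ t in (0:ℝ)..(2 * Real.pi), (t - Real.pi) * f (θ + (t : Circ)) := rfl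

noncomputable def shift (s : Circ) (f : C(Circ, ℝ)) : C(Circ, ℝ) :=
  ⟨fun θ => f (θ + s), f.continuous.comp (continuous_id.add continuous_const)⟩

theorem shift_apply (s : Circ) (f : C(Circ, ℝ)) (θ) : shift s f θ = f (θ + s) := rfl

theorem prim_shift (s : Circ) (f : C(Circ, ℝ)) : prim (shift s f) = shift s (prim f) := by
  ext θ
  simp only [shift_apply, prim_apply]
  simp only [add_right_comm]

theorem mean_shift (s : Circ) (f : C(Circ, ℝ)) : mean (shift s f) = mean f := by
  obtain ⟨s, rfl⟩ := QuotientAddGroup.mk_surjective s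
  simp only [mean_apply, shift_apply]
  congr 1
  have hper : Function.Periodic (fun t : ℝ => f (t : Circ)) (2 * Real.pi) := by
    intro t
    simp
  have h1 : ∀ t : ℝ, f ((t : Circ) + (s : Circ)) = (fun t : ℝ => f (t : Circ)) (t + s) := by
    intro t
    simp
  have h2 : ∫ t in (0:ℝ)..(2 * Real.pi), f ((t : Circ) + (s : Circ)) =
      ∫ t in (0:ℝ)..(2 * Real.pi), (fun t : ℝ => f (t : Circ)) (t + s) := by
    simp only [← h1]
  refine h2.trans ?_
  rw [intervalIntegral.integral_comp_add_right (fun t : ℝ => f (t : Circ)) s]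
  have := hper.intervalIntegral_add_eq s 0
  rw [zero_add, add_comm (2 * Real.pi)]
  rw [zero_add] at this
  exact this

theorem prim_hasDerivAt (f : C(Circ, ℝ)) (s : ℝ) :
    HasDerivAt (fun s : ℝ => prim f (s : Circ)) (f (s : Circ) - mean f) s := by
  set F : ℝ → ℝ := fun t => f (t : Circ) with hF
  have hFc : Continuous F := f.continuous.comp (AddCircle.continuous_mk' _)
  have hper : Function.Periodic F (2 * Real.pi) := by
    intro t
    simp [F]
  have hm : ∀ s, ∫ t in s..(s + 2 * Real.pi), F t = 2 * Real.pi * mean f := by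
    intro s
    rw [mean_apply, mul_inv_cancel_left₀ (by positivity), hper.intervalIntegral_add_eq s 0, zero_add]
  have hG : Continuous (fun t => t * F t) := continuous_id.mul hFc
  have e1 : ∀ s : ℝ, prim f (s : Circ) = (2 * Real.pi)⁻¹ *
      ((∫ t in (0:ℝ)..(s + 2 * Real.pi), t * F t) - (∫ t in (0:ℝ)..s, t * F t)
        - (s + Real.pi) * (2 * Real.pi * mean f)) := by
    intro s
    rw [prim_apply]
    congr 1
    rw [intervalIntegral.integral_interval_sub_left (hG.intervalIntegrable _ _) (hG.intervalIntegrable _ _)]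
    rw [← hm s, ← intervalIntegral.integral_const_mul, ← intervalIntegral.integral_sub
      (hG.intervalIntegrable _ _) ((show Continuous (fun t => (s + Real.pi) * F t) from
        continuous_const.mul hFc).intervalIntegrable _ _)]
    have h2 : ∀ t : ℝ, (t - Real.pi) * f ((s : Circ) + (t : Circ)) =
        (fun t => t * F t - (s + Real.pi) * F t) (t + s) := by
      intro t
      simp only [F]
      rw [add_comm (s : Circ), ← AddCircle.coe_add]
      ring
    simp only [h2]
    rw [intervalIntegral.integral_comp_add_right (fun t => t * F t - (s + Real.pi) * F t) s,
      zero_add, add_comm (2 * Real.pi)]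
  have e2 : (fun s : ℝ => prim f (s : Circ)) = fun s => _ := funext e1
  rw [e2]
  have d1 : HasDerivAt (fun s : ℝ => ∫ t in (0:ℝ)..(s + 2 * Real.pi), t * F t)
      ((s + 2 * Real.pi) * F (s + 2 * Real.pi)) s := by
    have := (hG.integral_hasStrictDerivAt 0 (s + 2 * Real.pi)).hasDerivAt.comp s
      ((hasDerivAt_id s).add_const (2 * Real.pi))
    simp only [id_eq, mul_one] at this
    exact this
  have d2 : HasDerivAt (fun s : ℝ => ∫ t in (0:ℝ)..s, t * F t) (s * F s) s :=
    (hG.integral_hasStrictDerivAt 0 s).hasDerivAt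
  have d3 : HasDerivAt (fun s : ℝ => (s + Real.pi) * (2 * Real.pi * mean f)) (2 * Real.pi * mean f) s := by
    simpa using ((hasDerivAt_id s).add_const Real.pi).mul_const (2 * Real.pi * mean f)
  refine (((d1.sub d2).sub d3).const_mul (2 * Real.pi)⁻¹).congr_deriv ?_
  rw [hper s]
  show _ = F s - mean f
  field_simp
  ring

noncomputable def cosK : C(Circ, ℝ) := ⟨fun θ => Real.Angle.cos θ, Real.Angle.continuous_cos⟩
noncomputable def sinK : C(Circ, ℝ) := ⟨fun θ => Real.Angle.sin θ, Real.Angle.continuous_sin⟩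

theorem cosK_coe (t : ℝ) : cosK (t : Circ) = Real.cos t := Real.Angle.cos_coe t
theorem sinK_coe (t : ℝ) : sinK (t : Circ) = Real.sin t := Real.Angle.sin_coe t

theorem cosK_add (a b : Circ) : cosK (a + b) = cosK a * cosK b - sinK a * sinK b :=
  Real.Angle.cos_add a b
theorem sinK_add (a b : Circ) : sinK (a + b) = sinK a * cosK b + cosK a * sinK b :=
  Real.Angle.sin_add a b
theorem cosK_sq (a : Circ) : cosK a ^ 2 + sinK a ^ 2 = 1 := Real.Angle.cos_sq_add_sin_sq a

theorem mean_cos : mean cosK = 0 := by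
  simp [mean_apply, cosK_coe]
theorem mean_sin : mean sinK = 0 := by
  simp [mean_apply, sinK_coe]

theorem mean_const (c : ℝ) : mean (algebraMap ℝ _ c) = c := by
  simp only [mean_apply]
  simp
  field_simp

theorem prim_const (c : ℝ) : prim (algebraMap ℝ _ c) = 0 := by
  ext θ
  simp only [prim_apply]
  have : ∫ t in (0:ℝ)..(2 * Real.pi), (t - Real.pi) = 0 := by
    rw [intervalIntegral.integral_sub (by simp) (by simp)]
    simp
    ring
  simp [this]

theorem prim_cos : prim cosK = sinK := by
  ext θ
  obtain ⟨s, rfl⟩ := QuotientAddGroup.mk_surjective θ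
  simp only [prim_apply]
  have h : ∀ t : ℝ, HasDerivAt (fun t : ℝ => (t - Real.pi) * Real.sin (s + t) + Real.cos (s + t))
      ((t - Real.pi) * cosK ((s : Circ) + (t : Circ))) t := by
    intro t
    have a := (((hasDerivAt_id t).sub_const Real.pi).mul ((hasDerivAt_id t).const_add s).sin).add
      ((hasDerivAt_id t).const_add s).cos
    refine a.congr_deriv ?_
    rw [← AddCircle.coe_add, cosK_coe]
    simp
  have := intervalIntegral.integral_eq_sub_of_hasDerivAt (a := 0) (b := 2 * Real.pi)
    (fun t _ => h t) (prim_ii cosK s _ _)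
  show (2 * Real.pi)⁻¹ * (∫ t in (0:ℝ)..(2 * Real.pi), (t - Real.pi) * cosK ((s : Circ) + (t : Circ))) = sinK (s : Circ)
  rw [this, sinK_coe]
  simp
  field_simp
  ring

theorem prim_sin : prim sinK = -cosK := by
  ext θ
  obtain ⟨s, rfl⟩ := QuotientAddGroup.mk_surjective θ
  simp only [prim_apply]
  have h : ∀ t : ℝ, HasDerivAt (fun t : ℝ => -((t - Real.pi) * Real.cos (s + t)) + Real.sin (s + t))
      ((t - Real.pi) * sinK ((s : Circ) + (t : Circ))) t := by
    intro t
    have a := ((((hasDerivAt_id t).sub_const Real.pi).mul ((hasDerivAt_id t).const_add s).cos).neg).add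
      ((hasDerivAt_id t).const_add s).sin
    refine a.congr_deriv ?_
    rw [← AddCircle.coe_add, sinK_coe]
    simp
  have := intervalIntegral.integral_eq_sub_of_hasDerivAt (a := 0) (b := 2 * Real.pi)
    (fun t _ => h t) (prim_ii sinK s _ _)
  show (2 * Real.pi)⁻¹ * (∫ t in (0:ℝ)..(2 * Real.pi), (t - Real.pi) * sinK ((s : Circ) + (t : Circ))) = -cosK (s : Circ)
  rw [this, cosK_coe]
  simp
  field_simp
  ring
end NambuLin

open scoped ContDiff
namespace NambuLin
open Metric Filter Topology

section rotation
variable {ι : Type} [Fintype ι] [DecidableEq ι]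

noncomputable def rot (i j : ι) (θ : Circ) : (ι → ℝ) →L[ℝ] (ι → ℝ) :=
  ContinuousLinearMap.pi fun k =>
    if k = i then cosK θ • ContinuousLinearMap.proj i + sinK θ • ContinuousLinearMap.proj j
    else if k = j then (-sinK θ) • ContinuousLinearMap.proj i + cosK θ • ContinuousLinearMap.proj j
    else ContinuousLinearMap.proj k

noncomputable def JJ (i j : ι) : (ι → ℝ) →L[ℝ] (ι → ℝ) :=
  ContinuousLinearMap.pi fun k =>
    if k = i then ContinuousLinearMap.proj j
    else if k = j then - ContinuousLinearMap.proj i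
    else 0

theorem rot_apply (i j : ι) (θ : Circ) (x : ι → ℝ) (k : ι) : rot i j θ x k =
    if k = i then cosK θ * x i + sinK θ * x j
    else if k = j then -sinK θ * x i + cosK θ * x j else x k := by
  simp only [rot, ContinuousLinearMap.pi_apply]
  split_ifs <;> simp

theorem JJ_apply (i j : ι) (x : ι → ℝ) (k : ι) : JJ i j x k =
    if k = i then x j else if k = j then - x i else 0 := by
  simp only [JJ, ContinuousLinearMap.pi_apply]
  split_ifs <;> simp

variable {i j : ι}

theorem rot_i (θ : Circ) (x : ι → ℝ) : rot i j θ x i = cosK θ * x i + sinK θ * x j := by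
  simp [rot_apply]
theorem rot_j (hij : i ≠ j) (θ : Circ) (x : ι → ℝ) : rot i j θ x j = -sinK θ * x i + cosK θ * x j := by
  simp [rot_apply, hij.symm]
theorem rot_k (θ : Circ) (x : ι → ℝ) {k : ι} (h1 : k ≠ i) (h2 : k ≠ j) : rot i j θ x k = x k := by
  simp [rot_apply, h1, h2]
theorem JJ_i (x : ι → ℝ) : JJ i j x i = x j := by
  simp [JJ_apply]
theorem JJ_j (hij : i ≠ j) (x : ι → ℝ) : JJ i j x j = - x i := by
  simp [JJ_apply, hij.symm]
theorem JJ_k (x : ι → ℝ) {k : ι} (h1 : k ≠ i) (h2 : k ≠ j) : JJ i j x k = 0 := by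
  simp [JJ_apply, h1, h2]

theorem cosK_zero : cosK 0 = 1 := Real.Angle.cos_zero
theorem sinK_zero : sinK 0 = 0 := Real.Angle.sin_zero
theorem cosK_neg (a : Circ) : cosK (-a) = cosK a := Real.Angle.cos_neg a
theorem sinK_neg (a : Circ) : sinK (-a) = -sinK a := Real.Angle.sin_neg a

theorem rot_zero (hij : i ≠ j) (x : ι → ℝ) : rot i j 0 x = x := by
  ext k
  by_cases h1 : k = i
  · subst h1; simp [rot_i, cosK_zero, sinK_zero]
  by_cases h2 : k = j
  · subst h2; simp [rot_j hij, cosK_zero, sinK_zero]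
  rw [rot_k _ _ h1 h2]

theorem rot_add (hij : i ≠ j) (a b : Circ) (x : ι → ℝ) : rot i j (a + b) x = rot i j a (rot i j b x) := by
  ext k
  by_cases h1 : k = i
  · subst h1; simp only [rot_i, rot_j hij, cosK_add, sinK_add]; ring
  by_cases h2 : k = j
  · subst h2; simp only [rot_i, rot_j hij, cosK_add, sinK_add]; ring
  rw [rot_k _ _ h1 h2, rot_k _ _ h1 h2, rot_k _ _ h1 h2]

theorem rot_neg_rot (hij : i ≠ j) (a : Circ) (x : ι → ℝ) : rot i j (-a) (rot i j a x) = x := by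
  rw [← rot_add hij, neg_add_cancel, rot_zero hij]

theorem rot_rot_neg (hij : i ≠ j) (a : Circ) (x : ι → ℝ) : rot i j a (rot i j (-a) x) = x := by
  rw [← rot_add hij, add_neg_cancel, rot_zero hij]

theorem JJ_rot (hij : i ≠ j) (a : Circ) (x : ι → ℝ) : JJ i j (rot i j a x) = rot i j a (JJ i j x) := by
  ext k
  by_cases h1 : k = i
  · subst h1; simp only [rot_i, rot_j hij, JJ_i, JJ_j hij]; ring
  by_cases h2 : k = j
  · subst h2; simp only [rot_i, rot_j hij, JJ_i, JJ_j hij]; ring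
  rw [rot_k _ _ h1 h2, JJ_k _ h1 h2, JJ_k _ h1 h2]

theorem abs_cosK_le (a : Circ) : |cosK a| ≤ 1 := by
  have := cosK_sq a
  exact abs_le_one_iff_mul_self_le_one.2 (by nlinarith [sq_nonneg (sinK a)])
theorem abs_sinK_le (a : Circ) : |sinK a| ≤ 1 := by
  have := cosK_sq a
  exact abs_le_one_iff_mul_self_le_one.2 (by nlinarith [sq_nonneg (cosK a)])

theorem norm_rot_le (hij : i ≠ j) (a : Circ) (x : ι → ℝ) : ‖rot i j a x‖ ≤ 2 * ‖x‖ := by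
  rw [pi_norm_le_iff_of_nonneg (by positivity)]
  have hc := abs_cosK_le a
  have hs := abs_sinK_le a
  have hi := norm_le_pi_norm x i
  have hj := norm_le_pi_norm x j
  rw [Real.norm_eq_abs] at hi hj
  intro k
  by_cases h1 : k = i
  · subst h1
    rw [rot_i, Real.norm_eq_abs]
    refine (abs_add_le _ _).trans ?_
    rw [abs_mul, abs_mul]
    nlinarith [abs_nonneg (x k), abs_nonneg (x j)]
  by_cases h2 : k = j
  · subst h2
    rw [rot_j hij, Real.norm_eq_abs]
    refine (abs_add_le _ _).trans ?_
    rw [abs_mul, abs_mul, abs_neg]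
    nlinarith [abs_nonneg (x k), abs_nonneg (x i)]
  rw [rot_k _ _ h1 h2]
  linarith [norm_le_pi_norm x k, norm_nonneg x]

theorem rot_hasDerivAt (hij : i ≠ j) {c : ℝ → (ι → ℝ)} {c' : ι → ℝ} {s : ℝ} (hc : HasDerivAt c c' s) :
    HasDerivAt (fun s : ℝ => rot i j (s : Circ) (c s))
      (JJ i j (rot i j (s : Circ) (c s)) + rot i j (s : Circ) c') s := by
  rw [hasDerivAt_pi] at hc ⊢
  intro k
  have dc : HasDerivAt (fun s : ℝ => cosK (s : Circ)) (- sinK (s : Circ)) s := by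
    simp only [cosK_coe, sinK_coe]; exact Real.hasDerivAt_cos s
  have ds : HasDerivAt (fun s : ℝ => sinK (s : Circ)) (cosK (s : Circ)) s := by
    simp only [cosK_coe, sinK_coe]; exact Real.hasDerivAt_sin s
  by_cases h1 : k = i
  · subst h1
    simp only [rot_i, JJ_i, rot_j hij, Pi.add_apply]
    refine ((dc.mul (hc k)).add (ds.mul (hc j))).congr_deriv ?_
    ring
  by_cases h2 : k = j
  · subst h2
    simp only [rot_i, JJ_j hij, rot_j hij, Pi.add_apply]
    refine ((ds.neg.mul (hc i)).add (dc.mul (hc k))).congr_deriv ?_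
    simp only [Pi.neg_apply]
    ring
  · simp only [rot_k _ _ h1 h2, Pi.add_apply, JJ_k _ h1 h2]
    exact (hc k).congr_deriv (by ring)

theorem continuous_rot : Continuous (fun z : Circ × (ι → ℝ) => rot i j z.1 z.2) := by
  rw [continuous_pi_iff]
  intro k
  simp only [rot_apply]
  have h1 : Continuous (fun z : Circ × (ι → ℝ) => cosK z.1) := cosK.continuous.comp continuous_fst
  have h2 : Continuous (fun z : Circ × (ι → ℝ) => sinK z.1) := sinK.continuous.comp continuous_fst
  split_ifs <;> fun_prop

noncomputable def gam (i j : ι) (x : ι → ℝ) (v : ι → C(Circ, ℝ)) (t : Circ) : ι → ℝ :=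
  rot i j t (fun k => x k + prim (v k) t)

def Solves (i j : ι) (X : (ι → ℝ) → (ι → ℝ)) (p : (ι → ℝ) × ℝ) (v : ι → C(Circ, ℝ)) : Prop :=
  ∀ t, (fun k => v k t) =
    rot i j (-t) ((1 + p.2) • X (gam i j p.1 v t) - JJ i j (gam i j p.1 v t))

noncomputable def LL (k : ι) : ((ι → ℝ) × ℝ) × (ι → C(Circ, ℝ)) →L[ℝ] C(Circ, ℝ) :=
  algebraMapCLM ℝ C(Circ, ℝ) ∘L ContinuousLinearMap.proj k ∘L ContinuousLinearMap.fst ℝ _ _ ∘L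
    ContinuousLinearMap.fst ℝ _ _ +
  prim ∘L ContinuousLinearMap.proj k ∘L ContinuousLinearMap.snd ℝ _ _

theorem LL_apply (k : ι) (z : ((ι → ℝ) × ℝ) × (ι → C(Circ, ℝ))) (t : Circ) :
    LL k z t = z.1.1 k + prim (z.2 k) t := by
  simp [LL]

noncomputable def GamL (i j : ι) : ((ι → ℝ) × ℝ) × (ι → C(Circ, ℝ)) →L[ℝ] (ι → C(Circ, ℝ)) :=
  ContinuousLinearMap.pi fun k =>
    if k = i then ContinuousLinearMap.mul ℝ _ cosK ∘L LL i + ContinuousLinearMap.mul ℝ _ sinK ∘L LL j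
    else if k = j then ContinuousLinearMap.mul ℝ _ (-sinK) ∘L LL i +
      ContinuousLinearMap.mul ℝ _ cosK ∘L LL j
    else LL k

theorem GamL_apply (z : ((ι → ℝ) × ℝ) × (ι → C(Circ, ℝ))) (t : Circ) :
    (fun k => GamL i j z k t) = gam i j z.1.1 z.2 t := by
  ext k
  simp only [gam, rot_apply, GamL, ContinuousLinearMap.pi_apply]
  split_ifs <;> simp [LL_apply]

theorem gam_add (x x' : ι → ℝ) (v v' : ι → C(Circ, ℝ)) (t : Circ) :
    gam i j (x + x') (v + v') t = gam i j x v t + gam i j x' v' t := by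
  simp only [gam, ← map_add]
  congr 1
  ext k
  simp
  ring

theorem gam_smul (c : ℝ) (x : ι → ℝ) (v : ι → C(Circ, ℝ)) (t : Circ) :
    gam i j (c • x) (c • v) t = c • gam i j x v t := by
  simp only [gam, ← map_smul]
  congr 1
  ext k
  simp
  ring

theorem circle_family (hij : i ≠ j) (X : (ι → ℝ) → (ι → ℝ)) (hX : AnalyticAt ℝ X 0) (hX0 : X 0 = 0)
    (hdX : fderiv ℝ X 0 = JJ i j) :
    ∃ v : (ι → ℝ) × ℝ → ι → C(Circ, ℝ), AnalyticAt ℝ v 0 ∧ v 0 = 0 ∧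
      (∀ᶠ p in 𝓝 0, Solves i j X p (v p)) ∧
      ∀ᶠ z : ((ι → ℝ) × ℝ) × (ι → C(Circ, ℝ)) in 𝓝 0, Solves i j X z.1 z.2 → z.2 = v z.1 := by
  have hXk : ∀ k, AnalyticAt ℝ (fun x => X x k) 0 := fun k =>
    ((ContinuousLinearMap.proj k : (ι → ℝ) →L[ℝ] ℝ).analyticAt _).comp hX
  choose NX hNX hNXe using fun k => nemytskii (hXk k) Circ
  let h : ι → ((ι → ℝ) × ℝ) × (ι → C(Circ, ℝ)) → C(Circ, ℝ) := fun k z =>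
    (1 + z.1.2) • NX k (GamL i j z) -
      if k = i then GamL i j z j else if k = j then - GamL i j z i else 0
  let G : ((ι → ℝ) × ℝ) × (ι → C(Circ, ℝ)) → ι → C(Circ, ℝ) := fun z k =>
    if k = i then cosK * h i z - sinK * h j z else if k = j then sinK * h i z + cosK * h j z
    else h k z
  have hproj : ∀ k, AnalyticAt ℝ (fun z => GamL i j z k) 0 := fun k =>
    ((ContinuousLinearMap.proj k : (ι → C(Circ, ℝ)) →L[ℝ] C(Circ, ℝ)) ∘L GamL i j).analyticAt 0
  have hsig : AnalyticAt ℝ (fun z : ((ι → ℝ) × ℝ) × (ι → C(Circ, ℝ)) => z.1.2) 0 :=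
    ((ContinuousLinearMap.snd ℝ (ι → ℝ) ℝ) ∘L (ContinuousLinearMap.fst ℝ _ (ι → C(Circ, ℝ)))).analyticAt 0
  have hh : ∀ k, AnalyticAt ℝ (h k) 0 := by
    intro k
    have a1 : AnalyticAt ℝ (fun z => NX k (GamL i j z)) 0 := by
      refine AnalyticAt.comp (g := NX k) (f := fun z => GamL i j z) ?_ ((GamL i j).analyticAt 0)
      rw [map_zero]; exact hNX k
    refine ((analyticAt_const.add hsig).smul a1).sub ?_
    split_ifs
    · exact hproj j
    · exact (hproj i).neg
    · exact analyticAt_const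
  have hG : AnalyticAt ℝ G 0 := by
    refine AnalyticAt.pi fun k => ?_
    show AnalyticAt ℝ (fun z => if k = i then cosK * h i z - sinK * h j z else if k = j then sinK * h i z + cosK * h j z
    else h k z) 0
    split_ifs
    · exact (analyticAt_const.mul (hh i)).sub (analyticAt_const.mul (hh j))
    · exact (analyticAt_const.mul (hh i)).add (analyticAt_const.mul (hh j))
    · exact hh k
  have hGe : ∀ᶠ z in 𝓝 (0 : ((ι → ℝ) × ℝ) × (ι → C(Circ, ℝ))), ∀ t, (fun k => G z k t) =
      rot i j (-t) ((1 + z.1.2) • X (gam i j z.1.1 z.2 t) - JJ i j (gam i j z.1.1 z.2 t)) := by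
    have hc : Tendsto (GamL i j) (𝓝 0) (𝓝 0) := by
      have := (GamL i j).continuous.tendsto 0
      rwa [map_zero] at this
    filter_upwards [hc.eventually (eventually_all.2 hNXe)] with z hz t
    have hht : ∀ k, h k z t = ((1 + z.1.2) • X (gam i j z.1.1 z.2 t) - JJ i j (gam i j z.1.1 z.2 t)) k := by
      intro k
      have := hz k t
      rw [GamL_apply] at this
      have h2 : ∀ k, GamL i j z k t = gam i j z.1.1 z.2 t k := fun k => congrFun (GamL_apply z t) k
      simp only [h, ContinuousMap.sub_apply, ContinuousMap.smul_apply, this, Pi.sub_apply,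
        Pi.smul_apply, JJ_apply]
      split_ifs <;> simp [h2]
    ext k
    simp only [G, rot_apply, cosK_neg, sinK_neg, ← hht]
    split_ifs <;> simp <;> ring
  have hG0 : G 0 = 0 := by
    ext k t
    have := congrFun (hGe.self_of_nhds t) k
    have g0 : gam i j (0 : ι → ℝ) 0 t = 0 := by
      simpa using gam_smul (i := i) (j := j) 0 (0 : ι → ℝ) 0 t
    simp only [Prod.fst_zero, Prod.snd_zero, g0, hX0] at this
    simpa using this
  have hdG : ∀ δ, fderiv ℝ G 0 δ = 0 := by
    intro δ
    ext k t
    have hl : HasDerivAt (fun τ : ℝ => τ • δ) δ 0 := by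
      simpa using (hasDerivAt_id (0:ℝ)).smul_const δ
    have d1 : HasDerivAt (fun τ : ℝ => G (τ • δ)) (fderiv ℝ G 0 δ) 0 := by
      have : HasFDerivAt G (fderiv ℝ G 0) ((0:ℝ) • δ) := by
        rw [zero_smul]; exact hG.differentiableAt.hasFDerivAt
      exact this.comp_hasDerivAt 0 hl
    have d2 : HasDerivAt (fun τ : ℝ => (fun k => G (τ • δ) k t)) (fun k => fderiv ℝ G 0 δ k t) 0 := by
      rw [hasDerivAt_pi]
      intro k
      exact ((ContinuousMap.evalCLM ℝ t) ∘L (ContinuousLinearMap.proj k :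
        (ι → C(Circ, ℝ)) →L[ℝ] C(Circ, ℝ))).hasFDerivAt.comp_hasDerivAt 0 d1
    set w := gam i j δ.1.1 δ.2 t
    have hw : HasDerivAt (fun τ : ℝ => τ • w) w 0 := by
      simpa using (hasDerivAt_id (0:ℝ)).smul_const w
    have d3 : HasDerivAt (fun τ : ℝ => X (τ • w)) (JJ i j w) 0 := by
      have : HasFDerivAt X (JJ i j) ((0:ℝ) • w) := by
        rw [zero_smul, ← hdX]; exact hX.differentiableAt.hasFDerivAt
      exact this.comp_hasDerivAt 0 hw
    have d4 : HasDerivAt (fun τ : ℝ => (1 + τ * δ.1.2)) (δ.1.2) 0 := by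
      simpa using ((hasDerivAt_id (0:ℝ)).mul_const δ.1.2).const_add 1
    have d5 := (rot i j (-t)).hasFDerivAt.comp_hasDerivAt (0:ℝ)
      ((d4.smul d3).sub ((JJ i j).hasFDerivAt.comp_hasDerivAt (0:ℝ) hw))
    have hev : (fun τ : ℝ => (fun k => G (τ • δ) k t)) =ᶠ[𝓝 0] fun τ : ℝ =>
        rot i j (-t) ((1 + τ * δ.1.2) • X (τ • w) - JJ i j (τ • w)) := by
      have : Tendsto (fun τ : ℝ => τ • δ) (𝓝 0) (𝓝 0) := by
        simpa using hl.continuousAt.tendsto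
      filter_upwards [this.eventually hGe] with τ hτ
      rw [hτ t]
      simp only [Prod.smul_fst, Prod.smul_snd, gam_smul, smul_eq_mul]
      rfl
    have d6 := (d5.congr_of_eventuallyEq hev).unique d2
    have d7 := congrFun d6 k
    simp only [zero_mul, add_zero, one_smul, zero_smul, hX0, smul_zero, sub_self,
      map_zero] at d7
    rw [← d7]
    rfl
  obtain ⟨v, h1, h2, h3, h4⟩ := implicit_fixed hG hG0 (fun w => hdG _)
  refine ⟨v, h1, h2, ?_, ?_⟩
  · have hc : Tendsto (fun p => (p, v p)) (𝓝 0) (𝓝 (0 : ((ι → ℝ) × ℝ) × (ι → C(Circ, ℝ)))) := by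
      have := (continuousAt_id.prodMk h1.continuousAt).tendsto
      rw [h2] at this
      exact this
    filter_upwards [h3, hc.eventually hGe] with p hp1 hp2 t
    rw [← hp2 t, ← hp1]
  · filter_upwards [h4, hGe] with z hz1 hz2 hs
    apply hz1
    ext k t
    rw [congrFun (hs t) k, ← congrFun (hz2 t) k]
end rotation
end NambuLin

open scoped ContDiff
namespace NambuLin
open Metric Filter Topology

section family
variable {ι : Type} [Fintype ι] [DecidableEq ι]

noncomputable def rotV (i j : ι) (s : Circ) (v : ι → C(Circ, ℝ)) : ι → C(Circ, ℝ) := fun k =>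
  if k = i then cosK s • shift s (v i) + sinK s • shift s (v j)
  else if k = j then (-sinK s) • shift s (v i) + cosK s • shift s (v j)
  else shift s (v k)

theorem rotV_apply (i j : ι) (s : Circ) (v : ι → C(Circ, ℝ)) (t : Circ) :
    (fun k => rotV i j s v k t) = rot i j s (fun k => v k (t + s)) := by
  ext k
  simp only [rotV, rot_apply]
  split_ifs <;> simp [shift_apply]

theorem prim_rotV (i j : ι) (s : Circ) (v : ι → C(Circ, ℝ)) (t : Circ) :
    (fun k => prim (rotV i j s v k) t) = rot i j s (fun k => prim (v k) (t + s)) := by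
  ext k
  simp only [rotV, rot_apply]
  split_ifs <;> simp [prim_shift, shift_apply]

theorem mean_rotV (i j : ι) (s : Circ) (v : ι → C(Circ, ℝ)) :
    (fun k => mean (rotV i j s v k)) = rot i j s (fun k => mean (v k)) := by
  ext k
  simp only [rotV, rot_apply]
  split_ifs <;> simp [mean_shift]

theorem norm_rotV_le {i j : ι} (hij : i ≠ j) (s : Circ) (v : ι → C(Circ, ℝ)) :
    ‖rotV i j s v‖ ≤ 2 * ‖v‖ := by
  rw [pi_norm_le_iff_of_nonneg (by positivity)]
  intro k
  rw [ContinuousMap.norm_le _ (by positivity)]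
  intro t
  have h : rotV i j s v k t = _ := congrFun (rotV_apply i j s v t) k
  rw [h]
  refine (norm_le_pi_norm _ k).trans ((norm_rot_le hij _ _).trans ?_)
  gcongr
  rw [pi_norm_le_iff_of_nonneg (by positivity)]
  intro k'
  exact ((v k').norm_coe_le_norm _).trans (norm_le_pi_norm v k')

theorem gam_rotV {i j : ι} (hij : i ≠ j) (s : Circ) (x : ι → ℝ) (v : ι → C(Circ, ℝ)) (t : Circ) :
    gam i j (rot i j s x) (rotV i j s v) t = gam i j x v (t + s) := by
  have h : (fun k => rot i j s x k + prim (rotV i j s v k) t) =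
      rot i j s (fun k => x k + prim (v k) (t + s)) := by
    have := prim_rotV i j s v t
    change rot i j s x + (fun k => prim (rotV i j s v k) t) = _
    rw [this, ← map_add]
    rfl
  simp only [gam]
  rw [h, rot_add hij]

theorem Solves.rot {i j : ι} (hij : i ≠ j) {X : (ι → ℝ) → (ι → ℝ)} {p : (ι → ℝ) × ℝ}
    {v : ι → C(Circ, ℝ)} (h : Solves i j X p v) (s : Circ) :
    Solves i j X (rot i j s p.1, p.2) (rotV i j s v) := by
  intro t
  rw [rotV_apply, gam_rotV hij, h (t + s), ← rot_add hij]
  congr 2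
  abel_nf

theorem norm_gam_le {i j : ι} (hij : i ≠ j) (x : ι → ℝ) (v : ι → C(Circ, ℝ)) (t : Circ) :
    ‖gam i j x v t‖ ≤ 2 * (‖x‖ + ‖prim‖ * ‖v‖) := by
  refine (norm_rot_le hij _ _).trans ?_
  gcongr
  rw [pi_norm_le_iff_of_nonneg (by positivity)]
  intro k
  refine (norm_add_le _ _).trans ?_
  gcongr
  · exact norm_le_pi_norm x k
  · refine ((prim (v k)).norm_coe_le_norm _).trans ((prim.le_opNorm _).trans ?_)
    gcongr
    exact norm_le_pi_norm v k

theorem gam_small {i j : ι} (hij : i ≠ j) {p : (ι → ℝ) → Prop} (hp : ∀ᶠ x in 𝓝 0, p x) :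
    ∀ᶠ z : (ι → ℝ) × (ι → C(Circ, ℝ)) in 𝓝 0, ∀ t, p (gam i j z.1 z.2 t) := by
  rw [Metric.eventually_nhds_iff] at hp
  obtain ⟨ε, hε, hp⟩ := hp
  have : Tendsto (fun z : (ι → ℝ) × (ι → C(Circ, ℝ)) => 2 * (‖z.1‖ + ‖prim‖ * ‖z.2‖)) (𝓝 0) (𝓝 0) := by
    have : Continuous (fun z : (ι → ℝ) × (ι → C(Circ, ℝ)) => 2 * (‖z.1‖ + ‖prim‖ * ‖z.2‖)) := by
      fun_prop
    simpa using this.tendsto 0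
  filter_upwards [this.eventually (gt_mem_nhds hε)] with z hz t
  apply hp
  rw [dist_zero_right]
  exact (norm_gam_le hij _ _ _).trans_lt hz

theorem rot_small {i j : ι} (hij : i ≠ j) {p : (ι → ℝ) → Prop} (hp : ∀ᶠ x in 𝓝 0, p x) :
    ∀ᶠ x : (ι → ℝ) in 𝓝 0, ∀ t, p (rot i j t x) := by
  rw [Metric.eventually_nhds_iff] at hp
  obtain ⟨ε, hε, hp⟩ := hp
  have : Tendsto (fun z : (ι → ℝ) => 2 * ‖z‖) (𝓝 0) (𝓝 0) := by
    have : Continuous (fun z : (ι → ℝ) => 2 * ‖z‖) := by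
      fun_prop
    simpa using this.tendsto 0
  filter_upwards [this.eventually (gt_mem_nhds hε)] with z hz t
  apply hp
  rw [dist_zero_right]
  exact (norm_rot_le hij _ _).trans_lt hz

/-- local uniqueness gives equivariance -/
theorem family_equiv {i j : ι} (hij : i ≠ j) {X : (ι → ℝ) → (ι → ℝ)}
    {v : (ι → ℝ) × ℝ → ι → C(Circ, ℝ)} (hv : AnalyticAt ℝ v 0) (hv0 : v 0 = 0)
    (hS : ∀ᶠ p in 𝓝 0, Solves i j X p (v p))
    (hU : ∀ᶠ z : ((ι → ℝ) × ℝ) × (ι → C(Circ, ℝ)) in 𝓝 0, Solves i j X z.1 z.2 → z.2 = v z.1) :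
    ∀ᶠ p : (ι → ℝ) × ℝ in 𝓝 0, ∀ s, v (rot i j s p.1, p.2) = rotV i j s (v p) := by
  rw [Metric.eventually_nhds_iff] at hU
  obtain ⟨ε, hε, hU⟩ := hU
  have hc : Tendsto (fun p => 2 * ‖p‖ + 2 * ‖v p‖) (𝓝 0) (𝓝 0) := by
    have : ContinuousAt (fun p => 2 * ‖p‖ + 2 * ‖v p‖) 0 :=
      ((continuousAt_id.norm).const_mul 2).add ((hv.continuousAt.norm).const_mul 2)
    have := this.tendsto
    simpa [hv0] using this
  filter_upwards [hS, hc.eventually (gt_mem_nhds hε)] with p hp1 hp2 s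
  refine (hU (y := ((rot i j s p.1, p.2), rotV i j s (v p))) ?_ (hp1.rot hij s)).symm
  rw [dist_zero_right]
  refine lt_of_le_of_lt ?_ hp2
  have h1 := norm_rot_le hij s p.1
  have h2 := norm_rotV_le hij s (v p)
  have h3 := norm_fst_le p
  have h4 := norm_snd_le p
  have h5 := norm_nonneg (v p)
  have h6 := norm_nonneg p
  simp only [Prod.norm_def, sup_le_iff]
  simp only [Prod.norm_def] at h1 h2 h3 h4 h5 h6
  refine ⟨⟨?_, ?_⟩, ?_⟩ <;> linarith

noncomputable def vconst (i j : ι) : (ι → ℝ) →L[ℝ] (ι → C(Circ, ℝ)) :=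
  ContinuousLinearMap.pi fun k =>
    if k = i then - (ContinuousLinearMap.smulRight (ContinuousLinearMap.proj i) sinK +
      ContinuousLinearMap.smulRight (ContinuousLinearMap.proj j) cosK)
    else if k = j then (ContinuousLinearMap.smulRight (ContinuousLinearMap.proj i) cosK -
      ContinuousLinearMap.smulRight (ContinuousLinearMap.proj j) sinK)
    else 0

def zij (i j : ι) (x : ι → ℝ) : ι → ℝ := fun k => if k = i ∨ k = j then 0 else x k

theorem gam_vconst {i j : ι} (hij : i ≠ j) (p : ι → ℝ) (t : Circ) :
    gam i j (zij i j p) (vconst i j p) t = p := by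
  have h : (fun k => zij i j p k + prim (vconst i j p k) t) = rot i j (-t) p := by
    ext k
    simp only [rot_apply, vconst, zij, cosK_neg, sinK_neg]
    by_cases h1 : k = i
    · subst h1; simp [prim_cos, prim_sin]; ring
    by_cases h2 : k = j
    · subst h2; simp [prim_cos, prim_sin, h1]; ring
    simp [h1, h2]
  rw [gam, h, rot_rot_neg hij]

theorem mean_vconst (i j : ι) (p : ι → ℝ) (k : ι) : mean (vconst i j p k) = 0 := by
  simp only [vconst, ContinuousLinearMap.pi_apply]
  split_ifs <;> simp [mean_cos, mean_sin]

theorem solves_vconst {i j : ι} (hij : i ≠ j) {X : (ι → ℝ) → (ι → ℝ)} {p : ι → ℝ} (hp : X p = 0)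
    (σ : ℝ) : Solves i j X (zij i j p, σ) (vconst i j p) := by
  intro t
  rw [gam_vconst hij, hp, smul_zero, zero_sub]
  ext k
  by_cases h1 : k = i
  · subst h1
    simp only [map_neg, Pi.neg_apply, rot_i, JJ_i, JJ_j hij, cosK_neg, sinK_neg]
    simp [vconst]; ring
  by_cases h2 : k = j
  · subst h2
    simp only [map_neg, Pi.neg_apply, rot_j hij, JJ_i, JJ_j hij, cosK_neg, sinK_neg]
    simp [vconst, h1]; ring
  simp only [map_neg, Pi.neg_apply, rot_k _ _ h1 h2, JJ_k _ h1 h2]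
  simp [vconst, h1, h2]

theorem family_const {i j : ι} (hij : i ≠ j) {X : (ι → ℝ) → (ι → ℝ)}
    {v : (ι → ℝ) × ℝ → ι → C(Circ, ℝ)}
    (hU : ∀ᶠ z : ((ι → ℝ) × ℝ) × (ι → C(Circ, ℝ)) in 𝓝 0, Solves i j X z.1 z.2 → z.2 = v z.1) :
    ∀ᶠ p : (ι → ℝ) × ℝ in 𝓝 0, X p.1 = 0 → v (zij i j p.1, p.2) = vconst i j p.1 := by
  have hz : Continuous (zij i j) := by
    unfold zij
    refine continuous_pi fun k => ?_
    split_ifs <;> fun_prop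
  have hc : Continuous (fun p : (ι → ℝ) × ℝ => ((zij i j p.1, p.2), vconst i j p.1)) := by
    fun_prop
  have h0 : zij i j 0 = 0 := by ext k; simp [zij]
  have := hc.tendsto 0
  simp only [Prod.fst_zero, Prod.snd_zero, h0, map_zero, Prod.mk_zero_zero] at this
  filter_upwards [this.eventually hU] with p hp hX
  exact (hp (solves_vconst hij hX _)).symm
end family
end NambuLin

open scoped ContDiff
namespace NambuLin
open Metric Filter Topology

section family
variable {ι : Type} [Fintype ι] [DecidableEq ι]

theorem gam_hasDerivAt (i j : ι) {x : ℝ → ι → ℝ} {w : ℝ → ι → C(Circ, ℝ)} {ξ d} {a : ℝ}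
    (hx : HasDerivAt x ξ a) (hw : HasDerivAt w d a) (t : Circ) :
    HasDerivAt (fun τ => gam i j (x τ) (w τ) t) (gam i j ξ d t) a := by
  unfold gam
  refine (rot i j t).hasFDerivAt.comp_hasDerivAt a ?_
  rw [hasDerivAt_pi] at *
  intro k
  refine (hx k).add ?_
  exact ((ContinuousMap.evalCLM ℝ t) ∘L prim).hasFDerivAt.comp_hasDerivAt a (hw k)

theorem family_zero {i j : ι} (hij : i ≠ j) {X : (ι → ℝ) → (ι → ℝ)}
    {v : (ι → ℝ) × ℝ → ι → C(Circ, ℝ)} (hX0 : X 0 = 0)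
    (hU : ∀ᶠ z : ((ι → ℝ) × ℝ) × (ι → C(Circ, ℝ)) in 𝓝 0, Solves i j X z.1 z.2 → z.2 = v z.1) :
    ∀ᶠ σ : ℝ in 𝓝 0, v (0, σ) = 0 := by
  have hl : Continuous (fun σ : ℝ => ((0 : ι → ℝ), σ)) := by fun_prop
  have h0 : zij i j 0 = 0 := by ext k; simp [zij]
  filter_upwards [(hl.tendsto 0).eventually (family_const hij hU)] with σ hσ
  have := hσ hX0
  simpa [h0] using this

theorem family_deriv {i j : ι} (hij : i ≠ j) {X : (ι → ℝ) → (ι → ℝ)} (hX0 : X 0 = 0)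
    (hX : HasFDerivAt X (JJ i j) 0)
    {v : (ι → ℝ) × ℝ → ι → C(Circ, ℝ)} (hv : AnalyticAt ℝ v 0)
    (hS : ∀ᶠ p in 𝓝 0, Solves i j X p (v p))
    (hU : ∀ᶠ z : ((ι → ℝ) × ℝ) × (ι → C(Circ, ℝ)) in 𝓝 0, Solves i j X z.1 z.2 → z.2 = v z.1) :
    ∀ᶠ σ : ℝ in 𝓝 0, ∀ ξ : ι → ℝ, ∀ t, (fun k => fderiv ℝ v (0, σ) (ξ, 0) k t) =
      σ • JJ i j (fun k => ξ k + prim (fderiv ℝ v (0, σ) (ξ, 0) k) t) := by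
  have hl : Continuous (fun σ : ℝ => ((0 : ι → ℝ), σ)) := by fun_prop
  have hl' := hl.tendsto 0
  filter_upwards [family_zero hij hX0 hU, hl'.eventually hv.eventually_analyticAt,
    hl'.eventually (eventually_eventually_nhds.2 hS)] with σ h1 h2 h3 ξ t
  set d := fderiv ℝ v (0, σ) (ξ, 0) with hd
  have hx : HasDerivAt (fun τ : ℝ => τ • ξ) ξ 0 := by
    simpa using (hasDerivAt_id (0 : ℝ)).smul_const ξ
  have hc : HasDerivAt (fun τ : ℝ => (τ • ξ, σ)) (ξ, (0 : ℝ)) 0 := hx.prodMk (hasDerivAt_const _ _)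
  have hw : HasDerivAt (fun τ : ℝ => v (τ • ξ, σ)) d 0 := by
    have := h2.differentiableAt.hasFDerivAt
    have e : ((0 : ι → ℝ), σ) = ((0 : ℝ) • ξ, σ) := by simp
    rw [e] at this
    have h := this.comp_hasDerivAt (0 : ℝ) hc
    rw [← e] at h
    exact h
  have hg := gam_hasDerivAt i j hx hw t
  have hg0 : gam i j ((0 : ℝ) • ξ) (v ((0 : ℝ) • ξ, σ)) t = 0 := by
    rw [zero_smul, h1]
    have := gam_smul (i := i) (j := j) (0 : ℝ) (0 : ι → ℝ) (0 : ι → C(Circ, ℝ)) t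
    simpa using this
  have hXg : HasDerivAt (fun τ : ℝ => X (gam i j (τ • ξ) (v (τ • ξ, σ)) t))
      (JJ i j (gam i j ξ d t)) 0 := by
    rw [← hg0] at hX
    exact hX.comp_hasDerivAt (0 : ℝ) hg
  have hJg := (JJ i j).hasFDerivAt.comp_hasDerivAt (0 : ℝ) hg
  have hR := (rot i j (-t)).hasFDerivAt.comp_hasDerivAt (0 : ℝ) ((hXg.const_smul (1 + σ)).sub hJg)
  have hL : HasDerivAt (fun τ : ℝ => (fun k => v (τ • ξ, σ) k t)) (fun k => d k t) 0 := by
    rw [hasDerivAt_pi] at *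
    intro k
    exact (ContinuousMap.evalCLM ℝ t).hasFDerivAt.comp_hasDerivAt (0 : ℝ) (hw k)
  have hev : ∀ᶠ τ : ℝ in 𝓝 0, Solves i j X (τ • ξ, σ) (v (τ • ξ, σ)) := by
    have := hc.continuousAt.tendsto
    simp only [zero_smul] at this
    exact this.eventually h3
  have := hL.unique (hR.congr_of_eventuallyEq (hev.mono fun τ hτ => hτ t))
  rw [this]
  have e : (1 + σ) • JJ i j (gam i j ξ d t) - JJ i j (gam i j ξ d t) =
      σ • JJ i j (gam i j ξ d t) := by module
  rw [e, map_smul, ← JJ_rot hij, gam, rot_neg_rot hij]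

/-- explicit ray derivative -/
theorem family_deriv_ray {i j : ι} (hij : i ≠ j) {X : (ι → ℝ) → (ι → ℝ)} (hX0 : X 0 = 0)
    (hX : HasFDerivAt X (JJ i j) 0)
    {v : (ι → ℝ) × ℝ → ι → C(Circ, ℝ)} (hv : AnalyticAt ℝ v 0)
    (hS : ∀ᶠ p in 𝓝 0, Solves i j X p (v p))
    (hU : ∀ᶠ z : ((ι → ℝ) × ℝ) × (ι → C(Circ, ℝ)) in 𝓝 0, Solves i j X z.1 z.2 → z.2 = v z.1) :
    ∀ᶠ σ : ℝ in 𝓝 0, mean (fderiv ℝ v (0, σ) (Pi.single i 1, 0) j) = - σ := by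
  have hsm : ∀ᶠ σ : ℝ in 𝓝 0, σ ^ 2 * ‖prim‖ ^ 2 < 1 := by
    have : Continuous (fun σ : ℝ => σ ^ 2 * ‖prim‖ ^ 2) := by fun_prop
    have := this.tendsto 0
    simp only [ne_eq, OfNat.ofNat_ne_zero, not_false_eq_true, zero_pow, zero_mul] at this
    exact this.eventually (gt_mem_nhds one_pos)
  filter_upwards [family_deriv hij hX0 hX hv hS hU, hsm] with σ h hs
  have h := h (Pi.single i 1)
  set d := fderiv ℝ v (0, σ) (Pi.single i 1, 0) with hd
  have hi : d i = σ • prim (d j) := by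
    ext t
    have := congrFun (h t) i
    simp only [Pi.smul_apply, JJ_i] at this
    rw [this]
    simp [hij.symm]
  have hj : d j = algebraMap ℝ C(Circ, ℝ) (-σ) - σ • prim (d i) := by
    ext t
    have := congrFun (h t) j
    simp only [Pi.smul_apply, JJ_j hij] at this
    rw [this]
    simp; ring
  have hi2 : d i = - (σ ^ 2) • prim (prim (d i)) := by
    conv_lhs => rw [hi, hj, map_sub, prim_const, map_smul]
    rw [zero_sub, smul_neg, smul_smul, pow_two, neg_smul]
  have hi0 : d i = 0 := by
    by_contra hne
    have hpos : 0 < ‖d i‖ := norm_pos_iff.2 hne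
    have h1 : ‖d i‖ ≤ σ ^ 2 * (‖prim‖ * (‖prim‖ * ‖d i‖)) := by
      conv_lhs => rw [hi2]
      rw [norm_smul, norm_neg, Real.norm_eq_abs, abs_of_nonneg (sq_nonneg σ)]
      gcongr
      refine (prim.le_opNorm _).trans ?_
      gcongr
      exact prim.le_opNorm _
    nlinarith
  rw [hj, hi0, map_zero, smul_zero, sub_zero, mean_const]

end family
end NambuLin

open scoped ContDiff
namespace NambuLin
open Metric Filter Topology

section family
variable {ι : Type} [Fintype ι] [DecidableEq ι]

theorem family_Z {i j : ι} (hij : i ≠ j) {X : (ι → ℝ) → (ι → ℝ)}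
    {v : (ι → ℝ) × ℝ → ι → C(Circ, ℝ)}
    (hU : ∀ᶠ z : ((ι → ℝ) × ℝ) × (ι → C(Circ, ℝ)) in 𝓝 0, Solves i j X z.1 z.2 → z.2 = v z.1)
    {ζ : (ι → ℝ) → (ι → ℝ)} (hζ : ContinuousAt ζ 0) (hζ0 : ζ 0 = 0)
    (hZ : ∀ᶠ x in 𝓝 0, X (ζ x) = 0 ∧ ∀ k, k ≠ i → k ≠ j → ζ x k = x k) :
    ∀ᶠ p : (ι → ℝ) × ℝ in 𝓝 0, p.1 i = 0 → p.1 j = 0 →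
      (∀ k, mean (v p k) = 0) ∧ ∀ t, gam i j p.1 (v p) t = ζ p.1 := by
  have hc : Tendsto (fun p : (ι → ℝ) × ℝ => (ζ p.1, p.2)) (𝓝 0) (𝓝 0) := by
    have h1 : ContinuousAt (fun p : (ι → ℝ) × ℝ => ζ p.1) 0 :=
      ContinuousAt.comp (f := Prod.fst) (g := ζ) (by simpa using hζ) continuousAt_fst
    have := (h1.prodMk continuousAt_snd).tendsto
    rw [show ((0 : (ι → ℝ) × ℝ).1) = 0 from rfl, hζ0] at this
    exact this
  have hf : Tendsto (fun p : (ι → ℝ) × ℝ => p.1) (𝓝 0) (𝓝 0) :=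
    (continuous_fst.tendsto (0 : (ι → ℝ) × ℝ))
  filter_upwards [hc.eventually (family_const hij hU), hf.eventually hZ] with p h1 h2 hi hj
  have hz : zij i j (ζ p.1) = p.1 := by
    ext k
    simp only [zij]
    split_ifs with h
    · rcases h with rfl | rfl
      · exact hi.symm
      · exact hj.symm
    · push Not at h
      exact h2.2 k h.1 h.2
  have h3 := h1 h2.1
  simp only [hz] at h3
  rw [show (p.1, p.2) = p from rfl] at h3
  refine ⟨fun k => by rw [h3, mean_vconst], fun t => ?_⟩
  rw [h3]
  have h4 := gam_vconst hij (ζ p.1) t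
  rwa [hz] at h4

theorem half_turn {i j : ι} (hij : i ≠ j) (x : ι → ℝ) (hx : x j = 0) :
    rot i j ((Real.pi : ℝ) : Circ) x = Function.update x i (- x i) := by
  ext k
  by_cases h1 : k = i
  · subst h1; simp [rot_i, cosK_coe, sinK_coe]
  by_cases h2 : k = j
  · subst h2; simp [rot_j hij, cosK_coe, sinK_coe, hx, hij.symm]
  · rw [rot_k _ _ h1 h2]; simp [h1]

theorem sigma_exists {i j : ι} (hij : i ≠ j) {X : (ι → ℝ) → (ι → ℝ)} (hX0 : X 0 = 0)
    (hX : HasFDerivAt X (JJ i j) 0)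
    {v : (ι → ℝ) × ℝ → ι → C(Circ, ℝ)} (hv : AnalyticAt ℝ v 0) (hv0 : v 0 = 0)
    (hS : ∀ᶠ p in 𝓝 0, Solves i j X p (v p))
    (hU : ∀ᶠ z : ((ι → ℝ) × ℝ) × (ι → C(Circ, ℝ)) in 𝓝 0, Solves i j X z.1 z.2 → z.2 = v z.1)
    {ζ : (ι → ℝ) → (ι → ℝ)} (hζ : ContinuousAt ζ 0) (hζ0 : ζ 0 = 0)
    (hZ : ∀ᶠ x in 𝓝 0, X (ζ x) = 0 ∧ ∀ k, k ≠ i → k ≠ j → ζ x k = x k) :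
    ∃ σ : (ι → ℝ) → ℝ, AnalyticAt ℝ σ 0 ∧ σ 0 = 0 ∧ (∀ x s, σ (rot i j s x) = σ x) ∧
      ∀ᶠ x in 𝓝 0, x j = 0 → mean (v (x, σ x) j) = 0 := by
  let Lx : (Option ι → ℝ) →L[ℝ] (ι → ℝ) := ContinuousLinearMap.pi fun k =>
    if k = j then 0 else ContinuousLinearMap.proj (some k)
  let L : (Option ι → ℝ) →L[ℝ] (ι → ℝ) × ℝ := Lx.prod (ContinuousLinearMap.proj none)
  have hLj : ∀ z, Lx z j = 0 := fun z => by simp [Lx]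
  have hLk : ∀ z k, k ≠ j → Lx z k = z (some k) := fun z k hk => by simp [Lx, hk]
  have hL : ∀ z, L z = (Lx z, z none) := fun z => rfl
  let mj : (ι → C(Circ, ℝ)) →L[ℝ] ℝ := mean ∘L ContinuousLinearMap.proj j
  let f : (Option ι → ℝ) → ℝ := fun z => - mj (v (L z))
  have hLt : Tendsto L (𝓝 0) (𝓝 0) := by simpa using (L.continuous.tendsto 0)
  have hvL : AnalyticAt ℝ (fun z => v (L z)) 0 :=
    AnalyticAt.comp (f := L) (g := v) (by simpa using hv) (L.analyticAt 0)
  have hf : AnalyticAt ℝ f 0 := ((mj.analyticAt _).comp hvL).neg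
  obtain ⟨β, hβ, hfβ⟩ := hadamard_one hf (some i)
  -- vanishing on the axis
  have hup : Tendsto (fun z : Option ι → ℝ => Function.update z (some i) (0 : ℝ)) (𝓝 0) (𝓝 0) := by
    have : Continuous (fun z : Option ι → ℝ => Function.update z (some i) (0 : ℝ)) := by fun_prop
    have h := this.tendsto 0
    have e : Function.update (0 : Option ι → ℝ) (some i) (0 : ℝ) = 0 := by
      ext k; by_cases h : k = some i
      · subst h; simp
      · simp [h]
    rwa [e] at h
  have hfβ' : ∀ᶠ z in 𝓝 0, f z = z (some i) * β z := by
    filter_upwards [hfβ, (hLt.comp hup).eventually (family_Z hij hU hζ hζ0 hZ)] with z h1 h2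
    rw [h1]
    have := (h2 (by simp [hL, hLk _ i hij]) (hLj _)).1 j
    have h3 : f (Function.update z (some i) 0) = 0 := by
      simp only [f, mj, ContinuousLinearMap.comp_apply, ContinuousLinearMap.proj_apply, neg_eq_zero]
      exact this
    rw [h3, zero_add]
  -- value on the σ axis
  have hβσ : ∀ᶠ τ : ℝ in 𝓝 0, β (Pi.single none τ) = τ := by
    have hc : Continuous (fun τ : ℝ => (Pi.single none τ : Option ι → ℝ)) := by
      refine continuous_pi fun k => ?_
      by_cases h : k = none
      · subst h; simp only [Pi.single_eq_same]; exact continuous_id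
      · simp [h, continuous_const]
    have hc0 : Tendsto (fun τ : ℝ => (Pi.single none τ : Option ι → ℝ)) (𝓝 0) (𝓝 0) := by
      simpa using hc.tendsto 0
    have hl : Continuous (fun σ : ℝ => ((0 : ι → ℝ), σ)) := by fun_prop
    filter_upwards [hc0.eventually hβ.eventually_analyticAt,
      hc0.eventually (eventually_eventually_nhds.2 hfβ'),
      family_deriv_ray hij hX0 hX hv hS hU,
      (hl.tendsto 0).eventually hv.eventually_analyticAt] with σ h1 h2 h3 h4
    let c : ℝ → (Option ι → ℝ) := fun τ => Pi.single none σ + τ • Pi.single (some i) 1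
    have hcd : HasDerivAt c (Pi.single (some i) 1) 0 := by
      have := ((hasDerivAt_id (0 : ℝ)).smul_const (Pi.single (some i) (1:ℝ) : Option ι → ℝ)).const_add
        (Pi.single none σ)
      rw [one_smul] at this
      exact this
    have hc0' : c 0 = Pi.single none σ := by simp [c]
    have hLc : L (Pi.single none σ) = (0, σ) := by
      rw [hL]
      ext k
      · by_cases hk : k = j
        · subst hk; simp [hLj]
        · simp [hLk _ _ hk]
      · simp
    have hLe : L (Pi.single (some i) 1) = (Pi.single i 1, 0) := by
      rw [hL]
      ext k
      · by_cases hk : k = j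
        · subst hk; simp [hLj, hij.symm]
        · by_cases hi : k = i
          · subst hi; simp [hLk _ _ hk]
          · simp [hLk _ _ hk, hi]
      · simp
    have d1 : HasDerivAt (fun τ => f (c τ)) σ 0 := by
      have hh : HasFDerivAt v (fderiv ℝ v (0, σ)) (L (c 0)) := by
        rw [hc0', hLc]; exact h4.differentiableAt.hasFDerivAt
      have := (mj.hasFDerivAt.comp_hasDerivAt (0:ℝ)
        (hh.comp_hasDerivAt (0:ℝ) (L.hasFDerivAt.comp_hasDerivAt (0:ℝ) hcd))).neg
      refine this.congr_deriv ?_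
      rw [hLe]
      simp only [mj, ContinuousLinearMap.comp_apply, ContinuousLinearMap.proj_apply]
      rw [h3, neg_neg]
    have d2 : HasDerivAt (fun τ => f (c τ)) (β (Pi.single none σ)) 0 := by
      have hh : HasFDerivAt β (fderiv ℝ β (Pi.single none σ)) (c 0) := by
        rw [hc0']; exact h1.differentiableAt.hasFDerivAt
      have := (hasDerivAt_id (0:ℝ)).mul (hh.comp_hasDerivAt (0:ℝ) hcd)
      have hev : (fun τ => f (c τ)) =ᶠ[𝓝 0] (id * (β ∘ c)) := by
        have ht := hcd.continuousAt.tendsto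
        rw [hc0'] at ht
        filter_upwards [ht.eventually h2] with τ hτ
        rw [hτ]
        simp [c]
      refine (this.congr_of_eventuallyEq hev).congr_deriv ?_
      simp [hc0']
    exact d2.unique d1
  -- implicit function
  let M : (ι → ℝ) × ℝ →L[ℝ] (Option ι → ℝ) := ContinuousLinearMap.pi fun k =>
    Option.elim k (ContinuousLinearMap.snd ℝ _ _) fun k =>
      ContinuousLinearMap.proj k ∘L ContinuousLinearMap.fst ℝ _ _
  have hMn : ∀ p, M p none = p.2 := fun p => rfl
  have hMs : ∀ p k, M p (some k) = p.1 k := fun p k => rfl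
  let G : (ι → ℝ) × ℝ → ℝ := fun p => β (M p)
  have hMt : Tendsto M (𝓝 0) (𝓝 0) := by simpa using (M.continuous.tendsto 0)
  have hG : AnalyticAt ℝ G 0 :=
    AnalyticAt.comp (f := M) (g := β) (by simpa using hβ) (M.analyticAt 0)
  have hG0 : G 0 = 0 := by
    have := hβσ.self_of_nhds
    simpa [G] using this
  have hdG : fderiv ℝ G 0 (0, 1) = 1 := by
    have hcd : HasDerivAt (fun τ : ℝ => ((0 : ι → ℝ), τ)) ((0 : ι → ℝ), (1:ℝ)) 0 :=
      (hasDerivAt_const _ _).prodMk (hasDerivAt_id _)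
    have d1 : HasDerivAt (fun τ : ℝ => G (0, τ)) (fderiv ℝ G 0 (0, 1)) 0 :=
      HasFDerivAt.comp_hasDerivAt (l := G) (f := fun τ : ℝ => ((0 : ι → ℝ), τ)) (0:ℝ)
        hG.differentiableAt.hasFDerivAt hcd
    have d2 : HasDerivAt (fun τ : ℝ => G (0, τ)) 1 0 := by
      refine (hasDerivAt_id (0:ℝ)).congr_of_eventuallyEq ?_
      filter_upwards [hβσ] with τ hτ
      have : M (0, τ) = Pi.single none τ := by
        ext k; cases k with
        | none => simp [hMn]
        | some k => simp [hMs]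
      simp only [G, this, hτ, id]
    exact d1.unique d2
  obtain ⟨u, hu, hu0, hu1, hu2⟩ := implicit_zero hG hG0 (by
    refine ⟨ContinuousLinearEquiv.refl ℝ ℝ, ?_⟩
    ext
    simp [hdG])
  -- evenness
  have hneg : Continuous (fun x : ι → ℝ => Function.update x i (- x i)) := by fun_prop
  have hneg0 : Function.update (0 : ι → ℝ) i (- (0 : ι → ℝ) i) = 0 := by
    ext k; by_cases h : k = i
    · subst h; simp
    · simp [h]
  have hnegt : Tendsto (fun x : ι → ℝ => Function.update x i (- x i)) (𝓝 0) (𝓝 0) := by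
    have := hneg.tendsto 0
    rwa [hneg0] at this
  have hxu : Tendsto (fun x => (x, u x)) (𝓝 0) (𝓝 0) := by
    have := (continuousAt_id.prodMk hu.continuousAt).tendsto
    rw [hu0] at this
    exact this
  have hxu' : Tendsto (fun x => (Function.update x i (- x i), u x)) (𝓝 0) (𝓝 0) := by
    have := (hneg.continuousAt.prodMk hu.continuousAt).tendsto
    rw [hu0, hneg0] at this
    exact this
  have heven : ∀ᶠ x in 𝓝 0, u (Function.update x i (- x i)) = u x := by
    filter_upwards [hu1, hxu'.eventually hu2, (hMt.comp hxu').eventually hfβ',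
      (hMt.comp hxu).eventually hfβ',
      (hLt.comp (hMt.comp hxu)).eventually (family_equiv hij hv hv0 hS hU)] with x h1 h2 h3 h4 h5
    by_cases hxi : x i = 0
    · rw [hxi, neg_zero]
      congr 1
      ext k; by_cases h : k = i
      · subst h; simp [hxi]
      · simp [h]
    refine (h2 ?_).symm
    simp only [Function.comp_apply] at h3 h4 h5
    have h6 := h5 ((Real.pi : ℝ) : Circ)
    rw [hL] at h6
    simp only at h6
    rw [half_turn hij _ (hLj _), hLk _ _ hij, hMs, hMn] at h6
    have e : L (M (Function.update x i (-x i), u x)) =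
        (Function.update (Lx (M (x, u x))) i (- x i), u x) := by
      rw [hL]
      ext k
      · by_cases hk : k = i
        · subst hk; simp [hLk _ _ hij, hMs]
        · by_cases hk' : k = j
          · subst hk'; simp [hLj, hk]
          · simp [hLk _ _ hk', hMs, hk]
      · simp [hMn]
    have h7 : f (M (Function.update x i (-x i), u x)) = - f (M (x, u x)) := by
      simp only [f, mj, ContinuousLinearMap.comp_apply, ContinuousLinearMap.proj_apply]
      rw [e, h6]
      have := congrFun (mean_rotV i j ((Real.pi : ℝ) : Circ) (v (L (M (x, u x))))) j
      simp only [rot_j hij, cosK_coe, sinK_coe] at this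
      rw [hL, hMn] at this
      simp only at this
      rw [this, hL, hMn]
      simp
    rw [h3, h4] at h7
    simp only [hMs] at h7
    simp only [Function.update_self] at h7
    have h8 : G (x, u x) = 0 := h1
    simp only [G] at h8 ⊢
    rw [h8] at h7
    simp only [mul_zero, neg_zero, mul_eq_zero, neg_eq_zero] at h7
    exact h7.resolve_left hxi
  obtain ⟨h₀, h₁, hh₀, hh₁, hh⟩ := even_odd hu i
  have hue : ∀ᶠ x in 𝓝 0, u x = h₀ (Function.update x i (x i ^ 2)) := by
    filter_upwards [hh, heven, hnegt.eventually hh] with x h1 h2 h3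
    rw [h2] at h3
    simp only [Function.update_self, Function.update_idem, neg_sq] at h3
    linarith
  have hz0 : Function.update (Function.update (0 : ι → ℝ) i ((0 : ι → ℝ) i ^ 2 + (0 : ι → ℝ) j ^ 2)) j 0
      = 0 := by
    ext k; by_cases h : k = j
    · subst h; simp
    · by_cases h' : k = i
      · subst h'; simp [h]
      · simp [h, h']
  refine ⟨fun x => h₀ (Function.update (Function.update x i (x i ^ 2 + x j ^ 2)) j 0), ?_, ?_, ?_, ?_⟩
  · refine AnalyticAt.comp (g := h₀)
      (f := fun x => (Function.update (Function.update x i (x i ^ 2 + x j ^ 2)) j 0)) ?_ ?_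
    · rw [hz0]; exact hh₀
    · rw [analyticAt_pi_iff]
      intro k
      have hp : ∀ k, AnalyticAt ℝ (fun x : ι → ℝ => x k) 0 := fun k =>
        (ContinuousLinearMap.proj k : (ι → ℝ) →L[ℝ] ℝ).analyticAt 0
      by_cases h : k = j
      · subst h; simp only [Function.update_self]; exact analyticAt_const
      · simp only [Function.update_of_ne h]
        by_cases h' : k = i
        · subst h'; simp only [Function.update_self]; exact ((hp _).pow 2).add ((hp _).pow 2)
        · simp only [Function.update_of_ne h']; exact hp k
  · have := hue.self_of_nhds
    rw [hu0] at this
    simp only [hz0]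
    rw [this]
    congr 1
    ext k; by_cases h : k = i
    · subst h; simp
    · simp [h]
  · intro x s
    simp only
    congr 1
    ext k
    by_cases h : k = j
    · subst h; simp
    · simp only [Function.update_of_ne h]
      by_cases h' : k = i
      · subst h'; simp only [Function.update_self, rot_i, rot_j hij]
        nlinarith [cosK_sq s]
      · simp only [Function.update_of_ne h', rot_k _ _ h' h]
  · filter_upwards [hu1, hue, (hMt.comp hxu).eventually hfβ'] with x h1 h2 h3 hxj
    have e : Function.update (Function.update x i (x i ^ 2 + x j ^ 2)) j 0 =
        Function.update x i (x i ^ 2) := by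
      ext k
      by_cases h : k = j
      · subst h; simp [hxj, hij.symm]
      · simp [h, hxj]
    simp only [e, ← h2]
    simp only [Function.comp_apply] at h3
    have h8 : G (x, u x) = 0 := h1
    simp only [G] at h8
    rw [h8, mul_zero] at h3
    have e2 : L (M (x, u x)) = (x, u x) := by
      rw [hL, hMn]
      ext k
      · by_cases h : k = j
        · subst h; simp [hLj, hxj]
        · simp [hLk _ _ h, hMs]
      · rfl
    simp only [f, mj, ContinuousLinearMap.comp_apply, ContinuousLinearMap.proj_apply, e2,
      neg_eq_zero] at h3
    exact h3

end family
end NambuLin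

open scoped ContDiff
namespace NambuLin
open Metric Filter Topology

section family
variable {ι : Type} [Fintype ι] [DecidableEq ι]

theorem gam_ode {i j : ι} (hij : i ≠ j) {X : (ι → ℝ) → (ι → ℝ)} {x : ι → ℝ} {σ : ℝ}
    {v : ι → C(Circ, ℝ)} (h : Solves i j X (x, σ) v) (s : ℝ) :
    HasDerivAt (fun s : ℝ => gam i j x v (s : Circ))
      ((1 + σ) • X (gam i j x v (s : Circ)) - rot i j (s : Circ) (fun k => mean (v k))) s := by
  have hc : HasDerivAt (fun s : ℝ => (fun k => x k + prim (v k) (s : Circ)))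
      (fun k => v k (s : Circ) - mean (v k)) s := by
    rw [hasDerivAt_pi]
    intro k
    exact (prim_hasDerivAt (v k) s).const_add _
  refine (rot_hasDerivAt hij hc).congr_deriv ?_
  have e : (fun k => v k (s : Circ) - mean (v k)) = (fun k => v k (s : Circ)) - fun k => mean (v k) := rfl
  rw [e, map_sub, h s, rot_rot_neg hij]
  simp only [gam]
  abel

structure CircV (i j : ι) (X ζ : (ι → ℝ) → (ι → ℝ)) (V : (ι → ℝ) → ι → C(Circ, ℝ))
    (σ : (ι → ℝ) → ℝ) : Prop where
  an : AnalyticAt ℝ V 0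
  zero : V 0 = 0
  deriv : HasFDerivAt V (0 : (ι → ℝ) →L[ℝ] (ι → C(Circ, ℝ))) 0
  san : AnalyticAt ℝ σ 0
  szero : σ 0 = 0
  sinv : ∀ x s, σ (rot i j s x) = σ x
  solves : ∀ᶠ x in 𝓝 0, Solves i j X (x, σ x) (V x)
  equiv : ∀ᶠ x in 𝓝 0, ∀ s, V (rot i j s x) = rotV i j s (V x)
  ray : ∀ᶠ x in 𝓝 0, x j = 0 → mean (V x j) = 0
  axis : ∀ᶠ x in 𝓝 0, x i = 0 → x j = 0 →
    (∀ k, mean (V x k) = 0) ∧ ∀ t, gam i j x (V x) t = ζ x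
  triv : ∀ k, k ≠ i → k ≠ j → (∀ᶠ x in 𝓝 0, X x k = 0) → ∀ᶠ x in 𝓝 0, V x k = 0

theorem circV_exists {i j : ι} (hij : i ≠ j) {X : (ι → ℝ) → (ι → ℝ)} (hX : AnalyticAt ℝ X 0)
    (hX0 : X 0 = 0) (hdX : fderiv ℝ X 0 = JJ i j)
    {ζ : (ι → ℝ) → (ι → ℝ)} (hζ : ContinuousAt ζ 0) (hζ0 : ζ 0 = 0)
    (hZ : ∀ᶠ x in 𝓝 0, X (ζ x) = 0 ∧ ∀ k, k ≠ i → k ≠ j → ζ x k = x k) :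
    ∃ V σ, CircV i j X ζ V σ := by
  obtain ⟨v, hv, hv0, hS, hU⟩ := circle_family hij X hX hX0 hdX
  have hX' : HasFDerivAt X (JJ i j) 0 := hdX ▸ hX.differentiableAt.hasFDerivAt
  obtain ⟨σ, hσ, hσ0, hinv, hray⟩ := sigma_exists hij hX0 hX' hv hv0 hS hU hζ hζ0 hZ
  have hp : AnalyticAt ℝ (fun x => (x, σ x)) 0 := analyticAt_id.prod hσ
  have hp0 : ((0 : ι → ℝ), σ 0) = 0 := by rw [hσ0]; rfl
  have hpt : Tendsto (fun x => (x, σ x)) (𝓝 0) (𝓝 0) := by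
    have := hp.continuousAt.tendsto
    rwa [hp0] at this
  have hV : AnalyticAt ℝ (fun x => v (x, σ x)) 0 :=
    AnalyticAt.comp (f := fun x => (x, σ x)) (g := v) (by rw [hp0]; exact hv) hp
  have hV0 : v (0, σ 0) = 0 := by rw [hp0, hv0]
  have hzt : Tendsto (fun x => (x, v (x, σ x))) (𝓝 0) (𝓝 0) := by
    have := (continuousAt_id.prodMk hV.continuousAt).tendsto
    rw [hV0] at this
    exact this
  refine ⟨fun x => v (x, σ x), σ, hV, hV0, ?_, hσ, hσ0, hinv, hpt.eventually hS, ?_, hray, ?_, ?_⟩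
  · have d0 : fderiv ℝ v 0 = 0 := by
      have h1 : ∀ ξ, fderiv ℝ v 0 (ξ, 0) = 0 := by
        intro ξ
        have := (family_deriv hij hX0 hX' hv hS hU).self_of_nhds ξ
        ext k t
        have := congrFun (this t) k
        rw [show ((0 : ι → ℝ), (0:ℝ)) = 0 from rfl] at this
        simpa using this
      have h2 : fderiv ℝ v 0 (0, 1) = 0 := by
        have hcd : HasDerivAt (fun τ : ℝ => ((0 : ι → ℝ), τ)) ((0 : ι → ℝ), (1:ℝ)) 0 :=
          (hasDerivAt_const _ _).prodMk (hasDerivAt_id _)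
        have d1 : HasDerivAt (fun τ : ℝ => v (0, τ)) (fderiv ℝ v 0 (0, 1)) 0 :=
          HasFDerivAt.comp_hasDerivAt (l := v) (f := fun τ : ℝ => ((0 : ι → ℝ), τ)) (0:ℝ)
            hv.differentiableAt.hasFDerivAt hcd
        refine d1.unique ((hasDerivAt_const (0:ℝ) (0 : ι → C(Circ, ℝ))).congr_of_eventuallyEq ?_)
        exact family_zero hij hX0 hU
      refine ContinuousLinearMap.ext fun p => ?_
      have : p = (p.1, (0:ℝ)) + p.2 • ((0 : ι → ℝ), (1:ℝ)) := by ext <;> simp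
      rw [this, map_add, map_smul, h1, h2]
      simp
    have d1 : HasFDerivAt v (0 : (ι → ℝ) × ℝ →L[ℝ] ι → C(Circ, ℝ)) (0, σ 0) := by
      rw [hp0, ← d0]; exact hv.differentiableAt.hasFDerivAt
    have := d1.comp (0 : ι → ℝ) hp.differentiableAt.hasFDerivAt
    simpa using this
  · filter_upwards [hpt.eventually (family_equiv hij hv hv0 hS hU)] with x hx s
    rw [hinv, hx s]
  · exact hpt.eventually (family_Z hij hU hζ hζ0 hZ)
  · intro k hk1 hk2 hk
    filter_upwards [hpt.eventually hS, hzt.eventually (gam_small hij hk)] with x h1 h2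
    ext t
    have := congrFun (h1 t) k
    simp only [rot_k _ _ hk1 hk2, Pi.sub_apply, Pi.smul_apply, JJ_k _ hk1 hk2] at this
    rw [this, h2 t]
    simp

end family
end NambuLin

open scoped ContDiff
namespace NambuLin
open Metric Filter Topology

section leaf
variable {ι : Type} [Fintype ι] [DecidableEq ι]

theorem exists_left_inv (V : Submodule ℝ (ι → ℝ)) (D : (ι → ℝ) →L[ℝ] (ι → ℝ))
    (h : ∀ v ∈ V, D v = 0 → v = 0) :
    ∃ L : (ι → ℝ) →L[ℝ] (ι → ℝ), ∀ v ∈ V, L (D v) = v := by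
  have hk : LinearMap.ker (D.toLinearMap ∘ₗ V.subtype) = ⊥ := by
    rw [LinearMap.ker_eq_bot']
    intro m hm
    exact Subtype.ext (h m m.2 hm)
  obtain ⟨g, hg⟩ := LinearMap.exists_leftInverse_of_injective _ hk
  refine ⟨LinearMap.toContinuousLinearMap (V.subtype ∘ₗ g), fun v hv => ?_⟩
  have := congrArg (fun f => ((f ⟨v, hv⟩ : V) : ι → ℝ)) hg
  simpa using this

/-- second order normalised leaf function -/
theorem leaf_fun2 (V : Submodule ℝ (ι → ℝ)) {g : (ι → ℝ) → (ι → ℝ)} {p : ι → ℝ} (l : ι)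
    (hg : ContDiffAt ℝ 2 g p) (hV : ∀ v ∈ V, fderiv ℝ g p v = v) :
    ∃ h : (ι → ℝ) → ℝ, ContDiffAt ℝ 2 h p ∧ (∀ v, fderiv ℝ h p v = fderiv ℝ g p v l) ∧
      (∀ᶠ x in 𝓝 p, ∀ v, fderiv ℝ g x v = 0 → fderiv ℝ h x v = 0) ∧
      (∀ u ∈ V, ∀ v ∈ V, fderiv ℝ (fderiv ℝ h) p u v = 0) := by
  have hgl : ContDiffAt ℝ 2 (fun x => g x l) p := contDiffAt_pi.1 hg l
  set B := fderiv ℝ (fderiv ℝ (fun x => g x l)) p with hB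
  have hsym : ∀ u v, B u v = B v u := by
    intro u v
    have := hgl.isSymmSndFDerivAt (n := 2) (by simp)
    exact this u v
  let h : (ι → ℝ) → ℝ := fun x => g x l - (1/2) * B (g x - g p) (g x - g p)
  have hd : ∀ x, DifferentiableAt ℝ g x → HasFDerivAt h
      ((ContinuousLinearMap.proj l) ∘L fderiv ℝ g x - (B (g x - g p)) ∘L fderiv ℝ g x) x := by
    intro x hx
    have h1 : HasFDerivAt (fun x => g x l) ((ContinuousLinearMap.proj l) ∘L fderiv ℝ g x) x :=
      (ContinuousLinearMap.proj (R := ℝ) (φ := fun _ : ι => ℝ) l).hasFDerivAt.comp x hx.hasFDerivAt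
    have h2 : HasFDerivAt (fun x => g x - g p) (fderiv ℝ g x) x := hx.hasFDerivAt.sub_const _
    have h3 := ((B.hasFDerivAt.comp x h2).clm_apply h2).const_mul (1/2 : ℝ)
    refine (h1.sub h3).congr_fderiv ?_
    refine ContinuousLinearMap.ext fun v => ?_
    simp
    rw [hsym (fderiv ℝ g x v) (g x), hsym (fderiv ℝ g x v) (g p)]
    ring
  have hgd : ∀ᶠ x in 𝓝 p, ContDiffAt ℝ 2 g x := hg.eventually (by simp)
  have hfd : ∀ᶠ x in 𝓝 p, fderiv ℝ h x = (ContinuousLinearMap.proj l) ∘L fderiv ℝ g x - (B (g x - g p)) ∘L fderiv ℝ g x := by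
    filter_upwards [hgd] with x hx
    exact (hd x (hx.differentiableAt (by simp))).fderiv
  refine ⟨h, ?_, ?_, ?_, ?_⟩
  · have h2 : ContDiffAt ℝ 2 (fun x => g x - g p) p := hg.sub contDiffAt_const
    exact hgl.sub (contDiffAt_const.mul ((B.contDiff.contDiffAt.comp p h2).clm_apply h2))
  · intro v
    rw [hfd.self_of_nhds]
    simp
  · filter_upwards [hfd] with x hx v hv
    rw [hx]
    simp [hv]
  · intro u hu v hv
    rw [Filter.EventuallyEq.fderiv_eq hfd]
    have hg2 : DifferentiableAt ℝ (fderiv ℝ g) p :=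
      (hg.fderiv_right (m := 1) (by norm_num)).differentiableAt (by simp)
    have hgp := (hg.differentiableAt (by simp)).hasFDerivAt
    have h2 : HasFDerivAt (fun x => g x - g p) (fderiv ℝ g p) p := hgp.sub_const _
    have e1 : HasFDerivAt (fun x => ((ContinuousLinearMap.proj l) ∘L fderiv ℝ g x - (B (g x - g p)) ∘L fderiv ℝ g x : (ι → ℝ) →L[ℝ] ℝ)) _ p :=
      ((hasFDerivAt_const _ _).clm_comp hg2.hasFDerivAt).sub
        ((B.hasFDerivAt.comp p h2).clm_comp hg2.hasFDerivAt)
    rw [e1.fderiv]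
    have e2 : B u v = fderiv ℝ (fderiv ℝ g) p u v l := by
      have : ∀ᶠ x in 𝓝 p, fderiv ℝ (fun x => g x l) x = (ContinuousLinearMap.proj l) ∘L fderiv ℝ g x := by
        filter_upwards [hgd] with x hx
        exact ((ContinuousLinearMap.proj (R := ℝ) (φ := fun _ : ι => ℝ) l).hasFDerivAt.comp x (hx.differentiableAt (by simp)).hasFDerivAt).fderiv
      rw [hB, Filter.EventuallyEq.fderiv_eq this, ((hasFDerivAt_const _ _).clm_comp hg2.hasFDerivAt).fderiv]
      simp
    simp [hV u hu, hV v hv, e2]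


theorem snd_formula {T : Finset ι} {i j l : ι} (hij : i ≠ j)
    {p : ι → ℝ} {h : (ι → ℝ) → ℝ} (hh : ContDiffAt ℝ 2 h p)
    {y : ι → (ι → ℝ) → ℝ} {W : ι → (ι → ℝ) → (ι → ℝ)}
    (hlam : y l p ≠ 0) (hyl : DifferentiableAt ℝ (y l) p)
    (hc : ∀ c, c = i ∨ c = j → DifferentiableAt ℝ (y c) p ∧ DifferentiableAt ℝ (W c) p ∧ y c p = 0 ∧
      (∀ᶠ x in 𝓝 p, ∀ a ∈ T, W c x a = 0) ∧
      ∀ᶠ x in 𝓝 p, fderiv ℝ h x (y l x • Pi.single c 1 - y c x • Pi.single l 1 + W c x) = 0)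
    (hl1 : fderiv ℝ h p (Pi.single l 1) = 1)
    (hw : ∀ v : ι → ℝ, (∀ a ∈ T, v a = 0) → fderiv ℝ h p v = 0)
    (hww : ∀ u v : ι → ℝ, (∀ a ∈ T, u a = 0) → (∀ a ∈ T, v a = 0) →
      fderiv ℝ (fderiv ℝ h) p u v = 0) :
    ∀ c, c = i ∨ c = j → fderiv ℝ h p (Pi.single c 1) = 0 ∧
      ∀ u : ι → ℝ, (∀ a ∈ T, a ≠ i → a ≠ j → u a = 0) →
      y l p * fderiv ℝ (fderiv ℝ h) p u (Pi.single c 1) = fderiv ℝ (y c) p u -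
        (u i * fderiv ℝ (y i) p (W c p) + u j * fderiv ℝ (y j) p (W c p)) / y l p := by
  set B := fderiv ℝ (fderiv ℝ h) p with hB
  have hsym : ∀ u v, B u v = B v u := by
    intro u v
    have := hh.isSymmSndFDerivAt (n := 2) (by simp)
    exact this u v
  have hh2 : DifferentiableAt ℝ (fderiv ℝ h) p :=
    (hh.fderiv_right (m := 1) (by norm_num)).differentiableAt (by simp)
  have h0 : ∀ c, c = i ∨ c = j → fderiv ℝ h p (Pi.single c 1) = 0 := by
    intro c hc'
    obtain ⟨-, -, h3, h4, h5⟩ := hc c hc'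
    have := h5.self_of_nhds
    rw [h3, zero_smul, sub_zero, map_add, hw _ h4.self_of_nhds, add_zero, map_smul, smul_eq_mul] at this
    exact (mul_eq_zero.1 this).resolve_left hlam
  have h1 : ∀ c, c = i ∨ c = j → ∀ u, y l p * B u (Pi.single c 1) + B u (W c p) = fderiv ℝ (y c) p u := by
    intro c hc' u
    obtain ⟨h1, h2, h3, h4, h5⟩ := hc c hc'
    have hd := hh2.hasFDerivAt.clm_apply (((hyl.hasFDerivAt.smul_const (Pi.single c (1:ℝ) : ι → ℝ)).sub
      (h1.hasFDerivAt.smul_const (Pi.single l (1:ℝ) : ι → ℝ))).add h2.hasFDerivAt)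
    have hz := hd.unique ((hasFDerivAt_const (0:ℝ) p).congr_of_eventuallyEq h5)
    have := congrArg (fun f => f u) hz
    have hWu : fderiv ℝ h p (fderiv ℝ (W c) p u) = 0 := by
      apply hw
      intro a ha
      have e1 : HasFDerivAt (fun x => W c x a) ((ContinuousLinearMap.proj a) ∘L fderiv ℝ (W c) p) p :=
        (ContinuousLinearMap.proj (R := ℝ) (φ := fun _ : ι => ℝ) a).hasFDerivAt.comp p h2.hasFDerivAt
      have e2 := e1.unique ((hasFDerivAt_const (0:ℝ) p).congr_of_eventuallyEq (h4.mono fun x hx => hx a ha))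
      exact congrArg (fun f => f u) e2
    simp [h3, hl1, h0 c hc', hWu, ← hB] at this
    linarith
  intro c hc'
  refine ⟨h0 c hc', fun u hu => ?_⟩
  obtain ⟨-, -, -, h4, -⟩ := hc c hc'
  have hWc := h4.self_of_nhds
  have h2 : ∀ d, d = i ∨ d = j → y l p * B (Pi.single d 1) (W c p) = fderiv ℝ (y d) p (W c p) := by
    intro d hd
    rw [← h1 d hd (W c p), hww _ _ hWc (hc d hd).2.2.2.1.self_of_nhds, hsym]
    ring
  have hu' : u = u i • Pi.single i 1 + u j • Pi.single j 1 +
      (u - u i • Pi.single i 1 - u j • Pi.single j 1) := by abel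
  have h3 : B (u - u i • Pi.single i 1 - u j • Pi.single j 1) (W c p) = 0 := by
    apply hww _ _ _ hWc
    intro a ha
    by_cases e1 : a = i
    · subst e1; simp [hij]
    by_cases e2 : a = j
    · subst e2; simp [Ne.symm hij]
    simp [hu a ha e1 e2, e1, e2]
  have h4 : y l p * B u (W c p) = u i * fderiv ℝ (y i) p (W c p) + u j * fderiv ℝ (y j) p (W c p) := by
    rw [hu', map_add, map_add, map_smul, map_smul]
    simp only [ContinuousLinearMap.add_apply, ContinuousLinearMap.smul_apply, h3, smul_eq_mul]
    rw [← h2 i (Or.inl rfl), ← h2 j (Or.inr rfl)]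
    have a1 : (u i • Pi.single i 1 + u j • Pi.single j 1 + (u - u i • Pi.single i 1 - u j • Pi.single j 1) : ι → ℝ) = u := by abel
    rw [a1]; ring
  rw [← h4, ← h1 c hc' u]
  field_simp
  ring

theorem int_zero {γ r : ℝ → ι → ℝ} {X : (ι → ℝ) → (ι → ℝ)} {τ : ℝ} {h : (ι → ℝ) → ℝ}
    (hγ : ∀ s, HasDerivAt γ (τ • X (γ s) - r s) s) (hper : γ (2 * Real.pi) = γ 0)
    (hr : Continuous r) (hh : ∀ s, ContDiffAt ℝ 1 h (γ s))
    (hX : ∀ s, fderiv ℝ h (γ s) (X (γ s)) = 0) :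
    Continuous (fun s => fderiv ℝ h (γ s) (r s)) ∧
    ∫ s in (0:ℝ)..(2 * Real.pi), fderiv ℝ h (γ s) (r s) = 0 := by
  have hγc : Continuous γ := continuous_iff_continuousAt.2 fun s => (hγ s).continuousAt
  have hc : Continuous (fun s => fderiv ℝ h (γ s) (r s)) := by
    rw [continuous_iff_continuousAt]
    intro s
    have h1 : ContinuousAt (fderiv ℝ h) (γ s) :=
      ((hh s).fderiv_right (m := 0) (by norm_num)).continuousAt
    exact (ContinuousAt.comp (f := γ) h1 hγc.continuousAt).clm_apply hr.continuousAt
  refine ⟨hc, ?_⟩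
  have hd : ∀ s, HasDerivAt (fun s => - h (γ s)) (fderiv ℝ h (γ s) (r s)) s := by
    intro s
    have := (((hh s).differentiableAt (by simp)).hasFDerivAt.comp_hasDerivAt s (hγ s)).neg
    refine this.congr_deriv ?_
    rw [map_sub, map_smul, hX s]
    simp
  rw [intervalIntegral.integral_eq_sub_of_hasDerivAt (fun s _ => hd s) (hc.intervalIntegrable _ _), hper]
  simp

end leaf
end NambuLin

open scoped ContDiff
namespace NambuLin
open Metric Filter Topology

section leaf
variable {ι : Type} [Fintype ι] [DecidableEq ι]

theorem abs_int_le {f g : ℝ → ℝ} (hf : Continuous f) (hg : Continuous g) {K : ℝ}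
    (h : ∀ s, |f s - g s| ≤ K) (hf0 : ∫ s in (0:ℝ)..(2 * Real.pi), f s = 0) :
    |∫ s in (0:ℝ)..(2 * Real.pi), g s| ≤ 2 * Real.pi * K := by
  have e : ∫ s in (0:ℝ)..(2 * Real.pi), g s = ∫ s in (0:ℝ)..(2 * Real.pi), (g s - f s) := by
    rw [intervalIntegral.integral_sub (hg.intervalIntegrable _ _) (hf.intervalIntegrable _ _), hf0, sub_zero]
  rw [e]
  have := intervalIntegral.norm_integral_le_of_norm_le_const (f := fun s => g s - f s)
    (a := 0) (b := 2 * Real.pi) (C := K) (fun s _ => by rw [Real.norm_eq_abs, abs_sub_comm]; exact h s)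
  rw [Real.norm_eq_abs] at this
  rw [sub_zero, abs_of_pos (by positivity : 0 < 2 * Real.pi)] at this
  linarith

theorem continuous_rot_line {i j : ι} (x : ι → ℝ) : Continuous (fun θ : ℝ => rot i j (θ : Circ) x) := by
  have h1 : Continuous (fun θ : ℝ => ((θ : Circ), x)) :=
    Continuous.prodMk (AddCircle.continuous_mk' (2 * Real.pi)) continuous_const
  exact Continuous.comp (f := fun θ : ℝ => ((θ : Circ), x)) continuous_rot h1

theorem rot_single {i j : ι} (hij : i ≠ j) (t : Circ) :
    rot i j t (Pi.single i 1) = cosK t • Pi.single i 1 - sinK t • Pi.single j 1 := by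
  ext k
  by_cases h1 : k = i
  · subst h1; simp [rot_i, hij, Ne.symm hij]
  by_cases h2 : k = j
  · subst h2; simp [rot_j hij, hij, Ne.symm hij]
  rw [rot_k _ _ h1 h2]; simp [h1, h2]

theorem rot_fix {i j : ι} (t : Circ) {β : ι → ℝ} (hi : β i = 0) (hj : β j = 0) :
    rot i j t β = β := by
  ext k
  simp only [rot_apply]
  split_ifs with h1 h2
  · subst h1; simp [hi, hj]
  · subst h2; simp [hi, hj]
  · rfl

theorem stepB {i j : ι} (hij : i ≠ j) {T : Finset ι} (hiT : i ∈ T) (hjT : j ∈ T)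
    {dy : ι → (ι → ℝ) →L[ℝ] ℝ} {W : ι → ι → ℝ} {Y s η bi κ C : ℝ}
    {B : (ι → ℝ) →L[ℝ] (ι → ℝ) →L[ℝ] ℝ} {R D : (ι → ℝ) →L[ℝ] ℝ} {t : Circ} {u β bs : ι → ℝ}
    (hY : 0 < |Y|) (hη0 : 0 < η) (hη : 40 * η ≤ 1) (hκ0 : 0 < κ) (hκ : κ = 1 / (72 * |Y|)) (hC0 : 0 < C)
    (hD : ∀ c, c = i ∨ c = j → D (Pi.single c 1) = 0)
    (hf : ∀ c, c = i ∨ c = j → Y * B u (Pi.single c 1) = dy c u - (u i * dy i (W c) + u j * dy j (W c)) / Y)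
    (e4 : D β = 0) (hW : ∀ c, c = i ∨ c = j → ∀ a ∈ T, W c a = 0)
    (hyη : ∀ c, c = i ∨ c = j → (∀ u, |dy c u - u c| ≤ η * ‖u‖) ∧ ‖W c‖ ≤ |Y|)
    (hut : ‖u‖ ≤ 3 * |s|) (hcl : ‖u - s • rot i j t (Pi.single i 1)‖ ≤ η * |s|)
    (hR : ‖R‖ ≤ κ * (3 * |s|)) (hrb : rot i j t bs = bi • rot i j t (Pi.single i 1) + β)
    (hN : ‖β‖ ≤ 12 * C * |s| * |bi|) (s2 : 12 * C * |s| ≤ 1) (s3 : 36 * ‖B‖ * C * |Y| * |s| ≤ 1 / 8) :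
    |Y * (D + B u + R) (rot i j t bs) - bi * s| ≤ 3 / 4 * (|bi| * |s|) := by
  set r := rot i j t (Pi.single i 1) with hr
  have hrn : ‖r‖ ≤ 2 := by
    refine (norm_rot_le hij t _).trans ?_
    rw [Pi.norm_single]; simp
  have e3 : D r = 0 := by
    rw [hr, rot_single hij, map_sub, map_smul, map_smul, hD i (Or.inl rfl), hD j (Or.inr rfl)]; simp
  have comp : ∀ c, |u c - s * r c| ≤ η * |s| := fun c => by
    have := (norm_le_pi_norm (u - s • r) c).trans hcl
    simpa using this
  have aux : ∀ c, c = i ∨ c = j → |Y * B u (Pi.single c 1) - s * r c| ≤ 10 * η * |s| := by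
    intro c hc'
    obtain ⟨q1, q2⟩ := hyη c hc'
    have q3 : |dy c u - u c| ≤ η * (3 * |s|) := (q1 u).trans (mul_le_mul_of_nonneg_left hut hη0.le)
    have q4 : ∀ d, d = i ∨ d = j → d ∈ T → |u d * dy d (W c)| ≤ 3 * |s| * (η * |Y|) := by
      intro d hd hdT
      have := (hyη d hd).1 (W c)
      rw [hW c hc' d hdT, sub_zero] at this
      rw [abs_mul]
      have : |dy d (W c)| ≤ η * |Y| := this.trans (mul_le_mul_of_nonneg_left q2 hη0.le)
      have q5 : |u d| ≤ 3 * |s| := (norm_le_pi_norm u d).trans hut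
      gcongr
    have q6 : |(u i * dy i (W c) + u j * dy j (W c)) / Y| ≤ 6 * |s| * η := by
      rw [abs_div, div_le_iff₀ hY]
      refine (abs_add_le _ _).trans ?_
      have := q4 i (Or.inl rfl) hiT
      have := q4 j (Or.inr rfl) hjT
      linarith
    have q7 := comp c
    rw [hf c hc']
    rw [abs_le] at q3 q6 q7 ⊢
    constructor <;> linarith [q3.1, q3.2, q6.1, q6.2, q7.1, q7.2]
  have hB1 : |Y * B u r - s| ≤ 1 / 2 * |s| := by
    have ri : r i = cosK t := by simp [hr, rot_i, hij]
    have rj : r j = - sinK t := by simp [hr, rot_j hij, Ne.symm hij]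
    have a1 := aux i (Or.inl rfl)
    have a2 := aux j (Or.inr rfl)
    rw [ri] at a1
    rw [rj] at a2
    have e6 : Y * B u r - s = cosK t * (Y * B u (Pi.single i 1) - s * cosK t)
        - sinK t * (Y * B u (Pi.single j 1) - s * -sinK t) := by
      rw [hr, rot_single hij, map_sub, map_smul, map_smul, smul_eq_mul, smul_eq_mul]
      linear_combination s * cosK_sq t
    rw [e6]
    refine (abs_sub _ _).trans ?_
    rw [abs_mul, abs_mul]
    have h1 := abs_cosK_le t
    have h2 := abs_sinK_le t
    have b1 : |cosK t| * |Y * B u (Pi.single i 1) - s * cosK t| ≤ 1 * (10 * η * |s|) := by gcongr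
    have b2 : |sinK t| * |Y * B u (Pi.single j 1) - s * -sinK t| ≤ 1 * (10 * η * |s|) := by gcongr
    nlinarith [abs_nonneg s]
  have e7 : Y * (D + B u + R) (rot i j t bs) - bi * s =
      bi * (Y * B u r - s) + Y * (B u β) + Y * R (rot i j t bs) := by
    rw [ContinuousLinearMap.add_apply, ContinuousLinearMap.add_apply, hrb, map_add, map_add, map_smul, map_smul, e3, e4, smul_eq_mul, smul_eq_mul]
    ring
  have t1 : |bi * (Y * B u r - s)| ≤ |bi| * (1 / 2 * |s|) := by
    rw [abs_mul]; gcongr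
  have t2 : |Y * (B u β)| ≤ 1 / 8 * (|bi| * |s|) := by
    rw [abs_mul]
    have : |B u β| ≤ ‖B‖ * (3 * |s|) * (12 * C * |s| * |bi|) := by
      refine (B.le_opNorm₂ u β).trans ?_
      gcongr
    calc |Y| * |B u β| ≤ |Y| * (‖B‖ * (3 * |s|) * (12 * C * |s| * |bi|)) := by gcongr
      _ = (36 * ‖B‖ * C * |Y| * |s|) * (|bi| * |s|) := by ring
      _ ≤ _ := by gcongr
  have t3 : |Y * R (rot i j t bs)| ≤ 1 / 8 * (|bi| * |s|) := by
    rw [abs_mul]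
    have e3 : ‖rot i j t bs‖ ≤ 3 * |bi| := by
      rw [hrb]
      refine (norm_add_le _ _).trans ?_
      rw [norm_smul, Real.norm_eq_abs]
      have : ‖β‖ ≤ 1 * |bi| := hN.trans (by gcongr)
      nlinarith [abs_nonneg bi]
    have : |R (rot i j t bs)| ≤ κ * (3 * |s|) * (3 * |bi|) := by
      refine (R.le_opNorm _).trans ?_
      gcongr
    calc |Y| * |R (rot i j t bs)| ≤ |Y| * (κ * (3 * |s|) * (3 * |bi|)) := by gcongr
      _ = 1 / 8 * (|bi| * |s|) := by rw [hκ]; field_simp; ring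
  rw [e7]
  refine (abs_add_three _ _ _).trans ?_
  linarith

theorem stepA {i j : ι} (hij : i ≠ j) {g X : (ι → ℝ) → (ι → ℝ)} {p bs β : ι → ℝ} {γ : Circ → ι → ℝ}
    {s σ bi C : ℝ} (hC0 : 0 < C)
    (hode : ∀ θ : ℝ, HasDerivAt (fun θ : ℝ => γ (θ : Circ))
        ((1 + σ) • X (γ (θ : Circ)) - rot i j (θ : Circ) bs) θ)
    (hgd : ∀ t, ContDiffAt ℝ 2 g (γ t)) (hgX : ∀ t, fderiv ℝ g (γ t) (X (γ t)) = 0)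
    (hgC : ∀ t, ‖fderiv ℝ g (γ t) - fderiv ℝ g p‖ ≤ C * ‖γ t - p‖)
    (hun : ∀ t, ‖γ t - p‖ ≤ 3 * |s|) (hβ : fderiv ℝ g p β = β)
    (hrb : ∀ t, rot i j t bs = bi • rot i j t (Pi.single i 1) + β) (s2 : 12 * C * |s| ≤ 1) :
    ‖β‖ ≤ 12 * C * |s| * |bi| := by
  have hrn : ∀ t, ‖rot i j t (Pi.single i 1)‖ ≤ 2 := fun t => by
    refine (norm_rot_le hij t _).trans ?_
    rw [Pi.norm_single]; simp
  have hrbc : Continuous (fun θ : ℝ => rot i j (θ : Circ) bs) :=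
    continuous_rot_line _
  have hper : γ ((2 * Real.pi : ℝ) : Circ) = γ ((0:ℝ) : Circ) := by
    rw [AddCircle.coe_period, AddCircle.coe_zero]
  have hβn : ‖β‖ ≤ C * (3 * |s|) * (2 * |bi| + ‖β‖) := by
    rw [pi_norm_le_iff_of_nonneg (by positivity)]
    intro w
    have hgw : ∀ x, DifferentiableAt ℝ g x → ∀ v, fderiv ℝ (fun x => g x w) x v = fderiv ℝ g x v w := by
      intro x hx v
      have e : HasFDerivAt (fun x => g x w) ((ContinuousLinearMap.proj w) ∘L fderiv ℝ g x) x :=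
        (ContinuousLinearMap.proj (R := ℝ) (φ := fun _ : ι => ℝ) w).hasFDerivAt.comp x hx.hasFDerivAt
      rw [e.fderiv]
      rfl
    obtain ⟨i1, i2⟩ := int_zero (h := fun x => g x w) hode hper hrbc
      (fun θ => (contDiffAt_pi.1 (hgd θ) w).of_le (by norm_num)) (fun θ => by
        rw [hgw _ ((hgd _).differentiableAt (by simp)), hgX]; rfl)
    have hlc : Continuous (fun θ : ℝ => fderiv ℝ g p (rot i j (θ : Circ) bs) w) :=
      (continuous_apply w).comp ((fderiv ℝ g p).continuous.comp hrbc)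
    have := abs_int_le i1 hlc (K := C * (3 * |s|) * (2 * |bi| + ‖β‖)) (by
      intro θ
      rw [hgw _ ((hgd _).differentiableAt (by simp))]
      have e1 := hgC θ
      have e2 : ‖fderiv ℝ g (γ θ) (rot i j (θ : Circ) bs) - fderiv ℝ g p (rot i j (θ : Circ) bs)‖
          ≤ C * (3 * |s|) * (2 * |bi| + ‖β‖) := by
        rw [← ContinuousLinearMap.sub_apply]
        refine (ContinuousLinearMap.le_opNorm _ _).trans ?_
        have e3 : ‖rot i j (θ : Circ) bs‖ ≤ 2 * |bi| + ‖β‖ := by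
          rw [hrb]
          refine (norm_add_le _ _).trans ?_
          rw [norm_smul, Real.norm_eq_abs]
          nlinarith [hrn θ, abs_nonneg (bi)]
        have e4 : ‖fderiv ℝ g (γ θ) - fderiv ℝ g p‖ ≤ C * (3 * |s|) :=
          e1.trans (mul_le_mul_of_nonneg_left (hun θ) hC0.le)
        gcongr
      exact (norm_le_pi_norm _ w).trans e2) i2
    have e5 : ∫ θ in (0:ℝ)..(2 * Real.pi), fderiv ℝ g p (rot i j (θ : Circ) bs) w = 2 * Real.pi * β w := by
      have e6 : ∀ θ : ℝ, fderiv ℝ g p (rot i j (θ : Circ) bs) w =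
          Real.cos θ * (bi * fderiv ℝ g p (Pi.single i 1) w) -
          Real.sin θ * (bi * fderiv ℝ g p (Pi.single j 1) w) + β w := by
        intro θ
        rw [hrb, map_add, hβ]
        simp only [rot_single hij, map_smul, map_sub, cosK_coe, sinK_coe, Pi.add_apply,
          Pi.smul_apply, Pi.sub_apply, smul_eq_mul]
        ring
      simp only [e6]
      rw [intervalIntegral.integral_add, intervalIntegral.integral_sub]
      · simp
      all_goals apply Continuous.intervalIntegrable; fun_prop
    rw [e5, abs_mul, abs_of_pos (by positivity : 0 < 2 * Real.pi)] at this
    exact le_of_mul_le_mul_left this (by positivity)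
  nlinarith [norm_nonneg β, abs_nonneg (bi)]

set_option maxHeartbeats 3200000 in
theorem b_zero_local {T : Finset ι} {i j l : ι} (hij : i ≠ j) (hil : i ≠ l) (hjl : j ≠ l)
    (hiT : i ∈ T) (hjT : j ∈ T) (hlT : l ∈ T)
    {X H : (ι → ℝ) → (ι → ℝ)} {p : ι → ℝ}
    {y : ι → (ι → ℝ) → ℝ} {W : ι → (ι → ℝ) → (ι → ℝ)} {η : ℝ}
    (hH : ∀ᶠ x in 𝓝 p, ContDiffAt ℝ 2 H x ∧ fderiv ℝ H x (X x) = 0)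
    (hinj : ∀ v, (∀ a ∈ T, a ≠ l → v a = 0) → fderiv ℝ H p v = 0 → v = 0)
    (hlam : y l p ≠ 0) (hyl : DifferentiableAt ℝ (y l) p)
    (hc : ∀ c, c = i ∨ c = j → DifferentiableAt ℝ (y c) p ∧ DifferentiableAt ℝ (W c) p ∧ y c p = 0 ∧
      (∀ᶠ x in 𝓝 p, ∀ a ∈ T, W c x a = 0) ∧
      ∀ᶠ x in 𝓝 p, fderiv ℝ H x (y l x • Pi.single c 1 - y c x • Pi.single l 1 + W c x) = 0)
    (hη0 : 0 < η) (hη : 40 * η ≤ 1)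
    (hyη : ∀ c, c = i ∨ c = j → (∀ u, |fderiv ℝ (y c) p u - u c| ≤ η * ‖u‖) ∧ ‖W c p‖ ≤ |y l p|)
    {γ : ℝ → Circ → ι → ℝ} {b : ℝ → ι → ℝ} {σ : ℝ → ℝ}
    (hγ : ∀ᶠ s in 𝓝[≠] (0:ℝ), (∀ θ : ℝ, HasDerivAt (fun θ : ℝ => γ s (θ : Circ))
        ((1 + σ s) • X (γ s (θ : Circ)) - rot i j (θ : Circ) (b s)) θ) ∧
      (∀ t, ‖γ s t - p - s • rot i j t (Pi.single i 1)‖ ≤ η * |s|) ∧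
      (∀ t, ∀ a ∈ T, a ≠ i → a ≠ j → γ s t a = p a) ∧ (∀ a ∈ T, a ≠ i → b s a = 0)) :
    ∀ᶠ s in 𝓝[≠] (0:ℝ), b s = 0 := by
  let V : Submodule ℝ (ι → ℝ) :=
    { carrier := {v | ∀ a ∈ T, a ≠ l → v a = 0}
      add_mem' := by intro u v hu hv a ha hal; simp [hu a ha hal, hv a ha hal]
      zero_mem' := by intro a _ _; rfl
      smul_mem' := by intro c v hv a ha hal; simp [hv a ha hal] }
  have memV : ∀ v, v ∈ V ↔ ∀ a ∈ T, a ≠ l → v a = 0 := fun v => Iff.rfl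
  obtain ⟨L, hL⟩ := exists_left_inv V (fderiv ℝ H p) (fun v hv => hinj v hv)
  set g : (ι → ℝ) → (ι → ℝ) := fun x => L (H x) with hgdef
  have hg : ∀ᶠ x in 𝓝 p, ContDiffAt ℝ 2 g x ∧ ∀ v, fderiv ℝ g x v = L (fderiv ℝ H x v) := by
    filter_upwards [hH] with x hx
    refine ⟨L.contDiff.contDiffAt.comp x hx.1, fun v => ?_⟩
    have e : HasFDerivAt g (L ∘L fderiv ℝ H x) x :=
      L.hasFDerivAt.comp x (hx.1.differentiableAt (by simp)).hasFDerivAt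
    rw [e.fderiv]
    rfl
  have hgp := hg.self_of_nhds
  have hgV : ∀ v ∈ V, fderiv ℝ g p v = v := fun v hv => by rw [hgp.2, hL v hv]
  obtain ⟨h, hh, hhp, hhk, hhV⟩ := leaf_fun2 V l hgp.1 hgV
  have hV0 : ∀ v : ι → ℝ, (∀ a ∈ T, v a = 0) → v ∈ V := fun v hv => (memV v).2 fun a ha _ => hv a ha
  have hform := snd_formula (T := T) (l := l) hij hh hlam hyl (y := y) (W := W)
    (by
      intro c hc'
      obtain ⟨h1, h2, h3, h4, h5⟩ := hc c hc'
      refine ⟨h1, h2, h3, h4, ?_⟩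
      filter_upwards [h5, hhk, hg] with x e1 e2 e3
      apply e2
      rw [e3.2, e1, map_zero])
    (by
      rw [hhp, hgV]
      · simp
      · rw [memV]; intro a _ hal; simp [hal])
    (by
      intro v hv
      rw [hhp, hgV v (hV0 v hv), hv l hlT])
    (fun u v hu hv => hhV u (hV0 u hu) v (hV0 v hv))
  set B := fderiv ℝ (fderiv ℝ h) p with hB
  have hh2 : DifferentiableAt ℝ (fderiv ℝ h) p :=
    (hh.fderiv_right (m := 1) (by norm_num)).differentiableAt (by simp)
  have hg2 : DifferentiableAt ℝ (fderiv ℝ g) p :=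
    (hgp.1.fderiv_right (m := 1) (by norm_num)).differentiableAt (by simp)
  obtain ⟨C, hC0, hC⟩ := hg2.hasFDerivAt.isBigO_sub.exists_pos
  have hC := hC.bound
  set κ : ℝ := 1 / (72 * |y l p|) with hκ
  have hlam' : 0 < |y l p| := abs_pos.2 hlam
  have hκ0 : 0 < κ := by positivity
  have hlo := hh2.hasFDerivAt.isLittleO.def hκ0
  have hh1 : ∀ᶠ x in 𝓝 p, ContDiffAt ℝ 2 h x := hh.eventually (by simp)
  obtain ⟨r, hr, hall⟩ := Metric.eventually_nhds_iff.1 (hH.and (hg.and (hC.and (hlo.and (hh1.and hhk)))))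
  set K : ℝ := 36 * ‖B‖ * C * |y l p| with hK
  have hs1 : ∀ᶠ s : ℝ in 𝓝[≠] 0, 3 * |s| < r ∧ 12 * C * |s| ≤ 1 ∧ K * |s| ≤ 1 / 8 := by
    have c1 : ContinuousAt (fun s : ℝ => 3 * |s|) 0 := by fun_prop
    have c2 : ContinuousAt (fun s : ℝ => 12 * C * |s|) 0 := by fun_prop
    have c3 : ContinuousAt (fun s : ℝ => K * |s|) 0 := by fun_prop
    refine nhdsWithin_le_nhds ?_
    have d1 := c1.eventually_lt continuousAt_const (by simpa using hr : 3 * |(0:ℝ)| < r)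
    have d2 := c2.eventually_lt continuousAt_const (by simp : 12 * C * |(0:ℝ)| < 1)
    have d3 := c3.eventually_lt continuousAt_const (by simp : K * |(0:ℝ)| < 1/8)
    filter_upwards [d1, d2, d3] with s h1 h2 h3
    exact ⟨h1, h2.le, h3.le⟩
  filter_upwards [hγ, hs1, self_mem_nhdsWithin] with s ⟨hode, hclose, hT, hbT⟩ ⟨s1, s2, s3⟩ hs0
  have hs : 0 < |s| := abs_pos.2 hs0
  set r' : Circ → ι → ℝ := fun t => rot i j t (Pi.single i 1) with hr'
  have hrn : ∀ t, ‖r' t‖ ≤ 2 := fun t => by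
    refine (norm_rot_le hij t _).trans ?_
    rw [Pi.norm_single]; simp
  have hun : ∀ t, ‖γ s t - p‖ ≤ 3 * |s| := by
    intro t
    have e : γ s t - p = (γ s t - p - s • r' t) + s • r' t := by abel
    rw [e]
    refine (norm_add_le _ _).trans ?_
    rw [norm_smul, Real.norm_eq_abs]
    have := hclose t
    nlinarith [hrn t]
  have hin : ∀ t, dist (γ s t) p < r := fun t => by rw [dist_eq_norm]; exact (hun t).trans_lt s1
  set β : ι → ℝ := b s - b s i • Pi.single i 1 with hβ
  have hβi : β i = 0 := by simp [hβ]
  have hβT : ∀ a ∈ T, β a = 0 := by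
    intro a ha
    by_cases e : a = i
    · rw [e, hβi]
    · simp [hβ, e, hbT a ha e]
  have hbs : b s = b s i • Pi.single i 1 + β := by rw [hβ]; abel
  have hrb : ∀ t, rot i j t (b s) = b s i • r' t + β := by
    intro t
    conv_lhs => rw [hbs]
    rw [map_add, map_smul, rot_fix t hβi (hβT j hjT)]
  have hrbc : Continuous (fun θ : ℝ => rot i j (θ : Circ) (b s)) :=
    continuous_rot_line _
  have hrc : Continuous (fun θ : ℝ => r' (θ : Circ)) :=
    continuous_rot_line _
  have hper : γ s ((2 * Real.pi : ℝ) : Circ) = γ s ((0:ℝ) : Circ) := by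
    rw [AddCircle.coe_period, AddCircle.coe_zero]
  have hN : ‖β‖ ≤ 12 * C * |s| * |b s i| :=
    stepA hij hC0 hode (fun t => (hall (hin t)).2.1.1) (fun t => by
      rw [(hall (hin t)).2.1.2, (hall (hin t)).1.2, map_zero]) (fun t => (hall (hin t)).2.2.1) hun
      (hgV β (hV0 β hβT)) hrb s2
  -- step B
  have hD : ∀ t : Circ, |y l p * fderiv ℝ h (γ s t) (rot i j t (b s)) - b s i * s| ≤ 3 / 4 * (|b s i| * |s|) := by
    intro t
    have e1 := (hall (hin t)).2.2.2.1
    have e1' := e1.trans (mul_le_mul_of_nonneg_left (hun t) hκ0.le)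
    have e4 : fderiv ℝ h p β = 0 := by rw [hhp, hgV β (hV0 β hβT), hβT l hlT]
    have hus : ∀ a ∈ T, a ≠ i → a ≠ j → (γ s t - p) a = 0 := by
      intro a ha h1 h2; simp [hT t a ha h1 h2]
    have := stepB hij hiT hjT (dy := fun c => fderiv ℝ (y c) p) (W := fun c => W c p) hlam' hη0 hη hκ0 hκ hC0
      (fun c hc' => (hform c hc').1) (fun c hc' => (hform c hc').2 _ hus) e4
      (fun c hc' => (hc c hc').2.2.2.1.self_of_nhds) hyη (hun t) (hclose t) e1' (hrb t) hN s2 s3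
    have e2 : fderiv ℝ h p + B (γ s t - p) + (fderiv ℝ h (γ s t) - fderiv ℝ h p - B (γ s t - p)) = fderiv ℝ h (γ s t) := by abel
    rw [e2] at this
    exact this
  have hbi : b s i = 0 := by
    obtain ⟨i1, i2⟩ := int_zero (h := h) hode hper hrbc
        (fun θ => ((hall (hin θ)).2.2.2.2.1).of_le (by norm_num)) (fun θ => by
          apply (hall (hin θ)).2.2.2.2.2
          rw [(hall (hin θ)).2.1.2, (hall (hin θ)).1.2]
          simp)
    have := abs_int_le (f := fun θ : ℝ => y l p * fderiv ℝ h (γ s θ) (rot i j θ (b s)))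
      (continuous_const.mul i1) (g := fun _ => b s i * s) continuous_const (fun θ => hD θ)
      (by rw [intervalIntegral.integral_const_mul, i2, mul_zero])
    rw [intervalIntegral.integral_const, sub_zero, smul_eq_mul, abs_mul, abs_of_pos (by positivity : 0 < 2 * Real.pi), abs_mul] at this
    have := le_of_mul_le_mul_left this (by positivity)
    have : |b s i| * |s| ≤ 0 := by linarith
    have : |b s i| ≤ 0 := by
      by_contra hcon
      push Not at hcon
      nlinarith [mul_pos hcon hs]
    exact abs_nonpos_iff.1 this
  have hβ0 : β = 0 := by
    rw [hbi] at hN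
    simpa using hN
  rw [hbs, hbi, hβ0]; simp

end leaf
end NambuLin

open scoped ContDiff
namespace NambuLin
open Metric Filter Topology

section ndata
variable {ι : Type} [Fintype ι] [DecidableEq ι]

theorem hasFDerivAt_coord {E : Type*} [NormedAddCommGroup E] [NormedSpace ℝ E]
    {f : E → ι → ℝ} {f' : E →L[ℝ] (ι → ℝ)} {x : E} (h : HasFDerivAt f f' x) (k : ι) :
    HasFDerivAt (fun x => f x k) ((ContinuousLinearMap.proj k) ∘L f') x :=
  (ContinuousLinearMap.proj (R := ℝ) (φ := fun _ : ι => ℝ) k).hasFDerivAt.comp x h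

theorem fderiv_coord {E : Type*} [NormedAddCommGroup E] [NormedSpace ℝ E]
    {f : E → ι → ℝ} {x : E} (h : DifferentiableAt ℝ f x) (v : E) (k : ι) :
    fderiv ℝ (fun x => f x k) x v = fderiv ℝ f x v k := by
  rw [(hasFDerivAt_coord h.hasFDerivAt k).fderiv]; rfl

theorem analyticAt_coord {E : Type*} [NormedAddCommGroup E] [NormedSpace ℝ E]
    {f : E → ι → ℝ} {x : E} (h : AnalyticAt ℝ f x) (k : ι) : AnalyticAt ℝ (fun x => f x k) x :=
  (analyticAt_pi_iff.1 h) k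

/-- local first integrals -/
def Reg (T : Finset ι) (y : ι → (ι → ℝ) → ℝ) (Y : ι → ι → (ι → ℝ) → (ι → ℝ))
    (H : (ι → ℝ) → (ι → ℝ)) (x : ι → ℝ) : Prop :=
  ∀ᶠ x' in 𝓝 x, ContDiffAt ℝ 2 H x' ∧
    (∀ a ∈ T, ∀ b ∈ T, a ≠ b → fderiv ℝ H x' (Y a b x') = 0) ∧
    ∀ v, fderiv ℝ H x' v = 0 → (∑ a ∈ T, y a x' * v a = 0) ∧ ((∀ a ∈ T, v a = 0) → v = 0)

structure NData (T : Finset ι) (ε : ι → ℝ) (y : ι → (ι → ℝ) → ℝ)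
    (Y : ι → ι → (ι → ℝ) → (ι → ℝ)) : Prop where
  y_an : ∀ a ∈ T, AnalyticAt ℝ (y a) 0
  y_zero : ∀ a ∈ T, y a 0 = 0
  y_deriv : ∀ a ∈ T, ∀ v, fderiv ℝ (y a) 0 v = ε a * v a
  eps : ∀ a ∈ T, |ε a| = 1
  Y_an : ∀ a ∈ T, ∀ b ∈ T, a ≠ b → AnalyticAt ℝ (Y a b) 0
  Y_T : ∀ a ∈ T, ∀ b ∈ T, a ≠ b → ∀ᶠ x in 𝓝 0, ∀ c ∈ T,
    Y a b x c = if c = a then y b x else if c = b then - y a x else 0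
  Y_zero : ∀ a ∈ T, ∀ b ∈ T, a ≠ b → Y a b 0 = 0
  Y_deriv : ∀ a ∈ T, ∀ b ∈ T, a ≠ b → ∀ v, ∀ w, w ∉ T → fderiv ℝ (Y a b) 0 v w = 0
  reg : ∀ᶠ x in 𝓝 0, (∃ a ∈ T, y a x ≠ 0) → ∃ H, Reg T y Y H x

theorem NData.Y_deriv_T {T : Finset ι} {ε : ι → ℝ} {y : ι → (ι → ℝ) → ℝ}
    {Y : ι → ι → (ι → ℝ) → (ι → ℝ)} (D : NData T ε y Y) {a b : ι} (ha : a ∈ T) (hb : b ∈ T)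
    (hab : a ≠ b) (v : ι → ℝ) {c : ι} (hc : c ∈ T) :
    fderiv ℝ (Y a b) 0 v c = if c = a then ε b * v b else if c = b then - (ε a * v a) else 0 := by
  rw [← fderiv_coord (D.Y_an a ha b hb hab).differentiableAt]
  have h := D.Y_T a ha b hb hab
  split_ifs with h1 h2
  · have : (fun x => Y a b x c) =ᶠ[𝓝 0] y b := by
      filter_upwards [h] with x hx
      rw [hx c hc, if_pos h1]
    rw [Filter.EventuallyEq.fderiv_eq this, D.y_deriv b hb]
  · have : (fun x => Y a b x c) =ᶠ[𝓝 0] fun x => - y a x := by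
      filter_upwards [h] with x hx
      rw [hx c hc, if_neg h1, if_pos h2]
    rw [Filter.EventuallyEq.fderiv_eq this, fderiv_fun_neg, ContinuousLinearMap.neg_apply, D.y_deriv a ha]
  · have : (fun x => Y a b x c) =ᶠ[𝓝 0] fun x => 0 := by
      filter_upwards [h] with x hx
      rw [hx c hc, if_neg h1, if_neg h2]
    rw [Filter.EventuallyEq.fderiv_eq this]; simp

theorem NData.X_deriv {T : Finset ι} {ε : ι → ℝ} {y : ι → (ι → ℝ) → ℝ}
    {Y : ι → ι → (ι → ℝ) → (ι → ℝ)} (D : NData T ε y Y) {i j : ι} (hi : i ∈ T) (hj : j ∈ T)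
    (hij : i ≠ j) (ei : ε i = 1) (ej : ε j = 1) : fderiv ℝ (Y i j) 0 = JJ i j := by
  refine ContinuousLinearMap.ext fun v => ?_
  ext c
  by_cases hc : c ∈ T
  · rw [D.Y_deriv_T hi hj hij v hc, ei, ej]
    split_ifs with h1 h2
    · rw [h1, JJ_i, one_mul]
    · rw [h2, JJ_j hij, one_mul]
    · rw [JJ_k _ h1 h2]
  · rw [D.Y_deriv i hi j hj hij v c hc, JJ_k]
    · rintro rfl; exact hc hi
    · rintro rfl; exact hc hj

theorem analyticAt_zij (i j : ι) (x : ι → ℝ) : AnalyticAt ℝ (zij i j) x := by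
  rw [analyticAt_pi_iff]
  intro k
  simp only [zij]
  split_ifs
  · exact analyticAt_const
  · exact (ContinuousLinearMap.proj (R := ℝ) (φ := fun _ : ι => ℝ) k).analyticAt x

theorem zeta_exists {i j : ι} (hij : i ≠ j) {y1 y2 : (ι → ℝ) → ℝ} (h1 : AnalyticAt ℝ y1 0)
    (h2 : AnalyticAt ℝ y2 0) (z1 : y1 0 = 0) (z2 : y2 0 = 0) (d1 : ∀ v, fderiv ℝ y1 0 v = v i)
    (d2 : ∀ v, fderiv ℝ y2 0 v = v j) :
    ∃ ζ : (ι → ℝ) → (ι → ℝ), AnalyticAt ℝ ζ 0 ∧ ζ 0 = 0 ∧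
      ∀ᶠ x in 𝓝 0, y1 (ζ x) = 0 ∧ y2 (ζ x) = 0 ∧ ∀ k, k ≠ i → k ≠ j → ζ x k = x k := by
  let θ : (ι → ℝ) → (ι → ℝ) := fun x k => if k = i then y1 x else if k = j then y2 x else x k
  have hk : ∀ k, AnalyticAt ℝ (fun x => θ x k) 0 ∧ fderiv ℝ (fun x => θ x k) 0 = ContinuousLinearMap.proj k := by
    intro k
    simp only [θ]
    split_ifs with e1 e2
    · subst e1; exact ⟨h1, ContinuousLinearMap.ext d1⟩
    · subst e2; exact ⟨h2, ContinuousLinearMap.ext d2⟩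
    · have := (ContinuousLinearMap.proj (R := ℝ) (φ := fun _ : ι => ℝ) k)
      exact ⟨(ContinuousLinearMap.proj (R := ℝ) (φ := fun _ : ι => ℝ) k).analyticAt 0,
        (ContinuousLinearMap.proj (R := ℝ) (φ := fun _ : ι => ℝ) k).hasFDerivAt.fderiv⟩
  have hθ : AnalyticAt ℝ θ 0 := analyticAt_pi_iff.2 fun k => (hk k).1
  have hθ0 : θ 0 = 0 := by
    ext k; simp only [θ]; split_ifs <;> simp [z1, z2]
  have hd : fderiv ℝ θ 0 = ((ContinuousLinearEquiv.refl ℝ (ι → ℝ)) : (ι → ℝ) →L[ℝ] (ι → ℝ)) := by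
    refine ContinuousLinearMap.ext fun v => ?_
    ext k
    rw [← fderiv_coord hθ.differentiableAt, (hk k).2]; rfl
  obtain ⟨ψ, hψ, hψ0, -, hinv⟩ := local_inverse hθ hθ0 _ hd
  have hz0 : zij i j (0 : ι → ℝ) = 0 := by ext k; simp [zij]
  have hzt : Tendsto (zij i j) (𝓝 (0 : ι → ℝ)) (𝓝 0) := by
    have := (analyticAt_zij i j (0 : ι → ℝ)).continuousAt.tendsto
    rwa [hz0] at this
  refine ⟨fun x => ψ (zij i j x), AnalyticAt.comp (f := zij i j) (g := ψ) (by rw [hz0]; exact hψ)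
    (analyticAt_zij i j 0), by show ψ (zij i j 0) = 0; rw [hz0, hψ0], ?_⟩
  filter_upwards [hzt.eventually hinv] with x hx
  refine ⟨?_, ?_, ?_⟩
  · have := congrFun hx i
    simpa [θ, zij] using this
  · have := congrFun hx j
    simpa [θ, zij, Ne.symm hij] using this
  · intro k hi hj
    have := congrFun hx k
    simpa [θ, zij, hi, hj] using this

theorem NData.zeta {T : Finset ι} {ε : ι → ℝ} {y : ι → (ι → ℝ) → ℝ}
    {Y : ι → ι → (ι → ℝ) → (ι → ℝ)} (D : NData T ε y Y) {i j l : ι} (hi : i ∈ T) (hj : j ∈ T)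
    (hl : l ∈ T) (hij : i ≠ j) (hil : i ≠ l) (hjl : j ≠ l) (ei : ε i = 1) (ej : ε j = 1) :
    ∃ ζ : (ι → ℝ) → (ι → ℝ), AnalyticAt ℝ ζ 0 ∧ ζ 0 = 0 ∧
      ∀ᶠ x in 𝓝 0, y i (ζ x) = 0 ∧ y j (ζ x) = 0 ∧ (∀ k, k ≠ i → k ≠ j → ζ x k = x k) ∧
        Y i j (ζ x) = 0 := by
  obtain ⟨ζ, hζ, hζ0, hz⟩ := zeta_exists hij (D.y_an i hi) (D.y_an j hj) (D.y_zero i hi) (D.y_zero j hj)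
    (fun v => by rw [D.y_deriv i hi, ei, one_mul]) (fun v => by rw [D.y_deriv j hj, ej, one_mul])
  refine ⟨ζ, hζ, hζ0, ?_⟩
  have hζt : Tendsto ζ (𝓝 0) (𝓝 0) := by
    have := hζ.continuousAt.tendsto
    rwa [hζ0] at this
  have hc : ∀ᶠ x in 𝓝 0, Y i j (ζ x) = 0 := by
    apply density (g := fun x => y l (ζ x)) (Pi.single l 1)
    · have : AnalyticAt ℝ (fun x => Y i j (ζ x)) 0 :=
        AnalyticAt.comp (f := ζ) (g := Y i j) (by rw [hζ0]; exact D.Y_an i hi j hj hij) hζ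
      filter_upwards [eventually_analyticAt' this] with x hx
      exact hx.continuousAt
    · exact AnalyticAt.comp (f := ζ) (g := y l) (by rw [hζ0]; exact D.y_an l hl) hζ
    · have h1 : HasFDerivAt (fun x => y l (ζ x)) (fderiv ℝ (y l) 0 ∘L fderiv ℝ ζ 0) 0 := by
        have := (D.y_an l hl).differentiableAt.hasFDerivAt
        rw [← hζ0] at this
        have := this.comp (0 : ι → ℝ) hζ.differentiableAt.hasFDerivAt
        rw [hζ0] at this
        exact this
      rw [h1.fderiv, ContinuousLinearMap.comp_apply, D.y_deriv l hl, ← fderiv_coord hζ.differentiableAt]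
      have : (fun x => ζ x l) =ᶠ[𝓝 0] fun x => x l := by
        filter_upwards [hz] with x hx
        exact hx.2.2 l hil.symm hjl.symm
      rw [Filter.EventuallyEq.fderiv_eq this]
      have e : fderiv ℝ (fun x : ι → ℝ => x l) 0 = ContinuousLinearMap.proj l :=
        (ContinuousLinearMap.proj (R := ℝ) (φ := fun _ : ι => ℝ) l).hasFDerivAt.fderiv
      rw [e]
      have := D.eps l hl
      simp
      intro h; rw [h] at this; simp at this
    · filter_upwards [hz, hζt.eventually D.reg, hζt.eventually (D.Y_T i hi j hj hij)] with x h1 h2 h3 h4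
      obtain ⟨H, hH⟩ := h2 ⟨l, hl, h4⟩
      have hH := hH.self_of_nhds
      apply (hH.2.2 _ (hH.2.1 i hi j hj hij)).2
      intro a ha
      rw [h3 a ha, h1.1, h1.2.1]
      simp
  filter_upwards [hz, hc] with x h1 h2
  exact ⟨h1.1, h1.2.1, h1.2.2, h2⟩

end ndata
end NambuLin

open scoped ContDiff
namespace NambuLin
open Metric Filter Topology

section ndata
variable {ι : Type} [Fintype ι] [DecidableEq ι]

/-- the remainder field -/
def Wf (y : ι → (ι → ℝ) → ℝ) (Y : ι → ι → (ι → ℝ) → (ι → ℝ)) (l c : ι) (x : ι → ℝ) : ι → ℝ :=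
  Y c l x - y l x • Pi.single c 1 + y c x • Pi.single l 1

theorem Wf_props {T : Finset ι} {ε : ι → ℝ} {y : ι → (ι → ℝ) → ℝ}
    {Y : ι → ι → (ι → ℝ) → (ι → ℝ)} (D : NData T ε y Y) {c l : ι} (hcT : c ∈ T) (hlT : l ∈ T)
    (hcl : c ≠ l) : AnalyticAt ℝ (Wf y Y l c) 0 ∧ Wf y Y l c 0 = 0 ∧
      (∀ᶠ x in 𝓝 0, ∀ a ∈ T, Wf y Y l c x a = 0) ∧ fderiv ℝ (Wf y Y l c) 0 = 0 := by
  have han : AnalyticAt ℝ (Wf y Y l c) 0 :=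
    ((D.Y_an c hcT l hlT hcl).sub ((D.y_an l hlT).smul analyticAt_const)).add
      ((D.y_an c hcT).smul analyticAt_const)
  have hT : ∀ᶠ x in 𝓝 0, ∀ a ∈ T, Wf y Y l c x a = 0 := by
    filter_upwards [D.Y_T c hcT l hlT hcl] with x hx a ha
    simp only [Wf, Pi.add_apply, Pi.sub_apply, Pi.smul_apply, hx a ha]
    by_cases h1 : a = c
    · subst h1; simp [hcl]
    by_cases h2 : a = l
    · subst h2; simp [h1]
    simp [h1, h2]
  refine ⟨han, ?_, hT, ?_⟩
  · simp [Wf, D.Y_zero c hcT l hlT hcl, D.y_zero l hlT, D.y_zero c hcT]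
  · refine ContinuousLinearMap.ext fun v => ?_
    ext w
    rw [← fderiv_coord han.differentiableAt]
    by_cases hw : w ∈ T
    · have : (fun x => Wf y Y l c x w) =ᶠ[𝓝 0] fun _ => 0 := by
        filter_upwards [hT] with x hx
        exact hx w hw
      rw [Filter.EventuallyEq.fderiv_eq this]; simp
    · have : (fun x => Wf y Y l c x w) = fun x => Y c l x w := by
        ext x
        have h1 : w ≠ c := by rintro rfl; exact hw hcT
        have h2 : w ≠ l := by rintro rfl; exact hw hlT
        simp [Wf, h1, h2]
      rw [this, fderiv_coord (D.Y_an c hcT l hlT hcl).differentiableAt, D.Y_deriv c hcT l hlT hcl v w hw]; rfl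

theorem gam_k {i j k : ι} (h1 : k ≠ i) (h2 : k ≠ j) (x : ι → ℝ) (v : ι → C(Circ, ℝ)) (t : Circ) :
    gam i j x v t k = x k + prim (v k) t := by
  simp only [gam]; rw [rot_k _ _ h1 h2]

theorem HasFDerivAt.comp_zero {E F G : Type*} [NormedAddCommGroup E] [NormedSpace ℝ E]
    [NormedAddCommGroup F] [NormedSpace ℝ F] [NormedAddCommGroup G] [NormedSpace ℝ G]
    {f : E → F} {g : F → G} {f' : E →L[ℝ] F} {g' : F →L[ℝ] G} (hg : HasFDerivAt g g' 0)
    (hf : HasFDerivAt f f' 0) (h0 : f 0 = 0) : HasFDerivAt (fun x => g (f x)) (g' ∘L f') 0 := by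
  rw [← h0] at hg
  exact hg.comp (0 : E) hf

theorem b_axis {T : Finset ι} {ε : ι → ℝ} {y : ι → (ι → ℝ) → ℝ}
    {Y : ι → ι → (ι → ℝ) → (ι → ℝ)} (D : NData T ε y Y) {i j l : ι} (hi : i ∈ T) (hj : j ∈ T)
    (hl : l ∈ T) (hij : i ≠ j) (hil : i ≠ l) (hjl : j ≠ l) (ei : ε i = 1) (ej : ε j = 1)
    {ζ : (ι → ℝ) → (ι → ℝ)} (hζ : AnalyticAt ℝ ζ 0) (hζ0 : ζ 0 = 0)
    (hz : ∀ᶠ x in 𝓝 0, y i (ζ x) = 0 ∧ y j (ζ x) = 0 ∧ (∀ k, k ≠ i → k ≠ j → ζ x k = x k) ∧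
        Y i j (ζ x) = 0) {V : (ι → ℝ) → ι → C(Circ, ℝ)} {σ : (ι → ℝ) → ℝ}
    (hV : CircV i j (Y i j) ζ V σ) :
    ∀ᶠ x in 𝓝 0, x i = 0 → x j = 0 → x ≠ 0 → 3 * ‖x‖ ≤ 4 * |x l| →
      ∀ᶠ s in 𝓝[≠] (0:ℝ), (fun k => mean (V (x + s • Pi.single i 1) k)) = 0 := by
  have hζt : Tendsto ζ (𝓝 0) (𝓝 0) := by
    have := hζ.continuousAt.tendsto
    rwa [hζ0] at this
  have hlc : ∀ c, c = i ∨ c = j → c ∈ T ∧ c ≠ l ∧ ε c = 1 := by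
    rintro c (rfl | rfl)
    · exact ⟨hi, hil, ei⟩
    · exact ⟨hj, hjl, ej⟩
  -- size of y l
  have hyl : ∀ᶠ x in 𝓝 0, |y l (ζ x) - ε l * x l| ≤ 1/4 * ‖x‖ := by
    have h1 := HasFDerivAt.comp_zero (D.y_an l hl).differentiableAt.hasFDerivAt hζ.differentiableAt.hasFDerivAt hζ0
    have h2 := h1.isLittleO.def (by norm_num : (0:ℝ) < 1/4)
    filter_upwards [h2] with x hx
    have e1 : fderiv ℝ ζ 0 x l = x l := by
      rw [← fderiv_coord hζ.differentiableAt]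
      have : (fun x => ζ x l) =ᶠ[𝓝 0] fun x => x l := by
        filter_upwards [hz] with x hx
        exact hx.2.2.1 l hil.symm hjl.symm
      rw [Filter.EventuallyEq.fderiv_eq this]
      have e : fderiv ℝ (fun x : ι → ℝ => x l) 0 = ContinuousLinearMap.proj l :=
        (ContinuousLinearMap.proj (R := ℝ) (φ := fun _ : ι => ℝ) l).hasFDerivAt.fderiv
      rw [e]; rfl
    rw [hζ0, D.y_zero l hl] at hx
    simp only [sub_zero, ContinuousLinearMap.comp_apply, D.y_deriv l hl, e1] at hx
    exact hx
  have hW : ∀ c, c = i ∨ c = j → ∀ᶠ x in 𝓝 0, ‖Wf y Y l c (ζ x)‖ ≤ 1/2 * ‖x‖ := by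
    intro c hc
    obtain ⟨q1, q2, q3, q4⟩ := Wf_props D (hlc c hc).1 hl (hlc c hc).2.1
    have h1 := HasFDerivAt.comp_zero q1.differentiableAt.hasFDerivAt hζ.differentiableAt.hasFDerivAt hζ0
    have h2 := h1.isLittleO.def (by norm_num : (0:ℝ) < 1/2)
    filter_upwards [h2] with x hx
    rw [hζ0, q2, q4] at hx
    simpa using hx
  -- derivatives of y c
  have hyd : ∀ c, c = i ∨ c = j → ∀ᶠ x in 𝓝 0, ∀ u, |fderiv ℝ (y c) x u - u c| ≤ 1/40 * ‖u‖ := by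
    intro c hc
    have h1 : ContinuousAt (fderiv ℝ (y c)) 0 := (D.y_an c (hlc c hc).1).fderiv.continuousAt
    have h2 := Metric.continuousAt_iff.1 h1 (1/40) (by norm_num)
    obtain ⟨δ, hδ, h2⟩ := h2
    filter_upwards [Metric.ball_mem_nhds (0 : ι → ℝ) hδ] with x hx u
    have h3 := h2 hx
    rw [dist_eq_norm] at h3
    have h4 := (fderiv ℝ (y c) x - fderiv ℝ (y c) 0).le_opNorm u
    rw [ContinuousLinearMap.sub_apply, D.y_deriv c (hlc c hc).1, (hlc c hc).2.2, one_mul] at h4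
    exact h4.trans (by gcongr)
  -- closeness
  set K : ℝ := 2 * ‖prim‖ + 1 with hK
  have hK0 : 0 < K := by positivity
  have hstrict : HasStrictFDerivAt V (0 : (ι → ℝ) →L[ℝ] (ι → C(Circ, ℝ))) 0 := by
    have := hV.an.hasStrictFDerivAt
    rwa [hV.deriv.fderiv] at this
  have hlip := hstrict.isLittleO.def (by positivity : 0 < (1/40) / K)
  obtain ⟨r, hr, hlip⟩ := Metric.eventually_nhds_iff.1 hlip
  have hball : ∀ᶠ x in 𝓝 (0 : ι → ℝ), ‖x‖ < r := by
    filter_upwards [Metric.ball_mem_nhds (0 : ι → ℝ) hr] with x hx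
    simpa using hx
  have htriv : ∀ᶠ x in 𝓝 0, ∀ k ∈ T, k ≠ i → k ≠ j → V x k = 0 := by
    rw [Filter.eventually_all_finset]
    intro k hk
    by_cases h1 : k = i
    · exact Eventually.of_forall fun x h => absurd h1 h
    by_cases h2 : k = j
    · exact Eventually.of_forall fun x _ h => absurd h2 h
    have := hV.triv k h1 h2 (by
      filter_upwards [D.Y_T i hi j hj hij] with x hx
      rw [hx k hk, if_neg h1, if_neg h2])
    filter_upwards [this] with x hx _ _ using hx
  have good : ∀ᶠ x in 𝓝 0, Solves i j (Y i j) (x, σ x) (V x) ∧ (x j = 0 → mean (V x j) = 0) ∧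
      ‖x‖ < r ∧ ∀ k ∈ T, k ≠ i → k ≠ j → V x k = 0 := by
    filter_upwards [hV.solves, hV.ray, hball, htriv] with x h1 h2 h3 h4 using ⟨h1, h2, h3, h4⟩
  have hWs : ∀ c, c = i ∨ c = j → ∀ᶠ x in 𝓝 0, DifferentiableAt ℝ (Wf y Y l c) x ∧
      (∀ᶠ x in 𝓝 x, ∀ a ∈ T, Wf y Y l c x a = 0) ∧ DifferentiableAt ℝ (y c) x := by
    intro c hc
    obtain ⟨q1, q2, q3, q4⟩ := Wf_props D (hlc c hc).1 hl (hlc c hc).2.1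
    filter_upwards [eventually_analyticAt' q1, q3.eventually_nhds, eventually_analyticAt' (D.y_an c (hlc c hc).1)] with x h1 h2 h3
    exact ⟨h1.differentiableAt, h2, h3.differentiableAt⟩
  filter_upwards [hyl, hW i (Or.inl rfl), hW j (Or.inr rfl), hζt.eventually (hyd i (Or.inl rfl)),
    hζt.eventually (hyd j (Or.inr rfl)), hball, htriv, good.eventually_nhds, hz, hV.axis,
    hζt.eventually D.reg, hζt.eventually (hWs i (Or.inl rfl)), hζt.eventually (hWs j (Or.inr rfl)),
    hζt.eventually (eventually_analyticAt' (D.y_an l hl))]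
    with x g1 g2 g3 g4 g5 g6 g7 g8 g9 g10 g11 g12 g13 g14 xi xj x0 hcone
  have hx0 : 0 < ‖x‖ := norm_pos_iff.2 x0
  have hε := D.eps l hl
  have hyx : 1/2 * ‖x‖ ≤ |y l (ζ x)| := by
    have : |ε l * x l| = |x l| := by rw [abs_mul, hε, one_mul]
    have h2 : |ε l * x l| ≤ |y l (ζ x)| + |y l (ζ x) - ε l * x l| := by
      have := abs_sub_abs_le_abs_sub (ε l * x l) (y l (ζ x))
      rw [abs_sub_comm] at this
      linarith
    linarith
  have hylne : y l (ζ x) ≠ 0 := by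
    intro h; rw [h] at hyx; simp at hyx; linarith
  obtain ⟨H, hH⟩ := g11 ⟨l, hl, hylne⟩
  obtain ⟨-, hax⟩ := g10 xi xj
  refine b_zero_local (T := T) hij hil hjl hi hj hl (X := Y i j) (H := H) (p := ζ x) (y := y)
    (W := Wf y Y l) (η := 1/40) ?_ ?_ hylne g14.differentiableAt ?_ (by norm_num) (by norm_num) ?_
    (γ := fun s => gam i j (x + s • Pi.single i 1) (V (x + s • Pi.single i 1)))
    (σ := fun s => σ (x + s • Pi.single i 1)) ?_
  · filter_upwards [hH] with x' hx'
    exact ⟨hx'.1, hx'.2.1 i hi j hj hij⟩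
  · intro v hv hv0
    obtain ⟨h1, h2⟩ := hH.self_of_nhds.2.2 v hv0
    apply h2
    intro a ha
    by_cases hal : a = l
    · subst hal
      rw [Finset.sum_eq_single_of_mem a ha] at h1
      · exact (mul_eq_zero.1 h1).resolve_left hylne
      · intro b hb hba; rw [hv b hb hba, mul_zero]
    · exact hv a ha hal
  · intro c hc
    have e : DifferentiableAt ℝ (Wf y Y l c) (ζ x) ∧
      (∀ᶠ x in 𝓝 (ζ x), ∀ a ∈ T, Wf y Y l c x a = 0) ∧ DifferentiableAt ℝ (y c) (ζ x) := by
      rcases hc with rfl | rfl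
      exacts [g12, g13]
    refine ⟨e.2.2, e.1, ?_, e.2.1, ?_⟩
    · rcases hc with rfl | rfl
      exacts [g9.1, g9.2.1]
    · filter_upwards [hH] with x' hx'
      have : y l x' • Pi.single c 1 - y c x' • Pi.single l 1 + Wf y Y l c x' = Y c l x' := by
        simp only [Wf]; abel
      rw [this]
      exact hx'.2.1 c (hlc c hc).1 l hl (hlc c hc).2.1
  · rintro c (rfl | rfl)
    · exact ⟨g4, g2.trans hyx⟩
    · exact ⟨g5, g3.trans hyx⟩
  · have ht : Tendsto (fun s : ℝ => x + s • (Pi.single i 1 : ι → ℝ)) (𝓝[≠] 0) (𝓝 x) := by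
      have : ContinuousAt (fun s : ℝ => x + s • (Pi.single i 1 : ι → ℝ)) 0 := by fun_prop
      have := this.tendsto
      simp only [zero_smul, add_zero] at this
      exact this.mono_left nhdsWithin_le_nhds
    filter_upwards [ht.eventually g8] with s hs
    obtain ⟨s1, s2, s3, s4⟩ := hs
    refine ⟨fun θ => gam_ode hij s1 θ, ?_, ?_, ?_⟩
    · intro t
      set x' := x + s • (Pi.single i 1 : ι → ℝ) with hx'
      have e1 : gam i j x' (V x') t - ζ x - s • rot i j t (Pi.single i 1) = gam i j 0 (V x' - V x) t := by
        rw [← hax t]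
        have e2 : gam i j x' (V x') t = gam i j x (V x) t + (gam i j (s • Pi.single i 1) 0 t + gam i j 0 (V x' - V x) t) := by
          rw [← gam_add, ← gam_add]
          congr 1
          · rw [hx']; simp
          · abel
        have e3 : gam i j (s • Pi.single i 1) 0 t = s • rot i j t (Pi.single i 1) := by
          rw [← map_smul]
          simp only [gam]
          congr 1
          ext k; simp
        rw [e2, e3]; abel
      rw [e1]
      refine (norm_gam_le hij _ _ _).trans ?_
      have h5 := @hlip (x', x) (by
        rw [Prod.dist_eq, max_lt_iff]; simpa using ⟨s3, g6⟩)
      simp only [ContinuousLinearMap.zero_apply, sub_zero] at h5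
      have h6 : ‖x' - x‖ = |s| := by
        rw [hx', add_sub_cancel_left, norm_smul, Pi.norm_single]; simp
      rw [h6] at h5
      rw [norm_zero, zero_add]
      have h7 : ‖prim‖ * ‖V x' - V x‖ ≤ ‖prim‖ * (1 / 40 / K * |s|) := by gcongr
      have h8 : K * (1 / 40 / K * |s|) = 1/40 * |s| := by field_simp
      have h9 : 0 ≤ 1 / 40 / K * |s| := by positivity
      rw [hK] at h8 h9 h7
      nlinarith
    · intro t a ha h1 h2
      rw [gam_k h1 h2, s4 a ha h1 h2, g9.2.2.1 a h1 h2]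
      simp [h1]
    · intro a ha h1
      by_cases h2 : a = j
      · subst h2
        exact s2 (by simp [xj, h1])
      · show mean _ = 0
        rw [s4 a ha h1 h2, map_zero]

end ndata
end NambuLin

open scoped ContDiff
namespace NambuLin
open Metric Filter Topology

section ndata
variable {ι : Type} [Fintype ι] [DecidableEq ι]

theorem exists_rot_ray {i j : ι} (hij : i ≠ j) (x : ι → ℝ) : ∃ s : Circ, rot i j s x j = 0 := by
  by_cases h : x i = 0 ∧ x j = 0
  · exact ⟨0, by rw [rot_j hij, h.1, h.2]; simp⟩
  · set z : ℂ := ⟨x i, x j⟩ with hz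
    have hz0 : z ≠ 0 := by
      intro h0
      apply h
      exact ⟨congrArg Complex.re h0, congrArg Complex.im h0⟩
    refine ⟨((Complex.arg z : ℝ) : Circ), ?_⟩
    rw [rot_j hij, cosK_coe, sinK_coe, Complex.cos_arg hz0, Complex.sin_arg]
    simp only [hz]
    ring

theorem analyticAt_update (j : ι) (c : ℝ) (x : ι → ℝ) : AnalyticAt ℝ (fun x : ι → ℝ => Function.update x j c) x := by
  rw [analyticAt_pi_iff]
  intro k
  by_cases h : k = j
  · subst h; simpa using analyticAt_const
  · simp only [Function.update_of_ne h]
    exact (ContinuousLinearMap.proj (R := ℝ) (φ := fun _ : ι => ℝ) k).analyticAt x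

theorem update_zero_zero (j : ι) : Function.update (0 : ι → ℝ) j 0 = 0 := by
  ext k; by_cases h : k = j
  · subst h; simp
  · simp [h]

noncomputable def meanL : (ι → C(Circ, ℝ)) →L[ℝ] (ι → ℝ) :=
  ContinuousLinearMap.pi fun k => mean ∘L ContinuousLinearMap.proj k

theorem meanL_apply (v : ι → C(Circ, ℝ)) : meanL v = fun k => mean (v k) := rfl

theorem b_zero {T : Finset ι} {ε : ι → ℝ} {y : ι → (ι → ℝ) → ℝ}
    {Y : ι → ι → (ι → ℝ) → (ι → ℝ)} (D : NData T ε y Y) {i j l : ι} (hi : i ∈ T) (hj : j ∈ T)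
    (hl : l ∈ T) (hij : i ≠ j) (hil : i ≠ l) (hjl : j ≠ l) (ei : ε i = 1) (ej : ε j = 1)
    {ζ : (ι → ℝ) → (ι → ℝ)} (hζ : AnalyticAt ℝ ζ 0) (hζ0 : ζ 0 = 0)
    (hz : ∀ᶠ x in 𝓝 0, y i (ζ x) = 0 ∧ y j (ζ x) = 0 ∧ (∀ k, k ≠ i → k ≠ j → ζ x k = x k) ∧
        Y i j (ζ x) = 0) {V : (ι → ℝ) → ι → C(Circ, ℝ)} {σ : (ι → ℝ) → ℝ}
    (hV : CircV i j (Y i j) ζ V σ) :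
    ∀ᶠ x in 𝓝 0, meanL (V x) = 0 := by
  have hax := b_axis D hi hj hl hij hil hjl ei ej hζ hζ0 hz hV
  obtain ⟨r, hr, hall⟩ := Metric.eventually_nhds_iff.1 (hax.and (eventually_analyticAt' hV.an))
  have hzero : ∀ x : ι → ℝ, ‖x‖ < r → zij i j x ≠ 0 → 3 * ‖zij i j x‖ ≤ 4 * |x l| →
      meanL (V (Function.update x j 0)) = 0 := by
    intro x hx hx0 hc
    have hzn : ‖zij i j x‖ ≤ ‖x‖ := by
      rw [pi_norm_le_iff_of_nonneg (norm_nonneg _)]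
      intro k
      simp only [zij]
      split_ifs
      · simp
      · exact norm_le_pi_norm x k
    have hzl : zij i j x l = x l := by simp [zij, hil.symm, hjl.symm]
    have h1 := (@hall (zij i j x) (by simpa using hzn.trans_lt hx)).1 (by simp [zij]) (by simp [zij]) hx0 (by rw [hzl]; exact hc)
    let g : ℝ → ι → ℝ := fun s => meanL (V (zij i j x + s • Pi.single i 1))
    have hg : AnalyticOnNhd ℝ g (Metric.ball 0 r) := by
      intro s hs
      have e1 : AnalyticAt ℝ (fun s : ℝ => zij i j x + s • (Pi.single i 1 : ι → ℝ)) s :=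
        analyticAt_const.add (analyticAt_id.smul analyticAt_const)
      have e2 : AnalyticAt ℝ V (zij i j x + s • Pi.single i 1) := by
        refine (@hall _ ?_).2
        rw [dist_zero_right, pi_norm_lt_iff hr]
        intro k
        by_cases hk : k = i
        · subst hk
          simpa [zij] using hs
        · have := (norm_le_pi_norm (zij i j x) k).trans_lt (hzn.trans_lt hx)
          simpa [hk] using this
      have e3 : AnalyticAt ℝ (fun s : ℝ => V (zij i j x + s • Pi.single i 1)) s :=
        AnalyticAt.comp (g := V) (f := fun s : ℝ => zij i j x + s • (Pi.single i 1 : ι → ℝ)) e2 e1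
      exact AnalyticAt.comp (g := (meanL : (ι → C(Circ, ℝ)) →L[ℝ] (ι → ℝ))) (f := fun s : ℝ => V (zij i j x + s • Pi.single i 1))
        (ContinuousLinearMap.analyticAt _ _) e3
    have h2 := hg.eqOn_zero_of_preconnected_of_frequently_eq_zero (convex_ball 0 r).isPreconnected
      (Metric.mem_ball_self hr) (Filter.Eventually.frequently h1)
    have h3 := h2 (x := x i) (by
      have := (norm_le_pi_norm x i).trans_lt hx
      simpa using this)
    have h4 : zij i j x + x i • (Pi.single i 1 : ι → ℝ) = Function.update x j 0 := by
      ext k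
      by_cases hk : k = i
      · subst hk; simp [zij, hij]
      by_cases hk' : k = j
      · subst hk'; simp [zij, hk]
      · simp [zij, hk, hk']
    simp only [g, h4] at h3
    exact h3
  have hupd : Tendsto (fun x : ι → ℝ => Function.update x j 0) (𝓝 0) (𝓝 0) := by
    have := (analyticAt_update j 0 (0 : ι → ℝ)).continuousAt.tendsto
    rwa [update_zero_zero] at this
  have hcont : ∀ᶠ x in 𝓝 0, meanL (V (Function.update x j 0)) = 0 := by
    apply continuation
    · have e3 : AnalyticAt ℝ (fun x : ι → ℝ => V (Function.update x j 0)) 0 :=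
        AnalyticAt.comp (g := V) (f := fun x : ι → ℝ => Function.update x j 0)
          (by rw [update_zero_zero]; exact hV.an) (analyticAt_update j 0 0)
      exact AnalyticAt.comp (g := (meanL : (ι → C(Circ, ℝ)) →L[ℝ] (ι → ℝ))) (f := fun x : ι → ℝ => V (Function.update x j 0))
        (ContinuousLinearMap.analyticAt _ _) e3
    · apply frequently_line (Pi.single l 1)
      have hsm : ∀ᶠ t : ℝ in 𝓝[>] 0, t < r := nhdsWithin_le_nhds (gt_mem_nhds hr)
      filter_upwards [hsm, self_mem_nhdsWithin] with t ht ht0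
      have ht0 : 0 < t := ht0
      have hn : ‖t • (Pi.single l 1 : ι → ℝ)‖ = t := by
        rw [norm_smul, Pi.norm_single]; simp [abs_of_pos ht0]
      have hzz : zij i j (t • (Pi.single l 1 : ι → ℝ)) = t • Pi.single l 1 := by
        ext k
        simp only [zij]
        split_ifs with h
        · rcases h with rfl | rfl <;> simp [hil, hjl]
        · rfl
      have c1 : Continuous (fun x : ι → ℝ => ‖x‖) := continuous_norm
      have hzc : Continuous (zij i j : (ι → ℝ) → (ι → ℝ)) :=
        continuous_iff_continuousAt.2 fun x => (analyticAt_zij i j x).continuousAt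
      have c2 : Continuous (fun x : ι → ℝ => 3 * ‖zij i j x‖) := continuous_const.mul hzc.norm
      have c3 : Continuous (fun x : ι → ℝ => 4 * |x l|) := by fun_prop
      have o1 := c1.continuousAt.eventually_lt continuousAt_const (by rw [hn]; exact ht :
        ‖t • (Pi.single l 1 : ι → ℝ)‖ < r)
      have o2 := c2.continuousAt.eventually_lt c3.continuousAt (x₀ := t • (Pi.single l 1 : ι → ℝ)) (by
        rw [hzz, hn]; simp [abs_of_pos ht0]; linarith)
      have o3 := hzc.continuousAt.eventually_ne (x := t • (Pi.single l 1 : ι → ℝ)) (y := 0) (by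
        rw [hzz]; intro h; rw [h] at hn; simp at hn; linarith)
      filter_upwards [o1, o2, o3] with x p1 p2 p3
      exact hzero x p1 p3 p2.le
  have hfin : ∀ᶠ x in 𝓝 0, x j = 0 → meanL (V x) = 0 := by
    filter_upwards [hcont] with x hx hxj
    rwa [← hxj, Function.update_eq_self] at hx
  filter_upwards [rot_small hij hfin, hV.equiv] with x h1 h2
  obtain ⟨s, hs⟩ := exists_rot_ray hij x
  have h3 := h1 s hs
  rw [h2 s, meanL_apply, mean_rotV] at h3
  have h4 := congrArg (rot i j (-s)) h3
  rw [rot_neg_rot hij, map_zero] at h4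
  exact h4

/-- output of stage 1 -/
theorem stage1 {T : Finset ι} {ε : ι → ℝ} {y : ι → (ι → ℝ) → ℝ}
    {Y : ι → ι → (ι → ℝ) → (ι → ℝ)} (D : NData T ε y Y) {i j l : ι} (hi : i ∈ T) (hj : j ∈ T)
    (hl : l ∈ T) (hij : i ≠ j) (hil : i ≠ l) (hjl : j ≠ l) (ei : ε i = 1) (ej : ε j = 1) :
    ∃ (φ : (ι → ℝ) → (ι → ℝ)) (σ : (ι → ℝ) → ℝ), AnalyticAt ℝ φ 0 ∧ φ 0 = 0 ∧
      fderiv ℝ φ 0 = ContinuousLinearMap.id ℝ _ ∧ AnalyticAt ℝ σ 0 ∧ σ 0 = 0 ∧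
      (∀ᶠ x in 𝓝 0, ∀ k ∈ T, k ≠ i → k ≠ j → φ x k = x k) ∧
      (∀ᶠ x in 𝓝 0, fderiv ℝ φ x (JJ i j x) = (1 + σ x) • Y i j (φ x)) ∧
      (∀ᶠ x in 𝓝 0, x i = 0 → x j = 0 → y i (φ x) = 0) := by
  obtain ⟨ζ, hζ, hζ0, hz⟩ := D.zeta hi hj hl hij hil hjl ei ej
  obtain ⟨V, σ, hV⟩ := circV_exists hij (D.Y_an i hi j hj hij) (D.Y_zero i hi j hj hij)
    (D.X_deriv hi hj hij ei ej) hζ.continuousAt hζ0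
    (hz.mono fun x hx => ⟨hx.2.2.2, hx.2.2.1⟩)
  have hb := b_zero D hi hj hl hij hil hjl ei ej hζ hζ0 hz hV
  let ev : (ι → C(Circ, ℝ)) →L[ℝ] (ι → ℝ) :=
    ContinuousLinearMap.pi fun k => (ContinuousMap.evalCLM ℝ (0 : Circ)) ∘L prim ∘L ContinuousLinearMap.proj k
  have hev : ∀ v k, ev v k = prim (v k) 0 := fun v k => rfl
  let φ : (ι → ℝ) → (ι → ℝ) := fun x => x + ev (V x)
  have hφg : ∀ x, φ x = gam i j x (V x) 0 := by
    intro x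
    simp only [gam, rot_zero hij, φ]
    rfl
  have hφ : AnalyticAt ℝ φ 0 := analyticAt_id.add
    (AnalyticAt.comp (g := ev) (f := V) (ev.analyticAt _) hV.an)
  have hrot : ∀ᶠ x in 𝓝 0, ∀ t, φ (rot i j t x) = gam i j x (V x) t := by
    filter_upwards [hV.equiv] with x hx t
    rw [hφg, hx t, gam_rotV hij, zero_add]
  refine ⟨φ, σ, hφ, ?_, ?_, hV.san, hV.szero, ?_, ?_, ?_⟩
  · simp only [φ, hV.zero, map_zero, add_zero]
  · have h1 : HasFDerivAt (fun x => ev (V x)) (ev ∘L (0 : (ι → ℝ) →L[ℝ] (ι → C(Circ, ℝ)))) 0 :=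
      ev.hasFDerivAt.comp (0 : ι → ℝ) hV.deriv
    have h2 : HasFDerivAt φ (ContinuousLinearMap.id ℝ _ + ev ∘L (0 : (ι → ℝ) →L[ℝ] (ι → C(Circ, ℝ)))) 0 := (hasFDerivAt_id (0 : ι → ℝ)).add h1
    rw [h2.fderiv]; simp
  · rw [Filter.eventually_all_finset]
    intro k hk
    by_cases h1 : k = i
    · exact Eventually.of_forall fun x h => absurd h1 h
    by_cases h2 : k = j
    · exact Eventually.of_forall fun x _ h => absurd h2 h
    have := hV.triv k h1 h2 (by
      filter_upwards [D.Y_T i hi j hj hij] with x hx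
      rw [hx k hk, if_neg h1, if_neg h2])
    filter_upwards [this] with x hx _ _
    simp [φ, hev, hx]
  · filter_upwards [hrot, hV.solves, hb, eventually_analyticAt' hφ] with x h1 h2 h3 h4
    have e1 := gam_ode hij h2 0
    rw [meanL_apply] at h3
    rw [h3, map_zero, sub_zero] at e1
    have e2 : HasDerivAt (fun s : ℝ => φ (rot i j (s : Circ) x)) (fderiv ℝ φ x (JJ i j x)) 0 := by
      have e3 := rot_hasDerivAt hij (hasDerivAt_const (0:ℝ) x)
      rw [map_zero, add_zero] at e3
      have e0 : rot i j ((0:ℝ) : Circ) x = x := by rw [AddCircle.coe_zero, rot_zero hij]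
      rw [e0] at e3
      refine HasFDerivAt.comp_hasDerivAt (l := φ) (f := fun s : ℝ => rot i j (s : Circ) x) (0:ℝ) ?_ e3
      rw [e0]; exact h4.differentiableAt.hasFDerivAt
    simp only [h1] at e2
    rw [e2.unique e1, AddCircle.coe_zero, hφg]
  · filter_upwards [hV.axis, hz] with x h1 h2 xi xj
    rw [hφg, (h1 xi xj).2 0]
    exact h2.1

end ndata
end NambuLin

open scoped ContDiff
namespace NambuLin
open Metric Filter Topology

section flow
variable {ι : Type} [Fintype ι] [DecidableEq ι]

noncomputable def extI (f : C(unitInterval, ℝ)) : ℝ → ℝ := Set.IccExtend (zero_le_one' ℝ) f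

theorem extI_cont (f : C(unitInterval, ℝ)) : Continuous (extI f) := f.continuous.Icc_extend'

theorem extI_coe (f : C(unitInterval, ℝ)) (t : unitInterval) : extI f t = f t :=
  Set.IccExtend_val _ _ _

theorem primI_deriv (f : C(unitInterval, ℝ)) (t : ℝ) :
    HasDerivAt (fun t => ∫ s in (0:ℝ)..t, extI f s) (extI f t) t :=
  intervalIntegral.integral_hasDerivAt_right ((extI_cont f).intervalIntegrable _ _)
    ((extI_cont f).stronglyMeasurableAtFilter _ _) (extI_cont f).continuousAt

noncomputable def primI : C(unitInterval, ℝ) →L[ℝ] C(unitInterval, ℝ) :=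
  LinearMap.mkContinuous
    { toFun := fun f => ⟨fun t => ∫ s in (0:ℝ)..t, extI f s,
        (continuous_iff_continuousAt.2 fun t => (primI_deriv f t).continuousAt).comp continuous_subtype_val⟩
      map_add' := by
        intro f g
        ext t
        simp only [ContinuousMap.coe_mk, ContinuousMap.add_apply]
        rw [← intervalIntegral.integral_add ((extI_cont f).intervalIntegrable _ _) ((extI_cont g).intervalIntegrable _ _)]
        rfl
      map_smul' := by
        intro c f
        ext t
        simp only [ContinuousMap.coe_mk, ContinuousMap.smul_apply, RingHom.id_apply, smul_eq_mul]
        rw [← intervalIntegral.integral_const_mul]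
        rfl } 1 (by
    intro f
    rw [one_mul, ContinuousMap.norm_le _ (norm_nonneg _)]
    intro t
    have := intervalIntegral.norm_integral_le_of_norm_le_const (f := extI f) (a := 0) (b := (t:ℝ)) (C := ‖f‖)
      (fun s _ => f.norm_coe_le_norm _)
    refine this.trans ?_
    rw [sub_zero, abs_of_nonneg t.2.1]
    exact mul_le_of_le_one_right (norm_nonneg _) t.2.2)

theorem primI_apply (f : C(unitInterval, ℝ)) (t : unitInterval) :
    primI f t = ∫ s in (0:ℝ)..t, extI f s := rfl

theorem flow_exists (S : Finset ι) {A : ι → ι → (ι → ℝ) → ℝ} (hA : ∀ k c, AnalyticAt ℝ (A k c) 0) :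
    ∃ u : (ι → ℝ) → ι → C(unitInterval, ℝ), AnalyticAt ℝ u 0 ∧ u 0 = 0 ∧
      (∀ᶠ m in 𝓝 0, (∀ k ∈ S, m k = 0) → ∀ c t, u m c t = m c) ∧
      ∀ᶠ m in 𝓝 0, ∃ M : ℝ → ι → ℝ, M 0 = m ∧ (∀ (t : unitInterval) c, M t c = u m c t) ∧
        ∀ t ∈ Set.Icc (0:ℝ) 1, HasDerivAt M (fun c => - ∑ k ∈ S, m k * A k c (M t)) t := by
  choose F hF hFA using fun k c => nemytskii (hA k c) unitInterval
  let cst : ℝ →L[ℝ] C(unitInterval, ℝ) := algebraMapCLM ℝ C(unitInterval, ℝ)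
  have hcst : ∀ r t, cst r t = r := fun r t => rfl
  let G : (ι → ℝ) × (ι → C(unitInterval, ℝ)) → (ι → C(unitInterval, ℝ)) := fun z c =>
    cst (z.1 c) - primI (∑ k ∈ S, z.1 k • F k c z.2)
  have hG : AnalyticAt ℝ G 0 := by
    rw [analyticAt_pi_iff]
    intro c
    have p1 : ∀ k, AnalyticAt ℝ (fun z : (ι → ℝ) × (ι → C(unitInterval, ℝ)) => z.1 k) 0 := fun k => by
      let L : ((ι → ℝ) × (ι → C(unitInterval, ℝ))) →L[ℝ] ℝ :=
        (ContinuousLinearMap.proj (R := ℝ) (φ := fun _ : ι => ℝ) k) ∘L ContinuousLinearMap.fst ℝ _ _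
      exact L.analyticAt 0
    have p2 : ∀ k, AnalyticAt ℝ (fun z : (ι → ℝ) × (ι → C(unitInterval, ℝ)) => F k c z.2) 0 := fun k =>
      AnalyticAt.comp (g := F k c) (f := fun z : (ι → ℝ) × (ι → C(unitInterval, ℝ)) => z.2) (hF k c) analyticAt_snd
    refine AnalyticAt.sub ?_ ?_
    · exact AnalyticAt.comp (g := cst) (f := fun z : (ι → ℝ) × (ι → C(unitInterval, ℝ)) => z.1 c) (cst.analyticAt _) (p1 c)
    · refine AnalyticAt.comp (g := primI) (f := fun z : (ι → ℝ) × (ι → C(unitInterval, ℝ)) => ∑ k ∈ S, z.1 k • F k c z.2) (primI.analyticAt _) ?_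
      exact Finset.analyticAt_fun_sum _ fun k _ => (p1 k).smul (p2 k)
  have hG1 : ∀ m μ, (∀ k ∈ S, m k = 0) → G (m, μ) = fun c => cst (m c) := by
    intro m μ hm
    ext1 c
    simp only [G]
    rw [Finset.sum_eq_zero fun k hk => by rw [hm k hk, zero_smul], map_zero, sub_zero]
  have hG0 : ∀ μ, G (0, μ) = 0 := by
    intro μ
    rw [hG1 0 μ (fun _ _ => rfl)]
    ext1 c; exact map_zero cst
  obtain ⟨u, hu, hu0, hfix, -⟩ := implicit_fixed hG (hG0 0) (by
    intro v
    have hcd : HasDerivAt (fun τ : ℝ => ((0 : ι → ℝ), τ • v)) ((0 : ι → ℝ), v) 0 := by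
      have := (hasDerivAt_const (0:ℝ) (0 : ι → ℝ)).prodMk ((hasDerivAt_id (0:ℝ)).smul_const v)
      simpa using this
    have e0 : ((0 : ι → ℝ), (0:ℝ) • v) = 0 := by rw [zero_smul]; rfl
    have d1 : HasDerivAt (fun τ : ℝ => G (0, τ • v)) (fderiv ℝ G 0 (0, v)) 0 :=
      HasFDerivAt.comp_hasDerivAt (l := G) (f := fun τ : ℝ => ((0 : ι → ℝ), τ • v)) (0:ℝ)
        (by rw [e0]; exact hG.differentiableAt.hasFDerivAt) hcd
    simp only [hG0] at d1
    exact d1.unique (hasDerivAt_const _ _))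
  refine ⟨u, hu, hu0, ?_, ?_⟩
  · filter_upwards [hfix] with m hm h0 c t
    rw [hm, hG1 m _ h0]; rfl
  · have hut : Tendsto u (𝓝 0) (𝓝 0) := by
      have := hu.continuousAt.tendsto
      rwa [hu0] at this
    have hFA' : ∀ᶠ μ in 𝓝 0, ∀ k c, ∀ t, F k c μ t = A k c (fun a => μ a t) := by
      rw [Filter.eventually_all]; intro k
      rw [Filter.eventually_all]; intro c
      exact hFA k c
    filter_upwards [hfix, hut.eventually hFA'] with m hm hF'
    let g : ι → C(unitInterval, ℝ) := fun c => ∑ k ∈ S, m k • F k c (u m)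
    let M : ℝ → ι → ℝ := fun t c => m c - ∫ s in (0:ℝ)..t, extI (g c) s
    have hMu : ∀ (t : unitInterval) c, M t c = u m c t := by
      intro t c
      have := congrArg (fun f : C(unitInterval, ℝ) => f t) (congrFun hm c)
      rw [this]
      rfl
    refine ⟨M, ?_, hMu, ?_⟩
    · ext c; simp [M]
    · intro t ht
      rw [hasDerivAt_pi]
      intro c
      have h1 := (primI_deriv (g c) t).const_sub (m c)
      have h2 : extI (g c) t = ∑ k ∈ S, m k * A k c (M t) := by
        have := extI_coe (g c) ⟨t, ht⟩
        rw [show ((⟨t, ht⟩ : unitInterval) : ℝ) = t from rfl] at this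
        rw [this]
        simp only [g, ContinuousMap.sum_apply, ContinuousMap.smul_apply, smul_eq_mul]
        refine Finset.sum_congr rfl fun k _ => ?_
        rw [hF' k c]
        congr 2
        ext a
        exact (hMu ⟨t, ht⟩ a).symm
      rw [h2] at h1
      exact h1

end flow
end NambuLin

open scoped ContDiff
namespace NambuLin
open Metric Filter Topology

section s2
variable {ι : Type} [Fintype ι] [DecidableEq ι]

theorem analyticAt_eval (k : ι) (x : ι → ℝ) : AnalyticAt ℝ (fun m : ι → ℝ => m k) x :=
  (ContinuousLinearMap.proj (R := ℝ) (φ := fun _ : ι => ℝ) k).analyticAt x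

theorem analyticAt_update_fun {E : Type*} [NormedAddCommGroup E] [NormedSpace ℝ E] (k : ι)
    {g : E → ι → ℝ} {f : E → ℝ} {x : E} (hg : AnalyticAt ℝ g x)
    (hf : AnalyticAt ℝ f x) : AnalyticAt ℝ (fun m => Function.update (g m) k (f m)) x := by
  rw [analyticAt_pi_iff]
  intro a
  by_cases h : a = k
  · subst h; simpa using hf
  · simpa [h] using analyticAt_coord hg a

/-- first integrals after straightening the rotation -/
def Good (S : Finset ι) (i j : ι) (η : (ι → ℝ) → ℝ) (Z : ι → (ι → ℝ) → (ι → ℝ))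
    (H : (ι → ℝ) → (ι → ℝ)) (x : ι → ℝ) : Prop :=
  ∀ᶠ x' in 𝓝 x, DifferentiableAt ℝ H x' ∧ fderiv ℝ H x' (JJ i j x') = 0 ∧
    (∀ k ∈ S, fderiv ℝ H x' (Z k x') = 0) ∧
    ∀ v, fderiv ℝ H x' v = 0 → (∀ c ∈ S, v c = 0) → η x' ≠ 0 → ∃ c : ℝ, v = c • JJ i j x'

structure S2 (S : Finset ι) (i j l : ι) (η : (ι → ℝ) → ℝ) (Z : ι → (ι → ℝ) → (ι → ℝ)) : Prop where
  hij : i ≠ j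
  hi : i ∉ S
  hj : j ∉ S
  hl : l ∈ S
  eta_an : AnalyticAt ℝ η 0
  eta_ax : ∀ᶠ x in 𝓝 0, x i = 0 → x j = 0 → η x = 0
  eta_deriv : fderiv ℝ η 0 (Pi.single i 1) = 1
  Z_an : ∀ k ∈ S, AnalyticAt ℝ (Z k) 0
  Z_S : ∀ᶠ x in 𝓝 0, ∀ k ∈ S, ∀ c ∈ S, Z k x c = if c = k then - η x else 0
  regl : ∀ᶠ t in 𝓝[>] (0:ℝ), ∃ H, Good S i j η Z H (t • Pi.single l 1)
  regi : ∀ᶠ t in 𝓝[>] (0:ℝ), ∃ H, Good S i j η Z H (t • Pi.single i 1)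

variable {S : Finset ι} {i j l : ι} {η : (ι → ℝ) → ℝ} {Z : ι → (ι → ℝ) → (ι → ℝ)}

theorem rot_small_at (hij : i ≠ j) {q : ι → ℝ} (hqi : q i = 0) (hqj : q j = 0) {p : (ι → ℝ) → Prop}
    (hp : ∀ᶠ x in 𝓝 q, p x) : ∀ᶠ x in 𝓝 q, ∀ t, p (rot i j t x) := by
  have h1 : ∀ᶠ z in 𝓝 (0 : ι → ℝ), p (q + z) := by
    have : Tendsto (fun z : ι → ℝ => q + z) (𝓝 0) (𝓝 q) := by
      have : Continuous (fun z : ι → ℝ => q + z) := by fun_prop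
      have := this.tendsto 0
      simpa using this
    exact this.eventually hp
  have h2 := rot_small hij h1
  have h3 : Tendsto (fun x : ι → ℝ => x - q) (𝓝 q) (𝓝 0) := by
    have : Continuous (fun z : ι → ℝ => z - q) := by fun_prop
    have := this.tendsto q
    simpa using this
  filter_upwards [h3.eventually h2] with x hx t
  have := hx t
  rwa [map_sub, rot_fix t hqi hqj, add_sub_cancel] at this

theorem good_rot (hij : i ≠ j) {q : ι → ℝ} (hqi : q i = 0) (hqj : q j = 0) {H : (ι → ℝ) → (ι → ℝ)}
    (hG : Good S i j η Z H q) :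
    ∀ᶠ x in 𝓝 q, ∀ t, ∀ v, fderiv ℝ H (rot i j t x) (rot i j t v) = fderiv ℝ H x v := by
  have h1 := rot_small_at hij hqi hqj hG
  have h2 : ∀ᶠ x in 𝓝 q, ∀ t : ℝ, H (rot i j (t : Circ) x) = H x := by
    filter_upwards [h1] with x hx t
    have hd : ∀ s : ℝ, HasDerivAt (fun s : ℝ => H (rot i j (s : Circ) x)) 0 s := by
      intro s
      obtain ⟨a, b, -⟩ := hx (s : Circ)
      have := HasFDerivAt.comp_hasDerivAt (l := H) (f := fun s : ℝ => rot i j (s : Circ) x) s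
        a.hasFDerivAt (rot_hasDerivAt hij (hasDerivAt_const s x))
      rw [map_zero, add_zero, b] at this
      exact this
    have := is_const_of_deriv_eq_zero (fun s => (hd s).differentiableAt) (fun s => (hd s).deriv) t 0
    rw [show ((0:ℝ) : Circ) = 0 from rfl, rot_zero hij] at this
    exact this
  filter_upwards [h1, h2.eventually_nhds] with x hx1 hx2 t v
  obtain ⟨t, rfl⟩ := QuotientAddGroup.mk_surjective t
  have e : (fun x => H (rot i j (t : Circ) x)) =ᶠ[𝓝 x] H := hx2.mono fun x hx => hx t
  rw [← e.fderiv_eq]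
  have := HasFDerivAt.comp x (hx1 (t : Circ)).1.hasFDerivAt (rot i j (t : Circ)).hasFDerivAt
  have h3 := this.fderiv
  have h4 : fderiv ℝ (fun x => H (rot i j (t : Circ) x)) x v = _ := congrArg (fun L => L v) h3
  rw [h4]; rfl

/-- the sign of the reflection -/
theorem parity_raw (D : S2 S i j l η Z) {υ : (ι → ℝ) → ℝ}
    (hυ : ∀ᶠ m in 𝓝 0, η (Function.update m j 0) = m i * υ m)
    (hυj : ∀ᶠ m in 𝓝 0, υ m ≠ 0) {k : ι} (hk : k ∈ S) {c : ι} (hcj : c ≠ j) :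
    ∀ᶠ t in 𝓝[>] (0:ℝ), ∀ᶠ m in 𝓝 (t • Pi.single l 1), m i *
      (υ m * Z k (Function.update (Function.update m i (- m i)) j 0) c -
       (if c = i then 1 else -1) * υ (Function.update m i (- m i)) * Z k (Function.update m j 0) c) = 0 := by
  have hil : i ≠ l := fun h => D.hi (h ▸ D.hl)
  have hjl : j ≠ l := fun h => D.hj (h ▸ D.hl)
  have hcu : Continuous fun m : ι → ℝ => Function.update m j 0 := by fun_prop
  have hcf : Continuous fun m : ι → ℝ => Function.update m i (- m i) := by fun_prop
  have hts : Tendsto (fun m : ι → ℝ => Function.update m j 0) (𝓝 0) (𝓝 0) := by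
    have := hcu.tendsto 0; rwa [update_zero_zero] at this
  have htf : Tendsto (fun m : ι → ℝ => Function.update m i (- m i)) (𝓝 0) (𝓝 0) := by
    have := hcf.tendsto 0
    rwa [Pi.zero_apply, neg_zero, update_zero_zero] at this
  have L := fun {p : (ι → ℝ) → Prop} (h : ∀ᶠ x in 𝓝 0, p x) =>
    eventually_line (Pi.single l 1) h.eventually_nhds
  filter_upwards [D.regl, L hυ, L hυj, L (htf.eventually hυ), L (hts.eventually D.Z_S),
    L (htf.eventually (hts.eventually D.Z_S))] with t ⟨H, hG⟩ h1 h2 h3 h4 h5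
  set q : ι → ℝ := t • Pi.single l 1 with hq
  have hqi : q i = 0 := by simp [hq, hil]
  have hqj : q j = 0 := by simp [hq, hjl]
  have hqu : Function.update q j 0 = q := by rw [← hqj]; exact Function.update_eq_self j q
  have hqf : Function.update q i (- q i) = q := by
    rw [hqi, neg_zero, ← hqi]; exact Function.update_eq_self i q
  have tu : Tendsto (fun m : ι → ℝ => Function.update m j 0) (𝓝 q) (𝓝 q) := by
    have := hcu.tendsto q; rwa [hqu] at this
  filter_upwards [tu.eventually (good_rot D.hij hqi hqj hG), tu.eventually hG,
    tu.eventually (rot_small_at D.hij hqi hqj hG), h1, h2, h3, h4, h5] with m g1 g2 g3 h1 h2 h3 h4 h5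
  by_cases hm : m i = 0
  · rw [hm, zero_mul]
  set x := Function.update m j 0 with hx
  have hxj : x j = 0 := by simp [hx]
  have hxi : x i = m i := by simp [hx, D.hij]
  set R := rot i j ((Real.pi : ℝ) : Circ) with hR
  have hRx : R x = Function.update (Function.update m i (- m i)) j 0 := by
    rw [hR, half_turn D.hij x hxj, hxi, hx, Function.update_comm D.hij.symm]
  rw [← hRx] at h3 h5 ⊢
  have hRR : R (R x) = x := by
    have e : R x j = 0 := by rw [hRx]; simp
    rw [hR, half_turn D.hij _ (by rw [← hR]; exact e), ← hR, hRx, Function.update_comm D.hij, ]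
    simp [hx, D.hij]
  set v := Z k x with hv
  set v' := Z k (R x) with hv'
  have k1 : fderiv ℝ H x v = 0 := g2.2.2.1 k hk
  have k2 : fderiv ℝ H x (R v') = 0 := by
    have e1 : fderiv ℝ H (R x) v' = 0 := (g3 _).2.2.1 k hk
    have e2 := good_rot D.hij hqi hqj hG
    have e3 := g1 (- ((Real.pi : ℝ) : Circ)) (R v')
    rw [rot_neg_rot D.hij] at e3
    have e4 : rot i j (- ((Real.pi : ℝ) : Circ)) x = R x := by
      conv_lhs => rw [← hRR]
      rw [hR, rot_neg_rot D.hij]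
    rw [e4, e1] at e3
    exact e3.symm
  have hη : η x ≠ 0 := by rw [h1]; exact mul_ne_zero hm h2
  obtain ⟨a, ha⟩ := g2.2.2.2 (η (R x) • v - η x • R v') (by rw [map_sub, map_smul, map_smul, k1, k2]; simp)
    (by
      intro c hc
      have c1 : c ≠ i := fun h => D.hi (h ▸ hc)
      have c2 : c ≠ j := fun h => D.hj (h ▸ hc)
      simp only [Pi.sub_apply, Pi.smul_apply, smul_eq_mul]
      rw [hR, rot_k _ _ c1 c2, ← hR, hv, hv', h4 k hk c hc, h5 k hk c hc]
      split_ifs <;> ring) hη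
  have hc := congrFun ha c
  have hJ : JJ i j x c = 0 := by
    by_cases h : c = i
    · rw [h, JJ_i, hxj]
    · rw [JJ_k _ h hcj]
  simp only [Pi.sub_apply, Pi.smul_apply, smul_eq_mul, hJ, mul_zero] at hc
  rw [h1, h3] at hc
  simp only [Function.update_self] at hc
  by_cases h : c = i
  · subst h
    have e : R v' c = - v' c := by rw [hR, rot_i]; simp [cosK_coe, sinK_coe]
    rw [e] at hc
    simp only [if_true]
    linarith
  · have e : R v' c = v' c := by rw [hR, rot_k _ _ h hcj]
    rw [e] at hc
    simp only [if_neg h]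
    linarith

theorem parity (D : S2 S i j l η Z) {υ : (ι → ℝ) → ℝ} (hυa : AnalyticAt ℝ υ 0)
    (hυ : ∀ᶠ m in 𝓝 0, η (Function.update m j 0) = m i * υ m)
    (hυj : ∀ᶠ m in 𝓝 0, υ m ≠ 0) {k : ι} (hk : k ∈ S) {c : ι} (hcj : c ≠ j) :
    ∀ᶠ m in 𝓝 0,
      υ m * Z k (Function.update (Function.update m i (- m i)) j 0) c -
       (if c = i then 1 else -1) * υ (Function.update m i (- m i)) * Z k (Function.update m j 0) c = 0 := by
  have hfl : AnalyticAt ℝ (fun m : ι → ℝ => Function.update m i (- m i)) 0 := by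
    exact analyticAt_update_fun i analyticAt_id (analyticAt_eval i 0).neg
  have e1 : Function.update (0 : ι → ℝ) i (- (0 : ι → ℝ) i) = 0 := by
    rw [Pi.zero_apply, neg_zero, update_zero_zero]
  have e2 := update_zero_zero j
  have hZ : AnalyticAt ℝ (fun x => Z k x c) 0 := analyticAt_coord (D.Z_an k hk) c
  have a1 : AnalyticAt ℝ (fun m : ι → ℝ => Z k (Function.update m j 0) c) 0 :=
    AnalyticAt.comp' (g := fun x => Z k x c) (f := fun m : ι → ℝ => Function.update m j 0) (by rw [e2]; exact hZ) (analyticAt_update j 0 0)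
  have a2 : AnalyticAt ℝ (fun m : ι → ℝ => Z k (Function.update (Function.update m i (- m i)) j 0) c) 0 :=
    AnalyticAt.comp' (g := fun m : ι → ℝ => Z k (Function.update m j 0) c) (f := fun m : ι → ℝ => Function.update m i (- m i)) (by rw [e1]; exact a1) hfl
  have a3 : AnalyticAt ℝ (fun m : ι → ℝ => υ (Function.update m i (- m i))) 0 :=
    AnalyticAt.comp' (g := υ) (f := fun m : ι → ℝ => Function.update m i (- m i)) (by rw [e1]; exact hυa) hfl
  have a4 := (hυa.mul a2).sub ((analyticAt_const (v := (if c = i then (1:ℝ) else -1))).mul a3 |>.mul a1)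
  have p : AnalyticAt ℝ (fun m : ι → ℝ => m i) 0 := (ContinuousLinearMap.proj (R := ℝ) (φ := fun _ : ι => ℝ) i).analyticAt 0
  have h1 := continuation (p.mul a4) (frequently_line (Pi.single l 1) (parity_raw D hυ hυj hk hcj))
  refine density (g := fun m => m i) (Pi.single i 1) ?_ p ?_ ?_
  · exact (eventually_analyticAt' a4).mono fun x hx => hx.continuousAt
  · have : HasFDerivAt (fun m : ι → ℝ => m i) (ContinuousLinearMap.proj (R := ℝ) (φ := fun _ : ι => ℝ) i) 0 :=
      (ContinuousLinearMap.proj (R := ℝ) (φ := fun _ : ι => ℝ) i).hasFDerivAt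
    rw [this.fderiv]; simp
  · filter_upwards [h1] with m hm hmi
    exact (mul_eq_zero.1 hm).resolve_left hmi

end s2
end NambuLin

open scoped ContDiff
namespace NambuLin
open Metric Filter Topology

section s2
variable {ι : Type} [Fintype ι] [DecidableEq ι]
variable {S : Finset ι} {i j l : ι} {η : (ι → ℝ) → ℝ} {Z : ι → (ι → ℝ) → (ι → ℝ)}

theorem upsilon (D : S2 S i j l η Z) : ∃ υ : (ι → ℝ) → ℝ, AnalyticAt ℝ υ 0 ∧ υ 0 = 1 ∧
    ∀ᶠ m in 𝓝 0, η (Function.update m j 0) = m i * υ m := by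
  have e2 := update_zero_zero j
  have a0 : AnalyticAt ℝ (fun m : ι → ℝ => η (Function.update m j 0)) 0 :=
    AnalyticAt.comp' (g := η) (f := fun m : ι → ℝ => Function.update m j 0) (by rw [e2]; exact D.eta_an) (analyticAt_update j 0 0)
  obtain ⟨υ, hυ, h⟩ := hadamard_one a0 i
  have ht : Tendsto (fun m : ι → ℝ => Function.update (Function.update m i 0) j 0) (𝓝 0) (𝓝 0) := by
    have : Continuous (fun m : ι → ℝ => Function.update (Function.update m i 0) j 0) := by fun_prop
    have := this.tendsto 0
    rwa [update_zero_zero, update_zero_zero] at this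
  have h' : ∀ᶠ m in 𝓝 0, η (Function.update m j 0) = m i * υ m := by
    filter_upwards [h, ht.eventually D.eta_ax] with m h1 h2
    rw [h1, h2 (by simp [D.hij]) (by simp), zero_add]
  refine ⟨υ, hυ, ?_, h'⟩
  have hd : HasDerivAt (fun t : ℝ => t • (Pi.single i 1 : ι → ℝ)) (Pi.single i 1) 0 := by
    have := (hasDerivAt_id (0:ℝ)).smul_const (Pi.single i 1 : ι → ℝ)
    simpa using this
  have d1 : HasDerivAt (fun t : ℝ => η (t • (Pi.single i 1 : ι → ℝ))) 1 0 := by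
    have := HasFDerivAt.comp_hasDerivAt (l := η) (f := fun t : ℝ => t • (Pi.single i 1 : ι → ℝ)) (0:ℝ)
      (by rw [zero_smul]; exact D.eta_an.differentiableAt.hasFDerivAt) hd
    rw [D.eta_deriv] at this
    exact this
  have d2 : HasDerivAt (fun t : ℝ => υ (t • (Pi.single i 1 : ι → ℝ))) (fderiv ℝ υ 0 (Pi.single i 1)) 0 :=
    HasFDerivAt.comp_hasDerivAt (l := υ) (f := fun t : ℝ => t • (Pi.single i 1 : ι → ℝ)) (0:ℝ)
      (by rw [zero_smul]; exact hυ.differentiableAt.hasFDerivAt) hd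
  have d3 := (hasDerivAt_id (0:ℝ)).mul d2
  simp only [zero_smul, one_mul, id, zero_mul, add_zero] at d3
  have ht2 : Tendsto (fun t : ℝ => t • (Pi.single i 1 : ι → ℝ)) (𝓝 0) (𝓝 0) := by
    have := hd.continuousAt.tendsto
    rwa [zero_smul] at this
  have e : (fun t : ℝ => η (t • (Pi.single i 1 : ι → ℝ))) =ᶠ[𝓝 0] (id * fun t : ℝ => υ (t • (Pi.single i 1 : ι → ℝ))) := by
    filter_upwards [ht2.eventually h'] with t h
    have e3 : Function.update (t • (Pi.single i 1 : ι → ℝ)) j 0 = t • (Pi.single i 1 : ι → ℝ) := by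
      conv_lhs => rw [show (0:ℝ) = (t • (Pi.single i 1 : ι → ℝ)) j by simp [D.hij.symm]]
      exact Function.update_eq_self _ _
    rw [e3] at h
    rw [h]; simp
  have d4 := d1.congr_of_eventuallyEq e.symm
  have := d3.unique d4
  simpa using this

theorem A_exists (D : S2 S i j l η Z) : ∃ A : ι → ι → (ι → ℝ) → ℝ, (∀ k c, AnalyticAt ℝ (A k c) 0) ∧
    (∀ k ∈ S, ∀ c ∈ S, ∀ ν, A k c ν = if c = k then 1 else 0) ∧ (∀ k ν, A k j ν = 0) ∧
    ∀ᶠ m in 𝓝 0, ∀ k ∈ S, ∀ c, c ≠ j → η (Function.update m j 0) * A k c (Function.update m i (m i ^ 2 / 2)) =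
      - ((if c = i then m i else 1) * Z k (Function.update m j 0) c) := by
  obtain ⟨υ, hυ, hυ0, hηυ⟩ := upsilon D
  have hυn : ∀ᶠ m in 𝓝 0, υ m ≠ 0 := hυ.continuousAt.eventually_ne (by rw [hυ0]; exact one_ne_zero)
  have e2 := update_zero_zero j
  let f : ι → ι → (ι → ℝ) → ℝ := fun k c m => - Z k (Function.update m j 0) c / υ m
  have hf : ∀ k ∈ S, ∀ c, AnalyticAt ℝ (f k c) 0 := by
    intro k hk c
    have a1 : AnalyticAt ℝ (fun m : ι → ℝ => Z k (Function.update m j 0) c) 0 :=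
      AnalyticAt.comp' (g := fun x => Z k x c) (f := fun m : ι → ℝ => Function.update m j 0)
        (by rw [e2]; exact analyticAt_coord (D.Z_an k hk) c) (analyticAt_update j 0 0)
    exact a1.neg.div hυ (by rw [hυ0]; exact one_ne_zero)
  have htf : Tendsto (fun m : ι → ℝ => Function.update m i (- m i)) (𝓝 0) (𝓝 0) := by
    have hcf : Continuous fun m : ι → ℝ => Function.update m i (- m i) := by fun_prop
    have := hcf.tendsto 0
    rwa [Pi.zero_apply, neg_zero, update_zero_zero] at this
  have hpar : ∀ k ∈ S, ∀ c, c ≠ j → ∀ᶠ m in 𝓝 0, f k c (Function.update m i (- m i)) = (if c = i then 1 else -1) * f k c m := by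
    intro k hk c hc
    filter_upwards [parity D hυ hηυ hυn hk hc, hυn, htf.eventually hυn] with m h h1 h2
    simp only [f]
    rw [div_eq_iff h2]
    field_simp
    linarith
  have hex : ∀ k c, ∃ a : (ι → ℝ) → ℝ, AnalyticAt ℝ a 0 ∧ (k ∈ S → c ≠ j → ∀ᶠ m in 𝓝 0,
      f k c m = (if c = i then 1 else m i) * a (Function.update m i (m i ^ 2))) := by
    intro k c
    by_cases hk : k ∈ S
    swap
    · exact ⟨fun _ => 0, analyticAt_const, fun h => absurd h hk⟩
    by_cases hc : c = j
    · exact ⟨fun _ => 0, analyticAt_const, fun _ h => absurd hc h⟩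
    obtain ⟨h0, h1, a0, a1, he⟩ := even_odd (hf k hk c) i
    by_cases hci : c = i
    · refine ⟨h0, a0, fun _ _ => ?_⟩
      filter_upwards [he, htf.eventually he, hpar k hk c hc] with m e1 e2 e3
      simp only [Function.update_self, Function.update_idem, neg_sq] at e2
      rw [if_pos hci] at e3 ⊢
      rw [e1, e2] at e3
      rw [e1]; linarith
    · refine ⟨h1, a1, fun _ _ => ?_⟩
      filter_upwards [he, htf.eventually he, hpar k hk c hc] with m e1 e2 e3
      simp only [Function.update_self, Function.update_idem, neg_sq] at e2
      rw [if_neg hci] at e3 ⊢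
      rw [e1, e2] at e3
      rw [e1]; linarith
  choose a ha hfa using hex
  refine ⟨fun k c ν => if c ∈ S then (if c = k then 1 else 0) else if c = j then 0 else a k c (Function.update ν i (2 * ν i)), ?_, ?_, ?_, ?_⟩
  · intro k c
    by_cases hc : c ∈ S
    · simp only [if_pos hc]; exact analyticAt_const
    · simp only [if_neg hc]
      by_cases hcj : c = j
      · simp only [if_pos hcj]; exact analyticAt_const
      · simp only [if_neg hcj]
        refine AnalyticAt.comp' (g := a k c) (f := fun ν : ι → ℝ => Function.update ν i (2 * ν i)) ?_
          (analyticAt_update_fun i analyticAt_id (analyticAt_const.mul (analyticAt_eval i 0)))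
        rw [Pi.zero_apply, mul_zero, update_zero_zero]
        exact ha k c
  · intro k hk c hc ν
    simp only [if_pos hc]
  · intro k ν
    simp only [if_neg D.hj, if_true]
  · have hts : Tendsto (fun m : ι → ℝ => Function.update m j 0) (𝓝 0) (𝓝 0) := by
      have hcu : Continuous fun m : ι → ℝ => Function.update m j 0 := by fun_prop
      have := hcu.tendsto 0; rwa [update_zero_zero] at this
    have hall : ∀ᶠ m in 𝓝 0, ∀ k c, k ∈ S → c ≠ j → f k c m = (if c = i then 1 else m i) * a k c (Function.update m i (m i ^ 2)) := by
      rw [Filter.eventually_all]; intro k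
      rw [Filter.eventually_all]; intro c
      by_cases hk : k ∈ S
      swap
      · exact Eventually.of_forall fun m h => absurd h hk
      by_cases hc : c = j
      · exact Eventually.of_forall fun m _ h => absurd hc h
      filter_upwards [hfa k c hk hc] with m h _ _ using h
    filter_upwards [hall, hts.eventually D.Z_S, hηυ, hυn] with m h1 h2 h3 h4 k hk c hc
    by_cases hcS : c ∈ S
    · simp only [if_pos hcS]
      have hci : c ≠ i := fun h => D.hi (h ▸ hcS)
      rw [h2 k hk c hcS, if_neg hci]
      split_ifs <;> ring
    · simp only [if_neg hcS, if_neg hc, Function.update_self, Function.update_idem]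
      have := h1 k c hk hc
      rw [show 2 * (m i ^ 2 / 2) = m i ^ 2 by ring]
      simp only [f] at this
      rw [div_eq_iff h4] at this
      rw [h3]
      by_cases hci : c = i
      · simp only [if_pos hci] at this ⊢
        linear_combination (- m i) * this
      · simp only [if_neg hci] at this ⊢
        linear_combination (- 1) * this

end s2
end NambuLin

open scoped ContDiff
namespace NambuLin
open Metric Filter Topology

section s2
variable {ι : Type} [Fintype ι] [DecidableEq ι]
variable {S : Finset ι} {i j l : ι} {η : (ι → ℝ) → ℝ} {Z : ι → (ι → ℝ) → (ι → ℝ)}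

noncomputable def sqm (i j : ι) (ν : ι → ℝ) : ι → ℝ := Function.update (Function.update ν j 0) i (√(2 * ν i))

noncomputable def sqmL (i j : ι) (ν : ι → ℝ) : (ι → ℝ) →L[ℝ] (ι → ℝ) :=
  ContinuousLinearMap.pi fun c => if c = i then (√(2 * ν i))⁻¹ • ContinuousLinearMap.proj i
    else if c = j then 0 else ContinuousLinearMap.proj c

theorem sqmL_apply (ν u : ι → ℝ) (c : ι) : sqmL i j ν u c =
    if c = i then (√(2 * ν i))⁻¹ * u i else if c = j then 0 else u c := by
  simp only [sqmL, ContinuousLinearMap.pi_apply]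
  split_ifs <;> simp

theorem sqm_hasFDerivAt {ν : ι → ℝ} (h : 0 < ν i) : HasFDerivAt (sqm i j) (sqmL i j ν) ν := by
  rw [hasFDerivAt_pi']
  intro c
  have hp : ∀ c, HasFDerivAt (fun m : ι → ℝ => m c) (ContinuousLinearMap.proj (R := ℝ) (φ := fun _ : ι => ℝ) c) ν :=
    fun c => (ContinuousLinearMap.proj (R := ℝ) (φ := fun _ : ι => ℝ) c).hasFDerivAt
  by_cases hi : c = i
  · subst hi
    have h1 := ((hp c).const_mul 2).sqrt (by positivity)
    have e1 : (fun x => sqm c j x c) = fun x => √(2 * x c) := by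
      ext x; simp [sqm]
    show HasFDerivAt (fun x => sqm c j x c) _ _
    rw [e1]
    refine h1.congr_fderiv (ContinuousLinearMap.ext fun u => ?_)
    show _ = sqmL c j ν u c
    rw [sqmL_apply, if_pos rfl]
    simp only [ContinuousLinearMap.smul_apply, ContinuousLinearMap.proj_apply, smul_eq_mul]
    field_simp
  · by_cases hj : c = j
    · subst hj
      have e1 : (fun x => sqm i c x c) = fun x => 0 := by
        ext x; simp [sqm, hi]
      show HasFDerivAt (fun x => sqm i c x c) _ _
      rw [e1]
      refine (hasFDerivAt_const (0:ℝ) ν).congr_fderiv (ContinuousLinearMap.ext fun u => ?_)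
      show _ = sqmL i c ν u c
      rw [sqmL_apply, if_neg hi, if_pos rfl]; rfl
    · have e1 : (fun x => sqm i j x c) = fun x => x c := by
        ext x; simp [sqm, hi, hj]
      show HasFDerivAt (fun x => sqm i j x c) _ _
      rw [e1]
      refine (hp c).congr_fderiv (ContinuousLinearMap.ext fun u => ?_)
      show _ = sqmL i j ν u c
      rw [sqmL_apply, if_neg hi, if_neg hj]; rfl

def RelA (S : Finset ι) (i j : ι) (η : (ι → ℝ) → ℝ) (Z : ι → (ι → ℝ) → (ι → ℝ))
    (A : ι → ι → (ι → ℝ) → ℝ) (m : ι → ℝ) : Prop :=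
  ∀ k ∈ S, ∀ c, c ≠ j → η (Function.update m j 0) * A k c (Function.update m i (m i ^ 2 / 2)) =
      - ((if c = i then m i else 1) * Z k (Function.update m j 0) c)

def KerA (S : Finset ι) (j : ι) (A : ι → ι → (ι → ℝ) → ℝ) (F : (ι → ℝ) → (ι → ℝ)) (ν : ι → ℝ) : Prop :=
  DifferentiableAt ℝ F ν ∧ (∀ k ∈ S, fderiv ℝ F ν (fun c => A k c ν) = 0) ∧
    ∀ u, u j = 0 → fderiv ℝ F ν u = 0 → ∀ c, u c = ∑ k ∈ S, u k * A k c ν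

theorem sqm_at {t : ℝ} (ht : 0 < t) (hij : i ≠ j) :
    sqm i j ((t ^ 2 / 2) • (Pi.single i 1 : ι → ℝ)) = t • (Pi.single i 1 : ι → ℝ) := by
  ext c
  by_cases hi : c = i
  · subst hi
    simp [sqm]
    rw [Real.sqrt_sq ht.le]; field_simp
  · by_cases hj : c = j
    · subst hj; simp [sqm, hi]
    · simp [sqm, hi, hj]

theorem kerA_of_good (hij : i ≠ j) (hi : i ∉ S) (hj : j ∉ S) {A : ι → ι → (ι → ℝ) → ℝ}
    (hAj : ∀ k ν, A k j ν = 0)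
    {t : ℝ} (ht : 0 < t) {H : (ι → ℝ) → (ι → ℝ)} (hG : Good S i j η Z H (t • Pi.single i 1))
    (hη : ∀ᶠ x in 𝓝 (t • (Pi.single i 1 : ι → ℝ)), η x ≠ 0)
    (hZ : ∀ᶠ x in 𝓝 (t • (Pi.single i 1 : ι → ℝ)), ∀ k ∈ S, ∀ c ∈ S, Z k x c = if c = k then - η x else 0)
    (hA : ∀ᶠ m in 𝓝 (t • (Pi.single i 1 : ι → ℝ)), RelA S i j η Z A m) :
    ∀ᶠ ν in 𝓝 ((t ^ 2 / 2) • (Pi.single i 1 : ι → ℝ)), KerA S j A (fun ν => H (sqm i j ν)) ν := by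
  set ν₀ : ι → ℝ := (t ^ 2 / 2) • Pi.single i 1 with hν₀
  set x₀ : ι → ℝ := t • Pi.single i 1 with hx₀
  have hν₀i : 0 < ν₀ i := by simp [hν₀]; positivity
  have hpos : ∀ᶠ ν in 𝓝 ν₀, 0 < ν i := (continuous_apply i).continuousAt.eventually_const_lt hν₀i
  have t1 : Tendsto (sqm i j) (𝓝 ν₀) (𝓝 x₀) := by
    have := (sqm_hasFDerivAt (j := j) hν₀i).continuousAt.tendsto
    rwa [sqm_at ht hij] at this
  have t2 : Tendsto (fun ν : ι → ℝ => Function.update ν i (√(2 * ν i))) (𝓝 ν₀) (𝓝 x₀) := by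
    have : Continuous (fun ν : ι → ℝ => Function.update ν i (√(2 * ν i))) := by fun_prop
    have := this.tendsto ν₀
    have e : Function.update ν₀ i (√(2 * ν₀ i)) = x₀ := by
      ext c
      by_cases h : c = i
      · subst h
        simp [hν₀, hx₀]
        rw [Real.sqrt_sq ht.le]; field_simp
      · simp [h, hν₀, hx₀]
    rwa [e] at this
  filter_upwards [hpos, t1.eventually hG, t1.eventually hη, t1.eventually hZ, t2.eventually hA] with ν hp ⟨g1, g2, g3, g4⟩ hη hZ hA
  have hd := g1.hasFDerivAt.comp ν (sqm_hasFDerivAt (j := j) hp)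
  have hfd : fderiv ℝ (fun ν => H (sqm i j ν)) ν = fderiv ℝ H (sqm i j ν) ∘L sqmL i j ν := hd.fderiv
  set m := √(2 * ν i) with hm
  have hm0 : m ≠ 0 := by positivity
  set x := sqm i j ν with hx
  have hxi : x i = m := by simp [hx, sqm, hm]
  have hxj : x j = 0 := by simp [hx, sqm, hij.symm]
  have hA' : ∀ k ∈ S, ∀ c, c ≠ j → η x * A k c ν = - ((if c = i then m else 1) * Z k x c) := by
    intro k hk c hc
    have := hA k hk c hc
    have e1 : Function.update (Function.update ν i m) j 0 = x := by
      rw [Function.update_comm hij]; rfl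
    have e2 : Function.update (Function.update ν i m) i ((Function.update ν i m) i ^ 2 / 2) = ν := by
      rw [Function.update_idem, Function.update_self, hm, Real.sq_sqrt (by positivity)]
      rw [show 2 * ν i / 2 = ν i by ring, Function.update_eq_self]
    rw [e1, e2, Function.update_self] at this
    exact this
  refine ⟨hd.differentiableAt, ?_, ?_⟩
  · intro k hk
    rw [hfd]
    show fderiv ℝ H x (sqmL i j ν fun c => A k c ν) = 0
    have e : η x • (sqmL i j ν fun c => A k c ν) = - Z k x + (-(Z k x j) / m) • JJ i j x := by
      ext c
      simp only [Pi.smul_apply, Pi.add_apply, Pi.neg_apply, smul_eq_mul, sqmL_apply]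
      by_cases h1 : c = i
      · subst h1
        rw [if_pos rfl, JJ_i, hxj]
        have := hA' k hk c hij
        rw [if_pos rfl] at this
        rw [← hm]
        field_simp
        linarith
      · by_cases h2 : c = j
        · subst h2
          rw [if_neg h1, if_pos rfl, JJ_j hij, hxi]
          field_simp; ring
        · rw [if_neg h1, if_neg h2, JJ_k _ h1 h2]
          have := hA' k hk c h2
          rw [if_neg h1] at this
          linarith
    have h2 := congrArg (fderiv ℝ H x) e
    rw [map_smul, map_add, map_neg, map_smul, g3 k hk, g2, neg_zero, smul_zero, add_zero] at h2
    exact (smul_eq_zero.1 h2).resolve_left hη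
  · intro u huj hu c
    rw [hfd] at hu
    have hu' : fderiv ℝ H x (sqmL i j ν u) = 0 := hu
    obtain ⟨b, hb⟩ := g4 (η x • sqmL i j ν u + ∑ k ∈ S, u k • Z k x)
      (by
        rw [map_add, map_smul, hu', map_sum, smul_zero, zero_add]
        exact Finset.sum_eq_zero fun k hk => by rw [map_smul, g3 k hk, smul_zero])
      (by
        intro c hc
        have h1 : c ≠ i := fun h => hi (h ▸ hc)
        have h2 : c ≠ j := fun h => hj (h ▸ hc)
        simp only [Pi.add_apply, Pi.smul_apply, Finset.sum_apply, smul_eq_mul, sqmL_apply, if_neg h1, if_neg h2]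
        rw [Finset.sum_eq_single c]
        · rw [hZ c hc c hc, if_pos rfl]; ring
        · intro k hk hkc
          rw [hZ k hk c hc, if_neg hkc.symm, mul_zero]
        · exact fun h => absurd hc h) hη
    by_cases h2 : c = j
    · subst h2
      rw [huj]; simp [hAj]
    have hc := congrFun hb c
    have hJ : JJ i j x c = 0 := by
      by_cases h1 : c = i
      · rw [h1, JJ_i, hxj]
      · rw [JJ_k _ h1 h2]
    simp only [Pi.add_apply, Pi.smul_apply, Finset.sum_apply, smul_eq_mul, sqmL_apply, hJ, mul_zero, if_neg h2] at hc
    have key : η x * ∑ k ∈ S, u k * A k c ν = - ((if c = i then m else 1) * ∑ k ∈ S, u k * Z k x c) := by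
      rw [Finset.mul_sum, Finset.mul_sum, ← Finset.sum_neg_distrib]
      refine Finset.sum_congr rfl fun k hk => ?_
      have := hA' k hk c h2
      linear_combination u k * this
    apply mul_left_cancel₀ hη
    rw [key]
    by_cases h1 : c = i
    · simp only [if_pos h1, ← hm] at hc ⊢
      field_simp at hc
      rw [h1] at hc ⊢
      linarith
    · simp only [if_neg h1] at hc ⊢
      linarith

end s2
end NambuLin

open scoped ContDiff
namespace NambuLin
open Metric Filter Topology

section s2
variable {ι : Type} [Fintype ι] [DecidableEq ι]
variable {S : Finset ι} {i j l : ι} {η : (ι → ℝ) → ℝ} {Z : ι → (ι → ℝ) → (ι → ℝ)}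

theorem analyticAt_clm_apply {E F G : Type*} [NormedAddCommGroup E] [NormedSpace ℝ E] [NormedAddCommGroup F]
    [NormedSpace ℝ F] [NormedAddCommGroup G] [NormedSpace ℝ G] {L : E → F →L[ℝ] G} {v : E → F} {x : E}
    (hL : AnalyticAt ℝ L x) (hv : AnalyticAt ℝ v x) : AnalyticAt ℝ (fun x => L x (v x)) x := by
  have h := (ContinuousLinearMap.id ℝ (F →L[ℝ] G)).analyticAt_bilinear (L x, v x)
  exact AnalyticAt.comp' (g := fun z : (F →L[ℝ] G) × F => z.1 z.2) (f := fun x => (L x, v x)) h (hL.prod hv)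

theorem const_Icc {F : Type*} [NormedAddCommGroup F] [NormedSpace ℝ F] {f : ℝ → F}
    (h : ∀ t ∈ Set.Icc (0:ℝ) 1, HasDerivAt f 0 t) : f 1 = f 0 :=
  constant_of_has_deriv_right_zero (fun t ht => (h t ht).continuousAt.continuousWithinAt)
    (fun t ht => (h t ⟨ht.1, ht.2.le⟩).hasDerivWithinAt) 1 ⟨zero_le_one, le_rfl⟩

theorem eta_ne (D : S2 S i j l η Z) : ∀ᶠ t in 𝓝[>] (0:ℝ), ∀ᶠ x in 𝓝 (t • (Pi.single i 1 : ι → ℝ)), η x ≠ 0 := by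
  obtain ⟨υ, hυ, hυ0, hηυ⟩ := upsilon D
  have hυn : ∀ᶠ m in 𝓝 0, υ m ≠ 0 := hυ.continuousAt.eventually_ne (by rw [hυ0]; exact one_ne_zero)
  filter_upwards [eventually_line (Pi.single i 1) hηυ, eventually_line (Pi.single i 1) hυn,
    eventually_line (Pi.single i 1) (eventually_analyticAt' D.eta_an), self_mem_nhdsWithin] with t h1 h2 h3 ht
  refine h3.continuousAt.eventually_ne ?_
  have e3 : Function.update (t • (Pi.single i 1 : ι → ℝ)) j 0 = t • (Pi.single i 1 : ι → ℝ) := by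
    conv_lhs => rw [show (0:ℝ) = (t • (Pi.single i 1 : ι → ℝ)) j by simp [D.hij.symm]]
    exact Function.update_eq_self _ _
  rw [e3] at h1
  rw [h1]
  refine mul_ne_zero ?_ h2
  simpa using (ne_of_gt ht : t ≠ 0)

theorem c_exists (D : S2 S i j l η Z) {A : ι → ι → (ι → ℝ) → ℝ} (hA : ∀ k c, AnalyticAt ℝ (A k c) 0)
    (hAS : ∀ k ∈ S, ∀ c ∈ S, ∀ ν, A k c ν = if c = k then 1 else 0) (hAj : ∀ k ν, A k j ν = 0)
    (hR : ∀ᶠ m in 𝓝 0, RelA S i j η Z A m) :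
    ∃ c : (ι → ℝ) → (ι → ℝ), AnalyticAt ℝ c 0 ∧ c 0 = 0 ∧
      (∀ᶠ m in 𝓝 0, (∀ k ∈ S, m k = 0) → c m = m) ∧
      ∀ᶠ m in 𝓝 0, ∀ k ∈ S, fderiv ℝ c m (fun a => A k a m) = 0 := by
  obtain ⟨u, hu, hu0, hfix, hM⟩ := flow_exists S hA
  let c : (ι → ℝ) → (ι → ℝ) := fun m a => u m a 1
  have hc : AnalyticAt ℝ c 0 := by
    rw [analyticAt_pi_iff]
    intro a
    let L : (ι → C(unitInterval, ℝ)) →L[ℝ] ℝ :=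
      (ContinuousMap.evalCLM ℝ (1 : unitInterval)) ∘L (ContinuousLinearMap.proj (R := ℝ) (φ := fun _ : ι => C(unitInterval, ℝ)) a)
    exact AnalyticAt.comp (g := L) (f := u) (L.analyticAt _) hu
  have hcS : ∀ᶠ m in 𝓝 0, (∀ k ∈ S, c m k = 0) ∧ c m j = m j := by
    filter_upwards [hM] with m ⟨M, hM0, hMu, hMd⟩
    constructor
    · intro k hk
      have := const_Icc (f := fun t => M t k + t * m k) (by
        intro t ht
        have h1 := (hasDerivAt_pi.1 (hMd t ht) k).add ((hasDerivAt_id t).mul_const (m k))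
        have e : -∑ k' ∈ S, m k' * A k' k (M t) + 1 * m k = 0 := by
          rw [Finset.sum_eq_single k]
          · rw [hAS k hk k hk, if_pos rfl]; ring
          · intro k' hk' hne
            rw [hAS k' hk' k hk, if_neg hne.symm, mul_zero]
          · exact fun h => absurd hk h
        rw [e] at h1
        exact h1)
      have e := hMu 1 k
      simp only [hM0, zero_mul, add_zero, one_mul] at this
      rw [show ((1 : unitInterval) : ℝ) = 1 from rfl] at e
      show u m k 1 = 0
      rw [← e]; linarith
    · have := const_Icc (f := fun t => M t j) (by
        intro t ht
        have h1 := hasDerivAt_pi.1 (hMd t ht) j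
        simp only [hAj, mul_zero, Finset.sum_const_zero, neg_zero] at h1
        exact h1)
      have e := hMu 1 j
      rw [show ((1 : unitInterval) : ℝ) = 1 from rfl] at e
      show u m j 1 = m j
      rw [← e, this, hM0]
  refine ⟨c, hc, ?_, ?_, ?_⟩
  · ext a; show u 0 a 1 = 0; rw [hu0]; rfl
  · filter_upwards [hfix] with m h h0
    ext a; exact h h0 a 1
  rw [Filter.eventually_all_finset]
  intro k hk
  refine continuation (f := fun m => fderiv ℝ c m (fun a => A k a m)) ?_ ?_
  · exact analyticAt_clm_apply hc.fderiv (analyticAt_pi_iff.2 fun a => hA k a)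
  have ht : Tendsto (fun t : ℝ => (t ^ 2 / 2) • (Pi.single i 1 : ι → ℝ)) (𝓝[>] 0) (𝓝 0) := by
    have : Continuous (fun t : ℝ => (t ^ 2 / 2) • (Pi.single i 1 : ι → ℝ)) := by fun_prop
    have := (this.tendsto 0).mono_left (nhdsWithin_le_nhds (s := Set.Ioi 0))
    simpa using this
  refine ht.frequently (Eventually.frequently ?_)
  filter_upwards [self_mem_nhdsWithin, D.regi, eta_ne D, eventually_line (Pi.single i 1) hR.eventually_nhds,
    eventually_line (Pi.single i 1) D.Z_S.eventually_nhds, ht.eventually hfix,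
    ht.eventually hM.eventually_nhds, ht.eventually hcS.eventually_nhds, ht.eventually (eventually_analyticAt' hu),
    ht.eventually (eventually_analyticAt' hc)]
    with t ht ⟨H, hG⟩ hη hR hZ hfix hM hcS hu hc
  have hK := kerA_of_good D.hij D.hi D.hj hAj ht hG hη hZ hR
  set ν₀ : ι → ℝ := (t ^ 2 / 2) • Pi.single i 1 with hν₀
  set F : (ι → ℝ) → (ι → ℝ) := fun ν => H (sqm i j ν) with hF
  have hν₀S : ∀ k ∈ S, ν₀ k = 0 := by
    intro k hk
    have : k ≠ i := fun h => D.hi (h ▸ hk)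
    simp [hν₀, this]
  have hfix' := hfix hν₀S
  obtain ⟨δ, hδ, hball⟩ := Metric.eventually_nhds_iff.1 hK
  have hnear : ∀ᶠ ν in 𝓝 ν₀, ∀ s : unitInterval, KerA S j A F (fun a => u ν a s) := by
    have := (Metric.tendsto_nhds.1 hu.continuousAt.tendsto) δ hδ
    filter_upwards [this] with ν hν s
    apply hball
    rw [dist_pi_lt_iff hδ]
    intro a
    rw [← hfix' a s]
    calc dist (u ν a s) (u ν₀ a s) ≤ dist (u ν a) (u ν₀ a) := ContinuousMap.dist_apply_le_dist _
      _ ≤ dist (u ν) (u ν₀) := dist_le_pi_dist _ _ _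
      _ < δ := hν
  have hconst : ∀ᶠ ν in 𝓝 ν₀, F (c ν) = F ν := by
    filter_upwards [hnear, hM] with ν hn ⟨M, hM0, hMu, hMd⟩
    have hMs : ∀ s (hs : s ∈ Set.Icc (0:ℝ) 1), M s = fun a => u ν a ⟨s, hs⟩ := by
      intro s hs
      ext a
      exact hMu ⟨s, hs⟩ a
    have := const_Icc (f := fun s => F (M s)) (by
      intro s hs
      have hk := hn ⟨s, hs⟩
      rw [← hMs s hs] at hk
      have h1 := HasFDerivAt.comp_hasDerivAt (l := F) (f := M) s hk.1.hasFDerivAt (hMd s hs)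
      have e : (fun c => - ∑ k ∈ S, ν k * A k c (M s)) = - ∑ k ∈ S, ν k • (fun c => A k c (M s)) := by
        ext a; simp [Finset.sum_apply]
      rw [e, map_neg, map_sum, Finset.sum_eq_zero, neg_zero] at h1
      · exact h1
      · intro k hk'
        rw [map_smul, hk.2.1 k hk', smul_zero])
    rw [show M 1 = c ν from hMs 1 ⟨zero_le_one, le_rfl⟩, hM0] at this
    exact this
  filter_upwards [hconst.eventually_nhds, hnear, hcS.eventually_nhds, hK, eventually_analyticAt' hc] with ν h1 h2 h3 h4 h5
  have hK1 : KerA S j A F (c ν) := h2 1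
  have hcd := h5.differentiableAt
  set w := fderiv ℝ c ν (fun a => A k a ν) with hw
  have hwF : fderiv ℝ F (c ν) w = 0 := by
    have e1 : (fun ν => F (c ν)) =ᶠ[𝓝 ν] F := h1
    have e2 : fderiv ℝ (fun ν => F (c ν)) ν = fderiv ℝ F (c ν) ∘L fderiv ℝ c ν :=
      (hK1.1.hasFDerivAt.comp ν hcd.hasFDerivAt).fderiv
    rw [e1.fderiv_eq] at e2
    have := congrArg (fun L => L (fun a => A k a ν)) e2
    rw [show (fderiv ℝ F ν) (fun a => A k a ν) = 0 from h4.2.1 k hk] at this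
    exact this.symm
  have hwj : w j = 0 := by
    rw [hw, ← fderiv_coord hcd]
    have e1 : (fun x => c x j) =ᶠ[𝓝 ν] fun x => x j := h3.mono fun x hx => hx.2
    rw [e1.fderiv_eq]
    have : HasFDerivAt (fun m : ι → ℝ => m j) (ContinuousLinearMap.proj (R := ℝ) (φ := fun _ : ι => ℝ) j) ν :=
      (ContinuousLinearMap.proj (R := ℝ) (φ := fun _ : ι => ℝ) j).hasFDerivAt
    rw [this.fderiv]
    exact hAj k ν
  have hwS : ∀ a ∈ S, w a = 0 := by
    intro a ha
    rw [hw, ← fderiv_coord hcd]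
    have e1 : (fun x => c x a) =ᶠ[𝓝 ν] fun x => 0 := h3.mono fun x hx => hx.1 a ha
    rw [e1.fderiv_eq]; simp
  ext a
  show w a = 0
  rw [hK1.2.2 w hwj hwF a]
  exact Finset.sum_eq_zero fun k hk => by rw [hwS k hk, zero_mul]

end s2
end NambuLin

open scoped ContDiff
namespace NambuLin
open Metric Filter Topology

section s2
variable {ι : Type} [Fintype ι] [DecidableEq ι]
variable {S : Finset ι} {i j l : ι} {η : (ι → ℝ) → ℝ} {Z : ι → (ι → ℝ) → (ι → ℝ)}

noncomputable def kap (i j : ι) (x : ι → ℝ) : ι → ℝ :=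
  Function.update (Function.update x j 0) i ((x i ^ 2 + x j ^ 2) / 2)

theorem kap_an (i j : ι) (x : ι → ℝ) : AnalyticAt ℝ (kap i j) x :=
  analyticAt_update_fun i (analyticAt_update j 0 x)
    ((((analyticAt_eval i x).pow 2).add ((analyticAt_eval j x).pow 2)).div_const)

theorem kap_zero (i j : ι) : kap i j 0 = 0 := by
  simp only [kap, Pi.zero_apply]
  rw [update_zero_zero]
  norm_num [update_zero_zero]

theorem kap_at (hij : i ≠ j) (t : ℝ) :
    kap i j (t • (Pi.single i 1 : ι → ℝ)) = (t ^ 2 / 2) • (Pi.single i 1 : ι → ℝ) := by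
  ext c
  by_cases hi : c = i
  · subst hi; simp [kap, hij.symm]
  · by_cases hj : c = j
    · subst hj; simp [kap, hi]
    · simp [kap, hi, hj]

theorem continuous_rot2 : Continuous (fun z : ℝ × (ι → ℝ) => rot i j (z.1 : Circ) z.2) := by
  have h1 : Continuous (fun z : ℝ × (ι → ℝ) => ((z.1 : Circ), z.2)) :=
    ((AddCircle.continuous_mk' (2 * Real.pi)).comp continuous_fst).prodMk continuous_snd
  exact Continuous.comp (f := fun z : ℝ × (ι → ℝ) => ((z.1 : Circ), z.2)) continuous_rot h1

theorem rot_arctan (hij : i ≠ j) {x : ι → ℝ} (hx : 0 < x i) :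
    rot i j ((Real.arctan (x j / x i) : ℝ) : Circ) x = sqm i j (kap i j x) := by
  have hq : √(1 + (x j / x i) ^ 2) = √(x i ^ 2 + x j ^ 2) / x i := by
    rw [show 1 + (x j / x i) ^ 2 = (x i ^ 2 + x j ^ 2) / x i ^ 2 by field_simp, Real.sqrt_div (by positivity), Real.sqrt_sq hx.le]
  have hp : 0 < √(x i ^ 2 + x j ^ 2) := by positivity
  have hs : √(x i ^ 2 + x j ^ 2) ^ 2 = x i ^ 2 + x j ^ 2 := Real.sq_sqrt (by positivity)
  ext c
  by_cases h1 : c = i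
  · subst h1
    rw [rot_i, cosK_coe, sinK_coe, Real.cos_arctan, Real.sin_arctan, hq]
    simp only [sqm, kap, Function.update_self]
    rw [show 2 * ((x c ^ 2 + x j ^ 2) / 2) = x c ^ 2 + x j ^ 2 by ring]
    field_simp
    linarith
  · by_cases h2 : c = j
    · subst h2
      rw [rot_j hij, cosK_coe, sinK_coe, Real.cos_arctan, Real.sin_arctan, hq]
      simp only [sqm, kap]
      rw [Function.update_of_ne h1, Function.update_self]
      field_simp
      ring
    · rw [rot_k _ _ h1 h2]
      simp [sqm, kap, h1, h2]

theorem H_kap (hij : i ≠ j) {t : ℝ} (ht : 0 < t) {H : (ι → ℝ) → (ι → ℝ)}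
    (hG : Good S i j η Z H (t • Pi.single i 1)) :
    ∀ᶠ x in 𝓝 (t • (Pi.single i 1 : ι → ℝ)), H (sqm i j (kap i j x)) = H x := by
  set x₀ : ι → ℝ := t • Pi.single i 1 with hx₀
  have hx₀i : 0 < x₀ i := by simp [hx₀]; exact ht
  have hx₀j : x₀ j = 0 := by simp [hx₀, hij.symm]
  have hpos : ∀ᶠ x in 𝓝 x₀, 0 < x i := (continuous_apply i).continuousAt.eventually_const_lt hx₀i
  have h1 : Tendsto (fun z : ℝ × (ι → ℝ) => rot i j (z.1 : Circ) z.2) (𝓝 (0, x₀)) (𝓝 x₀) := by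
    have := continuous_rot2 (i := i) (j := j) |>.tendsto ((0:ℝ), x₀)
    rwa [show ((0:ℝ) : Circ) = 0 from rfl, rot_zero hij] at this
  obtain ⟨δ, hδ, hb⟩ := Metric.eventually_nhds_iff.1 (h1.eventually hG)
  have hat : ContinuousAt (fun x : ι → ℝ => Real.arctan (x j / x i)) x₀ :=
    Real.continuous_arctan.continuousAt.comp ((continuous_apply j).continuousAt.div (continuous_apply i).continuousAt hx₀i.ne')
  have hat' : ∀ᶠ x in 𝓝 x₀, |Real.arctan (x j / x i)| < δ := by
    refine hat.abs.eventually_lt continuousAt_const ?_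
    rw [hx₀j]; simpa using hδ
  filter_upwards [hpos, hat', Metric.ball_mem_nhds x₀ hδ] with x hx ha hxb
  rw [← rot_arctan hij hx]
  set s := Real.arctan (x j / x i) with hs
  have := const_Icc (f := fun τ : ℝ => H (rot i j ((τ * s : ℝ) : Circ) x)) (by
    intro τ hτ
    have hb' := hb (y := (τ * s, x)) (by
      rw [Prod.dist_eq, max_lt_iff]
      refine ⟨?_, hxb⟩
      rw [Real.dist_eq, sub_zero, abs_mul, abs_of_nonneg hτ.1]
      exact lt_of_le_of_lt (mul_le_of_le_one_left (abs_nonneg _) hτ.2) ha)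
    obtain ⟨a, b, -⟩ := hb'
    have d1 := rot_hasDerivAt hij (hasDerivAt_const (τ * s) x)
    have d2 := HasDerivAt.scomp τ d1 ((hasDerivAt_id τ).mul_const s)
    have d3 := HasFDerivAt.comp_hasDerivAt (l := H) (f := fun τ : ℝ => rot i j ((τ * s : ℝ) : Circ) x) τ a.hasFDerivAt d2
    rw [map_zero, add_zero, map_smul] at d3
    simp only [id] at d3
    rw [b, smul_zero] at d3
    exact d3)
  simp only [one_mul, zero_mul] at this
  rw [show ((0:ℝ) : Circ) = 0 from rfl, rot_zero hij] at this
  exact this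

theorem S2.final (D : S2 S i j l η Z) : ∃ C : (ι → ℝ) → (ι → ℝ), AnalyticAt ℝ C 0 ∧ C 0 = 0 ∧
    (∀ᶠ x in 𝓝 0, (∀ k ∈ S, x k = 0) → C x = kap i j x) ∧
    ∀ᶠ t in 𝓝[>] (0:ℝ), ∀ H, Good S i j η Z H (t • Pi.single i 1) →
      ∀ᶠ x in 𝓝 (t • (Pi.single i 1 : ι → ℝ)), ∀ v, fderiv ℝ H x v = 0 → fderiv ℝ C x v = 0 := by
  obtain ⟨A, hA, hAS, hAj, hR⟩ := A_exists D
  obtain ⟨c, hc, hc0, hcfix, hcA⟩ := c_exists D hA hAS hAj hR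
  have tk : Tendsto (kap i j) (𝓝 0) (𝓝 0) := by
    have := (kap_an i j 0).continuousAt.tendsto
    rwa [kap_zero] at this
  refine ⟨fun x => c (kap i j x), ?_, ?_, ?_, ?_⟩
  · exact AnalyticAt.comp' (g := c) (f := kap i j) (by rw [kap_zero]; exact hc) (kap_an i j 0)
  · simp only [kap_zero, hc0]
  · filter_upwards [tk.eventually hcfix] with x hx h0
    refine hx fun k hk => ?_
    have h1 : k ≠ i := fun h => D.hi (h ▸ hk)
    have h2 : k ≠ j := fun h => D.hj (h ▸ hk)
    simp [kap, h1, h2, h0 k hk]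
  filter_upwards [self_mem_nhdsWithin, eta_ne D, eventually_line (Pi.single i 1) hR.eventually_nhds,
    eventually_line (Pi.single i 1) D.Z_S.eventually_nhds,
    eventually_line (Pi.single i 1) (tk.eventually hcA).eventually_nhds,
    eventually_line (Pi.single i 1) (tk.eventually (eventually_analyticAt' hc)).eventually_nhds]
    with t ht hη hR hZ hcA hcan H hG
  have hK := kerA_of_good D.hij D.hi D.hj hAj ht hG hη hZ hR
  have tk2 : Tendsto (kap i j) (𝓝 (t • (Pi.single i 1 : ι → ℝ))) (𝓝 ((t ^ 2 / 2) • (Pi.single i 1 : ι → ℝ))) := by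
    have := (kap_an i j (t • (Pi.single i 1 : ι → ℝ))).continuousAt.tendsto
    rwa [kap_at D.hij] at this
  filter_upwards [hcA, hcan, tk2.eventually hK, (H_kap D.hij ht hG).eventually_nhds] with x h1 h2 h3 h4 v hv
  have hkd : HasFDerivAt (kap i j) (fderiv ℝ (kap i j) x) x := (kap_an i j x).differentiableAt.hasFDerivAt
  set F : (ι → ℝ) → (ι → ℝ) := fun ν => H (sqm i j ν) with hF
  set w := fderiv ℝ (kap i j) x v with hw
  have e1 : (fun x => F (kap i j x)) =ᶠ[𝓝 x] H := h4
  have e2 : fderiv ℝ (fun x => F (kap i j x)) x = fderiv ℝ F (kap i j x) ∘L fderiv ℝ (kap i j) x :=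
    (h3.1.hasFDerivAt.comp x hkd).fderiv
  rw [e1.fderiv_eq] at e2
  have hw0 : fderiv ℝ F (kap i j x) w = 0 := by
    have := congrArg (fun L => L v) e2
    rw [show fderiv ℝ H x v = 0 from hv] at this
    exact this.symm
  have hwj : w j = 0 := by
    rw [hw, ← fderiv_coord hkd.differentiableAt]
    have : (fun x => kap i j x j) = fun x => 0 := by
      ext x; simp [kap, D.hij.symm]
    rw [this]; simp
  have hwS := h3.2.2 w hwj hw0
  have hwe : w = ∑ k ∈ S, w k • (fun a => A k a (kap i j x)) := by
    ext a
    rw [hwS a]; simp [Finset.sum_apply]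
  have e3 : fderiv ℝ (fun x => c (kap i j x)) x = fderiv ℝ c (kap i j x) ∘L fderiv ℝ (kap i j) x :=
    (h2.differentiableAt.hasFDerivAt.comp x hkd).fderiv
  rw [e3]
  show fderiv ℝ c (kap i j x) w = 0
  rw [hwe, map_sum]
  exact Finset.sum_eq_zero fun k hk => by rw [map_smul, h1 k hk, smul_zero]

end s2
end NambuLin

open scoped ContDiff
namespace NambuLin
open Metric Filter Topology

section s2
variable {ι : Type} [Fintype ι] [DecidableEq ι]

theorem line_ne {f : (ι → ℝ) → ℝ} (hf : DifferentiableAt ℝ f 0) (e : ι → ℝ)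
    (h : fderiv ℝ f 0 e ≠ 0) : ∀ᶠ t in 𝓝[>] (0:ℝ), f (t • e) ≠ 0 := by
  have hd : HasDerivAt (fun t : ℝ => t • e) e 0 := by
    have := (hasDerivAt_id (0:ℝ)).smul_const e
    simpa using this
  have d1 : HasDerivAt (fun t : ℝ => f (t • e)) (fderiv ℝ f 0 e) 0 :=
    HasFDerivAt.comp_hasDerivAt (l := f) (f := fun t : ℝ => t • e) (0:ℝ)
      (by rw [zero_smul]; exact hf.hasFDerivAt) hd
  exact (d1.eventually_ne h).filter_mono (nhdsWithin_mono _ fun x hx => ne_of_gt hx)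

/-- derivative identities for local inverses -/
theorem inv_deriv {φ ψ : (ι → ℝ) → (ι → ℝ)} (hφ : AnalyticAt ℝ φ 0) (hφ0 : φ 0 = 0) (hψ : AnalyticAt ℝ ψ 0)
    (h1 : ∀ᶠ x in 𝓝 0, ψ (φ x) = x) (h2 : ∀ᶠ y in 𝓝 0, φ (ψ y) = y) :
    ∀ᶠ x in 𝓝 0, ψ (φ x) = x ∧ DifferentiableAt ℝ φ x ∧ DifferentiableAt ℝ ψ (φ x) ∧
      (∀ v, fderiv ℝ ψ (φ x) (fderiv ℝ φ x v) = v) ∧ (∀ v, fderiv ℝ φ x (fderiv ℝ ψ (φ x) v) = v) := by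
  have tφ : Tendsto φ (𝓝 0) (𝓝 0) := by have := hφ.continuousAt.tendsto; rwa [hφ0] at this
  filter_upwards [h1.eventually_nhds, tφ.eventually h2.eventually_nhds, eventually_analyticAt' hφ,
    tφ.eventually (eventually_analyticAt' hψ)] with x a b c d
  have ax : ψ (φ x) = x := a.self_of_nhds
  refine ⟨ax, c.differentiableAt, d.differentiableAt, ?_, ?_⟩
  · intro v
    have e : (fun x => ψ (φ x)) =ᶠ[𝓝 x] id := a
    have e2 : fderiv ℝ (fun x => ψ (φ x)) x = _ := (d.differentiableAt.hasFDerivAt.comp x c.differentiableAt.hasFDerivAt).fderiv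
    rw [e.fderiv_eq, fderiv_id] at e2
    have := congrArg (fun L => L v) e2
    exact this.symm
  · intro v
    have e : (fun y => φ (ψ y)) =ᶠ[𝓝 (φ x)] id := b
    have e3 : HasFDerivAt φ (fderiv ℝ φ x) (ψ (φ x)) := by rw [ax]; exact c.differentiableAt.hasFDerivAt
    have e2 : fderiv ℝ (fun x => φ (ψ x)) (φ x) = _ := (e3.comp (φ x) d.differentiableAt.hasFDerivAt).fderiv
    rw [e.fderiv_eq, fderiv_id] at e2
    have := congrArg (fun L => L v) e2
    exact this.symm

theorem stage2 {T : Finset ι} {ε : ι → ℝ} {y : ι → (ι → ℝ) → ℝ}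
    {Y : ι → ι → (ι → ℝ) → (ι → ℝ)} (D : NData T ε y Y) {i j l : ι} (hi : i ∈ T) (hj : j ∈ T)
    (hl : l ∈ T) (hij : i ≠ j) (hil : i ≠ l) (hjl : j ≠ l) (ei : ε i = 1) (ej : ε j = 1) :
    ∃ (φ Q : (ι → ℝ) → (ι → ℝ)), AnalyticAt ℝ φ 0 ∧ φ 0 = 0 ∧
      fderiv ℝ φ 0 = ContinuousLinearMap.id ℝ _ ∧ AnalyticAt ℝ Q 0 ∧ Q 0 = 0 ∧
      (∀ᶠ x in 𝓝 0, ∀ a ∈ T, ∀ b ∈ T, a ≠ b → fderiv ℝ Q x (Y a b x) = 0) ∧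
      (∀ᶠ x in 𝓝 0, ∀ k ∈ T, k ≠ i → k ≠ j → φ x k = x k) ∧
      (∀ᶠ x in 𝓝 0, (∀ k ∈ T, k ≠ i → k ≠ j → x k = 0) → Q (φ x) = kap i j x) := by
  obtain ⟨φ, σ, hφ, hφ0, hφd, hσ, hσ0, hφk, hφJ, hφax⟩ := stage1 D hi hj hl hij hil hjl ei ej
  obtain ⟨ψ, hψ, hψ0, hψφ, hφψ⟩ := local_inverse hφ hφ0 (ContinuousLinearEquiv.refl ℝ _) hφd
  have hinv := inv_deriv hφ hφ0 hψ hψφ hφψ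
  have tφ : Tendsto φ (𝓝 0) (𝓝 0) := by have := hφ.continuousAt.tendsto; rwa [hφ0] at this
  have tψ : Tendsto ψ (𝓝 0) (𝓝 0) := by have := hψ.continuousAt.tendsto; rwa [hψ0] at this
  let S : Finset ι := (T.erase i).erase j
  have hS : ∀ k, k ∈ S ↔ k ≠ j ∧ k ≠ i ∧ k ∈ T := by intro k; simp [S]
  let Y' : ι → ι → (ι → ℝ) → (ι → ℝ) := fun a b x => fderiv ℝ ψ (φ x) (Y a b (φ x))
  have hY'an : ∀ a ∈ T, ∀ b ∈ T, a ≠ b → AnalyticAt ℝ (Y' a b) 0 := by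
    intro a ha b hb hab
    refine analyticAt_clm_apply ?_ ?_
    · exact AnalyticAt.comp' (g := fderiv ℝ ψ) (f := φ) (by rw [hφ0]; exact hψ.fderiv) hφ
    · exact AnalyticAt.comp' (g := Y a b) (f := φ) (by rw [hφ0]; exact D.Y_an a ha b hb hab) hφ
  let η : (ι → ℝ) → ℝ := fun x => y i (φ x)
  let Z : ι → (ι → ℝ) → (ι → ℝ) := fun k => Y' i k
  have hyφ : ∀ a ∈ T, AnalyticAt ℝ (fun x => y a (φ x)) 0 := fun a ha =>
    AnalyticAt.comp' (g := y a) (f := φ) (by rw [hφ0]; exact D.y_an a ha) hφ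
  have hyφd : ∀ a ∈ T, ∀ v, fderiv ℝ (fun x => y a (φ x)) 0 v = ε a * v a := by
    intro a ha v
    have h1 : HasFDerivAt (y a) (fderiv ℝ (y a) 0) (φ 0) := by
      rw [hφ0]; exact (D.y_an a ha).differentiableAt.hasFDerivAt
    have : fderiv ℝ (fun x => y a (φ x)) 0 = _ := (h1.comp 0 hφ.differentiableAt.hasFDerivAt).fderiv
    rw [this, hφd]
    exact D.y_deriv a ha v
  have hcoord : ∀ᶠ x in 𝓝 0, ∀ c ∈ S, ∀ v, fderiv ℝ φ x v c = v c := by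
    filter_upwards [hφk.eventually_nhds, hinv] with x h1 h2 c hc v
    rw [← fderiv_coord h2.2.1]
    have e1 : (fun x => φ x c) =ᶠ[𝓝 x] fun x => x c := h1.mono fun x hx => hx c ((hS c).1 hc).2.2 ((hS c).1 hc).2.1 ((hS c).1 hc).1
    rw [e1.fderiv_eq]
    have : HasFDerivAt (fun m : ι → ℝ => m c) (ContinuousLinearMap.proj (R := ℝ) (φ := fun _ : ι => ℝ) c) x :=
      (ContinuousLinearMap.proj (R := ℝ) (φ := fun _ : ι => ℝ) c).hasFDerivAt
    rw [this.fderiv]; rfl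
  have hYT : ∀ᶠ x in 𝓝 0, ∀ a ∈ T, ∀ b ∈ T, a ≠ b → ∀ c ∈ T,
      Y a b x c = if c = a then y b x else if c = b then - y a x else 0 := by
    rw [Filter.eventually_all_finset]; intro a ha
    rw [Filter.eventually_all_finset]; intro b hb
    by_cases hab : a = b
    · exact Eventually.of_forall fun x h => absurd hab h
    · exact (D.Y_T a ha b hb hab).mono fun x hx _ => hx
  have hσn : ∀ᶠ x in 𝓝 0, 1 + σ x ≠ 0 :=
    (continuousAt_const.add hσ.continuousAt).eventually_ne (by show 1 + σ 0 ≠ 0; rw [hσ0]; norm_num)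
  have hgood : ∀ᶠ x in 𝓝 0, (∃ a ∈ T, y a (φ x) ≠ 0) → ∃ H, Good S i j η Z H x ∧
      ∀ᶠ x' in 𝓝 x, ∀ a ∈ T, ∀ b ∈ T, a ≠ b → fderiv ℝ H x' (Y' a b x') = 0 := by
    filter_upwards [tφ.eventually D.reg, hinv.eventually_nhds, hcoord.eventually_nhds, hφJ.eventually_nhds,
      hσn.eventually_nhds, (tφ.eventually hYT).eventually_nhds] with x h1 h2 h3 h4 h5 h6 hne
    obtain ⟨H, hH⟩ := h1 hne
    have tx : Tendsto φ (𝓝 x) (𝓝 (φ x)) := h2.self_of_nhds.2.1.continuousAt.tendsto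
    have hmain : ∀ᶠ x' in 𝓝 x, DifferentiableAt ℝ H (φ x') ∧ DifferentiableAt ℝ φ x' ∧
        (∀ v, fderiv ℝ (fun x => H (φ x)) x' v = fderiv ℝ H (φ x') (fderiv ℝ φ x' v)) := by
      filter_upwards [tx.eventually hH, h2] with x' g1 g2
      have g3 := g1.1.differentiableAt (by norm_num)
      refine ⟨g3, g2.2.1, fun v => ?_⟩
      have : fderiv ℝ (fun x => H (φ x)) x' = _ := (g3.hasFDerivAt.comp x' g2.2.1.hasFDerivAt).fderiv
      rw [this]; rfl
    refine ⟨fun x => H (φ x), ?_, ?_⟩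
    · filter_upwards [hmain, tx.eventually hH, h2, h3, h4, h5, h6] with x' ⟨m1, m2, m3⟩ ⟨r1, r2, r3⟩ h2 h3 h4 h5 h6
      obtain ⟨-, -, -, h2a, h2b⟩ := h2
      refine ⟨m1.comp x' m2, ?_, ?_, ?_⟩
      · rw [m3, h4, map_smul, r2 i hi j hj hij, smul_zero]
      · intro k hk
        obtain ⟨kj, ki, kT⟩ := (hS k).1 hk
        rw [m3]
        show fderiv ℝ H (φ x') (fderiv ℝ φ x' (fderiv ℝ ψ (φ x') (Y i k (φ x')))) = 0
        rw [h2b, r2 i hi k kT ki.symm]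
      · intro v hv hvS hη
        rw [m3] at hv
        set w := fderiv ℝ φ x' v with hw
        have hwS : ∀ c ∈ S, w c = 0 := fun c hc => by rw [hw, h3 c hc, hvS c hc]
        have hη' : y i (φ x') ≠ 0 := hη
        have hsum := (r3 w hv).1
        have hsum' : y i (φ x') * w i + y j (φ x') * w j = 0 := by
          rw [← Finset.add_sum_erase T _ hi, ← Finset.add_sum_erase (T.erase i) _ (Finset.mem_erase.2 ⟨hij.symm, hj⟩)] at hsum
          rw [Finset.sum_eq_zero fun c hc => by rw [hwS c hc, mul_zero]] at hsum
          linarith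
        have hz := (r3 (w + (w j / y i (φ x')) • Y i j (φ x')) (by rw [map_add, hv, map_smul, r2 i hi j hj hij, smul_zero, add_zero])).2 (by
          intro c hc
          simp only [Pi.add_apply, Pi.smul_apply, smul_eq_mul]
          rw [h6 i hi j hj hij c hc]
          split_ifs with c1 c2
          · subst c1; field_simp; linarith
          · subst c2; field_simp; ring
          · rw [hwS c ((hS c).2 ⟨c2, c1, hc⟩)]; ring)
        refine ⟨-(w j / y i (φ x')) / (1 + σ x'), ?_⟩
        rw [← h2a v, ← h2a (JJ i j x'), h4, ← hw, ← map_smul]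
        congr 1
        rw [smul_smul, div_mul_cancel₀ _ h5, neg_smul]
        exact eq_neg_of_add_eq_zero_left hz
    · filter_upwards [hmain, tx.eventually hH, h2] with x' ⟨m1, m2, m3⟩ ⟨r1, r2, r3⟩ h2 a ha b hb hab
      rw [m3]
      show fderiv ℝ H (φ x') (fderiv ℝ φ x' (fderiv ℝ ψ (φ x') (Y a b (φ x')))) = 0
      rw [h2.2.2.2.2, r2 a ha b hb hab]
  have hline : ∀ a ∈ T, ∀ᶠ t in 𝓝[>] (0:ℝ), ∃ a' ∈ T, y a' (φ (t • (Pi.single a 1 : ι → ℝ))) ≠ 0 := by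
    intro a ha
    have := line_ne (hyφ a ha).differentiableAt (Pi.single a 1) (by
      rw [hyφd a ha]
      have := D.eps a ha
      have h0 : ε a ≠ 0 := by intro h; rw [h] at this; norm_num at this
      simpa using h0)
    exact this.mono fun t ht => ⟨a, ha, ht⟩
  have D2 : S2 S i j l η Z :=
    { hij := hij
      hi := fun h => ((hS i).1 h).2.1 rfl
      hj := fun h => ((hS j).1 h).1 rfl
      hl := (hS l).2 ⟨hjl.symm, hil.symm, hl⟩
      eta_an := hyφ i hi
      eta_ax := hφax
      eta_deriv := by
        show fderiv ℝ (fun x => y i (φ x)) 0 _ = 1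
        rw [hyφd i hi, ei]; simp
      Z_an := fun k hk => hY'an i hi k ((hS k).1 hk).2.2 ((hS k).1 hk).2.1.symm
      Z_S := by
        filter_upwards [hinv, hcoord, tφ.eventually hYT] with x h1 h2 h3 k hk c hc
        obtain ⟨kj, ki, kT⟩ := (hS k).1 hk
        obtain ⟨cj, ci, cT⟩ := (hS c).1 hc
        rw [← h2 c hc (Z k x)]
        show fderiv ℝ φ x (fderiv ℝ ψ (φ x) (Y i k (φ x))) c = _
        rw [h1.2.2.2.2, h3 i hi k kT ki.symm c cT, if_neg ci]
      regl := by
        filter_upwards [hline l hl, eventually_line (Pi.single l 1) hgood] with t h1 h2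
        obtain ⟨H, hH, -⟩ := h2 h1
        exact ⟨H, hH⟩
      regi := by
        filter_upwards [hline i hi, eventually_line (Pi.single i 1) hgood] with t h1 h2
        obtain ⟨H, hH, -⟩ := h2 h1
        exact ⟨H, hH⟩ }
  obtain ⟨C, hC, hC0, hCk, hCH⟩ := D2.final
  have hCY : ∀ᶠ x in 𝓝 0, ∀ a ∈ T, ∀ b ∈ T, a ≠ b → fderiv ℝ C x (Y' a b x) = 0 := by
    rw [Filter.eventually_all_finset]; intro a ha
    rw [Filter.eventually_all_finset]; intro b hb
    by_cases hab : a = b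
    · exact Eventually.of_forall fun x h => absurd hab h
    have := continuation (f := fun x => fderiv ℝ C x (Y' a b x)) (analyticAt_clm_apply hC.fderiv (hY'an a ha b hb hab))
      (frequently_line (Pi.single i 1) (by
        filter_upwards [hline i hi, eventually_line (Pi.single i 1) hgood, hCH] with t h1 h2 h3
        obtain ⟨H, hH, hHY⟩ := h2 h1
        filter_upwards [h3 H hH, hHY] with x h4 h5
        exact h4 _ (h5 a ha b hb hab)))
    exact this.mono fun x hx _ => hx
  refine ⟨φ, fun x => C (ψ x), hφ, hφ0, hφd, ?_, ?_, ?_, hφk, ?_⟩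
  · exact AnalyticAt.comp' (g := C) (f := ψ) (by rw [hψ0]; exact hC) hψ
  · simp only [hψ0, hC0]
  · filter_upwards [tψ.eventually hCY, hφψ, eventually_analyticAt' hψ, tψ.eventually (eventually_analyticAt' hC)] with x h1 h2 h3 h4 a ha b hb hab
    have : fderiv ℝ (fun x => C (ψ x)) x = _ := (h4.differentiableAt.hasFDerivAt.comp x h3.differentiableAt.hasFDerivAt).fderiv
    rw [this]
    have h5 := h1 a ha b hb hab
    simp only [Y', h2] at h5
    exact h5
  · filter_upwards [hψφ, hCk] with x h1 h2 h3
    rw [h1]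
    exact h2 fun k hk => h3 k ((hS k).1 hk).2.2 ((hS k).1 hk).2.1 ((hS k).1 hk).1

end s2
end NambuLin

open scoped ContDiff
namespace NambuLin
open Metric Filter Topology

section morse
variable {ι : Type} [Fintype ι] [DecidableEq ι]

noncomputable def updL {E : Type*} [NormedAddCommGroup E] [NormedSpace ℝ E] (a : ι) (g' : E →L[ℝ] (ι → ℝ)) (f' : E →L[ℝ] ℝ) :
    E →L[ℝ] (ι → ℝ) :=
  ContinuousLinearMap.pi fun c => if c = a then f' else (ContinuousLinearMap.proj c) ∘L g'

theorem updL_apply {E : Type*} [NormedAddCommGroup E] [NormedSpace ℝ E] (a : ι) (g' : E →L[ℝ] (ι → ℝ)) (f' : E →L[ℝ] ℝ) (v : E) :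
    updL a g' f' v = Function.update (g' v) a (f' v) := by
  ext c
  simp only [updL, ContinuousLinearMap.pi_apply]
  by_cases h : c = a
  · subst h; simp
  · simp [h]

theorem hasFDerivAt_update {E : Type*} [NormedAddCommGroup E] [NormedSpace ℝ E] (a : ι) {g : E → ι → ℝ} {f : E → ℝ}
    {g' : E →L[ℝ] (ι → ℝ)} {f' : E →L[ℝ] ℝ} {x : E} (hg : HasFDerivAt g g' x) (hf : HasFDerivAt f f' x) :
    HasFDerivAt (fun x => Function.update (g x) a (f x)) (updL a g' f') x := by
  rw [hasFDerivAt_pi']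
  intro c
  by_cases h : c = a
  · subst h
    have e : (fun x => Function.update (g x) c (f x) c) = f := by ext; simp
    rw [e]
    refine hf.congr_fderiv (ContinuousLinearMap.ext fun v => ?_)
    show _ = updL c g' f' v c
    rw [updL_apply]; simp
  · have e : (fun x => Function.update (g x) a (f x) c) = fun x => g x c := by ext; simp [h]
    rw [e]
    refine (hasFDerivAt_coord hg c).congr_fderiv (ContinuousLinearMap.ext fun v => ?_)
    show _ = updL a g' f' v c
    rw [updL_apply]; simp [h]

theorem fderiv_eval (c : ι) (x v : ι → ℝ) : fderiv ℝ (fun m : ι → ℝ => m c) x v = v c := by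
  have : HasFDerivAt (fun m : ι → ℝ => m c) (ContinuousLinearMap.proj (R := ℝ) (φ := fun _ : ι => ℝ) c) x :=
    (ContinuousLinearMap.proj (R := ℝ) (φ := fun _ : ι => ℝ) c).hasFDerivAt
  rw [this.fderiv]; rfl

theorem hasFDerivAt_eval (c : ι) (x : ι → ℝ) :
    HasFDerivAt (fun m : ι → ℝ => m c) (ContinuousLinearMap.proj (R := ℝ) (φ := fun _ : ι => ℝ) c) x :=
  (ContinuousLinearMap.proj (R := ℝ) (φ := fun _ : ι => ℝ) c).hasFDerivAt

theorem indep_deriv {F : Type*} [NormedAddCommGroup F] [NormedSpace ℝ F] {k : (ι → ℝ) → F} {a : ι} (hk : ∀ x s, k (Function.update x a s) = k x) {x : ι → ℝ}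
    (hd : DifferentiableAt ℝ k x) : fderiv ℝ k x (Pi.single a 1) = 0 := by
  have h1 : HasFDerivAt (fun y : ι → ℝ => Function.update y a 0) (updL a (ContinuousLinearMap.id ℝ _) 0) x :=
    hasFDerivAt_update a (hasFDerivAt_id x) (hasFDerivAt_const (0:ℝ) x)
  have h2 : k = (fun y => k (Function.update x a (y a))) ∘ (fun y => y) + fun y => k y - k (Function.update x a (y a)) := by
    ext y; simp
  have hl : HasDerivAt (fun t : ℝ => x + t • (Pi.single a 1 : ι → ℝ)) (Pi.single a 1) 0 := by
    have := ((hasDerivAt_id (0:ℝ)).smul_const (Pi.single a 1 : ι → ℝ)).const_add x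
    simpa using this
  have d1 : HasDerivAt (fun t : ℝ => k (x + t • (Pi.single a 1 : ι → ℝ))) (fderiv ℝ k x (Pi.single a 1)) 0 :=
    HasFDerivAt.comp_hasDerivAt (l := k) (f := fun t : ℝ => x + t • (Pi.single a 1 : ι → ℝ)) (0:ℝ)
      (by rw [zero_smul, add_zero]; exact hd.hasFDerivAt) hl
  have e : (fun t : ℝ => k (x + t • (Pi.single a 1 : ι → ℝ))) = fun _ => k x := by
    ext1 t
    have : x + t • (Pi.single a 1 : ι → ℝ) = Function.update x a (x a + t) := by
      ext c
      by_cases h : c = a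
      · subst h; simp
      · simp [h]
    rw [this, hk]
  rw [e] at d1
  exact d1.unique (hasDerivAt_const _ _)

theorem crit {g : (ι → ℝ) → ℝ} (hg : AnalyticAt ℝ g 0) (hg0 : g 0 = 0) (a : ι) {ε : ℝ} (hε : ε ≠ 0)
    (hgd : ∀ v, fderiv ℝ g 0 v = ε * v a) : ∃ k : (ι → ℝ) → ℝ, AnalyticAt ℝ k 0 ∧ k 0 = 0 ∧
      fderiv ℝ k 0 = 0 ∧ (∀ x s, k (Function.update x a s) = k x) ∧
      ∀ᶠ x in 𝓝 0, g (Function.update x a (k x)) = 0 := by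
  let G : (ι → ℝ) × ℝ → ℝ := fun z => g (Function.update z.1 a z.2)
  have hu : AnalyticAt ℝ (fun z : (ι → ℝ) × ℝ => Function.update z.1 a z.2) 0 :=
    analyticAt_update_fun a analyticAt_fst analyticAt_snd
  have hu0 : Function.update (0 : (ι → ℝ) × ℝ).1 a (0 : (ι → ℝ) × ℝ).2 = 0 := update_zero_zero a
  have hG : AnalyticAt ℝ G 0 :=
    AnalyticAt.comp' (g := g) (f := fun z : (ι → ℝ) × ℝ => Function.update z.1 a z.2) (by rw [hu0]; exact hg) hu
  have hGd : ∀ v s, fderiv ℝ G 0 (v, s) = ε * s := by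
    intro v s
    have h1 : HasFDerivAt (fun z : (ι → ℝ) × ℝ => Function.update z.1 a z.2) _ 0 :=
      hasFDerivAt_update a hasFDerivAt_fst hasFDerivAt_snd
    have h2 : HasFDerivAt g (fderiv ℝ g 0) (Function.update (0 : (ι → ℝ) × ℝ).1 a (0 : (ι → ℝ) × ℝ).2) := by
      rw [hu0]; exact hg.differentiableAt.hasFDerivAt
    have h3 : fderiv ℝ G 0 = _ := (h2.comp (0 : (ι → ℝ) × ℝ) h1).fderiv
    rw [h3]
    show fderiv ℝ g 0 (updL a _ _ (v, s)) = _
    rw [hgd, updL_apply]; simp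
  obtain ⟨u, hua, hu00, hz, -⟩ := implicit_zero hG (by show g (Function.update (0 : (ι → ℝ) × ℝ).1 a (0 : (ι → ℝ) × ℝ).2) = 0; rw [hu0, hg0]) (by
    refine ⟨ContinuousLinearEquiv.smulLeft (Units.mk0 ε hε), ?_⟩
    refine ContinuousLinearMap.ext fun s => ?_
    have : (fderiv ℝ G 0 ∘L ContinuousLinearMap.inr ℝ (ι → ℝ) ℝ) s = fderiv ℝ G 0 (0, s) := rfl
    rw [this, hGd]
    rfl)
  let k : (ι → ℝ) → ℝ := fun x => u (Function.update x a 0)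
  have hk : AnalyticAt ℝ k 0 := AnalyticAt.comp' (g := u) (f := fun x => Function.update x a 0) (by rw [update_zero_zero]; exact hua) (analyticAt_update a 0 0)
  have hk0 : k 0 = 0 := by show u (Function.update 0 a 0) = 0; rw [update_zero_zero, hu00]
  have hts : Tendsto (fun m : ι → ℝ => Function.update m a 0) (𝓝 0) (𝓝 0) := by
    have hcu : Continuous fun m : ι → ℝ => Function.update m a 0 := by fun_prop
    have := hcu.tendsto 0; rwa [update_zero_zero] at this
  have hz' : ∀ᶠ x in 𝓝 0, g (Function.update x a (k x)) = 0 := by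
    filter_upwards [hts.eventually hz] with x hx
    simp only [G, Function.update_idem] at hx
    exact hx
  refine ⟨k, hk, hk0, ?_, ?_, hz'⟩
  · refine ContinuousLinearMap.ext fun v => ?_
    have h1 : HasFDerivAt (fun x => Function.update x a (k x)) _ 0 :=
      hasFDerivAt_update a (hasFDerivAt_id (0 : ι → ℝ)) hk.differentiableAt.hasFDerivAt
    have h2 : HasFDerivAt g (fderiv ℝ g 0) (Function.update 0 a (k 0)) := by
      rw [hk0, update_zero_zero]; exact hg.differentiableAt.hasFDerivAt
    have h3 : fderiv ℝ (fun x => g (Function.update x a (k x))) 0 = _ := (h2.comp (0 : ι → ℝ) h1).fderiv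
    have h4 : (fun x => g (Function.update x a (k x))) =ᶠ[𝓝 0] fun _ => 0 := hz'
    rw [h4.fderiv_eq] at h3
    have h5 := congrArg (fun L => L v) h3
    simp only [fderiv_fun_const] at h5
    have h6 : (0:ℝ) = fderiv ℝ g 0 (updL a (ContinuousLinearMap.id ℝ _) (fderiv ℝ k 0) v) := h5
    rw [hgd, updL_apply, Function.update_self] at h6
    exact (mul_eq_zero.1 h6.symm).resolve_left hε
  · intro x s
    simp only [k, Function.update_idem]

theorem square_split {F : (ι → ℝ) → ℝ} (hF : AnalyticAt ℝ F 0) (a : ι) {ε : ℝ}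
    (h0 : ∀ᶠ x in 𝓝 0, x a = 0 → fderiv ℝ F x (Pi.single a 1) = 0)
    (hd : fderiv ℝ (fun x => fderiv ℝ F x (Pi.single a 1)) 0 (Pi.single a 1) = ε) :
    ∃ h : (ι → ℝ) → ℝ, AnalyticAt ℝ h 0 ∧ h 0 = ε / 2 ∧ ∀ᶠ x in 𝓝 0, F x = F (Function.update x a 0) + x a ^ 2 * h x := by
  obtain ⟨h1, h1a, e1⟩ := hadamard_one hF a
  have hts : Tendsto (fun m : ι → ℝ => Function.update m a 0) (𝓝 0) (𝓝 0) := by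
    have hcu : Continuous fun m : ι → ℝ => Function.update m a 0 := by fun_prop
    have := hcu.tendsto 0; rwa [update_zero_zero] at this
  have key : ∀ (p : ℝ → ℝ) (p' : ℝ → ℝ) (_ : ∀ s, HasDerivAt p (p' s) s) (h : (ι → ℝ) → ℝ), AnalyticAt ℝ h 0 →
      (∀ᶠ x in 𝓝 0, F x = F (Function.update x a 0) + p (x a) * h x) →
      ∀ᶠ x in 𝓝 0, fderiv ℝ F x (Pi.single a 1) = p' (x a) * h x + p (x a) * fderiv ℝ h x (Pi.single a 1) := by
    intro p p' hp h ha he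
    filter_upwards [he.eventually_nhds, eventually_analyticAt' ha, hts.eventually (eventually_analyticAt' hF)] with x h1 h2 h3
    have g1 : DifferentiableAt ℝ (fun x => F (Function.update x a 0)) x :=
      DifferentiableAt.comp (g := F) (f := fun x => Function.update x a 0) x h3.differentiableAt (analyticAt_update a 0 x).differentiableAt
    have g2 := indep_deriv (k := fun x => F (Function.update x a 0)) (a := a) (by intro x s; simp only [Function.update_idem]) g1
    have g3 := (hp (x a)).hasFDerivAt.comp x (hasFDerivAt_eval a x)
    have g4 := g1.hasFDerivAt.add (g3.mul h2.differentiableAt.hasFDerivAt)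
    have g5 := g4.congr_of_eventuallyEq h1
    rw [g5.fderiv]
    simp only [ContinuousLinearMap.add_apply, g2, ContinuousLinearMap.smul_apply, ContinuousLinearMap.comp_apply, smul_eq_mul, Function.comp]
    simp
    ring
  have k1 := key id (fun _ => 1) (fun s => hasDerivAt_id s) h1 h1a e1
  have h1z : ∀ᶠ x in 𝓝 0, h1 (Function.update x a 0) = 0 := by
    filter_upwards [hts.eventually k1, hts.eventually h0] with x a b
    rw [b (by simp)] at a
    simp at a
    exact a.symm
  obtain ⟨h, ha, e2⟩ := hadamard_one h1a a
  have e3 : ∀ᶠ x in 𝓝 0, F x = F (Function.update x a 0) + x a ^ 2 * h x := by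
    filter_upwards [e1, e2, h1z] with x g1 g2 g3
    rw [g1, g2, g3]; ring
  refine ⟨h, ha, ?_, e3⟩
  have k2 := key (fun s => s ^ 2) (fun s => 2 * s) (fun s => by simpa using hasDerivAt_pow 2 s) h ha e3
  have e4 : (fun x => fderiv ℝ F x (Pi.single a 1)) =ᶠ[𝓝 0] fun x => x a * (2 * h x + x a * fderiv ℝ h x (Pi.single a 1)) := by
    filter_upwards [k2] with x hx
    rw [hx]; ring
  rw [e4.fderiv_eq] at hd
  have m1 : DifferentiableAt ℝ (fun x => 2 * h x + x a * fderiv ℝ h x (Pi.single a 1)) 0 :=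
    ((analyticAt_const.mul ha).add ((analyticAt_eval a 0).mul (analyticAt_clm_apply ha.fderiv analyticAt_const))).differentiableAt
  have m2 := ((hasFDerivAt_eval a 0).mul m1.hasFDerivAt).fderiv
  rw [show fderiv ℝ (fun x : ι → ℝ => x a * (2 * h x + x a * fderiv ℝ h x (Pi.single a 1))) 0 = _ from m2] at hd
  simp at hd
  linarith

end morse
end NambuLin

open scoped ContDiff
namespace NambuLin
open Metric Filter Topology

section morse2
variable {ι : Type} [Fintype ι] [DecidableEq ι]

theorem analyticAt_comp_zero {E F G : Type*} [NormedAddCommGroup E] [NormedSpace ℝ E]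
    [NormedAddCommGroup F] [NormedSpace ℝ F] [NormedAddCommGroup G] [NormedSpace ℝ G]
    {f : E → F} {g : F → G} (hg : AnalyticAt ℝ g 0)
    (hf : AnalyticAt ℝ f 0) (h0 : f 0 = 0) : AnalyticAt ℝ (fun x => g (f x)) 0 :=
  AnalyticAt.comp' (g := g) (f := f) (by rw [h0]; exact hg) hf

theorem tendsto_zero {E F : Type*} [NormedAddCommGroup E] [NormedSpace ℝ E]
    [NormedAddCommGroup F] [NormedSpace ℝ F]
    {f : E → F} (hf : AnalyticAt ℝ f 0) (h0 : f 0 = 0) : Tendsto f (𝓝 0) (𝓝 0) := by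
  have := hf.continuousAt.tendsto
  rwa [h0] at this

theorem morse_step {F : (ι → ℝ) → ℝ} {ε : ι → ℝ} {a : ι} {S : Finset ι} (haS : a ∉ S) (hF : AnalyticAt ℝ F 0)
    (hε : ∀ b ∈ insert a S, |ε b| = 1)
    (h1 : ∀ b ∈ insert a S, fderiv ℝ F 0 (Pi.single b 1) = 0)
    (h2 : ∀ b ∈ insert a S, ∀ v, fderiv ℝ (fun x => fderiv ℝ F x (Pi.single b 1)) 0 v = ε b * v b) :
    ∃ (G : (ι → ℝ) → ℝ) (ξ : (ι → ℝ) → ℝ), AnalyticAt ℝ G 0 ∧ AnalyticAt ℝ ξ 0 ∧ ξ 0 = 0 ∧ (∀ v, fderiv ℝ ξ 0 v = v a) ∧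
      (∀ b ∈ S, fderiv ℝ G 0 (Pi.single b 1) = 0) ∧
      (∀ b ∈ S, ∀ v, fderiv ℝ (fun x => fderiv ℝ G x (Pi.single b 1)) 0 v = ε b * v b) ∧
      (∀ x s, G (Function.update x a s) = G x) ∧ ∀ᶠ x in 𝓝 0, F x = ε a * (ξ x) ^ 2 / 2 + G x := by
  have haI := Finset.mem_insert_self a S
  have hε2 : ε a * ε a = 1 := by
    rw [← abs_mul_abs_self, hε a haI]; norm_num
  have hε0 : ε a ≠ 0 := by intro h; rw [h] at hε2; norm_num at hε2
  have hpart : ∀ b, AnalyticAt ℝ (fun x => fderiv ℝ F x (Pi.single b 1)) 0 := fun b =>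
    analyticAt_clm_apply hF.fderiv analyticAt_const
  obtain ⟨k, hk, hk0, hkd, hki, hkz⟩ := crit (hpart a) (h1 a haI) a hε0 (h2 a haI)
  -- solve for the coordinate a
  have hid : AnalyticAt ℝ (fun x : ι → ℝ => x) 0 := analyticAt_id
  have hu : AnalyticAt ℝ (fun x : ι → ℝ => Function.update x a (k x)) 0 := analyticAt_update_fun a hid hk
  have hu0 : Function.update (0 : ι → ℝ) a (k 0) = 0 := by rw [hk0, update_zero_zero]
  have hp : AnalyticAt ℝ (fun x : ι → ℝ => Function.update x a (x a + k x)) 0 := analyticAt_update_fun a hid ((analyticAt_eval a 0).add hk)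
  have hp0 : Function.update (0 : ι → ℝ) a ((0 : ι → ℝ) a + k 0) = 0 := by rw [hk0, Pi.zero_apply, add_zero, update_zero_zero]
  have hm : AnalyticAt ℝ (fun x : ι → ℝ => Function.update x a (x a - k x)) 0 := analyticAt_update_fun a hid ((analyticAt_eval a 0).sub hk)
  have hm0 : Function.update (0 : ι → ℝ) a ((0 : ι → ℝ) a - k 0) = 0 := by rw [hk0, Pi.zero_apply, sub_zero, update_zero_zero]
  have hF1 : AnalyticAt ℝ (fun x => F (Function.update x a (x a + k x))) 0 := analyticAt_comp_zero hF hp hp0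
  have hG : AnalyticAt ℝ (fun x => F (Function.update x a (k x))) 0 := analyticAt_comp_zero hF hu hu0
  have d1 : (fun x => fderiv ℝ (fun x => F (Function.update x a (x a + k x))) x (Pi.single a 1)) =ᶠ[𝓝 0]
      fun x => fderiv ℝ F (Function.update x a (x a + k x)) (Pi.single a 1) := by
    filter_upwards [eventually_analyticAt' hk, (tendsto_zero hp hp0).eventually (eventually_analyticAt' hF)] with x g1 g2
    have g3 : HasFDerivAt (fun x : ι → ℝ => Function.update x a (x a + k x)) _ x :=
      hasFDerivAt_update a (hasFDerivAt_id x) ((hasFDerivAt_eval a x).add g1.differentiableAt.hasFDerivAt)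
    have g4 : fderiv ℝ (fun x => F (Function.update x a (x a + k x))) x = _ :=
      (HasFDerivAt.comp (g := F) (f := fun x => Function.update x a (x a + k x)) x g2.differentiableAt.hasFDerivAt g3).fderiv
    rw [g4, ContinuousLinearMap.comp_apply, updL_apply]
    congr 1
    have := indep_deriv hki g1.differentiableAt
    simp [this]
  obtain ⟨h, hh, hh0, hsp⟩ := square_split (ε := ε a) hF1 a (by
      filter_upwards [d1, hkz] with x g1 g2 g3
      rw [show fderiv ℝ (fun x => F (Function.update x a (x a + k x))) x (Pi.single a 1) = _ from g1]
      rw [g3, zero_add]; exact g2) (by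
      rw [d1.fderiv_eq]
      have g3 : HasFDerivAt (fun x : ι → ℝ => Function.update x a (x a + k x)) _ 0 :=
        hasFDerivAt_update a (hasFDerivAt_id 0) ((hasFDerivAt_eval a 0).add hk.differentiableAt.hasFDerivAt)
      have g4 : fderiv ℝ (fun x => fderiv ℝ F (Function.update x a (x a + k x)) (Pi.single a 1)) 0 = _ :=
        (HasFDerivAt.comp_zero (hpart a).differentiableAt.hasFDerivAt g3 hp0).fderiv
      rw [g4, ContinuousLinearMap.comp_apply, updL_apply, h2 a haI, hkd]
      simp)
  have hhm : AnalyticAt ℝ (fun x => 2 * ε a * h (Function.update x a (x a - k x))) 0 :=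
    analyticAt_const.mul (analyticAt_comp_zero hh hm hm0)
  have hhm0 : 2 * ε a * h (Function.update 0 a ((0 : ι → ℝ) a - k 0)) = 1 := by
    rw [hm0, hh0]; linear_combination hε2
  have hs : AnalyticAt ℝ (fun x => √(2 * ε a * h (Function.update x a (x a - k x)))) 0 := by
    rw [← analyticAt_iff_omega]
    exact ContDiffAt.sqrt (analyticAt_iff_omega.2 hhm) (by rw [hhm0]; norm_num)
  have hlin : AnalyticAt ℝ (fun x : ι → ℝ => x a - k x) 0 := (analyticAt_eval a 0).sub hk
  have d2 : ∀ b ∈ S, (fun x => fderiv ℝ (fun x => F (Function.update x a (k x))) x (Pi.single b 1)) =ᶠ[𝓝 0]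
      fun x => fderiv ℝ F (Function.update x a (k x)) (Pi.single b 1) := by
    intro b hb
    have hba : b ≠ a := by rintro rfl; exact haS hb
    filter_upwards [hkz, eventually_analyticAt' hk, (tendsto_zero hu hu0).eventually (eventually_analyticAt' hF)] with x g0 g1 g2
    have g3 : HasFDerivAt (fun x : ι → ℝ => Function.update x a (k x)) _ x :=
      hasFDerivAt_update a (hasFDerivAt_id x) (g1.differentiableAt.hasFDerivAt)
    have g4 : fderiv ℝ (fun x => F (Function.update x a (k x))) x = _ :=
      (HasFDerivAt.comp (g := F) (f := fun x => Function.update x a (k x)) x g2.differentiableAt.hasFDerivAt g3).fderiv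
    rw [g4, ContinuousLinearMap.comp_apply, updL_apply]
    have g5 : Function.update ((ContinuousLinearMap.id ℝ (ι → ℝ)) (Pi.single b 1)) a (fderiv ℝ k x (Pi.single b 1)) =
        Pi.single b 1 + fderiv ℝ k x (Pi.single b 1) • (Pi.single a 1 : ι → ℝ) := by
      ext c
      by_cases hc : c = a
      · subst hc; simp [hba.symm]
      · simp [hc]
    rw [g5, map_add, map_smul, g0]
    simp
  refine ⟨fun x => F (Function.update x a (k x)), fun x => (x a - k x) * √(2 * ε a * h (Function.update x a (x a - k x))), hG,
    hlin.mul hs, by simp [hk0], ?_, ?_, ?_, ?_, ?_⟩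
  · intro v
    have := (((hasFDerivAt_eval a 0).sub hk.differentiableAt.hasFDerivAt).mul hs.differentiableAt.hasFDerivAt).fderiv
    rw [show fderiv ℝ (fun x : ι → ℝ => (x a - k x) * √(2 * ε a * h (Function.update x a (x a - k x)))) 0 = _ from this]
    rw [hhm0, hkd]
    simp [hk0]
  · intro b hb
    rw [(d2 b hb).eq_of_nhds, hu0]
    exact h1 b (Finset.mem_insert_of_mem hb)
  · intro b hb v
    have hba : b ≠ a := by rintro rfl; exact haS hb
    rw [(d2 b hb).fderiv_eq]
    have g3 : HasFDerivAt (fun x : ι → ℝ => Function.update x a (k x)) _ 0 :=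
      hasFDerivAt_update a (hasFDerivAt_id 0) hk.differentiableAt.hasFDerivAt
    have g4 : fderiv ℝ (fun x => fderiv ℝ F (Function.update x a (k x)) (Pi.single b 1)) 0 = _ :=
      (HasFDerivAt.comp_zero (hpart b).differentiableAt.hasFDerivAt g3 hu0).fderiv
    rw [g4, ContinuousLinearMap.comp_apply, updL_apply, h2 b (Finset.mem_insert_of_mem hb)]
    simp [hba]
  · intro x s
    simp only [hki, Function.update_idem]
  · have hpos : ∀ᶠ x in 𝓝 0, 0 < 2 * ε a * h (Function.update x a (x a - k x)) := by
      refine hhm.continuousAt.eventually (lt_mem_nhds ?_)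
      show 0 < 2 * ε a * h (Function.update 0 a ((0 : ι → ℝ) a - k 0))
      rw [hhm0]; norm_num
    filter_upwards [hpos, (tendsto_zero hm hm0).eventually hsp] with x g1 g2
    simp only [hki, Function.update_idem, Function.update_self, sub_add_cancel, Function.update_eq_self, zero_add] at g2
    rw [mul_pow, Real.sq_sqrt g1.le, g2]
    linear_combination (-(x a - k x) ^ 2 * h (Function.update x a (x a - k x))) * hε2

theorem morse {ε : ι → ℝ} (S : Finset ι) : ∀ {F : (ι → ℝ) → ℝ} (_ : AnalyticAt ℝ F 0)
    (_ : ∀ b ∈ S, |ε b| = 1)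
    (_ : ∀ b ∈ S, fderiv ℝ F 0 (Pi.single b 1) = 0)
    (_ : ∀ b ∈ S, ∀ v, fderiv ℝ (fun x => fderiv ℝ F x (Pi.single b 1)) 0 v = ε b * v b),
    ∃ (Ξ : (ι → ℝ) → ι → ℝ) (G : (ι → ℝ) → ℝ), AnalyticAt ℝ Ξ 0 ∧ Ξ 0 = 0 ∧ fderiv ℝ Ξ 0 = ContinuousLinearMap.id ℝ _ ∧
      (∀ x, ∀ c ∉ S, Ξ x c = x c) ∧ AnalyticAt ℝ G 0 ∧ (∀ b ∈ S, ∀ x s, G (Function.update x b s) = G x) ∧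
      ∀ᶠ x in 𝓝 0, F x = (∑ b ∈ S, ε b * (Ξ x b) ^ 2) / 2 + G x := by
  induction S using Finset.induction_on with
  | empty =>
    intro F hF _ _ _
    refine ⟨fun x => x, F, analyticAt_id, rfl, fderiv_id, fun _ _ _ => rfl, hF, by simp, by simp⟩
  | insert a S haS ih =>
    intro F hF hε h1 h2
    obtain ⟨G1, ξ, hG1, hξ, hξ0, hξd, hd1, hd2, hGi, hFe⟩ := morse_step haS hF hε h1 h2
    obtain ⟨Ξ, G, hΞ, hΞ0, hΞd, hΞS, hG, hGS, he⟩ := ih hG1 (fun b hb => hε b (Finset.mem_insert_of_mem hb)) hd1 hd2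
    have hu := analyticAt_update a (0:ℝ) (0 : ι → ℝ)
    have hu0 := update_zero_zero a (ι := ι)
    have hΞu : AnalyticAt ℝ (fun x => Ξ (Function.update x a 0)) 0 := analyticAt_comp_zero hΞ hu hu0
    refine ⟨fun x => Function.update (Ξ (Function.update x a 0)) a (ξ x), fun x => G (Function.update x a 0),
      analyticAt_update_fun a hΞu hξ, ?_, ?_, ?_, analyticAt_comp_zero hG hu hu0, ?_, ?_⟩
    · show Function.update (Ξ (Function.update 0 a 0)) a (ξ 0) = 0
      rw [hu0, hΞ0, hξ0, update_zero_zero]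
    · have h3 : HasFDerivAt (fun y : ι → ℝ => Function.update y a 0) (updL a (ContinuousLinearMap.id ℝ _) 0) 0 :=
        hasFDerivAt_update a (hasFDerivAt_id 0) (hasFDerivAt_const (0:ℝ) 0)
      have h4 := HasFDerivAt.comp_zero hΞ.differentiableAt.hasFDerivAt h3 hu0
      have h5 := (hasFDerivAt_update a h4 hξ.differentiableAt.hasFDerivAt).fderiv
      rw [h5]
      refine ContinuousLinearMap.ext fun v => ?_
      rw [updL_apply, hΞd, ContinuousLinearMap.comp_apply, updL_apply, hξd]
      simp
    · intro x c hc
      simp only [Finset.mem_insert, not_or] at hc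
      simp [hc.1, hΞS _ c hc.2]
    · intro b hb x s
      by_cases hba : b = a
      · subst hba; simp only [Function.update_idem]
      · have hb' := (Finset.mem_insert.1 hb).resolve_left hba
        show G _ = G _
        rw [Function.update_comm hba, hGS b hb']
    · filter_upwards [hFe, (tendsto_zero hu hu0).eventually he] with x g1 g2
      rw [hGi] at g2
      rw [g1, g2, Finset.sum_insert haS]
      have : ∑ b ∈ S, ε b * (Function.update (Ξ (Function.update x a 0)) a (ξ x) b) ^ 2 = ∑ b ∈ S, ε b * (Ξ (Function.update x a 0) b) ^ 2 := by
        refine Finset.sum_congr rfl fun b hb => ?_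
        have hba : b ≠ a := by rintro rfl; exact haS hb
        simp [hba]
      rw [this]; simp; ring

end morse2
end NambuLin

open scoped ContDiff
namespace NambuLin
open Metric Filter Topology

section core
variable {ι : Type} [Fintype ι] [DecidableEq ι]

theorem prod_rel {E : Type*} [NormedAddCommGroup E] [NormedSpace ℝ E] {f1 f2 f3 f4 : E → ℝ}
    (h1 : DifferentiableAt ℝ f1 0) (h2 : DifferentiableAt ℝ f2 0) (h3 : DifferentiableAt ℝ f3 0) (h4 : DifferentiableAt ℝ f4 0)
    (z1 : f1 0 = 0) (z2 : f2 0 = 0) (z3 : f3 0 = 0) (z4 : f4 0 = 0) (h : ∀ᶠ x in 𝓝 0, f1 x * f2 x = f3 x * f4 x) (v : E) :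
    fderiv ℝ f1 0 v * fderiv ℝ f2 0 v = fderiv ℝ f3 0 v * fderiv ℝ f4 0 v := by
  have key : ∀ f : E → ℝ, DifferentiableAt ℝ f 0 → f 0 = 0 → Tendsto (fun t : ℝ => t⁻¹ * f (t • v)) (𝓝[≠] 0) (𝓝 (fderiv ℝ f 0 v)) := by
    intro f hf z
    have hl : HasDerivAt (fun t : ℝ => t • v) v 0 := by simpa using (hasDerivAt_id (0:ℝ)).smul_const v
    have hd : HasDerivAt (fun t : ℝ => f (t • v)) (fderiv ℝ f 0 v) 0 :=
      HasFDerivAt.comp_hasDerivAt (l := f) (f := fun t : ℝ => t • v) (0:ℝ) (by rw [zero_smul]; exact hf.hasFDerivAt) hl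
    have := hd.tendsto_slope_zero
    simpa [z] using this
  have hline : Tendsto (fun t : ℝ => t • v) (𝓝[≠] 0) (𝓝 0) := by
    have hc : Continuous fun t : ℝ => t • v := by fun_prop
    have := hc.tendsto 0
    rw [zero_smul] at this
    exact this.mono_left nhdsWithin_le_nhds
  refine tendsto_nhds_unique ((key f1 h1 z1).mul (key f2 h2 z2)) ?_
  refine ((key f3 h3 z3).mul (key f4 h4 z4)).congr' ?_
  filter_upwards [hline.eventually h] with t ht
  linear_combination (-(t⁻¹) ^ 2) * ht

theorem fderiv_zero_of_Y {F : Type*} [NormedAddCommGroup F] [NormedSpace ℝ F] {Q : (ι → ℝ) → F} {X : (ι → ℝ) → ι → ℝ} (hQ : AnalyticAt ℝ (fderiv ℝ Q) 0)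
    (hX : AnalyticAt ℝ X 0) (hX0 : X 0 = 0) (h : ∀ᶠ x in 𝓝 0, fderiv ℝ Q x (X x) = 0) (v : ι → ℝ) :
    fderiv ℝ Q 0 (fderiv ℝ X 0 v) = 0 := by
  have h1 := (hQ.differentiableAt.hasFDerivAt.clm_apply hX.differentiableAt.hasFDerivAt).fderiv
  have h2 : (fun x => fderiv ℝ Q x (X x)) =ᶠ[𝓝 0] fun _ => 0 := h
  rw [h2.fderiv_eq] at h1
  have h3 := congrArg (fun L => L v) h1
  simp [hX0] at h3
  exact h3.symm

theorem clm_ext_pi {F : Type*} [NormedAddCommGroup F] [NormedSpace ℝ F] {A B : (ι → ℝ) →L[ℝ] F}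
    (h : ∀ c, A (Pi.single c 1) = B (Pi.single c 1)) : A = B := by
  refine ContinuousLinearMap.ext fun v => ?_
  rw [pi_eq_sum_univ' v]
  simp only [map_sum, map_smul]
  refine Finset.sum_congr rfl fun c _ => ?_
  rw [h]

theorem kap_slice {i j : ι} (hij : i ≠ j) {x : ι → ℝ} (hi : x i = 0) (hj : x j = 0) : kap i j x = x := by
  ext c
  unfold kap
  by_cases h1 : c = i
  · subst h1; simp [hi, hj]
  · by_cases h2 : c = j
    · subst h2; simp [h1, hj]
    · simp [h1, h2]

theorem kap_axis {i j : ι} (hij : i ≠ j) (t : ℝ) : kap i j (t • Pi.single i 1) i = t ^ 2 / 2 := by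
  unfold kap
  simp [hij.symm]

theorem tendsto_line (v : ι → ℝ) : Tendsto (fun t : ℝ => t • v) (𝓝 0) (𝓝 0) := by
  have hc : Continuous fun t : ℝ => t • v := by fun_prop
  have := hc.tendsto 0
  rwa [zero_smul] at this

/-- `DQ(0)` is the projection on the coordinates outside `T`. -/
theorem DQ_zero {T : Finset ι} {ε : ι → ℝ} {y : ι → (ι → ℝ) → ℝ}
    {Y : ι → ι → (ι → ℝ) → (ι → ℝ)} (D : NData T ε y Y) {i j : ι} (hi : i ∈ T) (hj : j ∈ T)
    (hij : i ≠ j) {φ Q : (ι → ℝ) → (ι → ℝ)} (hφ : AnalyticAt ℝ φ 0) (hφ0 : φ 0 = 0)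
      (hφd : fderiv ℝ φ 0 = ContinuousLinearMap.id ℝ _) (hQ : AnalyticAt ℝ Q 0)
      (hQY : ∀ᶠ x in 𝓝 0, ∀ a ∈ T, ∀ b ∈ T, a ≠ b → fderiv ℝ Q x (Y a b x) = 0)
      (hsl : ∀ᶠ x in 𝓝 0, (∀ k ∈ T, k ≠ i → k ≠ j → x k = 0) → Q (φ x) = kap i j x) (v : ι → ℝ) (c : ι) :
    fderiv ℝ Q 0 v c = if c ∈ T then 0 else v c := by
  have hA : ∀ a ∈ T, fderiv ℝ Q 0 (Pi.single a 1) = 0 := by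
    intro a ha
    obtain ⟨b, hb, hab⟩ : ∃ b ∈ T, a ≠ b := by
      by_cases h : a = i
      · exact ⟨j, hj, h ▸ hij⟩
      · exact ⟨i, hi, h⟩
    have h1 := fderiv_zero_of_Y hQ.fderiv (D.Y_an a ha b hb hab) (D.Y_zero a ha b hb hab) (by
      filter_upwards [hQY] with x hx
      exact hx a ha b hb hab) (Pi.single b 1)
    have h2 : fderiv ℝ (Y a b) 0 (Pi.single b 1) = ε b • (Pi.single a 1 : ι → ℝ) := by
      ext c
      by_cases hc : c ∈ T
      · rw [D.Y_deriv_T ha hb hab _ hc]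
        by_cases h : c = a
        · subst h; simp
        · simp [h, hab]
      · rw [D.Y_deriv a ha b hb hab _ c hc]
        have : c ≠ a := by rintro rfl; exact hc ha
        simp [this]
    rw [h2, map_smul] at h1
    have h3 := D.eps b hb
    exact (smul_eq_zero.1 h1).resolve_left (by intro h; rw [h] at h3; simp at h3)
  have hB : ∀ w, w ∉ T → fderiv ℝ Q 0 (Pi.single w 1) = Pi.single w 1 := by
    intro w hw
    have h1 := HasFDerivAt.comp_zero hQ.differentiableAt.hasFDerivAt hφ.differentiableAt.hasFDerivAt hφ0
    have hl : HasDerivAt (fun t : ℝ => t • (Pi.single w 1 : ι → ℝ)) (Pi.single w 1) 0 := by simpa using (hasDerivAt_id (0:ℝ)).smul_const (Pi.single w 1 : ι → ℝ)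
    have h2 := HasFDerivAt.comp_hasDerivAt (l := fun x => Q (φ x)) (f := fun t : ℝ => t • (Pi.single w 1 : ι → ℝ)) (0:ℝ) (by rw [zero_smul]; exact h1) hl
    have hwne : ∀ k ∈ T, k ≠ w := by rintro k hk rfl; exact hw hk
    have h3 : ((fun x => Q (φ x)) ∘ fun t : ℝ => t • (Pi.single w 1 : ι → ℝ)) =ᶠ[𝓝 0] fun t : ℝ => t • (Pi.single w 1 : ι → ℝ) := by
      filter_upwards [(tendsto_line (Pi.single w 1)).eventually hsl] with t ht
      show Q (φ _) = _
      rw [ht (by intro k hk _ _; simp [hwne k hk]), kap_slice hij]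
      · simp [hwne i hi]
      · simp [hwne j hj]
    have h4 := (hl.congr_of_eventuallyEq h3).unique h2
    rw [hφd] at h4
    exact h4.symm
  have : fderiv ℝ Q 0 = ContinuousLinearMap.pi fun c => if c ∈ T then 0 else ContinuousLinearMap.proj c := by
    refine clm_ext_pi fun a => ?_
    ext c
    simp only [ContinuousLinearMap.pi_apply]
    by_cases ha : a ∈ T
    · rw [hA a ha]
      split_ifs with h
      · rfl
      · have : c ≠ a := by rintro rfl; exact h ha
        simp [this]
    · rw [hB a ha]
      split_ifs with h
      · have : c ≠ a := by rintro rfl; exact ha h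
        simp [this]
      · rfl
  rw [this]
  simp only [ContinuousLinearMap.pi_apply]
  split_ifs <;> rfl

/-- linear algebra for the Hessian -/
theorem hess_lin {T : Finset ι} {ε : ι → ℝ} (hε : ∀ a ∈ T, |ε a| = 1) {i j : ι} (hi : i ∈ T) (hj : j ∈ T)
    (hij : i ≠ j) (ei : ε i = 1) {G : ι → (ι → ℝ) →L[ℝ] ℝ}
    (h : ∀ a ∈ T, ∀ b ∈ T, a ≠ b → ∀ x : ι → ℝ, (ε b * x b) * G a x = (ε a * x a) * G b x)
    (h1 : G i (Pi.single i 1) = 1) : ∀ a ∈ T, ∀ v, G a v = ε a * v a := by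
  have ne : ∀ a ∈ T, ε a ≠ 0 := by
    intro a ha h; have := hε a ha; rw [h] at this; simp at this
  have hz : ∀ a ∈ T, ∀ x : ι → ℝ, x a = 0 → G a x = 0 := by
    intro a ha x hx
    obtain ⟨b, hb, hab⟩ : ∃ b ∈ T, a ≠ b := by
      by_cases h : a = i
      · exact ⟨j, hj, h ▸ hij⟩
      · exact ⟨i, hi, h⟩
    have key : ∀ x : ι → ℝ, x a = 0 → x b ≠ 0 → G a x = 0 := by
      intro x hx hxb
      have := h a ha b hb hab x
      rw [hx, mul_zero, zero_mul] at this
      exact (mul_eq_zero.1 this).resolve_left (mul_ne_zero (ne b hb) hxb)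
    by_cases hxb : x b = 0
    · have k1 := key (x + Pi.single b 1) (by simp [hx, hab]) (by simp [hxb])
      have k2 := key (Pi.single b 1) (by simp [hab]) (by simp)
      rw [map_add, k2, add_zero] at k1
      exact k1
    · exact key x hx hxb
  have hs : ∀ a ∈ T, ∀ x : ι → ℝ, G a x = G a (Pi.single a 1) * x a := by
    intro a ha x
    have := hz a ha (x - x a • Pi.single a 1) (by simp)
    rw [map_sub, map_smul] at this
    simp only [smul_eq_mul] at this
    linarith
  intro a ha v
  rw [hs a ha]
  congr 1
  by_cases hai : a = i
  · rw [hai, h1, ei]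
  · have := h a ha i hi hai (Pi.single a 1 + Pi.single i 1)
    rw [hs a ha (Pi.single a 1 + Pi.single i 1), hs i hi (Pi.single a 1 + Pi.single i 1), h1, ei] at this
    simp [hai, Ne.symm hai] at this
    exact this

end core
end NambuLin

open scoped ContDiff
namespace NambuLin
open Metric Filter Topology

section core2
variable {ι : Type} [Fintype ι] [DecidableEq ι]

theorem core {T : Finset ι} {ε : ι → ℝ} {y : ι → (ι → ℝ) → ℝ}
    {Y : ι → ι → (ι → ℝ) → (ι → ℝ)} (D : NData T ε y Y) {i j l : ι} (hi : i ∈ T) (hj : j ∈ T)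
    (hl : l ∈ T) (hij : i ≠ j) (hil : i ≠ l) (hjl : j ≠ l) (ei : ε i = 1) (ej : ε j = 1) :
    ∃ Φ : (ι → ℝ) → (ι → ℝ), AnalyticAt ℝ Φ 0 ∧ Φ 0 = 0 ∧
      fderiv ℝ Φ 0 = ContinuousLinearMap.id ℝ _ ∧
      ∀ᶠ x in 𝓝 0, ∀ a ∈ T, ∀ b ∈ T, a ≠ b → (∀ w, w ∉ T → fderiv ℝ Φ x (Y a b x) w = 0) ∧
        ∑ c ∈ T, ε c * Φ x c * fderiv ℝ Φ x (Y a b x) c = 0 := by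
  obtain ⟨φ, Q, hφ, hφ0, hφd, hQ, hQ0, hQY, -, hsl⟩ := stage2 D hi hj hl hij hil hjl ei ej
  have hDQ := DQ_zero D hi hj hij hφ hφ0 hφd hQ hQY hsl
  -- χ
  let χ : (ι → ℝ) → (ι → ℝ) := fun x c => if c ∈ T then x c else Q x c
  have hχT : ∀ x, ∀ c ∈ T, χ x c = x c := fun x c hc => if_pos hc
  have hχN : ∀ x, ∀ c, c ∉ T → χ x c = Q x c := fun x c hc => if_neg hc
  have hχ : AnalyticAt ℝ χ 0 := by
    rw [analyticAt_pi_iff]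
    intro c
    by_cases hc : c ∈ T
    · simp only [χ, if_pos hc]; exact analyticAt_eval c 0
    · simp only [χ, if_neg hc]; exact analyticAt_coord hQ c
  have hχ0 : χ 0 = 0 := by
    ext c
    by_cases hc : c ∈ T
    · simp [χ, hc]
    · simp [χ, hc, hQ0]
  have hχc : ∀ x, DifferentiableAt ℝ χ x → DifferentiableAt ℝ Q x → ∀ v c, fderiv ℝ χ x v c = if c ∈ T then v c else fderiv ℝ Q x v c := by
    intro x h1 h2 v c
    rw [← fderiv_coord h1]
    by_cases hc : c ∈ T
    · simp only [χ, if_pos hc]; exact fderiv_eval c x v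
    · simp only [χ, if_neg hc]; exact fderiv_coord h2 v c
  have hχd : fderiv ℝ χ 0 = ContinuousLinearMap.id ℝ _ := by
    refine ContinuousLinearMap.ext fun v => ?_
    ext c
    rw [hχc 0 hχ.differentiableAt hQ.differentiableAt, hDQ]
    split_ifs <;> rfl
  obtain ⟨θ, hθ, hθ0, hθχ, hχθ⟩ := local_inverse hχ hχ0 (ContinuousLinearEquiv.refl ℝ _) hχd
  have tχ := tendsto_zero hχ hχ0
  have tθ := tendsto_zero hθ hθ0
  have hinv := inv_deriv hχ hχ0 hθ hθχ hχθ
  -- derivative of χ along Y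
  have hχY : ∀ᶠ x in 𝓝 0, ∀ a ∈ T, ∀ b ∈ T, a ≠ b → fderiv ℝ χ x (Y a b x) =
      y b x • (Pi.single a 1 : ι → ℝ) - y a x • (Pi.single b 1 : ι → ℝ) := by
    have hYT : ∀ᶠ x in 𝓝 0, ∀ a ∈ T, ∀ b ∈ T, a ≠ b → ∀ c ∈ T,
        Y a b x c = if c = a then y b x else if c = b then - y a x else 0 := by
      rw [Filter.eventually_all_finset]; intro a ha
      rw [Filter.eventually_all_finset]; intro b hb
      rw [Filter.eventually_all]; intro hab
      exact D.Y_T a ha b hb hab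
    filter_upwards [hYT, hQY, eventually_analyticAt' hχ, eventually_analyticAt' hQ] with x h1 h2 h3 h4 a ha b hb hab
    ext c
    rw [hχc x h3.differentiableAt h4.differentiableAt, h2 a ha b hb hab]
    split_ifs with hc
    · rw [h1 a ha b hb hab c hc]
      by_cases g1 : c = a
      · subst g1; simp [hab]
      · by_cases g2 : c = b
        · subst g2; simp [g1]
        · simp [g1, g2]
    · have g1 : c ≠ a := by rintro rfl; exact hc ha
      have g2 : c ≠ b := by rintro rfl; exact hc hb
      simp [g1, g2]
  -- F
  have hθd : fderiv ℝ θ 0 = ContinuousLinearMap.id ℝ _ := by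
    have := hinv.self_of_nhds.2.2.2.1
    rw [hχ0, hχd] at this
    exact ContinuousLinearMap.ext this
  have hQi : AnalyticAt ℝ (fun x => Q x i) 0 := analyticAt_coord hQ i
  let F : (ι → ℝ) → ℝ := fun z => Q (θ z) i
  have hF : AnalyticAt ℝ F 0 := analyticAt_comp_zero hQi hθ hθ0
  have hFd : fderiv ℝ F 0 = 0 := by
    have h1 : fderiv ℝ F 0 = _ := (HasFDerivAt.comp_zero hQi.differentiableAt.hasFDerivAt hθ.differentiableAt.hasFDerivAt hθ0).fderiv
    rw [h1, hθd]
    refine ContinuousLinearMap.ext fun v => ?_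
    show fderiv ℝ (fun x => Q x i) 0 v = 0
    rw [fderiv_coord hQ.differentiableAt, hDQ, if_pos hi]
  have hFχ : ∀ᶠ x in 𝓝 0, F (χ x) = Q x i := by
    filter_upwards [hθχ] with x hx
    show Q (θ (χ x)) i = _
    rw [hx]
  have hFrel : ∀ᶠ x in 𝓝 0, ∀ a ∈ T, ∀ b ∈ T, a ≠ b →
      y b x * fderiv ℝ F (χ x) (Pi.single a 1) = y a x * fderiv ℝ F (χ x) (Pi.single b 1) := by
    filter_upwards [hFχ.eventually_nhds, hQY, hχY, eventually_analyticAt' hχ, tχ.eventually (eventually_analyticAt' hF), eventually_analyticAt' hQ]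
      with x h1 h2 h3 h4 h5 h6 a ha b hb hab
    have g1 : fderiv ℝ (fun x => F (χ x)) x = _ :=
      (HasFDerivAt.comp (g := F) (f := χ) x h5.differentiableAt.hasFDerivAt h4.differentiableAt.hasFDerivAt).fderiv
    have g2 : (fun x => F (χ x)) =ᶠ[𝓝 x] fun x => Q x i := h1
    rw [g2.fderiv_eq] at g1
    have g3 := congrArg (fun L => L (Y a b x)) g1
    have g4 : fderiv ℝ (fun x => Q x i) x (Y a b x) = fderiv ℝ F (χ x) (fderiv ℝ χ x (Y a b x)) := g3
    rw [fderiv_coord h6.differentiableAt, h2 a ha b hb hab, h3 a ha b hb hab, map_sub, map_smul, map_smul] at g4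
    simp only [smul_eq_mul, Pi.zero_apply] at g4
    linarith
  have hpart : ∀ b, AnalyticAt ℝ (fun x => fderiv ℝ F x (Pi.single b 1)) 0 := fun b =>
    analyticAt_clm_apply hF.fderiv analyticAt_const
  have hp0 : ∀ b, fderiv ℝ F 0 (Pi.single b 1) = 0 := fun b => by rw [hFd]; rfl
  -- Hessian
  have hH1 : ∀ a ∈ T, ∀ b ∈ T, a ≠ b → ∀ x : ι → ℝ,
      (ε b * x b) * fderiv ℝ (fun x => fderiv ℝ F x (Pi.single a 1)) 0 x = (ε a * x a) * fderiv ℝ (fun x => fderiv ℝ F x (Pi.single b 1)) 0 x := by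
    intro a ha b hb hab v
    have hd : ∀ c, fderiv ℝ (fun x => fderiv ℝ F (χ x) (Pi.single c 1)) 0 = fderiv ℝ (fun x => fderiv ℝ F x (Pi.single c 1)) 0 := by
      intro c
      have h1 : fderiv ℝ (fun x => fderiv ℝ F (χ x) (Pi.single c 1)) 0 = _ :=
        (HasFDerivAt.comp_zero (hpart c).differentiableAt.hasFDerivAt hχ.differentiableAt.hasFDerivAt hχ0).fderiv
      rw [h1, hχd]; rfl
    have hda : ∀ c, DifferentiableAt ℝ (fun x => fderiv ℝ F (χ x) (Pi.single c 1)) 0 := fun c =>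
      (analyticAt_comp_zero (hpart c) hχ hχ0).differentiableAt
    have := prod_rel (D.y_an b hb).differentiableAt (hda a) (D.y_an a ha).differentiableAt (hda b) (D.y_zero b hb)
      (by rw [hχ0]; exact hp0 a) (D.y_zero a ha) (by rw [hχ0]; exact hp0 b) (by
        filter_upwards [hFrel] with x hx
        exact hx a ha b hb hab) v
    rw [D.y_deriv a ha, D.y_deriv b hb, hd, hd] at this
    exact this
  have hH2 : fderiv ℝ (fun x => fderiv ℝ F x (Pi.single i 1)) 0 (Pi.single i 1) = 1 := by
    let R : (ι → ℝ) → (ι → ℝ) := fun x => χ (φ x)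
    have hR : AnalyticAt ℝ R 0 := analyticAt_comp_zero hχ hφ hφ0
    have hR0 : R 0 = 0 := by show χ (φ 0) = 0; rw [hφ0, hχ0]
    have hRd : fderiv ℝ R 0 = ContinuousLinearMap.id ℝ _ := by
      have h1 : fderiv ℝ R 0 = _ :=
        (HasFDerivAt.comp_zero hχ.differentiableAt.hasFDerivAt hφ.differentiableAt.hasFDerivAt hφ0).fderiv
      rw [h1, hχd, hφd]; rfl
    let e : ι → ℝ := Pi.single i 1
    have hlt : ∀ t : ℝ, HasDerivAt (fun t : ℝ => t • e) e t := fun t => by simpa using (hasDerivAt_id t).smul_const e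
    have tl := tendsto_line e
    have hFR : ∀ᶠ t : ℝ in 𝓝 0, F (R (t • e)) = t ^ 2 / 2 := by
      filter_upwards [tl.eventually hsl, tl.eventually ((tendsto_zero hφ hφ0).eventually hFχ)] with t h1 h2
      show F (χ (φ _)) = _
      rw [h2, h1]
      · exact kap_axis hij t
      · intro k _ hk _; simp [e, hk]
    have hFR' : ∀ᶠ t : ℝ in 𝓝 0, fderiv ℝ F (R (t • e)) (fderiv ℝ R (t • e) e) = t := by
      filter_upwards [hFR.eventually_nhds, tl.eventually (eventually_analyticAt' hR),
        tl.eventually ((tendsto_zero hR hR0).eventually (eventually_analyticAt' hF))] with t h1 h2 h3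
      have g1 := HasFDerivAt.comp (g := F) (f := R) (t • e) h3.differentiableAt.hasFDerivAt h2.differentiableAt.hasFDerivAt
      have g2 := HasFDerivAt.comp_hasDerivAt (l := F ∘ R) (f := fun t : ℝ => t • e) t g1 (hlt t)
      have g3 : ((F ∘ R) ∘ fun t : ℝ => t • e) =ᶠ[𝓝 t] fun t => t ^ 2 / 2 := h1
      have g4 : HasDerivAt (fun t : ℝ => t ^ 2 / 2) t t := by
        have := (hasDerivAt_pow 2 t).div_const 2
        simpa using this
      exact g2.unique (g4.congr_of_eventuallyEq g3)
    have k1 : HasFDerivAt (fun x => fderiv ℝ F (R x)) (fderiv ℝ (fderiv ℝ F) 0 ∘L fderiv ℝ R 0) 0 :=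
      HasFDerivAt.comp_zero hF.fderiv.differentiableAt.hasFDerivAt hR.differentiableAt.hasFDerivAt hR0
    have k2 : HasFDerivAt (fun x => fderiv ℝ R x e) (fderiv ℝ (fun x => fderiv ℝ R x e) 0) 0 :=
      (analyticAt_clm_apply hR.fderiv analyticAt_const).differentiableAt.hasFDerivAt
    have k3 := k1.clm_apply k2
    have k4 := HasFDerivAt.comp_hasDerivAt (l := fun x => fderiv ℝ F (R x) (fderiv ℝ R x e)) (f := fun t : ℝ => t • e) (0:ℝ)
      (by rw [zero_smul]; exact k3) (hlt 0)
    have k5 : ((fun x => fderiv ℝ F (R x) (fderiv ℝ R x e)) ∘ fun t : ℝ => t • e) =ᶠ[𝓝 0] fun t => t := hFR'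
    have k6 := k4.unique ((hasDerivAt_id (0:ℝ)).congr_of_eventuallyEq k5)
    rw [hR0, hFd, hRd] at k6
    simp at k6
    have k7 : fderiv ℝ (fun x => fderiv ℝ F x e) 0 = _ := (hF.fderiv.differentiableAt.hasFDerivAt.clm_apply (hasFDerivAt_const e 0)).fderiv
    rw [show (Pi.single i 1 : ι → ℝ) = e from rfl, k7]
    simpa using k6
  have hH := hess_lin D.eps hi hj hij ei (G := fun a => fderiv ℝ (fun x => fderiv ℝ F x (Pi.single a 1)) 0) hH1 hH2
  obtain ⟨Ξ, G, hΞ, hΞ0, hΞd, hΞN, hG, hGi, hFe⟩ := morse T hF D.eps (fun b _ => hp0 b) hH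
  have hΦ : AnalyticAt ℝ (fun x => Ξ (χ x)) 0 := analyticAt_comp_zero hΞ hχ hχ0
  refine ⟨fun x => Ξ (χ x), hΦ, by show Ξ (χ 0) = 0; rw [hχ0, hΞ0], ?_, ?_⟩
  · have h1 : fderiv ℝ (fun x => Ξ (χ x)) 0 = _ :=
      (HasFDerivAt.comp_zero hΞ.differentiableAt.hasFDerivAt hχ.differentiableAt.hasFDerivAt hχ0).fderiv
    rw [h1, hΞd, hχd]; rfl
  · have hQe : ∀ᶠ x in 𝓝 0, Q x i = (∑ b ∈ T, ε b * (Ξ (χ x) b) ^ 2) / 2 + G (χ x) := by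
      filter_upwards [tχ.eventually hFe, hFχ] with x h1 h2
      rw [← h2, h1]
    filter_upwards [hQe.eventually_nhds, hQY, hχY, eventually_analyticAt' hΦ, eventually_analyticAt' hQ, eventually_analyticAt' hχ,
      tχ.eventually (eventually_analyticAt' hG)] with x h1 h2 h3 h4 h5 h6 h7 a ha b hb hab
    constructor
    · intro w hw
      rw [← fderiv_coord h4.differentiableAt]
      have : (fun x => Ξ (χ x) w) = fun x => Q x w := by
        ext1 x; rw [hΞN _ w hw, hχN x w hw]
      rw [this, fderiv_coord h5.differentiableAt, h2 a ha b hb hab]; rfl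
    · have g1 : HasFDerivAt (fun x => ∑ b ∈ T, ε b * (Ξ (χ x) b) ^ 2) (∑ b ∈ T, ε b • ((2 * Ξ (χ x) b) • fderiv ℝ (fun x => Ξ (χ x) b) x)) x := by
        refine HasFDerivAt.fun_sum fun c _ => ?_
        have := (hasFDerivAt_coord h4.differentiableAt.hasFDerivAt c).pow 2
        have h8 : DifferentiableAt ℝ (fun x => Ξ (χ x) c) x := (analyticAt_coord h4 c).differentiableAt
        have := (h8.hasFDerivAt.pow 2).const_mul (ε c)
        simpa using this
      have g2 : HasFDerivAt (fun x => G (χ x)) _ x := HasFDerivAt.comp (g := G) (f := χ) x h7.differentiableAt.hasFDerivAt h6.differentiableAt.hasFDerivAt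
      have g3 := ((g1.mul_const (2⁻¹ : ℝ)).add g2).fderiv
      have g4 : (fun x => Q x i) =ᶠ[𝓝 x] ((fun x => (∑ b ∈ T, ε b * (Ξ (χ x) b) ^ 2) * 2⁻¹) + fun x => G (χ x)) := h1
      rw [← g4.fderiv_eq] at g3
      have g5 := congrArg (fun L => L (Y a b x)) g3
      simp only [ContinuousLinearMap.add_apply, ContinuousLinearMap.smul_apply, ContinuousLinearMap.sum_apply,
        ContinuousLinearMap.comp_apply, smul_eq_mul] at g5
      rw [fderiv_coord h5.differentiableAt, h2 a ha b hb hab, h3 a ha b hb hab, map_sub, map_smul, map_smul,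
        indep_deriv (hGi a ha) h7.differentiableAt, indep_deriv (hGi b hb) h7.differentiableAt] at g5
      simp only [smul_zero, sub_zero, add_zero, Pi.zero_apply, Finset.mul_sum] at g5
      rw [g5]
      refine Finset.sum_congr rfl fun c _ => ?_
      rw [fderiv_coord h4.differentiableAt]
      ring

end core2
end NambuLin

open scoped ContDiff
namespace NambuLin

section cb
variable {n q : ℕ}

/-- the increasing enumeration of a multi-index -/
noncomputable def oe (J : Idx n q) : Fin q → Fin n := J.1.orderEmbOfFin J.2

theorem oe_inj (J : Idx n q) : Function.Injective (oe J) := (J.1.orderEmbOfFin J.2).injective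

theorem oe_mem (J : Idx n q) (k : Fin q) : oe J k ∈ J.1 := Finset.orderEmbOfFin_mem _ _ _

theorem oe_surj (J : Idx n q) {c : Fin n} (hc : c ∈ J.1) : ∃ k, oe J k = c := by
  have : c ∈ Set.range (J.1.orderEmbOfFin J.2) := by rw [Finset.range_orderEmbOfFin]; exact hc
  exact this

theorem exists_perm (J : Idx n q) {σ : Fin q → Fin n} (hσ : Function.Injective σ) (hJ : ∀ k, σ k ∈ J.1) :
    ∃ π : Equiv.Perm (Fin q), ∀ k, oe J (π k) = σ k := by
  choose p hp using fun k => oe_surj J (hJ k)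
  have hpi : Function.Injective p := fun a b h => hσ (by rw [← hp a, ← hp b, h])
  exact ⟨Equiv.ofBijective p (Finite.injective_iff_bijective.1 hpi), hp⟩

/-- Coordinates of the wedge product of the columns of `M`. -/
noncomputable def wedge (M : Matrix (Fin n) (Fin q) ℝ) : MultiVec n q := fun J => (M.submatrix (oe J) id).det

theorem det_mul_expand (N : Matrix (Fin q) (Fin n) ℝ) (X : Matrix (Fin n) (Fin q) ℝ) :
    (N * X).det = ∑ f : Fin q → Fin n, (∏ i, N i (f i)) * (X.submatrix f id).det := by
  have h : (N * X : Matrix (Fin q) (Fin q) ℝ) = fun i => ∑ c : Fin n, N i c • X c := by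
    ext i j
    simp [Matrix.mul_apply]
  rw [h]
  have := (Matrix.detRowAlternating (n := Fin q) (R := ℝ)).toMultilinearMap.map_sum (fun i c => N i c • X c)
  refine this.trans ?_
  refine Finset.sum_congr rfl fun f _ => ?_
  have := (Matrix.detRowAlternating (n := Fin q) (R := ℝ)).toMultilinearMap.map_smul_univ (fun i => N i (f i)) (fun i => X (f i))
  exact this

theorem cauchy_binet (N : Matrix (Fin q) (Fin n) ℝ) (X : Matrix (Fin n) (Fin q) ℝ) :
    (N * X).det = ∑ I : Idx n q, (N.submatrix id (oe I)).det * (X.submatrix (oe I) id).det := by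
  classical
  rw [det_mul_expand]
  have h1 : ∀ I : Idx n q, (N.submatrix id (oe I)).det * (X.submatrix (oe I) id).det =
      ∑ π : Equiv.Perm (Fin q), (∏ i, N i (oe I (π i))) * (X.submatrix (fun k => oe I (π k)) id).det := by
    intro I
    rw [← Matrix.det_transpose (N.submatrix id (oe I)), Matrix.det_apply', Finset.sum_mul]
    refine Finset.sum_congr rfl fun π _ => ?_
    have : (X.submatrix (fun k => oe I (π k)) id).det = Equiv.Perm.sign π * (X.submatrix (oe I) id).det := by
      have := Matrix.det_permute π (X.submatrix (oe I) id)
      rw [← this]; rfl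
    rw [this]
    simp only [Matrix.transpose_apply, Matrix.submatrix_apply, id]
    ring
  simp_rw [h1]
  rw [Finset.sum_sigma']
  symm
  refine Finset.sum_of_injOn (fun z k => oe z.1 (z.2 k)) ?_ (by intro _ _; simp) ?_ (fun _ _ => rfl)
  · rintro ⟨I, π⟩ _ ⟨J, τ⟩ _ h
    have hIJ : I = J := by
      apply Subtype.ext
      refine Finset.eq_of_subset_of_card_le ?_ (by rw [I.2, J.2])
      intro c hc
      obtain ⟨k, hk⟩ := oe_surj I hc
      have := congrFun h (π.symm k)
      simp only [Equiv.apply_symm_apply] at this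
      rw [← hk, this]
      exact oe_mem J _
    subst hIJ
    congr 1
    ext k
    have := congrFun h k
    rw [oe_inj I this]
  · intro f _ hf
    by_cases hinj : Function.Injective f
    · exfalso; apply hf
      let J : Idx n q := ⟨Finset.univ.image f, by rw [Finset.card_image_of_injective _ hinj]; simp⟩
      obtain ⟨π, hπ⟩ := exists_perm J hinj (fun k => Finset.mem_image_of_mem _ (Finset.mem_univ k))
      exact ⟨⟨J, π⟩, by simp, funext hπ⟩
    · simp only [Function.Injective, not_forall] at hinj
      obtain ⟨a, b, hab, hne⟩ := hinj
      rw [Matrix.det_zero_of_row_eq (M := X.submatrix f id) hne (by ext j; simp [hab]), mul_zero]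

theorem extPow_wedge (A : Matrix (Fin n) (Fin n) ℝ) (M : Matrix (Fin n) (Fin q) ℝ) :
    extPow n q A (wedge M) = wedge (A * M) := by
  ext J
  have h := cauchy_binet (A.submatrix (oe J) id) M
  show _ = ((A * M).submatrix (oe J) id).det
  have e : (A * M).submatrix (oe J) id = A.submatrix (oe J) id * M := by
    ext a b; simp [Matrix.mul_apply]
  rw [e, h]
  rfl

theorem det_one_sub (K I : Idx n q) : ((1 : Matrix (Fin n) (Fin n) ℝ).submatrix (oe K) (oe I)).det = if K = I then 1 else 0 := by
  split_ifs with h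
  · subst h
    rw [Matrix.submatrix_one _ (oe_inj K), Matrix.det_one]
  · obtain ⟨c, hc, hcI⟩ : ∃ c ∈ K.1, c ∉ I.1 := by
      by_contra hcon
      push Not at hcon
      exact h (Subtype.ext (Finset.eq_of_subset_of_card_le hcon (by rw [I.2, K.2])))
    obtain ⟨k, hk⟩ := oe_surj K hc
    refine Matrix.det_eq_zero_of_row_eq_zero k fun j => ?_
    rw [Matrix.submatrix_apply, hk, Matrix.one_apply_ne]
    rintro rfl
    exact hcI (oe_mem I j)

theorem extPow_inv {A B : Matrix (Fin n) (Fin n) ℝ} (hBA : B * A = 1) (w : MultiVec n q) :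
    extPow n q B (extPow n q A w) = w := by
  ext K
  show ∑ J : Idx n q, (B.submatrix (oe K) (oe J)).det * (∑ I : Idx n q, (A.submatrix (oe J) (oe I)).det * w I) = w K
  simp_rw [Finset.mul_sum]
  rw [Finset.sum_comm]
  have h : ∀ I : Idx n q, ∑ J : Idx n q, (B.submatrix (oe K) (oe J)).det * ((A.submatrix (oe J) (oe I)).det * w I) = (if K = I then 1 else 0) * w I := by
    intro I
    simp_rw [← mul_assoc]
    rw [← Finset.sum_mul, ← det_one_sub, ← hBA]
    have := cauchy_binet (B.submatrix (oe K) id) (A.submatrix id (oe I))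
    have e : (B * A).submatrix (oe K) (oe I) = B.submatrix (oe K) id * A.submatrix id (oe I) := by
      ext a b; simp [Matrix.mul_apply]
    rw [e, this]
    rfl
  simp_rw [h]
  simp

theorem alt_exists [Nonempty (Idx n q)] (σ : Fin q → Fin n) : ∃ (s : ℝ) (J : Idx n q), (s = 0 ∨ ∀ k, σ k ∈ J.1) ∧
    ∀ M : Matrix (Fin n) (Fin q) ℝ, (M.submatrix σ id).det = s * wedge M J := by
  classical
  by_cases hinj : Function.Injective σ
  · let J : Idx n q := ⟨Finset.univ.image σ, by rw [Finset.card_image_of_injective _ hinj]; simp⟩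
    have hJ : ∀ k, σ k ∈ J.1 := fun k => Finset.mem_image_of_mem _ (Finset.mem_univ k)
    obtain ⟨π, hπ⟩ := exists_perm J hinj hJ
    refine ⟨Equiv.Perm.sign π, J, Or.inr hJ, fun M => ?_⟩
    have := Matrix.det_permute π (M.submatrix (oe J) id)
    rw [wedge, ← this]
    congr 1
    ext a b
    simp [hπ]
  · refine ⟨0, Classical.arbitrary _, Or.inl rfl, fun M => ?_⟩
    simp only [Function.Injective, not_forall] at hinj
    obtain ⟨a, b, hab, hne⟩ := hinj
    rw [Matrix.det_zero_of_row_eq (M := M.submatrix σ id) hne (by ext j; simp [hab]), zero_mul]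

end cb
end NambuLin

open scoped ContDiff
namespace NambuLin

section dec
variable {n q : ℕ}

def bord (v : Fin (q + 1) → ℝ) (N : Matrix (Fin (q + 1)) (Fin q) ℝ) : Matrix (Fin (q + 1)) (Fin (q + 1)) ℝ :=
  Matrix.of fun i => (Fin.cons (v i) (N i) : Fin (q + 1) → ℝ)

theorem bord_zero (v : Fin (q + 1) → ℝ) (N : Matrix (Fin (q + 1)) (Fin q) ℝ) (i : Fin (q + 1)) : bord v N i 0 = v i := rfl
theorem bord_succ (v : Fin (q + 1) → ℝ) (N : Matrix (Fin (q + 1)) (Fin q) ℝ) (i : Fin (q + 1)) (j : Fin q) : bord v N i j.succ = N i j := rfl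

theorem laplace (N : Matrix (Fin (q + 1)) (Fin q) ℝ) (v : Fin (q + 1) → ℝ) :
    (bord v N).det =
      ∑ a : Fin (q + 1), ((-1 : ℝ) ^ (a : ℕ) * (N.submatrix a.succAbove id).det) * v a := by
  rw [Matrix.det_succ_column_zero]
  refine Finset.sum_congr rfl fun a _ => ?_
  have : (bord v N).submatrix a.succAbove Fin.succ = N.submatrix a.succAbove id := by
    ext i j; simp [bord_succ]
  rw [this, bord_zero]
  ring

theorem laplace_zero (N : Matrix (Fin (q + 1)) (Fin q) ℝ) (κ : Fin q → ℝ) :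
    ∑ a : Fin (q + 1), ((-1 : ℝ) ^ (a : ℕ) * (N.submatrix a.succAbove id).det) * (N.mulVec κ) a = 0 := by
  have h : ∀ k, ∑ a : Fin (q + 1), ((-1 : ℝ) ^ (a : ℕ) * (N.submatrix a.succAbove id).det) * N a k = 0 := by
    intro k
    rw [← laplace N (fun a => N a k)]
    refine Matrix.det_zero_of_column_eq (i := 0) (j := k.succ) (Fin.succ_ne_zero k).symm fun i => ?_
    rw [bord_zero, bord_succ]
  simp only [Matrix.mulVec, dotProduct, Finset.mul_sum]
  rw [Finset.sum_comm]
  refine Finset.sum_eq_zero fun k _ => ?_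
  have := h k
  calc _ = (∑ a : Fin (q + 1), ((-1 : ℝ) ^ (a : ℕ) * (N.submatrix a.succAbove id).det) * N a k) * κ k := by
        rw [Finset.sum_mul]; exact Finset.sum_congr rfl fun a _ => by ring
    _ = 0 := by rw [this, zero_mul]

theorem laplace_swap (N : Matrix (Fin (q + 1)) (Fin q) ℝ) {a b : Fin (q + 1)} (hab : a ≠ b) :
    (-1 : ℝ) ^ (b : ℕ) * (N.submatrix (fun k => Equiv.swap a b (b.succAbove k)) id).det =
     - ((-1 : ℝ) ^ (a : ℕ) * (N.submatrix a.succAbove id).det) := by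
  have h1 := laplace N (Pi.single a 1)
  have h2 := laplace (N.submatrix (Equiv.swap a b) id) (Pi.single b 1)
  have h3 := Matrix.det_permute (Equiv.swap a b) (bord (Pi.single a 1) N)
  have h4 : (bord (Pi.single b 1) (N.submatrix (Equiv.swap a b) id))
     = (bord (Pi.single a 1) N).submatrix (Equiv.swap a b) id := by
    ext i j
    refine Fin.cases ?_ (fun j => ?_) j
    · simp only [bord_zero, Matrix.submatrix_apply, id]
      rw [Pi.single_apply, Pi.single_apply]
      congr 1
      rw [Equiv.swap_apply_eq_iff, Equiv.swap_apply_left]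
    · simp [bord_succ]
  rw [h4, h3, h1] at h2
  simp only [Pi.single_apply, mul_ite, mul_one, mul_zero, Finset.sum_ite_eq', Finset.mem_univ, if_true,
    Equiv.Perm.sign_swap hab] at h2
  rw [Matrix.submatrix_submatrix] at h2
  simp at h2
  rw [show (fun k => Equiv.swap a b (b.succAbove k)) = (Equiv.swap a b) ∘ b.succAbove from rfl]
  linarith

/-- embedding of the top indices -/
def tt (hn : q < n) (a : Fin (q + 1)) : Fin n := Fin.castLE hn a

theorem tt_inj (hn : q < n) {a b : Fin (q + 1)} : tt hn a = tt hn b ↔ a = b := by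
  simp [tt]

theorem tt_mem (hn : q < n) (a : Fin (q + 1)) : tt hn a ∈ topIdx n q := by
  have := a.2
  simp [tt, topIdx]; omega

theorem mem_top {c : Fin n} : c ∈ topIdx n q ↔ (c : ℕ) < q + 1 := by simp [topIdx]

theorem exists_tt (hn : q < n) {c : Fin n} (hc : c ∈ topIdx n q) : ∃ a, tt hn a = c :=
  ⟨⟨c, mem_top.1 hc⟩, by ext; simp [tt]⟩

theorem card_top (hn : q < n) : (topIdx n q).card = q + 1 := by
  have : topIdx n q = Finset.univ.image (tt hn) := by
    ext c
    constructor
    · intro hc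
      obtain ⟨a, rfl⟩ := exists_tt hn hc
      exact Finset.mem_image_of_mem _ (Finset.mem_univ a)
    · intro hc
      obtain ⟨a, -, rfl⟩ := Finset.mem_image.1 hc
      exact tt_mem hn a
  rw [this, Finset.card_image_of_injective _ (fun a b h => (tt_inj hn).1 h)]
  simp

/-- the multi-index `T ∖ {a}` -/
def Jb (hn : q < n) (a : Fin (q + 1)) : Idx n q := ⟨(topIdx n q).erase (tt hn a), by
  rw [Finset.card_erase_of_mem (tt_mem hn a), card_top hn]; rfl⟩

theorem oe_Jb (hn : q < n) (a : Fin (q + 1)) : oe (Jb hn a) = fun k => tt hn (a.succAbove k) := by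
  symm
  refine Finset.orderEmbOfFin_unique (Jb hn a).2 (fun k => ?_) ?_
  · refine Finset.mem_erase.2 ⟨?_, tt_mem hn _⟩
    rw [Ne, tt_inj]
    exact Fin.succAbove_ne a k
  · intro k l hkl
    have := (Fin.strictMono_succAbove a) hkl
    exact this

noncomputable def yv (hn : q < n) (w : MultiVec n q) (a : Fin (q + 1)) : ℝ := (-1) ^ (a : ℕ) * w (Jb hn a)

theorem yv_wedge (hn : q < n) (M : Matrix (Fin n) (Fin q) ℝ) (a : Fin (q + 1)) :
    yv hn (wedge M) a = (-1) ^ (a : ℕ) * ((M.submatrix (tt hn) id).submatrix a.succAbove id).det := by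
  rw [yv, wedge, oe_Jb]; rfl

theorem yv_rel (hn : q < n) (M : Matrix (Fin n) (Fin q) ℝ) (κ : Fin q → ℝ) :
    ∑ a, yv hn (wedge M) a * (M.mulVec κ) (tt hn a) = 0 := by
  simp_rw [yv_wedge]
  exact laplace_zero (M.submatrix (tt hn) id) κ

theorem nonempty_idx (hn : q < n) : Nonempty (Idx n q) := ⟨Jb hn 0⟩

def sg (hn : q < n) (a b : Fin (q + 1)) (c : Fin n) : Fin q → Fin n :=
  fun k => if b.succAbove k = a then c else tt hn (b.succAbove k)

noncomputable def aS (hn : q < n) (σ : Fin q → Fin n) : ℝ := (@alt_exists n q (nonempty_idx hn) σ).choose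
noncomputable def aJ (hn : q < n) (σ : Fin q → Fin n) : Idx n q := (@alt_exists n q (nonempty_idx hn) σ).choose_spec.choose

theorem aSJ (hn : q < n) (σ : Fin q → Fin n) : (aS hn σ = 0 ∨ ∀ k, σ k ∈ (aJ hn σ).1) ∧
    ∀ M : Matrix (Fin n) (Fin q) ℝ, (M.submatrix σ id).det = aS hn σ * wedge M (aJ hn σ) :=
  (@alt_exists n q (nonempty_idx hn) σ).choose_spec.choose_spec

noncomputable def Yv (hn : q < n) (w : MultiVec n q) (a b : Fin (q + 1)) (c : Fin n) : ℝ :=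
  if c ∈ topIdx n q then (if c = tt hn a then yv hn w b else if c = tt hn b then - yv hn w a else 0)
  else (-1) ^ (b : ℕ) * (aS hn (sg hn a b c) * w (aJ hn (sg hn a b c)))

theorem Yv_wedge (hn : q < n) (M : Matrix (Fin n) (Fin q) ℝ) {a b : Fin (q + 1)} (hab : a ≠ b) :
    ∃ κ, Yv hn (wedge M) a b = M.mulVec κ := by
  obtain ⟨a', ha'⟩ := Fin.exists_succAbove_eq hab
  let N : Matrix (Fin q) (Fin q) ℝ := M.submatrix (fun k => tt hn (b.succAbove k)) id
  let κ : Fin q → ℝ := fun k => (-1) ^ (b : ℕ) * Matrix.cramer N.transpose (Pi.single k 1) a'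
  have h1 : ∀ c, M.mulVec κ c = (-1) ^ (b : ℕ) * (M.submatrix (sg hn a b c) id).det := by
    intro c
    have e1 : M.submatrix (sg hn a b c) id = N.updateRow a' (M c) := by
      ext i j
      by_cases h : i = a'
      · subst h; simp [sg, ha']
      · have : b.succAbove i ≠ a := by
          rw [← ha']; exact fun hh => h (Fin.succAbove_right_injective hh)
        simp [sg, this, N, h]
    rw [e1, ← Matrix.cramer_transpose_apply, pi_eq_sum_univ' (M c)]
    rw [map_sum, Finset.sum_apply, Finset.mul_sum]
    simp only [Matrix.mulVec, dotProduct, κ, map_smul, Pi.smul_apply, smul_eq_mul]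
    refine Finset.sum_congr rfl fun k _ => ?_
    ring
  refine ⟨κ, ?_⟩
  ext c
  rw [h1]
  by_cases hc : c ∈ topIdx n q
  · rw [Yv, if_pos hc]
    obtain ⟨d, rfl⟩ := exists_tt hn hc
    simp only [tt_inj]
    split_ifs with g1 g2
    · subst g1
      rw [yv_wedge]
      congr 2
      ext i j
      simp only [Matrix.submatrix_apply, sg, id]
      split_ifs with h
      · rw [h]
      · rfl
    · subst g2
      rw [yv_wedge, ← laplace_swap (M.submatrix (tt hn) id) hab]
      congr 2
      ext i j
      simp only [Matrix.submatrix_apply, sg, id]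
      split_ifs with h
      · rw [h, Equiv.swap_apply_left]
      · rw [Equiv.swap_apply_of_ne_of_ne h (Fin.succAbove_ne d i)]
    · obtain ⟨d', hd'⟩ := Fin.exists_succAbove_eq g2
      have : a' ≠ d' := by rintro rfl; exact g1 (hd'.symm.trans ha')
      rw [Matrix.det_zero_of_row_eq this, mul_zero]
      ext j
      simp [sg, ha', hd', g1]
  · rw [Yv, if_neg hc, (aSJ hn (sg hn a b c)).2 M]

theorem ker_wedge (hn : q < n) (M : Matrix (Fin n) (Fin q) ℝ) {a : Fin (q + 1)} (ha : yv hn (wedge M) a ≠ 0) {κ : Fin q → ℝ}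
    (h : ∀ c, M.mulVec κ (tt hn c) = 0) : κ = 0 := by
  rw [yv_wedge] at ha
  refine Matrix.eq_zero_of_mulVec_eq_zero (right_ne_zero_of_mul ha) ?_
  ext k
  exact h (a.succAbove k)

theorem span_wedge (hn : q < n) (M : Matrix (Fin n) (Fin q) ℝ) {b : Fin (q + 1)} (hb : yv hn (wedge M) b ≠ 0)
    (ρ : (Fin n → ℝ) →ₗ[ℝ] ℝ) (hρ : ∀ a, a ≠ b → ρ (Yv hn (wedge M) a b) = 0) (κ : Fin q → ℝ) : ρ (M.mulVec κ) = 0 := by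
  choose! K hK using fun a (hab : a ≠ b) => Yv_wedge hn M hab
  set y := yv hn (wedge M) with hy
  let κ' : Fin q → ℝ := ∑ a ∈ Finset.univ.erase b, (M.mulVec κ (tt hn a) / y b) • K a
  have e1 : M.mulVec κ' = ∑ a ∈ Finset.univ.erase b, (M.mulVec κ (tt hn a) / y b) • Yv hn (wedge M) a b := by
    simp only [κ', Matrix.mulVec_sum, Matrix.mulVec_smul]
    refine Finset.sum_congr rfl fun a ha => ?_
    rw [hK a (Finset.mem_erase.1 ha).1]
  have e2 : ∀ c, c ≠ b → M.mulVec κ' (tt hn c) = M.mulVec κ (tt hn c) := by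
    intro c hc
    rw [e1, Finset.sum_apply, Finset.sum_eq_single c]
    · simp [Yv, tt_mem]
      rw [← hy]; field_simp
    · intro a _ hac
      simp [Yv, tt_mem, tt_inj, hac.symm, hc]
    · intro h; exact absurd (Finset.mem_erase.2 ⟨hc, Finset.mem_univ c⟩) h
  have e3 : M.mulVec κ' (tt hn b) = M.mulVec κ (tt hn b) := by
    have h1 := yv_rel hn M κ
    have h2 := yv_rel hn M κ'
    rw [← Finset.add_sum_erase _ _ (Finset.mem_univ b)] at h1 h2
    have h3 : ∑ a ∈ Finset.univ.erase b, yv hn (wedge M) a * (M.mulVec κ') (tt hn a) = ∑ a ∈ Finset.univ.erase b, yv hn (wedge M) a * (M.mulVec κ) (tt hn a) :=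
      Finset.sum_congr rfl fun a ha => by rw [e2 a (Finset.mem_erase.1 ha).1]
    rw [h3] at h2
    have : y b * M.mulVec κ' (tt hn b) = y b * M.mulVec κ (tt hn b) := by rw [hy]; linarith
    exact mul_left_cancel₀ hb this
  have e4 : κ - κ' = 0 := by
    refine ker_wedge hn M hb fun c => ?_
    rw [Matrix.mulVec_sub, Pi.sub_apply]
    by_cases hc : c = b
    · rw [hc, e3, sub_self]
    · rw [e2 c hc, sub_self]
  rw [sub_eq_zero.1 e4, e1, map_sum]
  refine Finset.sum_eq_zero fun a ha => ?_
  rw [map_smul, hρ a (Finset.mem_erase.1 ha).1, smul_zero]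

end dec
end NambuLin

open scoped ContDiff
namespace NambuLin
open Metric Filter Topology

section chart
variable {n q : ℕ}

theorem two_le_infty : (2 : WithTop ℕ∞) ≤ ∞ := by
  exact WithTop.coe_le_coe.2 (le_top : (2 : ℕ∞) ≤ ⊤)

theorem jac_mulVec (φ : (Fin n → ℝ) → (Fin n → ℝ)) (x v : Fin n → ℝ) : (jac φ x).mulVec v = fderiv ℝ φ x v := by
  have : (Matrix.toLin' (jac φ x)).toContinuousLinearMap = fderiv ℝ φ x := by
    refine clm_ext_pi fun c => ?_
    ext d
    simp [jac]
  rw [← this]; rfl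

theorem mat_ext {A B : Matrix (Fin n) (Fin n) ℝ} (h : ∀ v, A.mulVec v = B.mulVec v) : A = B :=
  Matrix.ext_of_mulVec_single fun i => h _

/-- padding by zeros -/
def pad (κ : Fin q → ℝ) (c : Fin n) : ℝ := if h : (c : ℕ) < q then κ ⟨c, h⟩ else 0

theorem pad_mulVec (hn : q < n) (B : Matrix (Fin n) (Fin n) ℝ) (κ : Fin q → ℝ) :
    (B.submatrix id (Fin.castLE hn.le)).mulVec κ = B.mulVec (pad κ) := by
  ext d
  simp only [Matrix.mulVec, dotProduct, Matrix.submatrix_apply, id]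
  refine Finset.sum_of_injOn (Fin.castLE hn.le) (fun a _ b _ h => Fin.castLE_injective _ h) (by intro _ _; simp) ?_ ?_
  · intro c _ hc
    rw [pad, dif_neg, mul_zero]
    intro h
    exact hc ⟨⟨c, h⟩, by simp, rfl⟩
  · intro k _
    simp [pad]

theorem extPow_std (hn : q < n) (B : Matrix (Fin n) (Fin n) ℝ) :
    extPow n q B (stdVec n q) = wedge (B.submatrix id (Fin.castLE hn.le)) := by
  have hc : (Finset.univ.filter (fun i : Fin n => (i : ℕ) < q)).card = q := by
    have : Finset.univ.filter (fun i : Fin n => (i : ℕ) < q) = Finset.univ.image (Fin.castLE hn.le) := by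
      ext c
      constructor
      · intro h
        simp only [Finset.mem_filter, Finset.mem_univ, true_and] at h
        exact Finset.mem_image.2 ⟨⟨c, h⟩, Finset.mem_univ _, rfl⟩
      · intro h
        obtain ⟨a, -, rfl⟩ := Finset.mem_image.1 h
        simp
    rw [this, Finset.card_image_of_injective _ (Fin.castLE_injective _)]
    simp
  let I0 : Idx n q := ⟨_, hc⟩
  have hI0 : oe I0 = Fin.castLE hn.le := by
    symm
    refine Finset.orderEmbOfFin_unique I0.2 (fun k => ?_) ?_
    · simp [I0]
    · intro k l hkl; exact hkl
  ext J
  show ∑ I : Idx n q, (B.submatrix (oe J) (oe I)).det * stdVec n q I = _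
  rw [Finset.sum_eq_single I0]
  · rw [hI0, stdVec, if_pos rfl, mul_one]; rfl
  · intro I _ hI
    rw [stdVec, if_neg, mul_zero]
    intro h; exact hI (Subtype.ext h)
  · intro h; exact absurd (Finset.mem_univ _) h

theorem chart (hn : q < n) {U : Set (Fin n → ℝ)} {P : (Fin n → ℝ) → MultiVec n q} (hN : IsNambu n q P U) {p : Fin n → ℝ} (hp : p ∈ U)
    (hP : P p ≠ 0) : ∃ H : (Fin n → ℝ) → (Fin n → ℝ), ∀ᶠ x in 𝓝 p, ContDiffAt ℝ 2 H x ∧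
      ∃ M : Matrix (Fin n) (Fin q) ℝ, P x = wedge M ∧ (∀ κ, fderiv ℝ H x (M.mulVec κ) = 0) ∧
      ∀ v, fderiv ℝ H x v = 0 → ∃ κ, v = M.mulVec κ := by
  obtain ⟨W, hpW, hWU, φ, ⟨hWo, hWi, hφ, ψ, hψ, hψφ, hφψ⟩, hst⟩ := hN.2 p hp hP
  refine ⟨fun x c => if (c : ℕ) < q then 0 else φ x c, ?_⟩
  filter_upwards [hWo.mem_nhds hpW] with x hx
  have hxn := hWo.mem_nhds hx
  have hφx : ContDiffAt ℝ ∞ φ x := hφ.contDiffAt hxn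
  have hyn := hWi.mem_nhds (Set.mem_image_of_mem φ hx)
  have hψx : ContDiffAt ℝ ∞ ψ (φ x) := hψ.contDiffAt hyn
  have dφ := (hφx.differentiableAt (by simp)).hasFDerivAt
  have dψ := (hψx.differentiableAt (by simp)).hasFDerivAt
  have hψd : ∀ v, fderiv ℝ ψ (φ x) (fderiv ℝ φ x v) = v := by
    intro v
    have h1 : (ψ ∘ φ) =ᶠ[𝓝 x] fun x => x := by filter_upwards [hxn] with z hz using hψφ z hz
    have h2 := ((dψ.comp x dφ).congr_of_eventuallyEq h1.symm).unique (hasFDerivAt_id x)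
    exact congrArg (fun L => L v) h2
  have hφd : ∀ v, fderiv ℝ φ x (fderiv ℝ ψ (φ x) v) = v := by
    intro v
    have h1 : (φ ∘ ψ) =ᶠ[𝓝 (φ x)] fun x => x := by filter_upwards [hyn] with z hz using hφψ z hz
    have dφ' : HasFDerivAt φ (fderiv ℝ φ x) (ψ (φ x)) := by rw [hψφ x hx]; exact dφ
    have h2 := ((dφ'.comp (φ x) dψ).congr_of_eventuallyEq h1.symm).unique (hasFDerivAt_id (φ x))
    exact congrArg (fun L => L v) h2
  have hBA : jac ψ (φ x) * jac φ x = 1 := by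
    refine mat_ext fun v => ?_
    rw [← Matrix.mulVec_mulVec, jac_mulVec, jac_mulVec, hψd, Matrix.one_mulVec]
  have hcd : ContDiffAt ℝ 2 (fun x c => if (c : ℕ) < q then 0 else φ x c : (Fin n → ℝ) → (Fin n → ℝ)) x := by
    rw [contDiffAt_pi]
    intro c
    by_cases hc : (c : ℕ) < q
    · simp only [if_pos hc]; exact contDiffAt_const
    · simp only [if_neg hc]
      exact (contDiffAt_pi.1 hφx c).of_le two_le_infty
  have hHd : ∀ v c, fderiv ℝ (fun x c => if (c : ℕ) < q then 0 else φ x c : (Fin n → ℝ) → (Fin n → ℝ)) x v c = if (c : ℕ) < q then 0 else fderiv ℝ φ x v c := by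
    intro v c
    rw [← fderiv_coord (hcd.differentiableAt (by simp))]
    by_cases hc : (c : ℕ) < q
    · simp only [if_pos hc]; simp
    · simp only [if_neg hc]; exact fderiv_coord dφ.differentiableAt v c
  refine ⟨hcd, (jac ψ (φ x)).submatrix id (Fin.castLE hn.le), ?_, ?_, ?_⟩
  · rw [← extPow_std hn, ← hst x hx, extPow_inv hBA]
  · intro κ
    ext c
    rw [hHd, pad_mulVec hn, jac_mulVec, hφd]
    split_ifs with h
    · rfl
    · simp [pad, h]
  · intro v hv
    refine ⟨fun k => fderiv ℝ φ x v (Fin.castLE hn.le k), ?_⟩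
    rw [pad_mulVec hn, jac_mulVec]
    have : pad (fun k => fderiv ℝ φ x v (Fin.castLE hn.le k)) = fderiv ℝ φ x v := by
      ext c
      by_cases h : (c : ℕ) < q
      · simp [pad, h]
      · have := hHd v c
        rw [hv, if_neg h] at this
        simp [pad, h, ← this]
    rw [this, hψd]

end chart
end NambuLin

open scoped ContDiff
namespace NambuLin
open Metric Filter Topology

section nd
variable {n q : ℕ}

theorem fderiv_coordP {E κ : Type*} [NormedAddCommGroup E] [NormedSpace ℝ E] [Fintype κ] {f : E → κ → ℝ} {x : E}
    (h : DifferentiableAt ℝ f x) (v : E) (k : κ) : fderiv ℝ (fun x => f x k) x v = fderiv ℝ f x v k := by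
  have := hasFDerivAt_pi'.1 h.hasFDerivAt k
  rw [this.fderiv]; rfl

theorem analyticAt_coordP {E κ : Type*} [NormedAddCommGroup E] [NormedSpace ℝ E] [Fintype κ] {f : E → κ → ℝ} {x : E}
    (h : AnalyticAt ℝ f x) (k : κ) : AnalyticAt ℝ (fun x => f x k) x := (analyticAt_pi_iff.1 h) k

noncomputable def yP (hn : q < n) (P : (Fin n → ℝ) → MultiVec n q) (a : Fin n) (x : Fin n → ℝ) : ℝ :=
  if h : (a : ℕ) < q + 1 then yv hn (P x) ⟨a, h⟩ else 0

noncomputable def YP (hn : q < n) (P : (Fin n → ℝ) → MultiVec n q) (a b : Fin n) (x : Fin n → ℝ) : Fin n → ℝ :=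
  if h : (a : ℕ) < q + 1 ∧ (b : ℕ) < q + 1 then Yv hn (P x) ⟨a, h.1⟩ ⟨b, h.2⟩ else 0

theorem yP_tt (hn : q < n) (P : (Fin n → ℝ) → MultiVec n q) (a : Fin (q + 1)) : yP hn P (tt hn a) = fun x => yv hn (P x) a := by
  ext x
  have : ((tt hn a : Fin n) : ℕ) < q + 1 := a.2
  rw [yP, dif_pos this]; rfl

theorem YP_tt (hn : q < n) (P : (Fin n → ℝ) → MultiVec n q) (a b : Fin (q + 1)) : YP hn P (tt hn a) (tt hn b) = fun x => Yv hn (P x) a b := by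
  ext1 x
  have : ((tt hn a : Fin n) : ℕ) < q + 1 ∧ ((tt hn b : Fin n) : ℕ) < q + 1 := ⟨a.2, b.2⟩
  rw [YP, dif_pos this]; rfl

theorem modelPi_Jb (hn : q < n) (k : ℕ) (v : Fin n → ℝ) (a : Fin (q + 1)) :
    modelPi n q k v (Jb hn a) = (-1) ^ (a : ℕ) * eps k (tt hn a) * v (tt hn a) := by
  rw [modelPi, Finset.sum_eq_single (tt hn a)]
  · rw [if_pos ⟨a.2, rfl⟩]; rfl
  · intro j _ hj
    rw [if_neg]
    rintro ⟨h1, h2⟩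
    have hjT : j ∈ topIdx n q := mem_top.2 h1
    have : j ∈ (topIdx n q).erase (tt hn a) := Finset.mem_erase.2 ⟨hj, hjT⟩
    have h3 : j ∈ (topIdx n q).erase j := by rw [← h2]; exact this
    exact absurd rfl (Finset.mem_erase.1 h3).1
  · intro h; exact absurd (Finset.mem_univ _) h

theorem modelPi_out (k : ℕ) (v : Fin n → ℝ) (J : Idx n q) {c : Fin n} (hc : c ∈ J.1) (hcT : c ∉ topIdx n q) :
    modelPi n q k v J = 0 := by
  refine Finset.sum_eq_zero fun j _ => ?_
  rw [if_neg]
  rintro ⟨-, h⟩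
  rw [h] at hc
  exact hcT (Finset.mem_erase.1 hc).2

theorem ndata (hn : q < n) (k : ℕ) {U : Set (Fin n → ℝ)} (hU : IsOpen U) (h0U : (0 : Fin n → ℝ) ∈ U)
    {P : (Fin n → ℝ) → MultiVec n q} (hN : IsNambu n q P U)
    (hPanalytic : AnalyticOnNhd ℝ P U)
    (hP0 : P 0 = 0) (hlin : ∀ v : Fin n → ℝ, fderiv ℝ P 0 v = modelPi n q k v) :
    NData (topIdx n q) (fun a => eps k a) (yP hn P) (YP hn P) := by
  have hPa : AnalyticAt ℝ P 0 := hPanalytic 0 h0U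
  have hPd := hPa.differentiableAt
  have hmm : ∀ a : Fin (q + 1), (-1 : ℝ) ^ (a : ℕ) * (-1) ^ (a : ℕ) = 1 := fun a => by
    rw [← mul_pow]; norm_num
  have yd : ∀ a v, fderiv ℝ (fun x => yv hn (P x) a) 0 v = eps k (tt hn a) * v (tt hn a) := by
    intro a v
    have h1 : DifferentiableAt ℝ (fun x => P x (Jb hn a)) 0 := (analyticAt_coordP hPa _).differentiableAt
    have h2 := (h1.hasFDerivAt.const_mul ((-1 : ℝ) ^ (a : ℕ))).fderiv
    rw [show fderiv ℝ (fun x => yv hn (P x) a) 0 = _ from h2]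
    rw [ContinuousLinearMap.smul_apply, fderiv_coordP hPd, hlin, modelPi_Jb hn]
    simp only [smul_eq_mul]
    linear_combination (eps k (tt hn a) * v (tt hn a)) * hmm a
  have ya : ∀ a x, AnalyticAt ℝ P x → AnalyticAt ℝ (fun x => yv hn (P x) a) x := fun a x hx =>
    analyticAt_const.mul (analyticAt_coordP hx _)
  have Ya : ∀ a b, AnalyticAt ℝ (fun x => Yv hn (P x) a b) 0 := by
    intro a b
    rw [analyticAt_pi_iff]
    intro c
    unfold Yv
    split_ifs
    · exact ya b 0 hPa
    · exact (ya a 0 hPa).neg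
    · exact analyticAt_const
    · exact analyticAt_const.mul (analyticAt_const.mul (analyticAt_coordP hPa _))
  have YT : ∀ (w : MultiVec n q) (a b : Fin (q + 1)), ∀ c ∈ topIdx n q, Yv hn w a b c = if c = tt hn a then yv hn w b else if c = tt hn b then - yv hn w a else 0 := by
    intro w a b c hc
    rw [Yv, if_pos hc]
  constructor
  · intro a ha
    obtain ⟨a, rfl⟩ := exists_tt hn ha
    rw [yP_tt]; exact ya a 0 hPa
  · intro a ha
    obtain ⟨a, rfl⟩ := exists_tt hn ha
    rw [yP_tt]; simp [yv, hP0]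
  · intro a ha v
    obtain ⟨a, rfl⟩ := exists_tt hn ha
    rw [yP_tt]; exact yd a v
  · intro a ha
    unfold eps
    split_ifs <;> simp
  · intro a ha b hb hab
    obtain ⟨a, rfl⟩ := exists_tt hn ha
    obtain ⟨b, rfl⟩ := exists_tt hn hb
    rw [YP_tt]; exact Ya a b
  · intro a ha b hb hab
    obtain ⟨a, rfl⟩ := exists_tt hn ha
    obtain ⟨b, rfl⟩ := exists_tt hn hb
    rw [YP_tt, yP_tt, yP_tt]
    exact Eventually.of_forall fun x c hc => YT _ a b c hc
  · intro a ha b hb hab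
    obtain ⟨a, rfl⟩ := exists_tt hn ha
    obtain ⟨b, rfl⟩ := exists_tt hn hb
    rw [YP_tt]
    show Yv hn (P 0) a b = 0
    rw [hP0]
    ext c
    simp [Yv, yv]
  · intro a ha b hb hab v w hw
    obtain ⟨a, rfl⟩ := exists_tt hn ha
    obtain ⟨b, rfl⟩ := exists_tt hn hb
    have hab' : a ≠ b := fun h => hab (by rw [h])
    rw [YP_tt, ← fderiv_coordP (Ya a b).differentiableAt]
    simp only [Yv, if_neg hw]
    have h1 : DifferentiableAt ℝ (fun x => P x (aJ hn (sg hn a b w))) 0 := (analyticAt_coordP hPa _).differentiableAt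
    have h2 := ((h1.hasFDerivAt.const_mul (aS hn (sg hn a b w))).const_mul ((-1 : ℝ) ^ (b : ℕ))).fderiv
    rw [h2]
    simp only [ContinuousLinearMap.smul_apply, smul_eq_mul]
    rw [fderiv_coordP hPd, hlin]
    rcases (aSJ hn (sg hn a b w)).1 with h | h
    · rw [h]; simp
    · obtain ⟨a', ha'⟩ := Fin.exists_succAbove_eq hab'
      have h3 := h a'
      rw [sg, if_pos ha'] at h3
      rw [modelPi_out k v _ h3 hw]; simp
  · filter_upwards [hU.mem_nhds h0U] with x hx
    rintro ⟨a, ha, hya⟩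
    obtain ⟨a, rfl⟩ := exists_tt hn ha
    rw [yP_tt] at hya
    have hPx : P x ≠ 0 := by
      intro h; apply hya
      simp [yv, h]
    obtain ⟨H, hH⟩ := chart hn hN hx hPx
    refine ⟨H, ?_⟩
    have hev : ∀ᶠ x' in 𝓝 x, yv hn (P x') a ≠ 0 :=
      (ya a x (hPanalytic x hx)).continuousAt.eventually_ne hya
    filter_upwards [hH, hev] with x' h1 h2
    obtain ⟨hc, M, hM, hM1, hM2⟩ := h1
    refine ⟨hc, ?_, ?_⟩
    · intro a ha b hb hab
      obtain ⟨a, rfl⟩ := exists_tt hn ha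
      obtain ⟨b, rfl⟩ := exists_tt hn hb
      rw [YP_tt]
      obtain ⟨κ, hκ⟩ := Yv_wedge hn M (fun h => hab (by rw [h]) : a ≠ b)
      show fderiv ℝ H x' (Yv hn (P x') a b) = 0
      rw [hM, hκ, hM1]
    · intro v hv
      obtain ⟨κ, rfl⟩ := hM2 v hv
      constructor
      · rw [← yv_rel hn M κ]
        symm
        refine Finset.sum_bij (fun a _ => tt hn a) (fun a _ => tt_mem hn a) (fun a _ b _ h => (tt_inj hn).1 h)
          (fun c hc => ?_) (fun a _ => ?_)
        · obtain ⟨a, rfl⟩ := exists_tt hn hc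
          exact ⟨a, Finset.mem_univ a, rfl⟩
        · rw [yP_tt, ← hM]
      · intro hT
        rw [hM] at h2
        rw [ker_wedge hn M h2 (fun c => hT _ (tt_mem hn c)), Matrix.mulVec_zero]

end nd
end NambuLin

open scoped ContDiff
namespace NambuLin
open Metric Filter Topology

section fin
variable {n q : ℕ}

theorem NData.neg {ι : Type} [Fintype ι] [DecidableEq ι] {T : Finset ι} {ε : ι → ℝ} {y : ι → (ι → ℝ) → ℝ}
    {Y : ι → ι → (ι → ℝ) → (ι → ℝ)} (D : NData T ε y Y) :
    NData T (fun a => - ε a) (fun a x => - y a x) (fun a b x => - Y a b x) := by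
  constructor
  · intro a ha; exact (D.y_an a ha).neg
  · intro a ha; simp [D.y_zero a ha]
  · intro a ha v
    rw [fderiv_fun_neg, ContinuousLinearMap.neg_apply, D.y_deriv a ha]; ring
  · intro a ha; rw [abs_neg]; exact D.eps a ha
  · intro a ha b hb hab; exact (D.Y_an a ha b hb hab).neg
  · intro a ha b hb hab
    filter_upwards [D.Y_T a ha b hb hab] with x hx c hc
    rw [Pi.neg_apply, hx c hc]
    split_ifs <;> simp
  · intro a ha b hb hab
    simp [D.Y_zero a ha b hb hab]
  · intro a ha b hb hab v w hw
    rw [fderiv_fun_neg, ContinuousLinearMap.neg_apply, Pi.neg_apply, D.Y_deriv a ha b hb hab v w hw, neg_zero]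
  · filter_upwards [D.reg] with x hx
    rintro ⟨a, ha, hya⟩
    obtain ⟨H, hH⟩ := hx ⟨a, ha, fun h => hya (by simp [h])⟩
    refine ⟨H, ?_⟩
    filter_upwards [hH] with x' h
    refine ⟨h.1, ?_, ?_⟩
    · intro a ha b hb hab
      rw [map_neg, h.2.1 a ha b hb hab, neg_zero]
    · intro v hv
      refine ⟨?_, (h.2.2 v hv).2⟩
      have := (h.2.2 v hv).1
      rw [← neg_eq_zero, ← Finset.sum_neg_distrib] at this
      rw [← this]
      exact Finset.sum_congr rfl fun a _ => by ring

theorem core_sgn {ι : Type} [Fintype ι] [DecidableEq ι] {T : Finset ι} {ε : ι → ℝ} {y : ι → (ι → ℝ) → ℝ}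
    {Y : ι → ι → (ι → ℝ) → (ι → ℝ)} (D : NData T ε y Y) {i j l : ι} (hi : i ∈ T) (hj : j ∈ T)
    (hl : l ∈ T) (hij : i ≠ j) (hil : i ≠ l) (hjl : j ≠ l) (e : ε i = ε j) (he : ε i = 1 ∨ ε i = -1) :
    ∃ Φ : (ι → ℝ) → (ι → ℝ), AnalyticAt ℝ Φ 0 ∧ Φ 0 = 0 ∧
      fderiv ℝ Φ 0 = ContinuousLinearMap.id ℝ _ ∧
      ∀ᶠ x in 𝓝 0, ∀ a ∈ T, ∀ b ∈ T, a ≠ b → (∀ w, w ∉ T → fderiv ℝ Φ x (Y a b x) w = 0) ∧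
        ∑ c ∈ T, ε c * Φ x c * fderiv ℝ Φ x (Y a b x) c = 0 := by
  rcases he with he | he
  · exact core D hi hj hl hij hil hjl he (e ▸ he)
  · obtain ⟨Φ, h1, h2, h3, h4⟩ := core D.neg hi hj hl hij hil hjl (by rw [he]; norm_num) (by rw [← e, he]; norm_num)
    refine ⟨Φ, h1, h2, h3, ?_⟩
    filter_upwards [h4] with x hx a ha b hb hab
    obtain ⟨h5, h6⟩ := hx a ha b hb hab
    constructor
    · intro w hw
      have := h5 w hw
      rwa [map_neg, Pi.neg_apply, neg_eq_zero] at this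
    · rw [← h6]
      refine Finset.sum_congr rfl fun c _ => ?_
      rw [map_neg, Pi.neg_apply]; ring

theorem core_any {ι : Type} [Fintype ι] [DecidableEq ι] {T : Finset ι} {ε : ι → ℝ} {y : ι → (ι → ℝ) → ℝ}
    {Y : ι → ι → (ι → ℝ) → (ι → ℝ)} (D : NData T ε y Y) {i j l : ι} (hi : i ∈ T) (hj : j ∈ T)
    (hl : l ∈ T) (hij : i ≠ j) (hil : i ≠ l) (hjl : j ≠ l) (he : ∀ i, ε i = 1 ∨ ε i = -1) :
    ∃ Φ : (ι → ℝ) → (ι → ℝ), AnalyticAt ℝ Φ 0 ∧ Φ 0 = 0 ∧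
      fderiv ℝ Φ 0 = ContinuousLinearMap.id ℝ _ ∧
      ∀ᶠ x in 𝓝 0, ∀ a ∈ T, ∀ b ∈ T, a ≠ b → (∀ w, w ∉ T → fderiv ℝ Φ x (Y a b x) w = 0) ∧
        ∑ c ∈ T, ε c * Φ x c * fderiv ℝ Φ x (Y a b x) c = 0 := by
  by_cases h1 : ε i = ε j
  · exact core_sgn D hi hj hl hij hil hjl h1 (he i)
  by_cases h2 : ε i = ε l
  · exact core_sgn D hi hl hj hil hij hjl.symm h2 (he i)
  refine core_sgn D hj hl hi hjl hij.symm hil.symm ?_ (he j)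
  rcases he i with a | a <;> rcases he j with b | b <;> rcases he l with c | c <;> simp_all

theorem sum_top (hn : q < n) (f : Fin n → ℝ) : ∑ c ∈ topIdx n q, f c = ∑ a, f (tt hn a) := by
  symm
  refine Finset.sum_bij (fun a _ => tt hn a) (fun a _ => tt_mem hn a) (fun a _ b _ h => (tt_inj hn).1 h)
    (fun c hc => ?_) (fun a _ => rfl)
  obtain ⟨a, rfl⟩ := exists_tt hn hc
  exact ⟨a, Finset.mem_univ a, rfl⟩

theorem pt (hn : q < n) (M : Matrix (Fin n) (Fin q) ℝ) (A : Matrix (Fin n) (Fin n) ℝ) (ξ : Fin n → ℝ) {b : Fin (q + 1)}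
    (hb : yv hn (wedge M) b ≠ 0)
    (h : ∀ a, a ≠ b → (∀ w, w ∉ topIdx n q → A.mulVec (Yv hn (wedge M) a b) w = 0) ∧
      ∑ c ∈ topIdx n q, ξ c * A.mulVec (Yv hn (wedge M) a b) c = 0) :
    (∀ J : Idx n q, (∃ c ∈ J.1, c ∉ topIdx n q) → extPow n q A (wedge M) J = 0) ∧
    ∀ a c, ξ (tt hn a) * yv hn (extPow n q A (wedge M)) c = ξ (tt hn c) * yv hn (extPow n q A (wedge M)) a := by
  rw [extPow_wedge]
  constructor
  · rintro J ⟨c, hc, hcT⟩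
    obtain ⟨k, rfl⟩ := oe_surj J hc
    refine Matrix.det_eq_zero_of_row_eq_zero k fun j => ?_
    have := span_wedge hn M hb ((LinearMap.proj (oe J k)) ∘ₗ A.mulVecLin) (fun a ha => (h a ha).1 _ hcT) (Pi.single j 1)
    simp only [LinearMap.comp_apply, Matrix.mulVecLin_apply, LinearMap.proj_apply, Matrix.mulVec_mulVec,
      Matrix.mulVec_single_one] at this
    exact this
  · intro a c
    by_cases hac : a = c
    · rw [hac]
    obtain ⟨κ, hκ⟩ := Yv_wedge hn (A * M) hac
    have h1 := span_wedge hn M hb ((∑ c ∈ topIdx n q, ξ c • (LinearMap.proj c : (Fin n → ℝ) →ₗ[ℝ] ℝ)) ∘ₗ A.mulVecLin)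
      (fun a ha => by
        have := (h a ha).2
        simpa [LinearMap.sum_apply] using this) κ
    simp only [LinearMap.comp_apply, Matrix.mulVecLin_apply, Matrix.mulVec_mulVec, ← hκ, LinearMap.sum_apply,
      LinearMap.smul_apply, LinearMap.proj_apply, smul_eq_mul] at h1
    rw [sum_top hn] at h1
    have h2 : ∀ d, ξ (tt hn d) * Yv hn (wedge (A * M)) a c (tt hn d) =
        (if d = a then ξ (tt hn a) * yv hn (wedge (A * M)) c else 0) -
        (if d = c then ξ (tt hn c) * yv hn (wedge (A * M)) a else 0) := by
      intro d
      rw [Yv, if_pos (tt_mem hn d)]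
      simp only [tt_inj]
      by_cases h3 : d = a
      · subst h3; simp [hac]
      · by_cases h4 : d = c
        · subst h4; simp [h3]
        · simp [h3, h4]
    simp only [h2, Finset.sum_sub_distrib, Finset.sum_ite_eq', Finset.mem_univ, if_true] at h1
    linarith

theorem extPow_one (w : MultiVec n q) : extPow n q 1 w = w := by
  have h : ∀ w : MultiVec n q, extPow n q 1 w = w := by
    intro w
    ext K
    show ∑ J : Idx n q, ((1 : Matrix (Fin n) (Fin n) ℝ).submatrix (oe K) (oe J)).det * w J = w K
    simp [det_one_sub]
  exact h w

theorem jac_analytic {Φ : (Fin n → ℝ) → (Fin n → ℝ)} (hΦ : AnalyticAt ℝ Φ 0) (i j : Fin n) :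
    AnalyticAt ℝ (fun x => jac Φ x i j) 0 := by
  show AnalyticAt ℝ (fun x => fderiv ℝ Φ x (Pi.single j 1) i) 0
  exact analyticAt_coordP (analyticAt_clm_apply hΦ.fderiv analyticAt_const) i

theorem det_analytic {m : ℕ} {A : (Fin n → ℝ) → Matrix (Fin m) (Fin m) ℝ} (hA : ∀ i j, AnalyticAt ℝ (fun x => A x i j) 0) :
    AnalyticAt ℝ (fun x => (A x).det) 0 := by
  simp only [Matrix.det_apply']
  refine Finset.analyticAt_fun_sum _ fun σ _ => analyticAt_const.mul ?_
  exact Finset.analyticAt_fun_prod _ fun i _ => hA _ _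

theorem ext_analytic {Φ : (Fin n → ℝ) → (Fin n → ℝ)} (hΦ : AnalyticAt ℝ Φ 0) {P : (Fin n → ℝ) → MultiVec n q}
    (hP : AnalyticAt ℝ P 0) (J : Idx n q) : AnalyticAt ℝ (fun x => extPow n q (jac Φ x) (P x) J) 0 := by
  show AnalyticAt ℝ (fun x => ∑ I : Idx n q, ((jac Φ x).submatrix (oe J) (oe I)).det * P x I) 0
  refine Finset.analyticAt_fun_sum _ fun I _ => ?_
  exact (det_analytic (fun i j => jac_analytic hΦ _ _)).mul (analyticAt_coordP hP I)

theorem ext_deriv {Φ : (Fin n → ℝ) → (Fin n → ℝ)} (hΦ : AnalyticAt ℝ Φ 0)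
    (hΦd : fderiv ℝ Φ 0 = ContinuousLinearMap.id ℝ _) {P : (Fin n → ℝ) → MultiVec n q}
    (hP : AnalyticAt ℝ P 0) (hP0 : P 0 = 0) (J : Idx n q) (v : Fin n → ℝ) :
    fderiv ℝ (fun x => extPow n q (jac Φ x) (P x) J) 0 v = fderiv ℝ P 0 v J := by
  have hj : jac Φ 0 = 1 := by
    ext i j
    show fderiv ℝ Φ 0 (Pi.single j 1) i = _
    rw [hΦd]
    simp [Matrix.one_apply, Pi.single_apply]
  have h : ∀ I : Idx n q, HasFDerivAt (fun x => ((jac Φ x).submatrix (oe J) (oe I)).det * P x I) _ 0 := fun I =>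
    ((det_analytic (A := fun x => (jac Φ x).submatrix (oe J) (oe I)) (fun i j => jac_analytic hΦ _ _)).differentiableAt.hasFDerivAt).mul
      (analyticAt_coordP hP I).differentiableAt.hasFDerivAt
  have h2 := (HasFDerivAt.fun_sum (u := Finset.univ) fun I _ => h I).fderiv
  have h3 : fderiv ℝ (fun x => extPow n q (jac Φ x) (P x) J) 0 = _ := h2
  rw [h3]
  conv_rhs => rw [← extPow_one (fderiv ℝ P 0 v)]
  show _ = ∑ I : Idx n q, ((1 : Matrix (Fin n) (Fin n) ℝ).submatrix (oe J) (oe I)).det * (fderiv ℝ P 0 v) I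
  simp only [ContinuousLinearMap.sum_apply, ContinuousLinearMap.add_apply, ContinuousLinearMap.smul_apply, hP0, hj, Pi.zero_apply,
    zero_smul, smul_eq_mul, zero_mul, add_zero]
  exact Finset.sum_congr rfl fun I _ => by rw [fderiv_coordP hP.differentiableAt]

end fin
end NambuLin

open scoped ContDiff
namespace NambuLin
open Metric Filter Topology

section fin2
variable {n q : ℕ}

theorem divide_std {ι κ : Type} [Fintype ι] [DecidableEq ι] [Fintype κ] (t : κ → ι) (ht : Function.Injective t)
    (r : κ → (ι → ℝ) → ℝ) (hr : ∀ a, AnalyticAt ℝ (r a) 0) (a₀ : κ) (hne : ∀ a : κ, ∃ b, b ≠ a)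
    (hrel : ∀ᶠ z in 𝓝 (0 : ι → ℝ), ∀ a b, z (t a) * r b z = z (t b) * r a z) :
    ∃ g : (ι → ℝ) → ℝ, AnalyticAt ℝ g 0 ∧ ∀ᶠ z in 𝓝 (0 : ι → ℝ), ∀ a, r a z = z (t a) * g z := by
  have evd : ∀ b : κ, fderiv ℝ (fun z : ι → ℝ => z (t b)) 0 (Pi.single (t b) 1) ≠ 0 := by
    intro b
    rw [fderiv_eval]; simp
  have hu0 : ∀ a, Tendsto (fun z : ι → ℝ => Function.update z (t a) 0) (𝓝 0) (𝓝 0) := fun a =>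
    tendsto_zero (analyticAt_update (t a) 0 0) (update_zero_zero (t a))
  have h1 : ∀ a, ∀ᶠ z in 𝓝 (0 : ι → ℝ), r a (Function.update z (t a) 0) = 0 := by
    intro a
    obtain ⟨b, hb⟩ := hne a
    have han : AnalyticAt ℝ (fun z => r a (Function.update z (t a) 0)) 0 :=
      analyticAt_comp_zero (hr a) (analyticAt_update (t a) 0 0) (update_zero_zero (t a))
    refine density (g := fun z : ι → ℝ => z (t b)) (Pi.single (t b) 1)
      ((eventually_analyticAt' han).mono fun _ h => h.continuousAt) (analyticAt_eval _ _) (evd b) ?_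
    filter_upwards [(hu0 a).eventually hrel] with z hz hzb
    have := hz a b
    rw [Function.update_self, Function.update_of_ne (fun h => hb (ht h)), zero_mul] at this
    rcases mul_eq_zero.1 this.symm with h | h
    · exact absurd h hzb
    · exact h
  choose h hh hhe using fun a => hadamard_one (hr a) (t a)
  have h2 : ∀ a, ∀ᶠ z in 𝓝 (0 : ι → ℝ), r a z = z (t a) * h a z := by
    intro a
    filter_upwards [h1 a, hhe a] with z e1 e2
    rw [e2, e1, zero_add]
  have h3 : ∀ a, ∀ᶠ z in 𝓝 (0 : ι → ℝ), h a z - h a₀ z = 0 := by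
    intro a
    have hc : ∀ᶠ z in 𝓝 (0 : ι → ℝ), ContinuousAt (fun z => h a z - h a₀ z) z :=
      (eventually_analyticAt' ((hh a).sub (hh a₀))).mono fun _ h => h.continuousAt
    refine density (g := fun z : ι → ℝ => z (t a)) (Pi.single (t a) 1) hc (analyticAt_eval _ _) (evd a) ?_
    have : ∀ᶠ z in 𝓝 (0 : ι → ℝ), z (t a) * (h a z - h a₀ z) = 0 := by
      have hc' : ∀ᶠ z in 𝓝 (0 : ι → ℝ), ContinuousAt (fun z => z (t a) * (h a z - h a₀ z)) z :=
        (eventually_analyticAt' ((analyticAt_eval (t a) 0).mul ((hh a).sub (hh a₀)))).mono fun _ h => h.continuousAt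
      refine density (g := fun z : ι → ℝ => z (t a₀)) (Pi.single (t a₀) 1) hc' (analyticAt_eval _ _) (evd a₀) ?_
      filter_upwards [hrel, h2 a, h2 a₀] with z e0 e1 e2 hz
      have e3 := e0 a a₀
      rw [e1, e2] at e3
      have : z (t a₀) * (z (t a) * (h a z - h a₀ z)) = 0 := by linear_combination -e3
      exact (mul_eq_zero.1 this).resolve_left hz
    filter_upwards [this] with z hz hz'
    exact (mul_eq_zero.1 hz).resolve_left hz'
  refine ⟨h a₀, hh a₀, ?_⟩
  filter_upwards [eventually_all.2 h2, eventually_all.2 h3] with z e1 e2 a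
  rw [e1 a, sub_eq_zero.1 (e2 a)]

theorem divide {ι κ : Type} [Fintype ι] [DecidableEq ι] [Fintype κ] (t : κ → ι) (ht : Function.Injective t)
    {Φ ψ : (ι → ℝ) → ι → ℝ} (hΦ : AnalyticAt ℝ Φ 0) (hΦ0 : Φ 0 = 0) (hψ : AnalyticAt ℝ ψ 0) (hψ0 : ψ 0 = 0)
    (h1 : ∀ᶠ x in 𝓝 0, ψ (Φ x) = x) (h2 : ∀ᶠ y in 𝓝 0, Φ (ψ y) = y)
    (p : κ → (ι → ℝ) → ℝ) (hp : ∀ a, AnalyticAt ℝ (p a) 0) (a₀ : κ) (hne : ∀ a : κ, ∃ b, b ≠ a)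
    (hrel : ∀ᶠ x in 𝓝 (0 : ι → ℝ), ∀ a b, Φ x (t a) * p b x = Φ x (t b) * p a x) :
    ∃ g : (ι → ℝ) → ℝ, AnalyticAt ℝ g 0 ∧ ∀ᶠ x in 𝓝 (0 : ι → ℝ), ∀ a, p a x = Φ x (t a) * g x := by
  obtain ⟨g, hg, hge⟩ := divide_std t ht (fun a z => p a (ψ z)) (fun a => analyticAt_comp_zero (hp a) hψ hψ0) a₀ hne (by
    filter_upwards [(tendsto_zero hψ hψ0).eventually hrel, h2] with z e1 e2 a b
    have := e1 a b
    rwa [e2] at this)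
  refine ⟨fun x => g (Φ x), analyticAt_comp_zero hg hΦ hΦ0, ?_⟩
  filter_upwards [(tendsto_zero hΦ hΦ0).eventually hge, h1] with x e1 e2 a
  have := e1 a
  rwa [e2] at this

theorem finish_open {E : Type*} [NormedAddCommGroup E] [NormedSpace ℝ E] [CompleteSpace E] {Φ ψ : E → E}
    (hΦ : AnalyticAt ℝ Φ 0) (hΦ0 : Φ 0 = 0) (hψ : AnalyticAt ℝ ψ 0) (hψ0 : ψ 0 = 0)
    (h1 : ∀ᶠ x in 𝓝 0, ψ (Φ x) = x) (h2 : ∀ᶠ y in 𝓝 0, Φ (ψ y) = y) {p : E → Prop} (hp : ∀ᶠ x in 𝓝 0, p x) :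
    ∃ W : Set E, (0 : E) ∈ W ∧ (∀ x ∈ W, p x) ∧ IsOpen W ∧ IsOpen (Φ '' W) ∧ AnalyticOnNhd ℝ Φ W ∧
      AnalyticOnNhd ℝ ψ (Φ '' W) ∧ (∀ x ∈ W, ψ (Φ x) = x) ∧ (∀ y ∈ Φ '' W, Φ (ψ y) = y) := by
  obtain ⟨V, hV, hVo, h0V⟩ := _root_.eventually_nhds_iff.1 (h2.and (eventually_analyticAt' hψ))
  obtain ⟨W', hW, hWo, h0W⟩ := _root_.eventually_nhds_iff.1 ((h1.and hp).and (eventually_analyticAt' hΦ))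
  have hcΦ : ContinuousOn Φ W' := fun x hx => (hW x hx).2.continuousAt.continuousWithinAt
  have hcψ : ContinuousOn ψ V := fun x hx => (hV x hx).2.continuousAt.continuousWithinAt
  have hW1 := hcΦ.isOpen_inter_preimage hWo hVo
  have hV1 := hcψ.isOpen_inter_preimage hVo hWo
  have him : Φ '' (W' ∩ Φ ⁻¹' V) = V ∩ ψ ⁻¹' W' := by
    ext y
    constructor
    · rintro ⟨x, ⟨hx, hxV⟩, rfl⟩
      refine ⟨hxV, ?_⟩
      show ψ (Φ x) ∈ W'
      rw [(hW x hx).1.1]; exact hx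
    · rintro ⟨hy, hyW⟩
      refine ⟨ψ y, ⟨hyW, ?_⟩, (hV y hy).1⟩
      show Φ (ψ y) ∈ V
      rw [(hV y hy).1]; exact hy
  refine ⟨W' ∩ Φ ⁻¹' V, ⟨h0W, ?_⟩, fun x hx => (hW x hx.1).1.2, hW1, ?_, fun x hx => (hW x hx.1).2, ?_,
    fun x hx => (hW x hx.1).1.1, ?_⟩
  · show Φ 0 ∈ V
    rw [hΦ0]; exact h0V
  · rw [him]; exact hV1
  · rw [him]; exact fun y hy => (hV y hy.1).2
  · rw [him]; exact fun y hy => (hV y hy.1).1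

end fin2

theorem analytic_linearization_up_to_function (n q k : ℕ) (hq : 2 ≤ q) (hn : q < n)
    (hk : k ≤ q + 1)
    (U : Set (Fin n → ℝ)) (hU : IsOpen U) (h0U : (0 : Fin n → ℝ) ∈ U)
    (P : (Fin n → ℝ) → MultiVec n q) (hN : IsNambu n q P U)
    (hPanalytic : AnalyticOnNhd ℝ P U)
    (hP0 : P 0 = 0) (hlin : ∀ v : Fin n → ℝ, fderiv ℝ P 0 v = modelPi n q k v) :
    ∃ W : Set (Fin n → ℝ), W ⊆ U ∧ (0 : Fin n → ℝ) ∈ W ∧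
      ∃ f : (Fin n → ℝ) → ℝ, AnalyticOnNhd ℝ f W ∧ f 0 ≠ 0 ∧
        ∃ φ : (Fin n → ℝ) → (Fin n → ℝ), IsAnalyticDiffeoOn φ W ∧ φ 0 = 0 ∧
          ∀ x ∈ W, extPow n q (jac φ x) (fun J => f x * P x J) = modelPi n q k (φ x) := by
  have hPa : AnalyticAt ℝ P 0 := hPanalytic 0 h0U
  have D := ndata hn k hU h0U hN hPanalytic hP0 hlin
  have heps : ∀ i : Fin n, eps k i = 1 ∨ eps k i = -1 := by
    intro i; unfold eps; split_ifs <;> simp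
  have hee : ∀ i : Fin n, eps k i * eps k i = 1 := by
    intro i; rcases heps i with h | h <;> rw [h] <;> norm_num
  have hmm : ∀ a : Fin (q + 1), (-1 : ℝ) ^ (a : ℕ) * (-1) ^ (a : ℕ) = 1 := fun a => by
    rw [← mul_pow]; norm_num
  let i0 : Fin (q + 1) := ⟨0, by omega⟩
  let i1 : Fin (q + 1) := ⟨1, by omega⟩
  let i2 : Fin (q + 1) := ⟨2, by omega⟩
  have h01 : i0 ≠ i1 := by simp [i0, i1]
  have h02 : i0 ≠ i2 := by simp [i0, i2]
  have h12 : i1 ≠ i2 := by simp [i1, i2]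
  obtain ⟨Φ, hΦ, hΦ0, hΦd, hΦY⟩ := core_any D (tt_mem hn i0) (tt_mem hn i1) (tt_mem hn i2)
    (fun h => h01 ((tt_inj hn).1 h)) (fun h => h02 ((tt_inj hn).1 h)) (fun h => h12 ((tt_inj hn).1 h)) heps
  obtain ⟨ψ, hψ, hψ0, hψ1, hψ2⟩ := local_inverse hΦ hΦ0 (ContinuousLinearEquiv.refl ℝ _) hΦd
  set Q : (Fin n → ℝ) → MultiVec n q := fun x => extPow n q (jac Φ x) (P x) with hQ
  have hQa : ∀ J, AnalyticAt ℝ (fun x => Q x J) 0 := fun J => ext_analytic hΦ hPa J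
  have hya : ∀ a, AnalyticAt ℝ (fun x => yv hn (Q x) a) 0 := fun a => analyticAt_const.mul (hQa _)
  have hPya : AnalyticAt ℝ (fun x => yv hn (P x) i0) 0 := analyticAt_const.mul (analyticAt_coordP hPa _)
  have hPyd : fderiv ℝ (fun x => yv hn (P x) i0) 0 (Pi.single (tt hn i0) 1) ≠ 0 := by
    have := D.y_deriv _ (tt_mem hn i0) (Pi.single (tt hn i0) 1)
    rw [yP_tt] at this
    rw [this, Pi.single_eq_same, mul_one]
    rcases heps (tt hn i0) with h | h <;> rw [h] <;> norm_num
  -- pointwise facts off the zero locus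
  have hpt : ∀ᶠ x in 𝓝 (0 : Fin n → ℝ), yv hn (P x) i0 ≠ 0 →
      (∀ J : Idx n q, (∃ c ∈ J.1, c ∉ topIdx n q) → Q x J = 0) ∧
      ∀ a c, eps k (tt hn a) * Φ x (tt hn a) * yv hn (Q x) c = eps k (tt hn c) * Φ x (tt hn c) * yv hn (Q x) a := by
    filter_upwards [hU.mem_nhds h0U, hΦY] with x hxU hx hy
    have hPx : P x ≠ 0 := by
      intro h; apply hy
      simp [yv, h]
    obtain ⟨H, hH⟩ := chart hn hN hxU hPx
    obtain ⟨-, M, hM, -⟩ := hH.self_of_nhds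
    rw [hM] at hy
    have := pt hn M (jac Φ x) (fun c => eps k c * Φ x c) hy (fun a ha => by
      have h := hx _ (tt_mem hn a) _ (tt_mem hn i0) (fun h => ha ((tt_inj hn).1 h))
      rw [YP_tt] at h
      simp only [hM] at h
      simp only [jac_mulVec]
      exact h)
    rw [← hM] at this
    exact this
  have hQ1 : ∀ J : Idx n q, (∃ c ∈ J.1, c ∉ topIdx n q) → ∀ᶠ x in 𝓝 (0 : Fin n → ℝ), Q x J = 0 := by
    intro J hJ
    refine density (g := fun x => yv hn (P x) i0) (Pi.single (tt hn i0) 1)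
      ((eventually_analyticAt' (hQa J)).mono fun _ h => h.continuousAt) hPya hPyd ?_
    filter_upwards [hpt] with x hx hy
    exact (hx hy).1 J hJ
  have hQ2 : ∀ a c, ∀ᶠ x in 𝓝 (0 : Fin n → ℝ), eps k (tt hn a) * Φ x (tt hn a) * yv hn (Q x) c - eps k (tt hn c) * Φ x (tt hn c) * yv hn (Q x) a = 0 := by
    intro a c
    have han : AnalyticAt ℝ (fun x => eps k (tt hn a) * Φ x (tt hn a) * yv hn (Q x) c - eps k (tt hn c) * Φ x (tt hn c) * yv hn (Q x) a) 0 :=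
      ((analyticAt_const.mul (analyticAt_coordP hΦ _)).mul (hya c)).sub ((analyticAt_const.mul (analyticAt_coordP hΦ _)).mul (hya a))
    refine density (g := fun x => yv hn (P x) i0) (Pi.single (tt hn i0) 1)
      ((eventually_analyticAt' han).mono fun _ h => h.continuousAt) hPya hPyd ?_
    filter_upwards [hpt] with x hx hy
    rw [(hx hy).2 a c, sub_self]
  obtain ⟨g, hg, hge⟩ := divide (tt hn) (fun a b h => (tt_inj hn).1 h) hΦ hΦ0 hψ hψ0 hψ1 hψ2
    (fun a x => eps k (tt hn a) * yv hn (Q x) a) (fun a => analyticAt_const.mul (hya a)) i0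
    (fun a => by
      by_cases h : a = i0
      · exact ⟨i1, fun h' => h01 (h.symm.trans h'.symm)⟩
      · exact ⟨i0, fun h' => h h'.symm⟩)
    (by
      filter_upwards [eventually_all.2 fun a => eventually_all.2 (hQ2 a)] with x hx a b
      have := hx a b
      linear_combination (eps k (tt hn a) * eps k (tt hn b)) * this - Φ x (tt hn a) * (eps k (tt hn b) * yv hn (Q x) b) * hee (tt hn a) + Φ x (tt hn b) * (eps k (tt hn a) * yv hn (Q x) a) * hee (tt hn b))
  have hQJ : ∀ᶠ x in 𝓝 (0 : Fin n → ℝ), ∀ J : Idx n q, (∃ c ∈ J.1, c ∉ topIdx n q) → Q x J = 0 := by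
    refine eventually_all.2 fun J => ?_
    by_cases hJ : ∃ c ∈ J.1, c ∉ topIdx n q
    · filter_upwards [hQ1 J hJ] with x hx _
      exact hx
    · exact Eventually.of_forall fun x h => absurd h hJ
  -- value of g at 0
  have hg0 : g 0 = 1 := by
    have e1 : (fun x => Q x (Jb hn i0)) =ᶠ[𝓝 0] fun x => ((-1 : ℝ) ^ (i0 : ℕ) * eps k (tt hn i0)) * (Φ x (tt hn i0) * g x) := by
      filter_upwards [hge] with x hx
      have := hx i0
      rw [← this, yv]
      linear_combination (-Q x (Jb hn i0)) * hmm i0 - ((-1 : ℝ) ^ (i0 : ℕ) * (-1 : ℝ) ^ (i0 : ℕ) * Q x (Jb hn i0)) * hee (tt hn i0)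
    have e2 := ext_deriv hΦ hΦd hPa hP0 (Jb hn i0) (Pi.single (tt hn i0) 1)
    rw [show fderiv ℝ (fun x => extPow n q (jac Φ x) (P x) (Jb hn i0)) 0 = _ from e1.fderiv_eq, hlin, modelPi_Jb] at e2
    have e3 := (((analyticAt_coordP hΦ (tt hn i0)).differentiableAt.hasFDerivAt.mul hg.differentiableAt.hasFDerivAt).const_mul
      ((-1 : ℝ) ^ (i0 : ℕ) * eps k (tt hn i0))).fderiv
    erw [e3] at e2
    simp only [ContinuousLinearMap.smul_apply, ContinuousLinearMap.add_apply, hΦ0, fderiv_coordP hΦ.differentiableAt, hΦd,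
      Pi.zero_apply, smul_eq_mul, zero_mul, ContinuousLinearMap.id_apply, Pi.single_eq_same, zero_add, mul_one] at e2
    have e4 : (-1 : ℝ) ^ (i0 : ℕ) * eps k (tt hn i0) ≠ 0 := by
      refine mul_ne_zero (pow_ne_zero _ (by norm_num)) ?_
      rcases heps (tt hn i0) with h | h <;> rw [h] <;> norm_num
    exact mul_left_cancel₀ e4 (e2.trans (mul_one _).symm)
  have hgne : ∀ᶠ x in 𝓝 (0 : Fin n → ℝ), g x ≠ 0 := hg.continuousAt.eventually_ne (by rw [hg0]; exact one_ne_zero)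
  have hgood : ∀ᶠ x in 𝓝 (0 : Fin n → ℝ), x ∈ U ∧ AnalyticAt ℝ (fun x => (g x)⁻¹) x ∧ g x ≠ 0 ∧
      (∀ a, eps k (tt hn a) * yv hn (Q x) a = Φ x (tt hn a) * g x) ∧
      ∀ J : Idx n q, (∃ c ∈ J.1, c ∉ topIdx n q) → Q x J = 0 := by
    filter_upwards [hU.mem_nhds h0U, eventually_analyticAt' hg, hgne, hge, hQJ] with x e1 e2 e3 e4 e5
    exact ⟨e1, e2.inv e3, e3, e4, e5⟩
  obtain ⟨W, h0W, hW, hWo, hWi, hΦW, hψW, hψΦ, hΦψ⟩ := finish_open hΦ hΦ0 hψ hψ0 hψ1 hψ2 hgood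
  refine ⟨W, fun x hx => (hW x hx).1, h0W, fun x => (g x)⁻¹, fun x hx => (hW x hx).2.1, ?_, Φ,
    ⟨hWo, hWi, hΦW, ψ, hψW, hψΦ, hΦψ⟩, hΦ0, ?_⟩
  · show (g 0)⁻¹ ≠ 0
    rw [hg0]; norm_num
  · intro x hx
    obtain ⟨-, -, hgx, hy, hJ0⟩ := hW x hx
    have hsc : extPow n q (jac Φ x) (fun J => (g x)⁻¹ * P x J) = fun J => (g x)⁻¹ * Q x J := by
      ext J
      simp only [hQ, extPow, Finset.mul_sum]
      exact Finset.sum_congr rfl fun I _ => by ring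
    rw [hsc]
    ext J
    show (g x)⁻¹ * Q x J = _
    by_cases hJ : ∃ c ∈ J.1, c ∉ topIdx n q
    · obtain ⟨c, hc, hcT⟩ := hJ
      rw [hJ0 J ⟨c, hc, hcT⟩, modelPi_out k _ J hc hcT, mul_zero]
    · push Not at hJ
      have hsub : J.1 ⊆ topIdx n q := fun c hc => hJ c hc
      obtain ⟨c, hc⟩ : ∃ c, c ∈ topIdx n q \ J.1 := by
        apply Finset.card_pos.1
        rw [Finset.card_sdiff_of_subset hsub, card_top hn, J.2]; omega
      obtain ⟨hcT, hcJ⟩ := Finset.mem_sdiff.1 hc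
      obtain ⟨a, rfl⟩ := exists_tt hn hcT
      have hJa : J = Jb hn a := by
        apply Subtype.ext
        refine Finset.eq_of_subset_of_card_le (fun d hd => Finset.mem_erase.2 ⟨fun h => hcJ (h ▸ hd), hsub hd⟩) ?_
        rw [J.2, (Jb hn a).2]
      rw [hJa, modelPi_Jb]
      have e1 := hy a
      rw [yv] at e1
      rw [inv_mul_eq_iff_eq_mul₀ hgx]
      linear_combination ((-1 : ℝ) ^ (a : ℕ) * eps k (tt hn a)) * e1 - (Q x (Jb hn a)) * hmm a - ((-1 : ℝ) ^ (a : ℕ) * (-1 : ℝ) ^ (a : ℕ) * Q x (Jb hn a)) * hee (tt hn a)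

end NambuLin
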